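/- Fix an integer d ≥ 1 and a natural number j. If j is odd, or if j > 2n, then Ext^j_S(I^d, S) = 0 (the Ext group is subsingleton). -/

import Mathlib

set_option linter.unusedSimpArgs false

namespace PfExt

/-- Coefficient families of elements of the graded pieces of the complexes: a subset of exterior
generators, an exponent vector, and an exponent of the extra even generator. -/
abbrev Fk (N : ℕ) (A : Type) := Finset (Fin N) → (Fin N →₀ ℕ) → ℕ → A

noncomputable section

section Slots

variable {N : ℕ} {A : Type} [CommRing A] (k : Type) [CommRing k] [Algebra k A]

/-- Weighted reindexing of the exterior slot. -/
def slotI (c : Finset (Fin N) → ℤ) (σ : Finset (Fin N) → Finset (Fin N)) :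
    Module.End k (Fk N A) where
  toFun f I α m := c I • f (σ I) α m
  map_add' f g := by ext; simp
  map_smul' r f := by ext; simp [smul_comm]

/-- Weighted reindexing of the symmetric slot. -/
def slotS (c : (Fin N →₀ ℕ) → ℤ) (σ : (Fin N →₀ ℕ) → (Fin N →₀ ℕ)) :
    Module.End k (Fk N A) where
  toFun f I α m := c α • f I (σ α) m
  map_add' f g := by ext; simp
  map_smul' r f := by ext; simp [smul_comm]

/-- Weighted reindexing of the slot of the extra generator. -/
def slotM (c : ℕ → ℤ) (σ : ℕ → ℕ) : Module.End k (Fk N A) where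
  toFun f I α m := c m • f I α (σ m)
  map_add' f g := by ext; simp
  map_smul' r f := by ext; simp [smul_comm]

/-- An endomorphism of the coefficients, applied pointwise. -/
def coef : Module.End k A →+* Module.End k (Fk N A) where
  toFun u :=
    { toFun := fun f I α m => u (f I α m)
      map_add' := fun f g => by ext; simp
      map_smul' := fun r f => by ext; simp }
  map_one' := rfl
  map_mul' _ _ := rfl
  map_zero' := rfl
  map_add' _ _ := rfl

@[simp] lemma slotI_apply (c σ) (f : Fk N A) (I α m) :
    slotI k c σ f I α m = c I • f (σ I) α m := rfl
@[simp] lemma slotS_apply (c σ) (f : Fk N A) (I α m) :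
    slotS k c σ f I α m = c α • f I (σ α) m := rfl
@[simp] lemma slotM_apply (c σ) (f : Fk N A) (I α m) :
    slotM k c σ f I α m = c m • f I α (σ m) := rfl
@[simp] lemma coef_apply (u : Module.End k A) (f : Fk N A) (I α m) :
    coef k u f I α m = u (f I α m) := rfl

variable {k}

lemma op_ext {u v : Module.End k (Fk N A)} (h : ∀ f I α m, u f I α m = v f I α m) : u = v := by
  refine LinearMap.ext fun f => ?_
  funext I α m
  exact h f I α m

lemma slotI_slotS (c σ c' σ') : slotI k c σ * slotS k c' σ' =
    (slotS k c' σ' * slotI k c σ : Module.End k (Fk N A)) := by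
  refine op_ext fun f I α m => ?_; simp [mul_left_comm]
lemma slotI_slotM (c σ c' σ') : slotI k c σ * slotM k c' σ' =
    (slotM k c' σ' * slotI k c σ : Module.End k (Fk N A)) := by
  refine op_ext fun f I α m => ?_; simp [mul_left_comm]
lemma slotS_slotM (c σ c' σ') : slotS k c σ * slotM k c' σ' =
    (slotM k c' σ' * slotS k c σ : Module.End k (Fk N A)) := by
  refine op_ext fun f I α m => ?_; simp [mul_left_comm]
lemma coef_slotI (u : Module.End k A) (c σ) : coef k u * slotI k c σ =
    (slotI k c σ * coef k u : Module.End k (Fk N A)) := by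
  refine op_ext fun f I α m => ?_; simp [-zsmul_eq_mul]
lemma coef_slotS (u : Module.End k A) (c σ) : coef k u * slotS k c σ =
    (slotS k c σ * coef k u : Module.End k (Fk N A)) := by
  refine op_ext fun f I α m => ?_; simp [-zsmul_eq_mul]
lemma coef_slotM (u : Module.End k A) (c σ) : coef k u * slotM k c σ =
    (slotM k c σ * coef k u : Module.End k (Fk N A)) := by
  refine op_ext fun f I α m => ?_; simp [-zsmul_eq_mul]

end Slots

section Signs

variable {N : ℕ}

/-- The sign of moving `i` to its place in `I`. -/
def sg (i : Fin N) (I : Finset (Fin N)) : ℤ := (-1) ^ (I.filter (· < i)).card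

lemma sg_sq (i : Fin N) (I) : sg i I * sg i I = 1 := by
  rw [sg, ← mul_pow]; simp

lemma sg_insert (i j : Fin N) (I) (h : j ∉ I) :
    sg i (insert j I) = if j < i then - sg i I else sg i I := by
  unfold sg
  rw [Finset.filter_insert]
  split_ifs with hj
  · rw [Finset.card_insert_of_notMem (by simp [h])]; ring
  · rfl

lemma sg_erase (i j : Fin N) (I) (h : j ∈ I) :
    sg i (I.erase j) = if j < i then - sg i I else sg i I := by
  have := sg_insert i j (I.erase j) (Finset.notMem_erase j I)
  rw [Finset.insert_erase h] at this
  rw [this]; split_ifs <;> simp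

end Signs

section Ops

variable {N : ℕ} {A : Type} [CommRing A] (k : Type) [CommRing k] [Algebra k A]

open Finset

/-- Exterior multiplication. -/
def opE (i : Fin N) : Module.End k (Fk N A) :=
  slotI k (fun I => if i ∈ I then sg i I else 0) (fun I => I.erase i)
/-- Contraction. -/
def opH (i : Fin N) : Module.End k (Fk N A) :=
  slotI k (fun I => if i ∈ I then 0 else sg i I) (fun I => insert i I)
/-- Multiplication by a variable on coefficient families. -/
def opT (i : Fin N) : Module.End k (Fk N A) :=
  slotS k (fun α => if α i = 0 then 0 else 1) (fun α => α - Finsupp.single i 1)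
/-- The transpose of multiplication by a variable. -/
def opP (i : Fin N) : Module.End k (Fk N A) :=
  slotS k (fun _ => 1) (fun α => α + Finsupp.single i 1)
/-- The operator which together with `opP` satisfies the canonical commutation relations. -/
def opY (i : Fin N) : Module.End k (Fk N A) :=
  slotS k (fun α => α i) (fun α => α - Finsupp.single i 1)
/-- Derivative in the divided power variable. -/
def opDt : Module.End k (Fk N A) := slotM k (fun _ => 1) (fun m => m + 1)
/-- Multiplication by the divided power variable. -/
def opMt : Module.End k (Fk N A) := slotM k (fun m => m) (fun m => m - 1)
/-- Multiplication by the dual variable. -/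
def opS : Module.End k (Fk N A) := slotM k (fun m => if m = 0 then 0 else 1) (fun m => m - 1)
/-- Derivative in the dual variable. -/
def opDs : Module.End k (Fk N A) := slotM k (fun m => m + 1) (fun m => m + 1)

@[simp] lemma opE_apply (i) (f : Fk N A) (I α m) :
    opE k i f I α m = (if i ∈ I then sg i I else 0) • f (I.erase i) α m := rfl
@[simp] lemma opH_apply (i) (f : Fk N A) (I α m) :
    opH k i f I α m = (if i ∈ I then 0 else sg i I) • f (insert i I) α m := rfl
@[simp] lemma opT_apply (i) (f : Fk N A) (I α m) :
    opT k i f I α m = (if α i = 0 then 0 else 1 : ℤ) • f I (α - Finsupp.single i 1) m := rfl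
@[simp] lemma opP_apply (i) (f : Fk N A) (I α m) :
    opP k i f I α m = f I (α + Finsupp.single i 1) m := by simp [opP]
@[simp] lemma opY_apply (i) (f : Fk N A) (I α m) :
    opY k i f I α m = (α i : ℤ) • f I (α - Finsupp.single i 1) m := rfl
@[simp] lemma opDt_apply (f : Fk N A) (I α m) :
    opDt k f I α m = f I α (m + 1) := by simp [opDt]
@[simp] lemma opMt_apply (f : Fk N A) (I α m) :
    opMt k f I α m = (m : ℤ) • f I α (m - 1) := rfl
@[simp] lemma opS_apply (f : Fk N A) (I α m) :
    opS k f I α m = (if m = 0 then 0 else 1 : ℤ) • f I α (m - 1) := rfl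
@[simp] lemma opDs_apply (f : Fk N A) (I α m) :
    opDs k f I α m = ((m : ℤ) + 1) • f I α (m + 1) := rfl

variable {k}

lemma opE_opE (i j : Fin N) : opE k i * opE k j = -(opE k j * opE k i : Module.End k (Fk N A)) := by
  refine op_ext fun f I α m => ?_
  simp only [Module.End.mul_apply, LinearMap.neg_apply, Pi.neg_apply, opE_apply, smul_smul,
    mem_erase]
  rcases eq_or_ne i j with rfl | hij
  · simp
  · by_cases hi : i ∈ I <;> by_cases hj : j ∈ I <;> simp only [hi, hj, hij, hij.symm, ne_eq,
      not_false_eq_true, and_true, and_false, if_true, if_false, mul_zero, zero_mul, zero_smul, neg_zero]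
    rw [erase_right_comm, ← neg_smul, sg_erase _ _ _ hi, sg_erase _ _ _ hj]
    congr 1
    rcases lt_or_gt_of_ne hij with h | h <;> simp [h, h.le.not_gt] <;> ring

lemma opH_opH (i j : Fin N) : opH k i * opH k j = -(opH k j * opH k i : Module.End k (Fk N A)) := by
  refine op_ext fun f I α m => ?_
  simp only [Module.End.mul_apply, LinearMap.neg_apply, Pi.neg_apply, opH_apply, smul_smul,
    mem_insert]
  rcases eq_or_ne i j with rfl | hij
  · simp
  · by_cases hi : i ∈ I <;> by_cases hj : j ∈ I <;> simp only [hi, hj, hij, hij.symm, or_true, or_false,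
      if_true, if_false, mul_zero, zero_mul, zero_smul, neg_zero]
    rw [insert_comm, ← neg_smul, sg_insert _ _ _ hi, sg_insert _ _ _ hj]
    congr 1
    rcases lt_or_gt_of_ne hij with h | h <;> simp [h, h.le.not_gt] <;> ring

lemma opH_opE (i j : Fin N) : opH k i * opE k j =
    (if i = j then 1 else 0) - (opE k j * opH k i : Module.End k (Fk N A)) := by
  refine op_ext fun f I α m => ?_
  simp only [Module.End.mul_apply, LinearMap.sub_apply, Pi.sub_apply, opH_apply, opE_apply, smul_smul,
    mem_insert, mem_erase]
  rcases eq_or_ne i j with rfl | hij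
  · by_cases hi : i ∈ I
    · simp [hi, insert_erase hi, sg_erase, sg_sq]
    · simp [hi, erase_insert hi, sg_insert, sg_sq]
  · by_cases hi : i ∈ I <;> by_cases hj : j ∈ I <;> simp only [hi, hj, hij, hij.symm, or_true, or_false,
      ne_eq, not_false_eq_true, and_true, and_false, LinearMap.zero_apply, Pi.zero_apply,
      if_true, if_false, mul_zero, zero_mul, zero_smul, sub_zero]
    rw [erase_insert_of_ne hij, zero_sub, ← neg_smul, sg_erase _ _ _ hj, sg_insert _ _ _ hi]
    congr 1
    rcases lt_or_gt_of_ne hij with h | h <;> simp [h, h.le.not_gt] <;> ring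

lemma opP_opP (i j : Fin N) : opP k i * opP k j = (opP k j * opP k i : Module.End k (Fk N A)) := by
  refine op_ext fun f I α m => ?_
  simp [add_right_comm]

lemma opT_opT (i j : Fin N) : opT k i * opT k j = (opT k j * opT k i : Module.End k (Fk N A)) := by
  refine op_ext fun f I α m => ?_
  rcases eq_or_ne i j with rfl | hij
  · rfl
  · simp [tsub_right_comm, hij, hij.symm]; try grind

lemma opY_opY (i j : Fin N) : opY k i * opY k j = (opY k j * opY k i : Module.End k (Fk N A)) := by
  refine op_ext fun f I α m => ?_
  rcases eq_or_ne i j with rfl | hij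
  · rfl
  · simp [tsub_right_comm, hij, hij.symm, mul_left_comm]; try grind

lemma opP_opT_of_ne {i j : Fin N} (h : i ≠ j) :
    opP k i * opT k j = (opT k j * opP k i : Module.End k (Fk N A)) := by
  refine op_ext fun f I α m => ?_
  simp only [Module.End.mul_apply, opP_apply, opT_apply, Finsupp.add_apply, Finsupp.single_apply, h,
    if_false, add_zero]
  by_cases hj : α j = 0
  · simp [hj]
  · congr 2
    ext l
    simp only [Finsupp.add_apply, Finsupp.tsub_apply, Finsupp.single_apply]
    split_ifs <;> grind

lemma opP_opT_self (i : Fin N) : opP k i * opT k i = (1 : Module.End k (Fk N A)) := by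
  refine op_ext fun f I α m => ?_
  simp

lemma opP_opY (i j : Fin N) : opP k i * opY k j =
    (if i = j then 1 else 0) + (opY k j * opP k i : Module.End k (Fk N A)) := by
  refine op_ext fun f I α m => ?_
  simp only [Module.End.mul_apply, opP_apply, opY_apply, Finsupp.add_apply, Finsupp.single_apply,
    LinearMap.add_apply, Pi.add_apply]
  rcases eq_or_ne i j with rfl | h
  · by_cases hj : α i = 0
    · simp [hj]
    · have : α - Finsupp.single i 1 + Finsupp.single i 1 = α := by
        ext l; simp only [Finsupp.add_apply, Finsupp.tsub_apply, Finsupp.single_apply]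
        split_ifs <;> grind
      simp [this, add_smul, add_comm]
  · by_cases hj : α j = 0
    · simp [hj, h]
    · simp only [h, if_false, add_zero, LinearMap.zero_apply, Pi.zero_apply, zero_add]
      congr 2
      ext l
      simp only [Finsupp.add_apply, Finsupp.tsub_apply, Finsupp.single_apply]
      split_ifs <;> grind

lemma opDs_opS : opDs k * opS k = 1 + (opS k * opDs k : Module.End k (Fk N A)) := by
  refine op_ext fun f I α m => ?_
  rcases m with _ | m
  · simp
  · simp [add_smul]; abel

lemma opDt_opMt : opDt k * opMt k = 1 + (opMt k * opDt k : Module.End k (Fk N A)) := by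
  refine op_ext fun f I α m => ?_
  rcases m with _ | m
  · simp
  · simp [add_smul]; abel

end Ops

end

end PfExt

namespace PfExt

section Commutators

variable {R : Type} [Ring R]

/-- The commutator in a ring. -/
def cm (a b : R) : R := a * b - b * a

lemma cm_mul (a b c : R) : cm a (b * c) = cm a b * c + b * cm a c := by
  unfold cm; noncomm_ring
lemma mul_cm (a b c : R) : cm (a * b) c = a * cm b c + cm a c * b := by
  unfold cm; noncomm_ring
lemma cm_add (a b c : R) : cm a (b + c) = cm a b + cm a c := by unfold cm; noncomm_ring
lemma add_cm (a b c : R) : cm (a + b) c = cm a c + cm b c := by unfold cm; noncomm_ring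
lemma cm_sub (a b c : R) : cm a (b - c) = cm a b - cm a c := by unfold cm; noncomm_ring
lemma sub_cm (a b c : R) : cm (a - b) c = cm a c - cm b c := by unfold cm; noncomm_ring
lemma cm_neg (a b : R) : cm a (-b) = -cm a b := by unfold cm; noncomm_ring
lemma neg_cm (a b : R) : cm (-a) b = -cm a b := by unfold cm; noncomm_ring
lemma cm_skew (a b : R) : cm a b = -cm b a := by unfold cm; noncomm_ring
lemma cm_sum {ι : Type} (a : R) (s : Finset ι) (f : ι → R) :
    cm a (∑ i ∈ s, f i) = ∑ i ∈ s, cm a (f i) := by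
  simp [cm, Finset.mul_sum, Finset.sum_mul]
lemma sum_cm {ι : Type} (a : R) (s : Finset ι) (f : ι → R) :
    cm (∑ i ∈ s, f i) a = ∑ i ∈ s, cm (f i) a := by
  simp [cm, Finset.mul_sum, Finset.sum_mul]
lemma cm_natCast (a : R) (n : ℕ) : cm a n = 0 := by
  simp [cm, Nat.cast_comm]
lemma natCast_cm (a : R) (n : ℕ) : cm (n : R) a = 0 := by
  simp [cm, Nat.cast_comm]
lemma cm_one (a : R) : cm a 1 = 0 := by simp [cm]
lemma cm_zero (a : R) : cm a 0 = 0 := by simp [cm]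
lemma cm_two (a : R) : cm a 2 = 0 := by exact_mod_cast cm_natCast a 2
lemma two_cm (a : R) : cm 2 a = 0 := by exact_mod_cast natCast_cm a 2
lemma eq_of_cm_eq_zero {a b : R} (h : cm a b = 0) : a * b = b * a := sub_eq_zero.mp h

end Commutators

/-- Operators satisfying the canonical (anti)commutation relations, together with the coordinates
of a skew-symmetric matrix and the corresponding partial derivatives. -/
structure FockRel {R : Type} [Ring R] (N : ℕ) (θ η y p : Fin N → R) (s δ : R)
    (x dx : Fin N → Fin N → R) : Prop where
  θθ : ∀ i j, θ i * θ j = -(θ j * θ i)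
  ηη : ∀ i j, η i * η j = -(η j * η i)
  ηθ : ∀ i j, η i * θ j = (if i = j then 1 else 0) - θ j * η i
  py : ∀ i j, cm (p i) (y j) = if i = j then 1 else 0
  pp : ∀ i j, cm (p i) (p j) = 0
  yy : ∀ i j, cm (y i) (y j) = 0
  δs : cm δ s = 1
  dxx : ∀ i j k l, cm (dx i j) (x k l) =
    (if i = k then if j = l then 1 else 0 else 0) - (if i = l then if j = k then 1 else 0 else 0)
  xx : ∀ i j k l, cm (x i j) (x k l) = 0
  dxdx : ∀ i j k l, cm (dx i j) (dx k l) = 0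
  xskew : ∀ i j, x j i = - x i j
  dxskew : ∀ i j, dx j i = - dx i j
  θy : ∀ i j, cm (θ i) (y j) = 0
  θp : ∀ i j, cm (θ i) (p j) = 0
  θs : ∀ i, cm (θ i) s = 0
  θδ : ∀ i, cm (θ i) δ = 0
  ηy : ∀ i j, cm (η i) (y j) = 0
  ηp : ∀ i j, cm (η i) (p j) = 0
  ηs : ∀ i, cm (η i) s = 0
  ηδ : ∀ i, cm (η i) δ = 0
  ys : ∀ i, cm (y i) s = 0
  yδ : ∀ i, cm (y i) δ = 0
  ps : ∀ i, cm (p i) s = 0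
  pδ : ∀ i, cm (p i) δ = 0
  xθ : ∀ i j k, cm (x i j) (θ k) = 0
  xη : ∀ i j k, cm (x i j) (η k) = 0
  xy : ∀ i j k, cm (x i j) (y k) = 0
  xp : ∀ i j k, cm (x i j) (p k) = 0
  xs : ∀ i j, cm (x i j) s = 0
  xδ : ∀ i j, cm (x i j) δ = 0
  dxθ : ∀ i j k, cm (dx i j) (θ k) = 0
  dxη : ∀ i j k, cm (dx i j) (η k) = 0
  dxy : ∀ i j k, cm (dx i j) (y k) = 0
  dxp : ∀ i j k, cm (dx i j) (p k) = 0
  dxs : ∀ i j, cm (dx i j) s = 0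
  dxδ : ∀ i j, cm (dx i j) δ = 0

namespace FockRel

open Finset

variable {R : Type} [Ring R] {N : ℕ} {θ η y p : Fin N → R} {s δ : R} {x dx : Fin N → Fin N → R}

section Defs
variable (N) (θ η y p : Fin N → R) (s δ : R) (x dx : Fin N → Fin N → R)

/-- The operator contracting one symmetric and one exterior index. -/
def cΔ : R := ∑ j, p j * η j
/-- The differential of the dual complex. -/
def cD : R := ∑ i, ∑ j, x i j * θ i * p j + s * cΔ N η p
/-- The part of the `gl`-action on the exterior and symmetric slots. -/
def cρ (i j : Fin N) : R := y i * p j - θ j * η i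
/-- The `gl`-action. -/
def cE (i j : Fin N) : R := ∑ k, x i k * dx j k + cρ N θ η y p i j
/-- The total degree operator. -/
def cn : R := ∑ k, y k * p k + ∑ k, θ k * η k + 2 * (s * δ)
/-- The commutator of a partial derivative with the differential. -/
def cq (i j : Fin N) : R := θ i * p j - θ j * p i
/-- The second order operators lowering the polynomial degree. -/
def cP (i j : Fin N) : R :=
  ∑ k, (cE N θ η y p x dx k i * dx k j - cρ N θ η y p k j * dx k i)
    + ((N : R) - cn N θ η y p s δ) * dx i j + 2 * (θ i * θ j * δ)
/-- The contraction of the symmetric and exterior variables. -/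
def cτ : R := ∑ i, y i * θ i

end Defs

variable (h : FockRel N θ η y p s δ x dx)
include h

lemma cm_ρ_θ (i j k) : cm (cρ N θ η y p i j) (θ k) = if i = k then -θ j else 0 := by
  have h1 := h.θθ k j
  have h2 := h.ηθ i k
  unfold cρ
  rw [sub_cm, mul_cm, cm_skew, h.θp, cm_skew (y i), h.θy]
  unfold cm
  rw [mul_assoc, h2, ← mul_assoc (θ k), h1]
  split_ifs <;> noncomm_ring

lemma cm_ρ_η (i j k) : cm (cρ N θ η y p i j) (η k) = if j = k then η i else 0 := by
  have h1 := h.ηη i k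
  have h2 := h.ηθ k j
  unfold cρ
  rw [sub_cm, mul_cm, cm_skew, h.ηp, cm_skew (y i), h.ηy]
  unfold cm
  rw [mul_assoc, h1, ← mul_assoc (η k), h2]
  by_cases hh : j = k
  · subst hh; simp; noncomm_ring
  · simp [hh, Ne.symm hh]; noncomm_ring

lemma cm_ρ_p (i j k) : cm (cρ N θ η y p i j) (p k) = if i = k then -p j else 0 := by
  unfold cρ
  rw [sub_cm, mul_cm, mul_cm, h.pp, h.θp, h.ηp, cm_skew (y i), h.py]
  by_cases hh : i = k
  · subst hh; simp
  · simp [hh, Ne.symm hh]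

lemma cm_ρ_s (i j) : cm (cρ N θ η y p i j) s = 0 := by
  simp [cρ, sub_cm, mul_cm, h.ps, h.ys, h.θs, h.ηs]

lemma cm_ρ_x (i j k l) : cm (cρ N θ η y p i j) (x k l) = 0 := by
  rw [cm_skew]; simp [cρ, cm_sub, cm_mul, h.xy, h.xp, h.xθ, h.xη]

lemma cm_dx_ρ (i j k l) : cm (dx k l) (cρ N θ η y p i j) = 0 := by
  simp [cρ, cm_sub, cm_mul, h.dxy, h.dxp, h.dxθ, h.dxη]

lemma cm_ρ_Δ (i j) : cm (cρ N θ η y p i j) (cΔ N η p) = 0 := by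
  simp [cΔ, cm_sum, cm_mul, h.cm_ρ_p, h.cm_ρ_η, sum_add_distrib]

lemma cm_E_x (i j k l) : cm (cE N θ η y p x dx i j) (x k l) =
    (if j = k then x i l else 0) + (if j = l then x k i else 0) := by
  simp only [cE, add_cm, sum_cm, mul_cm, h.xx, h.dxx, h.cm_ρ_x, zero_mul, add_zero, mul_sub, mul_ite,
    mul_one, mul_zero, sum_sub_distrib]
  by_cases h1 : j = k <;> by_cases h2 : j = l <;> simp [h1, h2, h.xskew k] <;> split_ifs <;> simp

lemma cm_E_θ (i j k) : cm (cE N θ η y p x dx i j) (θ k) = if i = k then -θ j else 0 := by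
  simp [cE, add_cm, sum_cm, mul_cm, h.xθ, h.dxθ, h.cm_ρ_θ]
lemma cm_E_p (i j k) : cm (cE N θ η y p x dx i j) (p k) = if i = k then -p j else 0 := by
  simp [cE, add_cm, sum_cm, mul_cm, h.xp, h.dxp, h.cm_ρ_p]
lemma cm_E_s (i j) : cm (cE N θ η y p x dx i j) s = 0 := by
  simp [cE, add_cm, sum_cm, mul_cm, h.xs, h.dxs, h.cm_ρ_s]
lemma cm_E_Δ (i j) : cm (cE N θ η y p x dx i j) (cΔ N η p) = 0 := by
  rw [cE, add_cm, h.cm_ρ_Δ]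
  simp [cΔ, sum_cm, cm_sum, mul_cm, cm_mul, h.xp, h.dxp, h.xη, h.dxη]

lemma cm_E_D (i j) : cm (cE N θ η y p x dx i j) (cD N θ η p s x) = 0 := by
  simp only [cD, cm_add, cm_sum, cm_mul, h.cm_E_x, h.cm_E_θ, h.cm_E_p, h.cm_E_s, h.cm_E_Δ]
  simp [add_mul, sum_add_distrib, ite_mul, mul_ite]

lemma cm_dx_Δ (k l) : cm (dx k l) (cΔ N η p) = 0 := by
  simp [cΔ, cm_sum, cm_mul, h.dxp, h.dxη]

lemma cm_dx_D (k l) : cm (dx k l) (cD N θ η p s x) = cq N θ p k l := by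
  simp only [cD, cm_add, cm_sum, cm_mul, h.dxx, h.dxθ, h.dxp, h.dxs, h.cm_dx_Δ]
  simp [sub_mul, sum_sub_distrib, ite_mul, cq]

lemma cm_ρ_D (i j) : cm (cρ N θ η y p i j) (cD N θ η p s x) =
    - ∑ l, x i l * cq N θ p j l := by
  simp only [cD, cm_add, cm_sum, cm_mul, h.cm_ρ_x, h.cm_ρ_θ, h.cm_ρ_p, h.cm_ρ_s, h.cm_ρ_Δ]
  simp [sum_add_distrib, ite_mul, mul_ite, cq, mul_sub, mul_assoc, h.xskew i]
  abel

lemma cm_n_D : cm (cn N θ η y p s δ) (cD N θ η p s x) = 0 := by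
  have h1 : cn N θ η y p s δ = ∑ k, cρ N θ η y p k k + 2 * (∑ k, θ k * η k) + 2 * (s * δ) := by
    simp [cn, cρ, sum_sub_distrib]; noncomm_ring
  have h2 : ∀ k, cm (∑ k, θ k * η k) (θ k) = θ k := by
    intro k
    rw [sum_cm]
    have : ∀ i, cm (θ i * η i) (θ k) = if i = k then θ k else 0 := by
      intro i
      have := h.cm_ρ_θ i i k
      rw [cρ, sub_cm, mul_cm, cm_skew, h.θp, cm_skew (y i), h.θy] at this
      by_cases hh : i = k
      · subst hh; simpa using this
      · simpa [hh] using this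
    simp [this]
  have h3 : ∀ k, cm (∑ k, θ k * η k) (η k) = -η k := by
    intro k
    rw [sum_cm]
    have : ∀ i, cm (θ i * η i) (η k) = if i = k then -η k else 0 := by
      intro i
      have := h.cm_ρ_η i i k
      rw [cρ, sub_cm, mul_cm, cm_skew, h.ηp, cm_skew (y i), h.ηy] at this
      by_cases hh : i = k
      · subst hh; simpa [neg_eq_iff_eq_neg] using this
      · simpa [hh] using this
    simp [this]
  have h4 : cm (∑ k, θ k * η k) (cD N θ η p s x) =
      ∑ i, ∑ j, x i j * θ i * p j - s * cΔ N η p := by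
    have a1 : ∀ i j, cm (∑ k, θ k * η k) (x i j) = 0 := by
      intro i j; rw [cm_skew]; simp [cm_sum, cm_mul, h.xθ, h.xη]
    have a2 : ∀ i, cm (∑ k, θ k * η k) (p i) = 0 := by
      intro i; simp [sum_cm, mul_cm, h.θp, h.ηp]
    have a3 : cm (∑ k, θ k * η k) s = 0 := by
      simp [sum_cm, mul_cm, h.θs, h.ηs]
    simp only [cD, cΔ, cm_add, cm_sum, cm_mul, a1, a2, a3, h2, h3]
    simp [mul_sum, sub_eq_add_neg]
  have h5 : cm (s * δ) (cD N θ η p s x) = s * cΔ N η p := by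
    simp [cD, cΔ, cm_add, cm_sum, cm_mul, mul_cm, cm_skew _ (x _ _), cm_skew δ (θ _), cm_skew s (θ _),
      cm_skew s (p _), cm_skew δ (p _), cm_skew s (η _), cm_skew δ (η _), h.xs, h.xδ, h.θs, h.θδ, h.ps,
      h.pδ, h.ηs, h.ηδ, h.δs, show cm s s = 0 from sub_self _]
  have h6 : ∑ k, cm (cρ N θ η y p k k) (cD N θ η p s x) =
      - (2 * ∑ i, ∑ j, x i j * θ i * p j) := by
    simp only [h.cm_ρ_D, cq, mul_sub, sum_sub_distrib, sum_neg_distrib]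
    have : ∑ k, ∑ l, x k l * (θ l * p k) = - ∑ i, ∑ j, x i j * θ i * p j := by
      rw [sum_comm, ← sum_neg_distrib]
      refine sum_congr rfl fun i _ => ?_
      rw [← sum_neg_distrib]
      refine sum_congr rfl fun j _ => ?_
      rw [h.xskew i j]; noncomm_ring
    rw [this]
    simp only [mul_assoc]
    noncomm_ring
  rw [h1, add_cm, add_cm, sum_cm, h6, mul_cm, mul_cm, two_cm, h4, h5]
  noncomm_ring

end FockRel

end PfExt

namespace PfExt
namespace FockRel

open Finset

variable {R : Type} [Ring R] {N : ℕ} {θ η y p : Fin N → R} {s δ : R} {x dx : Fin N → Fin N → R}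
variable (h : FockRel N θ η y p s δ x dx)
include h

lemma comm_pθ (i j) : p i * θ j = θ j * p i := (eq_of_cm_eq_zero (h.θp j i)).symm
lemma comm_pη (i j) : p i * η j = η j * p i := (eq_of_cm_eq_zero (h.ηp j i)).symm
lemma comm_yθ (i j) : y i * θ j = θ j * y i := (eq_of_cm_eq_zero (h.θy j i)).symm
lemma comm_yη (i j) : y i * η j = η j * y i := (eq_of_cm_eq_zero (h.ηy j i)).symm
lemma comm_pp (i j) : p i * p j = p j * p i := eq_of_cm_eq_zero (h.pp i j)
lemma comm_yy (i j) : y i * y j = y j * y i := eq_of_cm_eq_zero (h.yy i j)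

lemma sum_ρ_q_aux (i j) : ∑ k, cρ N θ η y p k i * cq N θ p k j =
    (∑ k, y k * θ k) * (p i * p j) - (∑ k, y k * p k) * (p i * θ j) - (N : R) * (θ i * p j)
      + θ i * (∑ k, θ k * η k) * p j + θ i * p j - θ i * θ j * cΔ N η p := by
  have key : ∀ k, cρ N θ η y p k i * cq N θ p k j =
      y k * θ k * (p i * p j) - y k * p k * (p i * θ j) - θ i * p j + θ i * (θ k * η k) * p j
        + (if k = j then θ i * p k else 0) - θ i * θ j * (p k * η k) := by
    intro k
    have e1 : η k * θ k = 1 - θ k * η k := by simpa using h.ηθ k k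
    have e2 := h.ηθ k j
    calc cρ N θ η y p k i * cq N θ p k j
        = y k * (p i * θ k) * p j - y k * (p i * θ j) * p k - θ i * (η k * θ k) * p j
          + θ i * (η k * θ j) * p k := by unfold cρ cq; noncomm_ring
      _ = y k * (θ k * p i) * p j - y k * (θ j * (p i * p k)) - θ i * (1 - θ k * η k) * p j
          + θ i * ((if k = j then 1 else 0) - θ j * η k) * p k := by
            rw [h.comm_pθ i k, h.comm_pθ i j, e1, e2]; noncomm_ring
      _ = _ := by
        rw [h.comm_pp i k, h.comm_pη k k, h.comm_pθ i j]
        have : y k * (θ j * (p k * p i)) = y k * p k * (θ j * p i) := by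
          rw [← mul_assoc (θ j), ← h.comm_pθ k j]; noncomm_ring
        rw [this]
        split_ifs <;> noncomm_ring
  simp only [key, sum_add_distrib, sum_sub_distrib, ← sum_mul, ← mul_sum, cΔ]
  simp [mul_assoc]

lemma sum_ρ_q (i j) : ∑ k, (cρ N θ η y p k i * cq N θ p k j - cρ N θ η y p k j * cq N θ p k i) =
    (∑ k, y k * p k + ∑ k, θ k * η k - (N : R)) * cq N θ p i j - 2 * (θ i * θ j) * cΔ N η p := by
  have hn : ∀ i, θ i * (∑ k, θ k * η k) = (∑ k, θ k * η k) * θ i - θ i := by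
    intro i
    have : ∀ k, θ i * (θ k * η k) = θ k * η k * θ i - if k = i then θ i else 0 := by
      intro k
      rw [mul_assoc, h.ηθ, ← mul_assoc, h.θθ i k]
      by_cases hh : k = i
      · subst hh; simp; noncomm_ring
      · simp [hh]; noncomm_ring
    rw [mul_sum, sum_congr rfl fun k _ => this k, sum_sub_distrib, sum_mul]
    simp
  rw [sum_sub_distrib, h.sum_ρ_q_aux, h.sum_ρ_q_aux, hn, hn, h.comm_pp j i, h.θθ j i, h.comm_pθ i j,
    h.comm_pθ j i]
  unfold cq
  generalize (∑ k, y k * p k) = ny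
  generalize (∑ k, y k * θ k) = t
  generalize (∑ k, θ k * η k) = nt
  noncomm_ring

lemma cm_P_D (i j) : cm (cP N θ η y p s δ x dx i j) (cD N θ η p s x) = 0 := by
  have hs : cm s (cΔ N η p) = 0 := by
    simp [cΔ, cm_sum, cm_mul, cm_skew s (p _), cm_skew s (η _), h.ps, h.ηs]
  have hδ : cm δ (cD N θ η p s x) = cΔ N η p := by
    have : cm δ (cΔ N η p) = 0 := by
      simp [cΔ, cm_sum, cm_mul, cm_skew δ (p _), cm_skew δ (η _), h.pδ, h.ηδ]
    simp only [cD, cm_add, cm_sum, cm_mul, this, h.δs, cm_skew δ (p _), cm_skew δ (θ _),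
      cm_skew δ (x _ _), h.xδ, h.pδ, h.θδ]
    simp
  have hθD : ∀ i, θ i * cD N θ η p s x + cD N θ η p s x * θ i = s * p i := by
    intro i
    have a1 : ∀ k l, θ i * (x k l * θ k * p l) = -(x k l * θ k * p l * θ i) := by
      intro k l
      rw [mul_assoc (x k l * θ k), h.comm_pθ, ← mul_assoc, ← mul_assoc, ← mul_assoc,
        ← eq_of_cm_eq_zero (h.xθ k l i), mul_assoc (x k l), h.θθ i k]
      noncomm_ring
    have a2 : cΔ N η p * θ i = p i - θ i * cΔ N η p := by
      have : ∀ k, p k * η k * θ i = (if k = i then p k else 0) - θ i * (p k * η k) := by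
        intro k
        rw [mul_assoc, h.ηθ, mul_sub, ← mul_assoc, h.comm_pθ, ← mul_assoc]
        split_ifs <;> simp
      simp only [cΔ, sum_mul, this, sum_sub_distrib, mul_sum]
      simp
    unfold cD
    rw [mul_add, add_mul, mul_sum, sum_mul]
    simp only [mul_sum, a1, sum_mul, sum_neg_distrib]
    rw [mul_assoc s, a2, ← mul_assoc (θ i), eq_of_cm_eq_zero (h.θs i)]
    noncomm_ring
  have hθθ : cm (θ i * θ j) (cD N θ η p s x) = s * cq N θ p i j := by
    have e1 := eq_sub_of_add_eq (hθD i)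
    have e2 := eq_sub_of_add_eq (hθD j)
    calc cm (θ i * θ j) (cD N θ η p s x)
        = θ i * (θ j * cD N θ η p s x) - cD N θ η p s x * θ i * θ j := by unfold cm; noncomm_ring
      _ = (θ i * s) * p j - (θ i * cD N θ η p s x) * θ j - cD N θ η p s x * θ i * θ j := by
        rw [e2]; noncomm_ring
      _ = s * (θ i * p j - p i * θ j) := by
        rw [e1, eq_of_cm_eq_zero (h.θs i)]; noncomm_ring
      _ = s * cq N θ p i j := by rw [h.comm_pθ, cq]
  have hqδ : cq N θ p i j * δ = δ * cq N θ p i j := by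
    apply eq_of_cm_eq_zero
    simp [cq, sub_cm, mul_cm, h.θδ, h.pδ]
  have hX : ∑ k, ((∑ l, x k l * dx i l) * cq N θ p k j) +
      ∑ k, (∑ l, x k l * cq N θ p j l) * dx k i = 0 := by
    simp only [sum_mul]
    rw [sum_comm (f := fun k l => x k l * cq N θ p j l * dx k i), ← sum_add_distrib]
    refine sum_eq_zero fun k _ => ?_
    rw [← sum_add_distrib]
    refine sum_eq_zero fun l _ => ?_
    have c1 : dx i l * cq N θ p k j = cq N θ p k j * dx i l := by
      apply eq_of_cm_eq_zero
      simp [cq, cm_sub, cm_mul, h.dxθ, h.dxp]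
    have c2 : cq N θ p j k = - cq N θ p k j := by unfold cq; noncomm_ring
    rw [mul_assoc, c1, c2, h.xskew k l, h.dxskew i l]
    noncomm_ring
  have hdρ := h.sum_ρ_q i j
  have hdE : ∀ k, cm (cE N θ η y p x dx k i * dx k j - cρ N θ η y p k j * dx k i)
      (cD N θ η p s x) = (∑ l, x k l * dx i l) * cq N θ p k j + (∑ l, x k l * cq N θ p j l) * dx k i
      + (cρ N θ η y p k i * cq N θ p k j - cρ N θ η y p k j * cq N θ p k i) := by
    intro k
    rw [sub_cm, mul_cm, mul_cm, h.cm_E_D, h.cm_ρ_D, h.cm_dx_D, h.cm_dx_D, cE]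
    noncomm_ring
  have hs2 : s * (δ * cq N θ p i j) = s * δ * cq N θ p i j := (mul_assoc _ _ _).symm
  rw [cP, add_cm, add_cm, sum_cm, sum_congr rfl fun k _ => hdE k, sum_add_distrib, sum_add_distrib,
    hX, hdρ, mul_cm, h.cm_dx_D, sub_cm, h.cm_n_D, natCast_cm, mul_cm, two_cm, mul_cm, hδ, hθθ,
    mul_assoc s, hqδ, hs2, cn]
  noncomm_ring

lemma cm_P_x (i j) (hij : i ≠ j) : cm (cP N θ η y p s δ x dx i j) (x i j) =
    cE N θ η y p x dx i i + cE N θ η y p x dx j j + ((N : R) - cn N θ η y p s δ) := by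
  have hn : cm (cn N θ η y p s δ) (x i j) = 0 := by
    rw [cm_skew]
    simp [cn, cm_add, cm_sum, cm_mul, h.xy, h.xp, h.xθ, h.xη, h.xs, h.xδ, cm_two]
  have hθ : cm (2 * (θ i * θ j * δ)) (x i j) = 0 := by
    rw [cm_skew]
    simp [cm_mul, h.xθ, h.xδ, cm_two]
  rw [cP, add_cm, add_cm, sum_cm, hθ, mul_cm, sub_cm, hn, natCast_cm, h.dxx]
  have : ∀ k, cm (cE N θ η y p x dx k i * dx k j - cρ N θ η y p k j * dx k i) (x i j) =
      (if k = i then cE N θ η y p x dx i i else 0) + x k j * dx k j +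
      (if k = j then cρ N θ η y p j j else 0) := by
    intro k
    rw [sub_cm, mul_cm, mul_cm, h.cm_E_x, h.cm_ρ_x, h.dxx, h.dxx]
    by_cases h1 : k = i
    · subst h1; simp [hij]
    · by_cases h2 : k = j
      · subst h2; simp [hij, hij.symm]
      · simp [h1, h2, hij]
  rw [sum_congr rfl fun k _ => this k, sum_add_distrib, sum_add_distrib]
  have h3 : ∑ k, x k j * dx k j = ∑ k, x j k * dx j k :=
    sum_congr rfl fun k _ => by rw [h.xskew k j, h.dxskew k j]; noncomm_ring
  rw [h3]
  simp [hij, cE]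
  abel

end FockRel
end PfExt

namespace PfExt
namespace FockRel

open Finset

variable {R : Type} [Ring R] {N : ℕ} {θ η y p : Fin N → R} {s δ : R} {x dx : Fin N → Fin N → R}
variable (h : FockRel N θ η y p s δ x dx)
include h

lemma cm_E_y (i j k) : cm (cE N θ η y p x dx i j) (y k) = if j = k then y i else 0 := by
  simp [cE, cρ, add_cm, sub_cm, sum_cm, mul_cm, h.xy, h.dxy, h.py, h.yy, h.θy, h.ηy]

lemma cm_E_η (i j k) : cm (cE N θ η y p x dx i j) (η k) = if j = k then η i else 0 := by
  simp [cE, add_cm, sum_cm, mul_cm, h.xη, h.dxη, h.cm_ρ_η]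

lemma cm_E_dx (i j k l) : cm (cE N θ η y p x dx i j) (dx k l) =
    -((if i = k then dx j l else 0) + (if i = l then dx k j else 0)) := by
  have h1 : ∀ a b, cm (x a b) (dx k l) =
      -((if k = a then if l = b then 1 else 0 else 0)
        - (if k = b then if l = a then 1 else 0 else 0)) := fun a b => by rw [cm_skew, h.dxx]
  have h2 : cm (cρ N θ η y p i j) (dx k l) = 0 := by rw [cm_skew, h.cm_dx_ρ, neg_zero]
  simp only [cE, add_cm, sum_cm, mul_cm, h1, h2, h.dxdx]
  by_cases e1 : i = k <;> by_cases e2 : i = l <;>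
    simp [e1, e2, Ne.symm, eq_comm, h.dxskew k, sub_mul, ite_mul, sum_sub_distrib] <;>
    split_ifs <;> simp_all [sub_eq_add_neg]

lemma cm_E_δ (i j) : cm (cE N θ η y p x dx i j) δ = 0 := by
  simp [cE, cρ, add_cm, sub_cm, sum_cm, mul_cm, h.xδ, h.dxδ, h.pδ, h.yδ, h.θδ, h.ηδ]

lemma cm_E_ρ (i j k l) : cm (cE N θ η y p x dx i j) (cρ N θ η y p k l) =
    (if j = k then cρ N θ η y p i l else 0) - (if i = l then cρ N θ η y p k j else 0) := by
  simp only [cρ, cm_sub, cm_mul, h.cm_E_y, h.cm_E_p, h.cm_E_θ, h.cm_E_η]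
  split_ifs <;> noncomm_ring

lemma cm_E_E (i j k l) : cm (cE N θ η y p x dx i j) (cE N θ η y p x dx k l) =
    (if j = k then cE N θ η y p x dx i l else 0) - (if i = l then cE N θ η y p x dx k j else 0) := by
  conv_lhs => rw [cE.eq_def N θ η y p x dx k l]
  simp only [cm_add, cm_sum, cm_mul, h.cm_E_x, h.cm_E_dx, h.cm_E_ρ]
  simp only [add_mul, mul_neg, mul_add, sum_add_distrib, sum_neg_distrib]
  simp [ite_mul, mul_ite, cE]
  split_ifs <;> abel

lemma cm_E_n (i j) : cm (cE N θ η y p x dx i j) (cn N θ η y p s δ) = 0 := by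
  simp [cn, cm_add, cm_sum, cm_mul, h.cm_E_y, h.cm_E_p, h.cm_E_θ, h.cm_E_η, h.cm_E_s, h.cm_E_δ,
    cm_two, sum_add_distrib]

lemma cm_E_P (k i j) (hij : i ≠ j) : cm (cE N θ η y p x dx k k) (cP N θ η y p s δ x dx i j) =
    -((if k = i then 1 else 0) + (if k = j then 1 else 0)) * cP N θ η y p s δ x dx i j := by
  have hθθ : θ j * θ j + θ j * θ j = 0 := by
    have := h.θθ j j; nth_rewrite 1 [this]; simp
  simp only [cP, cm_add, cm_sub, cm_sum, cm_mul, h.cm_E_E, h.cm_E_dx, h.cm_E_ρ, h.cm_E_n, h.cm_E_θ,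
    h.cm_E_δ, cm_two, cm_natCast]
  by_cases e1 : k = i
  · subst e1
    simp [hij, hij.symm, sub_mul, mul_sum, sum_add_distrib, sum_sub_distrib, ite_mul, mul_ite,
      neg_mul, mul_add]
    try noncomm_ring
  · by_cases e2 : k = j
    · subst e2
      simp [hij, hij.symm, e1, sub_mul, mul_sum, sum_add_distrib, sum_sub_distrib, ite_mul, mul_ite,
        neg_mul, mul_add]
      try noncomm_ring
    · simp [e1, e2, sub_mul, mul_sum, sum_add_distrib, sum_sub_distrib, ite_mul, mul_ite,
        neg_mul, mul_add]

lemma n_θ_mul (i) : (∑ k, θ k * η k) * θ i = θ i * (∑ k, θ k * η k) + θ i := by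
  have : ∀ k, θ k * η k * θ i = θ i * (θ k * η k) + if k = i then θ i else 0 := by
    intro k
    rw [mul_assoc, h.ηθ, ← mul_assoc (θ i), h.θθ i k]
    by_cases hh : k = i
    · subst hh; simp; noncomm_ring
    · simp [hh]; noncomm_ring
  rw [sum_mul, sum_congr rfl fun k _ => this k, sum_add_distrib, mul_sum]
  simp

lemma y_mul_n (i) : y i * (∑ k, y k * p k) = (∑ k, y k * p k) * y i - y i := by
  have : ∀ k, y i * (y k * p k) = y k * p k * y i - if k = i then y i else 0 := by
    intro k
    have h1 : p k * y i = y i * p k + if k = i then 1 else 0 := by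
      rw [← h.py]; unfold cm; abel
    rw [mul_assoc, h1, mul_add, ← mul_assoc, h.comm_yy i k]
    by_cases hh : k = i
    · subst hh; simp; noncomm_ring
    · simp [hh]; noncomm_ring
  rw [mul_sum, sum_congr rfl fun k _ => this k, sum_sub_distrib, sum_mul]
  simp

lemma sum_ρ_ρ : ∑ i, ∑ j, cρ N θ η y p i j * cρ N θ η y p j i =
    (∑ k, y k * p k) * (∑ k, y k * p k) + ((N : R) - 1) * (∑ k, y k * p k)
    + ((N : R) + 1) * (∑ k, θ k * η k) - (∑ k, θ k * η k) * (∑ k, θ k * η k)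
    - 2 * (cτ N θ y * cΔ N η p) := by
  have key : ∀ i j, cρ N θ η y p i j * cρ N θ η y p j i =
      y i * (y j * p j) * p i + y i * p i - (y i * θ i) * (p j * η j)
      - (y j * θ j) * (p i * η i) + θ j * η j - θ j * (θ i * η i) * η j := by
    intro i j
    have e1 : p j * y j = y j * p j + 1 := by
      have : cm (p j) (y j) = 1 := by simpa using h.py j j
      rw [← this]; unfold cm; abel
    have e2 : η i * θ i = 1 - θ i * η i := by simpa using h.ηθ i i
    calc cρ N θ η y p i j * cρ N θ η y p j i
        = y i * (p j * y j) * p i - y i * (p j * θ i) * η j - θ j * (η i * y j) * p i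
          + θ j * (η i * θ i) * η j := by unfold cρ; noncomm_ring
      _ = y i * (y j * p j) * p i + y i * p i - (y i * θ i) * (p j * η j)
          - (θ j * y j) * (η i * p i) + θ j * η j - θ j * (θ i * η i) * η j := by
        rw [e1, e2, h.comm_pθ j i, ← h.comm_yη j i]; noncomm_ring
      _ = _ := by rw [h.comm_yθ j j, h.comm_pη i i]
  simp only [key, sum_add_distrib, sum_sub_distrib, ← sum_mul, ← mul_sum]
  have e3 : ∑ i, y i * (∑ k, y k * p k) * p i =
      (∑ k, y k * p k) * (∑ k, y k * p k) - ∑ k, y k * p k := by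
    simp only [h.y_mul_n, sub_mul, sum_sub_distrib, mul_assoc, ← mul_sum]
  have e4 : ∑ i, θ i * (∑ k, θ k * η k) * η i =
      (∑ k, θ k * η k) * (∑ k, θ k * η k) - ∑ k, θ k * η k := by
    have : ∀ i, θ i * (∑ k, θ k * η k) = (∑ k, θ k * η k) * θ i - θ i := fun i => by
      rw [h.n_θ_mul]; abel
    simp only [this, sub_mul, sum_sub_distrib, mul_assoc, ← mul_sum]
  have e6 : ∑ i : Fin N, ∑ x, θ x * η x = (N : R) * ∑ x, θ x * η x := by simp
  have e7 : ∑ x, (∑ _i : Fin N, y x) * p x = (N : R) * ∑ x, y x * p x := by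
    simp [mul_sum, mul_assoc]
  have e8 : ∑ x, ∑ x_1, θ x_1 * (θ x * η x) * η x_1 = ∑ i, θ i * (∑ k, θ k * η k) * η i := by
    rw [sum_comm]; simp only [mul_sum, sum_mul]
  rw [e3, e6, e7, e8, e4, cτ, cΔ]
  generalize (∑ k, y k * p k) = ny
  generalize (∑ k, y k * θ k) = t
  generalize (∑ k, θ k * η k) = nt
  generalize (∑ k, p k * η k) = dd
  noncomm_ring

lemma Δ_τ : cΔ N η p * cτ N θ y + cτ N θ y * cΔ N η p =
    ∑ k, y k * p k + (N : R) - ∑ k, θ k * η k := by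
  have key : ∀ j i, p j * η j * (y i * θ i) + y i * θ i * (p j * η j) =
      if j = i then 1 + y i * p i - θ i * η i else 0 := by
    intro j i
    have e1 : p j * y i = y i * p j + if j = i then 1 else 0 := by
      rw [← h.py]; unfold cm; abel
    have e2 := h.ηθ j i
    calc _ = p j * (η j * y i) * θ i + y i * (θ i * p j) * η j := by noncomm_ring
      _ = (p j * y i) * (η j * θ i) + y i * p j * (θ i * η j) := by
        rw [← h.comm_yη, ← h.comm_pθ]; noncomm_ring
      _ = _ := by
        rw [e1, e2]
        split_ifs with hh
        · subst hh; noncomm_ring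
        · noncomm_ring
  have : cΔ N η p * cτ N θ y + cτ N θ y * cΔ N η p =
      ∑ j, ∑ i, (p j * η j * (y i * θ i) + y i * θ i * (p j * η j)) := by
    simp only [sum_add_distrib, ← mul_sum, ← sum_mul, cΔ, cτ]
  rw [this]
  simp only [key]
  simp [sum_add_distrib, sum_sub_distrib]
  abel

lemma D_τ : cD N θ η p s x * cτ N θ y + cτ N θ y * cD N θ η p s x =
    ∑ i, ∑ j, x i j * θ i * θ j + s * (∑ k, y k * p k + (N : R) - ∑ k, θ k * η k) := by
  have key : ∀ k l i, x k l * θ k * p l * (y i * θ i) + y i * θ i * (x k l * θ k * p l) =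
      if l = i then x k l * θ k * θ l else 0 := by
    intro k l i
    have e1 : p l * y i = y i * p l + if l = i then 1 else 0 := by
      rw [← h.py]; unfold cm; abel
    have e2 := h.θθ i k
    have e3 := eq_of_cm_eq_zero (h.xθ k l i)
    have e4 := eq_of_cm_eq_zero (h.xy k l i)
    calc _ = x k l * θ k * (p l * y i) * θ i + y i * (θ i * x k l) * θ k * p l := by noncomm_ring
      _ = x k l * θ k * (p l * y i) * θ i + (y i * x k l) * (θ i * θ k) * p l := by
        rw [← e3]; noncomm_ring
      _ = x k l * (θ k * y i) * (p l * θ i) + (if l = i then x k l * θ k * θ i else 0)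
          - x k l * y i * (θ k * (θ i * p l)) := by
        rw [e1, e2, ← e4]; split_ifs <;> noncomm_ring
      _ = _ := by
        rw [← h.comm_yθ, h.comm_pθ]
        split_ifs with hh
        · subst hh; noncomm_ring
        · noncomm_ring
  have hs : cτ N θ y * s = s * cτ N θ y := by
    apply eq_of_cm_eq_zero
    simp [cτ, sum_cm, mul_cm, h.ys, h.θs]
  have e : (∑ i, ∑ j, x i j * θ i * p j) * cτ N θ y + cτ N θ y * (∑ i, ∑ j, x i j * θ i * p j) =
      ∑ i, ∑ j, x i j * θ i * θ j := by
    have : (∑ i, ∑ j, x i j * θ i * p j) * cτ N θ y + cτ N θ y * (∑ i, ∑ j, x i j * θ i * p j) =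
        ∑ k, ∑ l, ∑ i, (x k l * θ k * p l * (y i * θ i) + y i * θ i * (x k l * θ k * p l)) := by
      simp only [sum_add_distrib, cτ]
      congr 1
      · simp only [← mul_sum, ← sum_mul]
      · simp only [← sum_mul]; simp only [mul_sum]
    rw [this]
    simp only [key]
    simp
  rw [← e, ← h.Δ_τ, cD]
  generalize (∑ i, ∑ j, x i j * θ i * p j) = u
  calc _ = u * cτ N θ y + s * cΔ N η p * cτ N θ y + cτ N θ y * u + (cτ N θ y * s) * cΔ N η p := by
        noncomm_ring
    _ = _ := by rw [hs]; noncomm_ring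

lemma sum_ε_ε : ∑ i, ∑ j, (∑ k, x i k * dx j k) * (∑ l, x j l * dx i l) =
    ∑ i, ∑ j, ∑ k, x i j * (∑ l, x k l * dx i l) * dx k j
      + ((N : R) - 1) * ∑ i, ∑ j, x i j * dx i j := by
  have key : ∀ i k j l, x i k * dx j k * (x j l * dx i l) = x i k * (x j l * dx i l) * dx j k
      + (if k = l then x i k * dx i k else 0) - (if j = l then if k = j then x i k * dx i l else 0 else 0) := by
    intro i k j l
    have e1 : dx j k * x j l = x j l * dx j k + ((if k = l then 1 else 0)
        - (if j = l then if k = j then 1 else 0 else 0)) := by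
      have := h.dxx j k j l
      rw [if_pos rfl] at this
      rw [← this]; unfold cm; abel
    have e2 := eq_of_cm_eq_zero (h.dxdx j k i l)
    calc _ = x i k * (dx j k * x j l) * dx i l := by noncomm_ring
      _ = _ := by
        rw [e1]
        have : x i k * (x j l * dx i l) * dx j k = x i k * x j l * (dx j k * dx i l) := by
          rw [e2]; noncomm_ring
        rw [this]
        split_ifs with h1 h2 h3 <;> (try subst h1) <;> noncomm_ring
  have e : ∑ i, ∑ j, (∑ k, x i k * dx j k) * (∑ l, x j l * dx i l) =
      ∑ i, ∑ k, ∑ j, ∑ l, x i k * dx j k * (x j l * dx i l) := by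
    refine sum_congr rfl fun i _ => ?_
    rw [sum_comm]
    refine sum_congr rfl fun j _ => ?_
    rw [sum_mul_sum]
  rw [e]
  simp only [key, sum_add_distrib, sum_sub_distrib]
  simp only [mul_sum, sum_mul]
  simp [sub_mul, mul_sum, sum_sub_distrib]
  abel

lemma cm_δ_D : cm δ (cD N θ η p s x) = cΔ N η p := by
  have : cm δ (cΔ N η p) = 0 := by
    simp [cΔ, cm_sum, cm_mul, cm_skew δ (p _), cm_skew δ (η _), h.pδ, h.ηδ]
  simp only [cD, cm_add, cm_sum, cm_mul, this, h.δs, cm_skew δ (p _), cm_skew δ (θ _),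
    cm_skew δ (x _ _), h.xδ, h.pδ, h.θδ]
  simp

/-- A quadratic identity expressing the Casimir operator, up to a homotopy for the differential, in
terms of the total degree. -/
theorem casimir : ∑ i, ∑ j, cE N θ η y p x dx i j * cE N θ η y p x dx j i
    - ∑ i, ∑ j, x i j * cP N θ η y p s δ x dx i j
    - (cn N θ η y p s δ - 1) * ∑ i, cE N θ η y p x dx i i
    + 2 * (cD N θ η p s x * (cτ N θ y * δ) + cτ N θ y * δ * cD N θ η p s x) =
    cn N θ η y p s δ * N := by
  set n := cn N θ η y p s δ with hn
  set ρ := cρ N θ η y p with hρ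
  set X := ∑ i, ∑ j, x i j * dx i j with hX
  set ny := ∑ k, y k * p k with hny
  set nt := ∑ k, θ k * η k with hnt
  have hxn : ∀ i j, x i j * n = n * x i j := by
    intro i j
    apply eq_of_cm_eq_zero
    simp [hn, cn, cm_add, cm_sum, cm_mul, h.xy, h.xp, h.xθ, h.xη, h.xs, h.xδ, cm_two]
  have hxρ : ∀ i j k l, x i j * ρ k l = ρ k l * x i j := by
    intro i j k l
    apply eq_of_cm_eq_zero
    rw [cm_skew, h.cm_ρ_x, neg_zero]
  have hdρ : ∀ i j k l, dx i j * ρ k l = ρ k l * dx i j := by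
    intro i j k l
    exact eq_of_cm_eq_zero (h.cm_dx_ρ _ _ _ _)
  have hE : ∀ i j, cE N θ η y p x dx i j = ∑ k, x i k * dx j k + ρ i j := fun i j => rfl
  have h1 : ∑ i, cE N θ η y p x dx i i = X + (ny - nt) := by
    simp [hE, hρ, hX, cρ, sum_add_distrib, hny, hnt]
  have h2 : ∑ i, ∑ j, cE N θ η y p x dx i j * cE N θ η y p x dx j i =
      ∑ i, ∑ j, (∑ k, x i k * dx j k) * (∑ l, x j l * dx i l) +
      2 * ∑ i, ∑ j, ρ i j * (∑ l, x j l * dx i l) + ∑ i, ∑ j, ρ i j * ρ j i := by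
    have : ∑ i, ∑ j, (∑ k, x i k * dx j k) * ρ j i = ∑ i, ∑ j, ρ i j * (∑ l, x j l * dx i l) := by
      rw [sum_comm]
      refine sum_congr rfl fun i _ => sum_congr rfl fun j _ => ?_
      rw [sum_mul, mul_sum]
      refine sum_congr rfl fun k _ => ?_
      rw [mul_assoc, hdρ, ← mul_assoc, hxρ, mul_assoc]
    simp only [hE, add_mul, mul_add, sum_add_distrib, this]
    noncomm_ring
  have h3 : ∑ i, ∑ j, x i j * cP N θ η y p s δ x dx i j =
      ∑ i, ∑ j, ∑ k, x i j * (∑ l, x k l * dx i l) * dx k j +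
      2 * ∑ i, ∑ j, ρ i j * (∑ l, x j l * dx i l) + ((N : R) - n) * X
      + 2 * ((∑ i, ∑ j, x i j * θ i * θ j) * δ) := by
    have e1 : ∑ i, ∑ j, ∑ k, x i j * (ρ k i * dx k j) = ∑ i, ∑ j, ρ i j * (∑ l, x j l * dx i l) := by
      have : ∀ i j k, x i j * (ρ k i * dx k j) = ρ k i * (x i j * dx k j) := by
        intro i j k; rw [← mul_assoc, hxρ, mul_assoc]
      simp only [this, mul_sum]
      exact (sum_congr rfl fun i _ => sum_comm).trans sum_comm
    have e2 : ∑ i, ∑ j, ∑ k, x i j * (ρ k j * dx k i) =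
        -∑ i, ∑ j, ρ i j * (∑ l, x j l * dx i l) := by
      rw [← e1, sum_comm, ← sum_neg_distrib]
      refine sum_congr rfl fun i _ => ?_
      rw [← sum_neg_distrib]
      refine sum_congr rfl fun j _ => ?_
      rw [← sum_neg_distrib]
      refine sum_congr rfl fun k _ => ?_
      rw [h.xskew i j, neg_mul]
    have e3 : ∀ i j, x i j * cP N θ η y p s δ x dx i j =
        ∑ k, x i j * (∑ l, x k l * dx i l) * dx k j + ∑ k, x i j * (ρ k i * dx k j)
        - ∑ k, x i j * (ρ k j * dx k i) + ((N : R) - n) * (x i j * dx i j)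
        + 2 * (x i j * θ i * θ j * δ) := by
      intro i j
      have : x i j * ((N : R) - n) = ((N : R) - n) * x i j := by
        rw [mul_sub, hxn, sub_mul, Nat.cast_comm]
      have e4 : x i j * ∑ k, (cE N θ η y p x dx k i * dx k j - cρ N θ η y p k j * dx k i) =
          ∑ k, x i j * (∑ l, x k l * dx i l) * dx k j + ∑ k, x i j * (ρ k i * dx k j)
          - ∑ k, x i j * (ρ k j * dx k i) := by
        rw [mul_sum, ← sum_add_distrib, ← sum_sub_distrib]
        refine sum_congr rfl fun k _ => ?_
        rw [hE, ← hρ]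
        generalize (∑ l, x k l * dx i l) = w
        noncomm_ring
      have e5 : x i j * (2 * (θ i * θ j * δ)) = 2 * (x i j * θ i * θ j * δ) := by noncomm_ring
      rw [cP, ← hn, mul_add, mul_add, e4, ← mul_assoc (x i j) _ (dx i j), this, e5, mul_assoc _ (x i j)]
    have e6 : ∑ i, ∑ j, ((N : R) - n) * (x i j * dx i j) = ((N : R) - n) * X := by
      simp only [hX, mul_sum]
    have e7 : ∑ i, ∑ j, 2 * (x i j * θ i * θ j * δ) = 2 * ((∑ i, ∑ j, x i j * θ i * θ j) * δ) := by
      simp only [mul_sum, sum_mul]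
    simp only [e3, sum_add_distrib, sum_sub_distrib]
    rw [e1, e2, e6, e7]
    noncomm_ring
  have h4 : cD N θ η p s x * (cτ N θ y * δ) + cτ N θ y * δ * cD N θ η p s x =
      (∑ i, ∑ j, x i j * θ i * θ j) * δ + s * (ny + (N : R) - nt) * δ + cτ N θ y * cΔ N η p := by
    have e1 : δ * cD N θ η p s x = cD N θ η p s x * δ + cΔ N η p := by
      rw [← h.cm_δ_D]; unfold cm; abel
    rw [mul_assoc _ δ, e1, ← add_mul, ← h.D_τ]
    noncomm_ring
  have c1 : δ * ny = ny * δ := by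
    apply eq_of_cm_eq_zero
    rw [cm_skew]; simp [hny, sum_cm, mul_cm, h.yδ, h.pδ]
  have c2 : δ * nt = nt * δ := by
    apply eq_of_cm_eq_zero
    rw [cm_skew]; simp [hnt, sum_cm, mul_cm, h.θδ, h.ηδ]
  have c3 : nt * ny = ny * nt := by
    apply eq_of_cm_eq_zero
    simp [hnt, hny, sum_cm, mul_cm, cm_sum, cm_mul, h.θy, h.θp, h.ηy, h.ηp]
  have c4 : ∀ a : R, a * (N : R) = N * a := fun a => (Nat.cast_comm N a).symm
  rw [h4, h1, h2, h3, h.sum_ε_ε, h.sum_ρ_ρ, ← hX, ← hny, ← hnt, c4]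
  have hn' : n = ny + nt + 2 * (s * δ) := rfl
  have c5 : s * (ny + (N : R) - nt) * δ = s * δ * ny + N * (s * δ) - s * δ * nt := by
    rw [mul_assoc s δ, c1, mul_assoc s δ, c2, mul_sub, mul_add, c4]; noncomm_ring
  rw [c5, hn']
  have c6 : (ny + nt + 2 * (s * δ) - 1) * (X + (ny - nt)) = (ny + nt + 2 * (s * δ) - 1) * X +
      ny * ny - nt * nt + 2 * (s * δ * ny) - 2 * (s * δ * nt) - ny + nt := by
    simp only [mul_add, mul_sub, add_mul, sub_mul, c3]; noncomm_ring
  rw [c6]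
  generalize (∑ i, ∑ j, x i j * θ i * θ j) = w1
  generalize ∑ i, ∑ j, ρ i j * (∑ l, x j l * dx i l) = w2
  generalize ∑ i, ∑ j, ∑ k, x i j * (∑ l, x k l * dx i l) * dx k j = w3
  noncomm_ring

end FockRel
end PfExt

namespace PfExt

open Finset

section Ladder

variable {K V : Type} [Field K] [AddCommGroup V] [Module K V]

lemma pow_apply_eigen {A B : Module.End K V} {c : K} {z : V} {v : K}
    (hAB : cm A B = c • B) (hz : A z = v • z) (k : ℕ) :
    A ((B ^ k) z) = (v + k * c) • (B ^ k) z := by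
  induction k with
  | zero => simp [hz]
  | succ k ih =>
    have h1 : A (B ((B ^ k) z)) = B (A ((B ^ k) z)) + c • B ((B ^ k) z) := by
      have := LinearMap.congr_fun hAB ((B ^ k) z)
      simp only [cm, LinearMap.sub_apply, Module.End.mul_apply, LinearMap.smul_apply] at this
      rw [← this]; abel
    rw [pow_succ', Module.End.mul_apply, h1, ih, map_smul, ← add_smul]
    congr 1; push_cast; ring

/-- A lowering operator detects membership in an invariant subspace along a ladder. -/
lemma mem_of_ladder (H : Submodule K V) {A B : Module.End K V} (c : ℕ → K) {z : V}
    (hA : ∀ w ∈ H, A w ∈ H) (hB : ∀ w ∈ H, B w ∈ H) (hz : A z ∈ H)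
    (hc : ∀ j, cm A B ((B ^ j) z) = c j • (B ^ j) z)
    (hne : ∀ k, 1 ≤ k → ∑ i ∈ range k, c i ≠ 0) (k : ℕ) (hk : (B ^ k) z ∈ H) : z ∈ H := by
  have key : ∀ k, A ((B ^ (k + 1)) z) - (∑ i ∈ range (k + 1), c i) • (B ^ k) z ∈ H := by
    intro k
    have h1 : ∀ j, A (B ((B ^ j) z)) = B (A ((B ^ j) z)) + c j • (B ^ j) z := by
      intro j
      have := hc j
      simp only [cm, LinearMap.sub_apply, Module.End.mul_apply] at this
      rw [← this]; abel
    induction k with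
    | zero =>
      have := h1 0
      simp only [pow_zero, Module.End.one_apply] at this
      simpa [this] using hB _ hz
    | succ k ih =>
      have h2 := hB _ ih
      rw [map_sub, map_smul] at h2
      rw [pow_succ', Module.End.mul_apply, h1 (k + 1), sum_range_succ, add_smul]
      convert h2 using 1
      rw [pow_succ', Module.End.mul_apply]; abel
  induction k with
  | zero => simpa using hk
  | succ k ih =>
    apply ih
    have h1 := H.sub_mem (hA _ hk) (key k)
    rw [sub_sub_cancel] at h1
    exact (H.smul_mem_iff (hne (k + 1) (by omega))).mp h1

/-- The saturation of a submodule with respect to an operator preserving it. -/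
def sat (H : Submodule K V) (x : Module.End K V) (hx : ∀ w ∈ H, x w ∈ H) : Submodule K V where
  carrier := {z | ∃ m, (x ^ m) z ∈ H}
  zero_mem' := ⟨0, by simp⟩
  add_mem' := by
    have up : ∀ (z : V) (m k : ℕ), (x ^ m) z ∈ H → (x ^ (k + m)) z ∈ H := by
      intro z m k hm
      induction k with
      | zero => simpa using hm
      | succ k ih =>
        rw [add_right_comm, pow_succ', Module.End.mul_apply]; exact hx _ ih
    rintro a b ⟨m, hm⟩ ⟨k, hk⟩
    refine ⟨k + m, ?_⟩
    rw [map_add]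
    exact H.add_mem (up _ _ _ hm) (by rw [add_comm]; exact up _ _ _ hk)
  smul_mem' := by
    rintro c a ⟨m, hm⟩
    exact ⟨m, by rw [map_smul]; exact H.smul_mem _ hm⟩

variable {H : Submodule K V} {x : Module.End K V} {hx : ∀ w ∈ H, x w ∈ H}

lemma mem_sat_of_pow {z : V} (m : ℕ) (h : (x ^ m) z ∈ sat H x hx) : z ∈ sat H x hx := by
  obtain ⟨k, hk⟩ := h
  exact ⟨k + m, by rwa [pow_add, Module.End.mul_apply]⟩

lemma le_sat {z : V} (h : z ∈ H) : z ∈ sat H x hx := ⟨0, by simpa using h⟩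

lemma pow_mem_sat {z : V} (h : z ∈ sat H x hx) (k : ℕ) : (x ^ k) z ∈ sat H x hx := by
  obtain ⟨m, hm⟩ := h
  refine ⟨m, ?_⟩
  rw [← Module.End.mul_apply, ← pow_add, add_comm, pow_add, Module.End.mul_apply]
  induction k with
  | zero => simpa using hm
  | succ k ih => rw [pow_succ', Module.End.mul_apply]; exact hx _ ih

lemma sat_of_cm {O : Module.End K V} (hO : ∀ w ∈ H, O w ∈ H)
    (hc : ∀ w ∈ sat H x hx, cm x O w ∈ sat H x hx) : ∀ w ∈ sat H x hx, O w ∈ sat H x hx := by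
  rintro z ⟨m, hm⟩
  apply mem_sat_of_pow m
  have : ∀ k, (x ^ k) (O z) - O ((x ^ k) z) ∈ sat H x hx := by
    intro k
    induction k with
    | zero => simp
    | succ k ih =>
      have h1 := pow_mem_sat ih 1
      have h2 := hc _ (pow_mem_sat (x := x) (hx := hx) ⟨m, hm⟩ k)
      simp only [cm, LinearMap.sub_apply, Module.End.mul_apply, pow_one, map_sub] at h1 h2
      have := (sat H x hx).add_mem h1 h2
      rw [pow_succ', Module.End.mul_apply, Module.End.mul_apply]
      convert this using 1
      abel
  have h3 := (sat H x hx).add_mem (this m) (le_sat (hO _ hm))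
  simpa using h3

/-- Operators of order at most two with respect to `x` preserve the saturation. -/
lemma sat_of_cm_cm_cm {O : Module.End K V} (hO : ∀ w ∈ H, O w ∈ H)
    (hc : cm x (cm x (cm x O)) = 0) : ∀ w ∈ sat H x hx, O w ∈ sat H x hx := by
  have hx' := hx
  have h1 : ∀ O : Module.End K V, (∀ w ∈ H, O w ∈ H) → ∀ w ∈ H, cm x O w ∈ H := by
    intro O hO w hw
    simp only [cm, LinearMap.sub_apply, Module.End.mul_apply]
    exact H.sub_mem (hx' _ (hO _ hw)) (hO _ (hx' _ hw))
  refine sat_of_cm hO (sat_of_cm (h1 _ hO) (sat_of_cm (h1 _ (h1 _ hO)) ?_))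
  rw [hc]; simp

end Ladder

namespace FockRel

variable {R : Type} [Ring R] {N : ℕ} {θ η y p : Fin N → R} {s δ : R} {x dx : Fin N → Fin N → R}
variable (h : FockRel N θ η y p s δ x dx)
include h

lemma cm_cm_x_E (i j k l) : cm (x k l) (cm (x k l) (cE N θ η y p x dx i j)) = 0 := by
  rw [cm_skew (x k l) (cE _ _ _ _ _ _ _ _ _), h.cm_E_x]
  split_ifs <;> simp [cm_neg, cm_add, cm_zero, h.xx]

lemma cm_cm_cm_x_P (i j k l) :
    cm (x k l) (cm (x k l) (cm (x k l) (cP N θ η y p s δ x dx i j))) = 0 := by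
  have hn : cm (x k l) (cn N θ η y p s δ) = 0 := by
    simp [cn, cm_add, cm_sum, cm_mul, h.xy, h.xp, h.xθ, h.xη, h.xs, h.xδ, cm_two]
  have hρ : ∀ i j, cm (x k l) (cρ N θ η y p i j) = 0 := fun i j => by
    rw [cm_skew, h.cm_ρ_x, neg_zero]
  have hd : ∀ i j, cm (x k l) (cm (x k l) (dx i j)) = 0 := fun i j => by
    rw [cm_skew (x k l) (dx i j), h.dxx, cm_neg, cm_sub]
    split_ifs <;> simp [cm_one, cm_zero]
  have h2 := h.cm_cm_x_E
  simp [cP, cm_add, cm_sub, cm_sum, cm_mul, hn, hρ, hd, h2, h.xθ, h.xδ, cm_natCast, cm_two, cm_zero]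

end FockRel
end PfExt

namespace PfExt

open Finset

/-- The numerical part of the weight argument: integral weights that are weakly increasing, bounded
below by `-1` and satisfy the quadratic equation are extremal. -/
lemma weights_extremal {N : ℕ} (d : ℕ) (a b : Fin N) (ha : a.val + 2 = N) (hb : b.val + 1 = N)
    (v : Fin N → ℤ) (hv : ∀ i, -1 ≤ v i) (hmono : ∀ i j, i < j → v i ≤ v j)
    (hab : v a + v b ≤ d - N)
    (hF : ∑ i : Fin N, (v i + 1) * (v i + 2 * (i.val : ℤ) + 1 - N - d) = 0) :
    (∀ i, i ≠ b → v i = -1) ∧ (v b = -1 ∨ v b = d - N + 1) := by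
  have hle : ∀ i ∈ univ, (v i + 1) * (v i + 2 * (i.val : ℤ) + 1 - N - d) ≤ 0 := by
    intro i _
    have h1 := hv i
    have ha' := hv a
    have hb' := hv b
    have hlt : a < b := by rw [Fin.lt_def]; omega
    have h2 := hmono a b hlt
    apply mul_nonpos_of_nonneg_of_nonpos (by linarith)
    by_cases hib : i = b
    · subst hib; omega
    · have hia : v i ≤ v a := by
        by_cases e : i = a
        · rw [e]
        · refine hmono i a ?_
          rw [Fin.lt_def]
          have := i.2
          have : i.val ≠ a.val := fun h => e (Fin.ext h)
          have : i.val ≠ b.val := fun h => hib (Fin.ext h)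
          omega
      have : i.val ≠ b.val := fun h => hib (Fin.ext h)
      have := i.2
      omega
  have hz := (sum_eq_zero_iff_of_nonpos hle).mp hF
  constructor
  · intro i hib
    have h0 := hz i (mem_univ i)
    rcases mul_eq_zero.mp h0 with h | h
    · linarith
    · exfalso
      have h1 := hv i
      have ha' := hv a
      have hb' := hv b
      have hlt : a < b := by rw [Fin.lt_def]; omega
      have h2 := hmono a b hlt
      have hia : v i ≤ v a := by
        by_cases e : i = a
        · rw [e]
        · refine hmono i a ?_
          rw [Fin.lt_def]
          have := i.2
          have : i.val ≠ a.val := fun h => e (Fin.ext h)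
          have : i.val ≠ b.val := fun h => hib (Fin.ext h)
          omega
      have : i.val ≠ b.val := fun h => hib (Fin.ext h)
      have := i.2
      omega
  · rcases mul_eq_zero.mp (hz b (mem_univ b)) with h | h
    · left; linarith
    · right; omega

namespace FockRel

variable {K V : Type} [Field K] [CharZero K] [AddCommGroup V] [Module K V]
variable {N : ℕ} {θ η y p : Fin N → Module.End K V} {s δ : Module.End K V}
  {x dx : Fin N → Fin N → Module.End K V}

lemma casimir_apply (h : FockRel N θ η y p s δ x dx) (d : ℕ) (H : Submodule K V)
    (hH : H = LinearMap.range (cD N θ η p s x)) (z : V) (v : Fin N → ℤ)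
    (hz : cD N θ η p s x z = 0) (hn : cn N θ η y p s δ z = (d : K) • z)
    (hv : ∀ i, cE N θ η y p x dx i i z = (v i : K) • z)
    (hE : ∀ i j, i < j → cE N θ η y p x dx j i z ∈ H)
    (hP : ∀ i j, i ≠ j → cP N θ η y p s δ x dx i j z ∈ H)
    (hEH : ∀ i j, ∀ w ∈ H, cE N θ η y p x dx i j w ∈ H)
    (hxH : ∀ i j, ∀ w ∈ H, x i j w ∈ H) :
    ((∑ i : Fin N, (v i + 1) * (v i + 2 * (i.val : ℤ) + 1 - N - d) : ℤ) : K) • z ∈ H := by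
  set E := cE N θ η y p x dx with hEdef
  have hxii : ∀ i, x i i = 0 := by
    intro i
    have := h.xskew i i
    have h2 : (2 : K) • x i i = 0 := by rw [two_smul]; nth_rewrite 1 [this]; simp
    exact (smul_eq_zero.mp h2).resolve_left two_ne_zero
  have hEE : ∀ i j, i < j → E i j (E j i z) + E j i (E i j z) - ((v j - v i : ℤ) : K) • z ∈ H := by
    intro i j hij
    have h1 := LinearMap.congr_fun (h.cm_E_E j i i j) z
    simp only [if_true, cm, LinearMap.sub_apply, Module.End.mul_apply, ← hEdef, hv] at h1
    have h2 := hEH i j _ (hE i j hij)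
    have h3 : E j i (E i j z) = E i j (E j i z) + ((v j - v i : ℤ) : K) • z := by
      push_cast
      rw [sub_smul, ← h1]; abel
    rw [h3, ← add_assoc, add_sub_cancel_right]
    exact H.add_mem h2 h2
  have hcas := LinearMap.congr_fun h.casimir z
  simp only [LinearMap.add_apply, LinearMap.sub_apply, LinearMap.sum_apply, Module.End.mul_apply,
    ← hEdef, hz, hv, map_zero, add_zero] at hcas
  -- rewrite each part modulo `H`
  have h1 : ∑ i, ∑ j, x i j (cP N θ η y p s δ x dx i j z) ∈ H := by
    refine H.sum_mem fun i _ => H.sum_mem fun j _ => ?_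
    by_cases hij : i = j
    · subst hij; rw [hxii]; simp
    · exact hxH _ _ _ (hP i j hij)
  have h2 : (2 : Module.End K V) (cD N θ η p s x (cτ N θ y (δ z))) ∈ H := by
    have : (2 : Module.End K V) = (2 : K) • (1 : Module.End K V) := by
      rw [two_smul, one_add_one_eq_two]
    rw [this, LinearMap.smul_apply, Module.End.one_apply, hH]
    exact Submodule.smul_mem _ _ ⟨_, rfl⟩
  have h3 : (cn N θ η y p s δ - 1 : Module.End K V) (∑ i, (v i : K) • z) =
      ((d - 1 : K) * ∑ i, (v i : K)) • z := by
    rw [← sum_smul, map_smul, LinearMap.sub_apply, hn, Module.End.one_apply, mul_comm, mul_smul,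
      sub_smul, one_smul]
  have h4 : cn N θ η y p s δ ((N : Module.End K V) z) = ((d : K) * N) • z := by
    have : (N : Module.End K V) z = (N : K) • z := by
      rw [Module.End.natCast_apply, Nat.cast_smul_eq_nsmul]
    rw [this, map_smul, hn, mul_comm, mul_smul]
  have h5 : ∑ i, ∑ j, E i j (E j i z) -
      (((∑ i, (v i * v i + v i * (2 * (i.val : ℤ) - N + 1)) : ℤ)) : K) • z ∈ H := by
    have e1 : ∑ i, ∑ j, E i j (E j i z) =
        ∑ i, E i i (E i i z) + ∑ i, ∑ j, if i < j then E i j (E j i z) + E j i (E i j z) else 0 := by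
      have e2 : ∀ i j : Fin N, E i j (E j i z) = (if i = j then E i j (E j i z) else 0) +
          (if i < j then E i j (E j i z) else 0) + (if j < i then E i j (E j i z) else 0) := by
        intro i j
        rcases lt_trichotomy i j with hh | hh | hh
        · simp [hh, hh.ne, hh.not_gt]
        · simp [hh]
        · simp [hh, hh.ne', hh.not_gt]
      have e3 : ∑ i, ∑ j, (if j < i then E i j (E j i z) else 0) =
          ∑ i, ∑ j, (if i < j then E j i (E i j z) else 0) := sum_comm
      calc ∑ i, ∑ j, E i j (E j i z) = ∑ i, ∑ j, ((if i = j then E i j (E j i z) else 0) +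
          (if i < j then E i j (E j i z) else 0) + (if j < i then E i j (E j i z) else 0)) :=
            sum_congr rfl fun i _ => sum_congr rfl fun j _ => e2 i j
        _ = _ := by
          simp only [sum_add_distrib, e3]
          rw [add_assoc]
          congr 1
          · simp
          · rw [← sum_add_distrib]
            refine sum_congr rfl fun i _ => ?_
            rw [← sum_add_distrib]
            refine sum_congr rfl fun j _ => ?_
            split_ifs <;> simp
    have e4 : ∑ i : Fin N, (v i * v i + v i * (2 * (i.val : ℤ) - N + 1)) =
        ∑ i, v i * v i + ∑ i, ∑ j, if i < j then v j - v i else 0 := by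
      rw [sum_add_distrib]
      congr 1
      have e5 : ∀ i j : Fin N, (if i < j then v j - v i else 0) =
        (if i < j then v j else 0) - (if i < j then v i else 0) := by
        intro i j; split_ifs <;> simp
      simp only [e5, sum_sub_distrib]
      rw [sum_comm (f := fun i j => if i < j then v j else 0), ← sum_sub_distrib]
      refine sum_congr rfl fun i _ => ?_
      rw [← sum_filter, ← sum_filter, sum_const, sum_const]
      have c1 : #{j | j < i} = i.val := by
        have : ({j | j < i} : Finset (Fin N)) = Iio i := by ext; simp
        rw [this, Fin.card_Iio]
      have c2 : #{j | i < j} = N - 1 - i.val := by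
        have : ({j | i < j} : Finset (Fin N)) = Ioi i := by ext; simp
        rw [this, Fin.card_Ioi]
      rw [c1, c2, nsmul_eq_mul, nsmul_eq_mul]
      have := i.2
      have c3 : ((N - 1 - i.val : ℕ) : ℤ) = N - 1 - i.val := by omega
      rw [c3]; ring
    rw [e1, e4]
    push_cast
    rw [add_smul, add_sub_add_comm]
    have e6 : ∑ i, E i i (E i i z) = (∑ i, (v i : K) * v i) • z := by
      rw [sum_smul]
      refine sum_congr rfl fun i _ => ?_
      rw [hv, map_smul, hv, mul_smul]
    rw [e6, sub_self, zero_add, sum_smul, ← sum_sub_distrib]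
    refine H.sum_mem fun i _ => ?_
    rw [sum_smul, ← sum_sub_distrib]
    refine H.sum_mem fun j _ => ?_
    split_ifs with hij
    · have := hEE i j hij
      push_cast at this
      exact this
    · simp
  rw [LinearMap.sub_apply] at h3
  rw [h3, h4] at hcas
  have h6 : (∑ i : Fin N, (v i + 1) * (v i + 2 * (i.val : ℤ) + 1 - N - d) : ℤ) =
      (∑ i, (v i * v i + v i * (2 * (i.val : ℤ) - N + 1))) - (d - 1) * (∑ i, v i) - d * N := by
    have e1 : ∑ i : Fin N, (2 * (i.val : ℤ) + 1 - N) = 0 := by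
      rw [sum_sub_distrib, sum_add_distrib, ← mul_sum]
      have := Fin.sum_univ_eq_sum_range (fun i => (i : ℤ)) N
      rw [this]
      have h7 := Finset.sum_range_id_mul_two N
      have h8 : (∑ i ∈ range N, (i : ℤ)) * 2 = N * (N - 1) := by
        rcases N with _ | N
        · simp
        · rw [← Nat.cast_sum, ← Nat.cast_two (R := ℤ), ← Nat.cast_mul, h7]; push_cast; simp
      rw [mul_comm, h8]; simp; ring
    have e2 : ∀ i : Fin N, (v i + 1) * (v i + 2 * (i.val : ℤ) + 1 - N - d) =
        (v i * v i + v i * (2 * (i.val : ℤ) - N + 1)) - (d - 1) * v i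
          + (2 * (i.val : ℤ) + 1 - N) - d := by intro i; ring
    simp only [e2]
    rw [sum_sub_distrib, sum_add_distrib, sum_sub_distrib, e1, ← mul_sum]
    simp; ring
  rw [h6]
  have h7 := H.sub_mem (H.sub_mem h1 h2) h5
  convert h7 using 1
  push_cast
  rw [sub_smul, sub_smul]
  have h8 := eq_add_of_sub_eq (eq_sub_of_add_eq hcas)
  rw [eq_add_of_sub_eq h8]
  abel

end FockRel
end PfExt

namespace PfExt

open Finset

namespace FockRel

variable {K V : Type} [Field K] [CharZero K] [AddCommGroup V] [Module K V]
variable {N : ℕ} {θ η y p : Fin N → Module.End K V} {s δ : Module.End K V}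
  {x dx : Fin N → Fin N → Module.End K V}

section

omit [CharZero K]

lemma range_stable {D O : Module.End K V} (hO : cm O D = 0) :
    ∀ w ∈ LinearMap.range D, O w ∈ LinearMap.range D := by
  rintro w ⟨u, rfl⟩
  refine ⟨O u, ?_⟩
  have := LinearMap.congr_fun (eq_of_cm_eq_zero hO) u
  simpa using this.symm

lemma cm_x_D (h : FockRel N θ η y p s δ x dx) (i j) : cm (x i j) (cD N θ η p s x) = 0 := by
  simp [cD, cΔ, cm_add, cm_sum, cm_mul, h.xx, h.xθ, h.xp, h.xs, h.xη]

lemma eigen_of_cm {A O : Module.End K V} {c v : K} {z : V} (hO : cm A O z = c • O z)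
    (hz : A z = v • z) : A (O z) = (v + c) • O z := by
  simp only [cm, LinearMap.sub_apply, Module.End.mul_apply, hz, map_smul] at hO
  rw [add_smul, ← hO]; abel

end

/-- The weight argument: an `x`-torsion cocycle of pure weight is a coboundary, provided this holds
for the extremal weights. -/
theorem mem_range_of_torsion (h : FockRel N θ η y p s δ x dx) (d : ℕ) (a b : Fin N)
    (ha : a.val + 2 = N) (hb : b.val + 1 = N) (C : Submodule K V)
    (hCE : ∀ i j, ∀ w ∈ C, cE N θ η y p x dx i j w ∈ C)
    (hCP : ∀ i j, ∀ w ∈ C, cP N θ η y p s δ x dx i j w ∈ C)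
    (hCn : ∀ w ∈ C, cn N θ η y p s δ w = (d : K) • w)
    (hC0 : ∀ w ∈ C, w ≠ 0 → ∀ v : Fin N → ℤ,
      (∀ i, cE N θ η y p x dx i i w = (v i : K) • w) → ∀ i, -1 ≤ v i)
    (hterm : ∀ w ∈ C, cD N θ η p s x w = 0 →
      (∃ m, ((x a b) ^ m) w ∈ LinearMap.range (cD N θ η p s x)) → ∀ v : Fin N → ℤ,
      (∀ i, cE N θ η y p x dx i i w = (v i : K) • w) → (∀ i, i ≠ b → v i = -1) →
      (v b = -1 ∨ v b = d - N + 1) → w ∈ LinearMap.range (cD N θ η p s x))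
    (z : V) (hzC : z ∈ C) (hz : cD N θ η p s x z = 0)
    (hm : ∃ m, ((x a b) ^ m) z ∈ LinearMap.range (cD N θ η p s x)) (v : Fin N → ℤ)
    (hv : ∀ i, cE N θ η y p x dx i i z = (v i : K) • z) :
    z ∈ LinearMap.range (cD N θ η p s x) := by
  set D := cD N θ η p s x with hD
  set H := LinearMap.range D with hH
  set E := cE N θ η y p x dx with hE
  set P := cP N θ η y p s δ x dx with hP
  have hab : a < b := by rw [Fin.lt_def]; omega
  have hEH : ∀ i j, ∀ w ∈ H, E i j w ∈ H := fun i j => range_stable (h.cm_E_D i j)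
  have hPH : ∀ i j, ∀ w ∈ H, P i j w ∈ H := fun i j => range_stable (h.cm_P_D i j)
  have hxH : ∀ i j, ∀ w ∈ H, x i j w ∈ H := fun i j => range_stable (h.cm_x_D i j)
  have hES : ∀ i j, ∀ w ∈ sat H (x a b) (hxH a b), E i j w ∈ sat H (x a b) (hxH a b) :=
    fun i j => sat_of_cm_cm_cm (hEH i j) (by rw [h.cm_cm_x_E, cm_zero])
  have hPS : ∀ i j, ∀ w ∈ sat H (x a b) (hxH a b), P i j w ∈ sat H (x a b) (hxH a b) :=
    fun i j => sat_of_cm_cm_cm (hPH i j) (h.cm_cm_cm_x_P i j a b)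
  have hker : ∀ O : Module.End K V, cm O D = 0 → ∀ w, D w = 0 → D (O w) = 0 := by
    intro O hO w hw
    have := LinearMap.congr_fun (eq_of_cm_eq_zero hO) w
    simp only [Module.End.mul_apply, hw, map_zero] at this
    exact this.symm
  suffices key : ∀ n : ℕ, ∀ z ∈ C, D z = 0 → z ∈ sat H (x a b) (hxH a b) → ∀ v : Fin N → ℤ,
      (∀ i, E i i z = (v i : K) • z) →
      ∑ i : Fin N, ((N : ℤ) - i.val) * (v i + 1) < n → z ∈ H by
    refine key (∑ i : Fin N, ((N : ℤ) - i.val) * (v i + 1) + 1).toNat z hzC hz hm v hv ?_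
    rw [Int.toNat_eq_max]
    omega
  intro n
  induction n with
  | zero =>
    intro z hzC hz hm v hv hn
    by_cases h0 : z = 0
    · rw [h0]; exact H.zero_mem
    · exfalso
      have h1 := hC0 z hzC h0 v hv
      refine absurd hn (not_lt.mpr ?_)
      refine sum_nonneg fun i _ => mul_nonneg ?_ ?_
      · have := i.2; omega
      · linarith [h1 i]
  | succ n ih =>
    intro z hzC hz hm v hv hn
    by_cases h0 : z = 0
    · rw [h0]; exact H.zero_mem
    have hv1 := hC0 z hzC h0 v hv
    -- lower elements
    have hPz : ∀ i j, i ≠ j → P i j z ∈ H := by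
      intro i j hij
      refine ih _ (hCP i j z hzC) (hker _ (h.cm_P_D i j) z hz) (hPS i j z hm)
        (fun k => v k - (if k = i then 1 else 0) - (if k = j then 1 else 0)) ?_ ?_
      · intro k
        have h1 : cm (E k k) (P i j) z =
            (-((if k = i then 1 else 0) + (if k = j then 1 else 0)) : K) • P i j z := by
          rw [h.cm_E_P k i j hij, Module.End.mul_apply]
          by_cases e1 : k = i
          · subst e1; simp [hij, ← hP]
          · by_cases e2 : k = j
            · subst e2; simp [e1, ← hP]
            · simp [e1, e2]
        rw [eigen_of_cm h1 (hv k)]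
        congr 1
        push_cast
        ring
      · have e : ∀ k : Fin N, ((N : ℤ) - k.val) *
            (v k - (if k = i then 1 else 0) - (if k = j then 1 else 0) + 1) =
            ((N : ℤ) - k.val) * (v k + 1) - (if k = i then (N : ℤ) - k.val else 0)
              - (if k = j then (N : ℤ) - k.val else 0) := by
          intro k; split_ifs <;> ring
        simp only [e, sum_sub_distrib]
        simp only [sum_ite_eq', mem_univ, if_true]
        have := i.2
        have := j.2
        push_cast at hn
        omega
    have hEz : ∀ i j, i < j → E j i z ∈ H := by
      intro i j hij
      refine ih _ (hCE j i z hzC) (hker _ (h.cm_E_D j i) z hz) (hES j i z hm)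
        (fun k => v k + (if k = j then 1 else 0) - (if k = i then 1 else 0)) ?_ ?_
      · intro k
        have h1 : cm (E k k) (E j i) z =
            ((if k = j then 1 else 0) - (if k = i then 1 else 0) : K) • E j i z := by
          rw [h.cm_E_E k k j i]
          by_cases e1 : k = j
          · subst e1
            simp [hij.ne', ← hE]
          · by_cases e2 : k = i
            · subst e2
              simp [hij.ne, ← hE]
            · simp [e1, e2]
        rw [eigen_of_cm h1 (hv k)]
        congr 1
        push_cast
        ring
      · have e : ∀ k : Fin N, ((N : ℤ) - k.val) *
            (v k + (if k = j then 1 else 0) - (if k = i then 1 else 0) + 1) =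
            ((N : ℤ) - k.val) * (v k + 1) + (if k = j then (N : ℤ) - k.val else 0)
              - (if k = i then (N : ℤ) - k.val else 0) := by
          intro k; split_ifs <;> ring
        simp only [e, sum_sub_distrib, sum_add_distrib]
        simp only [sum_ite_eq', mem_univ, if_true]
        rw [Fin.lt_def] at hij
        push_cast at hn
        omega
    -- the ladder for `x a b`
    by_cases hlam : 0 < v a + v b + N - d
    · obtain ⟨m, hm⟩ := hm
      refine mem_of_ladder H (A := P a b) (B := x a b)
        (fun j => ((v a + v b + N - d + 2 * j : ℤ) : K)) (hPH a b) (hxH a b) (hPz a b hab.ne) ?_ ?_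
        m hm
      · intro j
        have e1 : ∀ i : Fin N, i = a ∨ i = b → cm (E i i) (x a b) = (1 : K) • x a b := by
          rintro i (rfl | rfl)
          · rw [h.cm_E_x]; simp [hab.ne]
          · rw [h.cm_E_x]; simp [hab.ne']
        have e2 : cm (cn N θ η y p s δ) (x a b) = (0 : K) • x a b := by
          rw [cm_skew, zero_smul]
          simp [cn, cm_add, cm_sum, cm_mul, h.xy, h.xp, h.xθ, h.xη, h.xs, h.xδ, cm_two]
        rw [h.cm_P_x a b hab.ne]
        simp only [LinearMap.add_apply, LinearMap.sub_apply, ← hE]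
        rw [pow_apply_eigen (e1 a (Or.inl rfl)) (hv a), pow_apply_eigen (e1 b (Or.inr rfl)) (hv b),
          pow_apply_eigen e2 (hCn z hzC), Module.End.natCast_apply, ← Nat.cast_smul_eq_nsmul K,
          ← add_smul, ← sub_smul, ← add_smul]
        congr 1
        push_cast
        ring
      · intro k hk
        rw [← Int.cast_sum, Int.cast_ne_zero, sum_add_distrib, sum_const, card_range, nsmul_eq_mul]
        refine ne_of_gt (add_pos_of_pos_of_nonneg ?_ (sum_nonneg fun i _ => by positivity))
        exact mul_pos (by exact_mod_cast hk) hlam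
    -- the ladders for `E i j`
    by_cases hmono : ∃ i j, i < j ∧ v j < v i
    · obtain ⟨i, j, hij, hlt⟩ := hmono
      have eig : ∀ k, cm (E k k) (E i j) =
          ((if k = i then 1 else 0) - (if k = j then 1 else 0) : K) • E i j := by
        intro k
        rw [h.cm_E_E k k i j]
        by_cases e1 : k = i
        · subst e1
          simp [hij.ne, ← hE]
        · by_cases e2 : k = j
          · subst e2
            simp [hij.ne', ← hE]
          · simp [e1, e2]
      have hpC : ∀ m, (E i j ^ m) z ∈ C := by
        intro m
        induction m with
        | zero => simpa using hzC
        | succ m ihm => rw [pow_succ', Module.End.mul_apply]; exact hCE _ _ _ ihm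
      refine mem_of_ladder H (A := E j i) (B := E i j)
        (fun m => ((v j - v i - 2 * m : ℤ) : K)) (hEH j i) (hEH i j) (hEz i j hij) ?_ ?_
        (v j + 2).toNat ?_
      · intro m
        rw [h.cm_E_E j i i j]
        simp only [if_true, LinearMap.sub_apply, ← hE]
        rw [pow_apply_eigen (eig j) (hv j), pow_apply_eigen (eig i) (hv i), ← sub_smul]
        congr 1
        simp [hij.ne, hij.ne']
        ring
      · intro k hk
        rw [← Int.cast_sum, Int.cast_ne_zero, sum_sub_distrib, sum_const, card_range, nsmul_eq_mul]
        have h1 : (k : ℤ) * (v j - v i) < 0 :=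
          mul_neg_of_pos_of_neg (by exact_mod_cast hk) (by linarith)
        have h2 : 0 ≤ ∑ m ∈ range k, 2 * (m : ℤ) := sum_nonneg fun i _ => by positivity
        exact ne_of_lt (by linarith)
      · have h1 : (E i j ^ (v j + 2).toNat) z = 0 := by
          by_contra hne
          have h2 := hC0 _ (hpC _) hne (fun k => v k + (v j + 2).toNat *
            ((if k = i then 1 else 0) - (if k = j then 1 else 0))) (by
              intro k
              rw [pow_apply_eigen (eig k) (hv k)]
              congr 1
              push_cast
              rfl) j
          have h3 := hv1 j
          simp only [hij.ne', if_false, if_true] at h2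
          omega
        rw [h1]; exact H.zero_mem
    push Not at hmono
    by_cases hF : ∑ i : Fin N, (v i + 1) * (v i + 2 * (i.val : ℤ) + 1 - N - d) = 0
    · obtain ⟨h1, h2⟩ := weights_extremal d a b ha hb v hv1 hmono (by linarith) hF
      exact hterm z hzC hz hm v hv h1 h2
    · have := h.casimir_apply d H hH z v hz (hCn z hzC) hv hEz hPz hEH hxH
      exact (H.smul_mem_iff (by exact_mod_cast hF)).mp this

end FockRel
end PfExt

namespace PfExt

open Finset

noncomputable section

section Graded

variable {N : ℕ} {A : Type} [CommRing A] (k : Type) [CommRing k] [Algebra k A]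

/-- Families supported in prescribed exterior, symmetric and extra degrees. -/
def Gr (P : ℕ → ℕ → ℕ → Prop) : Submodule k (Fk N A) where
  carrier := {f | ∀ I α m, f I α m ≠ 0 → P I.card α.degree m}
  add_mem' {f g} hf hg I α m h := by
    by_cases h1 : f I α m = 0
    · exact hg I α m (by simpa [h1] using h)
    · exact hf I α m h1
  zero_mem' I α m h := absurd rfl h
  smul_mem' c f hf I α m h := hf I α m fun h0 => h (by simp [h0])

/-- The bigraded pieces of the complexes. -/
def Supp (d q : ℕ) : Submodule k (Fk N A) := Gr k fun b a c => a + q = d ∧ b + 2 * c = q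

variable {k} {P Q : ℕ → ℕ → ℕ → Prop} {f : Fk N A}

lemma Gr.mono (hf : f ∈ Gr k P) (h : ∀ b a c, P b a c → Q b a c) : f ∈ Gr k Q :=
  fun I α m hm => h _ _ _ (hf I α m hm)

lemma opE_mem (i : Fin N) (hf : f ∈ Gr k P) :
    opE k i f ∈ Gr k (fun b a c => ∃ b', b = b' + 1 ∧ P b' a c) := by
  intro I α m h
  rw [opE_apply] at h
  by_cases hi : i ∈ I
  · exact ⟨_, (card_erase_add_one hi).symm, hf _ _ _ (right_ne_zero_of_smul h)⟩
  · simp [hi] at h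

lemma opH_mem (i : Fin N) (hf : f ∈ Gr k P) :
    opH k i f ∈ Gr k (fun b a c => P (b + 1) a c) := by
  intro I α m h
  rw [opH_apply] at h
  by_cases hi : i ∈ I
  · simp [hi] at h
  · have := hf _ _ _ (right_ne_zero_of_smul h)
    rwa [card_insert_of_notMem hi] at this

lemma sub_single_add {α : Fin N →₀ ℕ} {i : Fin N} (h : α i ≠ 0) :
    α - Finsupp.single i 1 + Finsupp.single i 1 = α :=
  tsub_add_cancel_of_le (by
    rw [Finsupp.single_le_iff]; omega)

lemma degree_sub_single {α : Fin N →₀ ℕ} {i : Fin N} (h : α i ≠ 0) :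
    α.degree = (α - Finsupp.single i 1).degree + 1 := by
  conv_lhs => rw [← sub_single_add h]
  rw [map_add, Finsupp.degree_single]

lemma opT_mem (i : Fin N) (hf : f ∈ Gr k P) :
    opT k i f ∈ Gr k (fun b a c => ∃ a', a = a' + 1 ∧ P b a' c) := by
  intro I α m h
  rw [opT_apply] at h
  by_cases hi : α i = 0
  · simp [hi] at h
  · exact ⟨_, degree_sub_single hi, hf _ _ _ (right_ne_zero_of_smul h)⟩

lemma opY_mem (i : Fin N) (hf : f ∈ Gr k P) :
    opY k i f ∈ Gr k (fun b a c => ∃ a', a = a' + 1 ∧ P b a' c) := by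
  intro I α m h
  rw [opY_apply] at h
  by_cases hi : α i = 0
  · simp [hi] at h
  · exact ⟨_, degree_sub_single hi, hf _ _ _ (right_ne_zero_of_smul h)⟩

lemma opP_mem (i : Fin N) (hf : f ∈ Gr k P) :
    opP k i f ∈ Gr k (fun b a c => P b (a + 1) c) := by
  intro I α m h
  rw [opP_apply] at h
  have := hf _ _ _ h
  rwa [map_add, Finsupp.degree_single] at this

lemma opDt_mem (hf : f ∈ Gr k P) : opDt k f ∈ Gr k (fun b a c => P b a (c + 1)) := by
  intro I α m h
  rw [opDt_apply] at h
  exact hf _ _ _ h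

lemma opDs_mem (hf : f ∈ Gr k P) : opDs k f ∈ Gr k (fun b a c => P b a (c + 1)) := by
  intro I α m h
  rw [opDs_apply] at h
  exact hf _ _ _ (right_ne_zero_of_smul h)

lemma opS_mem (hf : f ∈ Gr k P) :
    opS k f ∈ Gr k (fun b a c => ∃ c', c = c' + 1 ∧ P b a c') := by
  intro I α m h
  rw [opS_apply] at h
  rcases m with _ | m
  · simp at h
  · exact ⟨m, rfl, hf _ _ _ (right_ne_zero_of_smul h)⟩

lemma coef_mem (u : Module.End k A) (hf : f ∈ Gr k P) : coef k u f ∈ Gr k P := by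
  intro I α m h
  exact hf _ _ _ fun h0 => h (by simp [h0])

end Graded

section Skew

variable (N : ℕ) (K : Type)

/-- The index set of the variables. -/
abbrev Vars := {p : Fin N × Fin N // p.1 < p.2}

variable [Field K]

/-- The coordinate ring of generic skew-symmetric matrices. -/
abbrev Sn := MvPolynomial (Vars N) K

variable {N} {K}

/-- The antisymmetric extension of a family indexed by pairs `i < j`. -/
def skew {B : Type} [AddCommGroup B] (u : Vars N → B) (i j : Fin N) : B :=
  if h : i < j then u ⟨(i, j), h⟩ else if h : j < i then -u ⟨(j, i), h⟩ else 0

section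
variable {B : Type} [AddCommGroup B]

lemma skew_swap (u : Vars N → B) (i j : Fin N) : skew u j i = - skew u i j := by
  unfold skew
  rcases lt_trichotomy i j with h | h | h
  · simp [h, h.not_gt]
  · simp [h]
  · simp [h, h.not_gt]

@[simp] lemma skew_self (u : Vars N → B) (i : Fin N) : skew u i i = 0 := by simp [skew]

lemma skew_of_lt (u : Vars N → B) {i j : Fin N} (h : i < j) : skew u i j = u ⟨(i, j), h⟩ := by
  simp [skew, h]

/-- To prove a property of all entries, it suffices to treat the entries above the diagonal. -/
lemma skew_induction (u : Vars N → B) {p : Fin N → Fin N → B → Prop}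
    (hlt : ∀ v : Vars N, p v.1.1 v.1.2 (u v)) (h0 : ∀ i, p i i 0)
    (hneg : ∀ i j b, p i j b → p j i (-b)) (i j : Fin N) : p i j (skew u i j) := by
  rcases lt_trichotomy i j with h | h | h
  · rw [skew_of_lt u h]; exact hlt ⟨(i, j), h⟩
  · subst h; rw [skew_self]; exact h0 i
  · rw [skew_swap, skew_of_lt u h]; exact hneg _ _ _ (hlt ⟨(j, i), h⟩)

end

variable (N K)

/-- The generic skew-symmetric matrix. -/
def gX : Matrix (Fin N) (Fin N) (Sn N K) := skew MvPolynomial.X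

variable {N K}

/-- Multiplication by an element, as an endomorphism. -/
abbrev mulE (k : Type) [CommRing k] {A : Type} [CommRing A] [Algebra k A] (a : A) :
    Module.End k A := LinearMap.mulLeft k a

/-- The antisymmetrized partial derivatives. -/
def gdX (i j : Fin N) : Module.End K (Sn N K) :=
  skew (fun v => (MvPolynomial.pderiv v : Derivation K (Sn N K) (Sn N K)).toLinearMap) i j

end Skew

section Differentials

variable {N : ℕ} {A : Type} [CommRing A] (k : Type) [CommRing k] [Algebra k A]

/-- The dual differential. -/
def dD (X : Matrix (Fin N) (Fin N) A) : Module.End k (Fk N A) :=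
  FockRel.cD N (opE k) (opH k) (opP k) (opS k) (fun i j => coef k (mulE k (X i j)))

variable {k}

lemma dD_apply (X : Matrix (Fin N) (Fin N) A) (f : Fk N A) (I α m) : dD k X f I α m =
    ∑ i, ∑ j, X i j * opE k i (opP k j f) I α m +
      ∑ j, opS k (opP k j (opH k j f)) I α m := by
  simp only [dD, FockRel.cD, FockRel.cΔ, LinearMap.add_apply, LinearMap.sum_apply, Pi.add_apply,
    Finset.sum_apply, Module.End.mul_apply, coef_apply, LinearMap.mulLeft_apply, mul_sum]

lemma dD_mem {X : Matrix (Fin N) (Fin N) A} {d q : ℕ} {f : Fk N A} (hf : f ∈ Supp k d q) :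
    dD k X f ∈ Supp k d (q + 1) := by
  simp only [dD, FockRel.cD, FockRel.cΔ, LinearMap.add_apply, LinearMap.sum_apply, mul_sum,
    Module.End.mul_apply]
  refine add_mem (sum_mem fun i _ => sum_mem fun j _ => ?_) (sum_mem fun j _ => ?_)
  · refine Gr.mono (coef_mem _ (opE_mem _ (opP_mem _ hf))) ?_
    grind
  · refine Gr.mono (opS_mem (opP_mem _ (opH_mem _ hf))) ?_
    grind

end Differentials

section Fock

variable {N : ℕ} {K : Type} [Field K]

lemma cm_of_eq {R : Type} [Ring R] {a b : R} (h : a * b = b * a) : cm a b = 0 := sub_eq_zero.mpr h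

lemma pderiv_comm (v w : Vars N) (f : Sn N K) :
    MvPolynomial.pderiv v (MvPolynomial.pderiv w f) =
      MvPolynomial.pderiv w (MvPolynomial.pderiv v f) := by
  have : ⁅(MvPolynomial.pderiv v : Derivation K (Sn N K) (Sn N K)),
      (MvPolynomial.pderiv w : Derivation K (Sn N K) (Sn N K))⁆ = 0 := by
    refine MvPolynomial.derivation_ext (R := K) fun i => ?_
    rw [Derivation.commutator_apply]
    simp only [MvPolynomial.pderiv_X, Pi.single_apply, apply_ite (MvPolynomial.pderiv (R := K) _), map_zero, MvPolynomial.pderiv_one, Derivation.zero_apply, ite_self, sub_self]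
  have := DFunLike.congr_fun this f
  rwa [Derivation.commutator_apply, Derivation.zero_apply, sub_eq_zero] at this

lemma gdX_comm (i j k l : Fin N) : (gdX i j * gdX k l : Module.End K (Sn N K)) =
    gdX k l * gdX i j := by
  refine skew_induction (B := Module.End K (Sn N K))
    (p := fun _ _ b => b * gdX k l = gdX k l * b) _ ?_ (fun _ => by rw [zero_mul, mul_zero])
    (fun _ _ b h => LinearMap.ext fun f => by
      have := LinearMap.congr_fun h f
      simp only [Module.End.mul_apply, LinearMap.neg_apply, map_neg] at this ⊢
      rw [this]) i j
  intro v
  refine skew_induction (B := Module.End K (Sn N K)) (p := fun _ _ b => _ * b = b * _) _ ?_ (fun _ => by rw [zero_mul, mul_zero])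
    (fun _ _ b h => LinearMap.ext fun f => by
      have := LinearMap.congr_fun h f
      simp only [Module.End.mul_apply, LinearMap.neg_apply, map_neg] at this ⊢
      rw [this]) k l
  intro w
  exact LinearMap.ext fun f => pderiv_comm v w f

lemma gdX_gX (i j k l : Fin N) : cm (gdX i j) (mulE K (gX N K k l)) =
    (if i = k then if j = l then 1 else 0 else 0) - (if i = l then if j = k then 1 else 0 else 0) := by
  have base : ∀ v w : Vars N, cm (MvPolynomial.pderiv v : Derivation K (Sn N K) (Sn N K)).toLinearMap
      (mulE K (MvPolynomial.X w : Sn N K)) = if v = w then (1 : Module.End K (Sn N K)) else 0 := by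
    intro v w
    refine LinearMap.ext fun f => ?_
    simp only [cm, LinearMap.sub_apply, Module.End.mul_apply, LinearMap.mulLeft_apply,
      Derivation.coeFn_coe, Derivation.leibniz, smul_eq_mul]
    by_cases h : v = w
    · subst h; simp [MvPolynomial.pderiv_X]
    · simp [MvPolynomial.pderiv_X, h, Pi.single_apply, Ne.symm h]
  have hneg : ∀ a : Sn N K, mulE K (-a) = - mulE K a := fun a => by ext; simp
  refine skew_induction (p := fun i j b => cm b (mulE K (gX N K k l)) =
    (if i = k then if j = l then 1 else 0 else 0) - (if i = l then if j = k then 1 else 0 else 0))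
    _ ?_ ?_ ?_ i j
  · intro v
    refine skew_induction (p := fun k l b => cm _ (mulE K b) =
      (if v.1.1 = k then if v.1.2 = l then 1 else 0 else 0) -
        (if v.1.1 = l then if v.1.2 = k then 1 else 0 else 0)) _ ?_ ?_ ?_ k l
    · intro w
      rw [base]
      obtain ⟨⟨v1, v2⟩, hv⟩ := v
      obtain ⟨⟨w1, w2⟩, hw⟩ := w
      simp only [Subtype.mk.injEq, Prod.mk.injEq] at hv hw ⊢
      have : ¬ (v1 = w2 ∧ v2 = w1) := by rintro ⟨rfl, rfl⟩; exact absurd hv hw.not_gt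
      simp only [← ite_and, this, if_false, sub_zero]
    · intro i
      have : mulE K (0 : Sn N K) = 0 := by ext; simp
      rw [this, cm_zero]
      simp
    · intro i j b h
      rw [hneg, cm_neg, h]
      abel
  · intro i
    rw [cm, zero_mul, mul_zero, sub_zero]
    split_ifs <;> simp_all
  · intro i j b h
    rw [neg_cm, h]
    have : ∀ a b c d : Fin N, (if a = b then if c = d then (1 : Module.End K (Sn N K)) else 0 else 0)
      = if c = d then if a = b then 1 else 0 else 0 := by intros; split_ifs <;> rfl
    rw [this i k j l, this i l j k]
    abel

lemma cm_coef {A : Type} [CommRing A] [Algebra K A] (a b : Module.End K A) :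
    cm (coef K a) (coef K b) = (coef K (cm a b) : Module.End K (Fk N A)) := by
  simp only [cm, map_sub, map_mul]

theorem fockRel : FockRel N (R := Module.End K (Fk N (Sn N K))) (opE K) (opH K) (opY K) (opP K)
    (opS K) (opDs K) (fun i j => coef K (mulE K (gX N K i j))) (fun i j => coef K (gdX i j)) where
  θθ := opE_opE
  ηη := opH_opH
  ηθ := opH_opE
  py i j := by rw [cm, opP_opY, add_sub_cancel_right]
  pp i j := cm_of_eq (opP_opP i j)
  yy i j := cm_of_eq (opY_opY i j)
  δs := by rw [cm, opDs_opS, add_sub_cancel_right]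
  dxx i j k l := by
    rw [cm_coef, gdX_gX]
    simp only [map_sub, apply_ite (coef K), map_one, map_zero]
  xx i j k l := by
    rw [cm_coef, cm_of_eq, map_zero]
    ext; simp [mul_left_comm]
  dxdx i j k l := by rw [cm_coef, cm_of_eq (gdX_comm i j k l), map_zero]
  xskew i j := by
    rw [gX, skew_swap, ← map_neg]
    congr 1
    exact LinearMap.ext fun f => by simp
  dxskew i j := by rw [gdX, skew_swap, map_neg]; rfl
  θy i j := cm_of_eq (slotI_slotS ..)
  θp i j := cm_of_eq (slotI_slotS ..)
  θs i := cm_of_eq (slotI_slotM ..)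
  θδ i := cm_of_eq (slotI_slotM ..)
  ηy i j := cm_of_eq (slotI_slotS ..)
  ηp i j := cm_of_eq (slotI_slotS ..)
  ηs i := cm_of_eq (slotI_slotM ..)
  ηδ i := cm_of_eq (slotI_slotM ..)
  ys i := cm_of_eq (slotS_slotM ..)
  yδ i := cm_of_eq (slotS_slotM ..)
  ps i := cm_of_eq (slotS_slotM ..)
  pδ i := cm_of_eq (slotS_slotM ..)
  xθ i j k := cm_of_eq (coef_slotI ..)
  xη i j k := cm_of_eq (coef_slotI ..)
  xy i j k := cm_of_eq (coef_slotS ..)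
  xp i j k := cm_of_eq (coef_slotS ..)
  xs i j := cm_of_eq (coef_slotM ..)
  xδ i j := cm_of_eq (coef_slotM ..)
  dxθ i j k := cm_of_eq (coef_slotI ..)
  dxη i j k := cm_of_eq (coef_slotI ..)
  dxy i j k := cm_of_eq (coef_slotS ..)
  dxp i j k := cm_of_eq (coef_slotS ..)
  dxs i j := cm_of_eq (coef_slotM ..)
  dxδ i j := cm_of_eq (coef_slotM ..)

end Fock

end

end PfExt

namespace PfExt

open Finset MvPolynomial

noncomputable section

variable {N : ℕ} {K : Type} [Field K]

/-- The torus weights of the variables. -/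
def vw (v : Vars N) : Fin N → ℤ := Pi.single v.1.1 1 + Pi.single v.1.2 1

/-- The torus weight of an exterior-symmetric index. -/
def shw (I : Finset (Fin N)) (α : Fin N →₀ ℕ) (i : Fin N) : ℤ := α i - if i ∈ I then 1 else 0

lemma whc_X_mul (v : Vars N) (n : Fin N → ℤ) (p : Sn N K) :
    weightedHomogeneousComponent vw (n + vw v) (X v * p) =
      X v * weightedHomogeneousComponent vw n p := by
  ext m
  rw [coeff_weightedHomogeneousComponent, coeff_X_mul', coeff_X_mul']
  by_cases h : v ∈ m.support
  · simp only [h, if_true]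
    rw [coeff_weightedHomogeneousComponent]
    have h1 : m - Finsupp.single v 1 + Finsupp.single v 1 = m :=
      tsub_add_cancel_of_le (by
        rw [Finsupp.single_le_iff]; have := Finsupp.mem_support_iff.mp h; omega)
    have : Finsupp.weight vw m = n + vw v ↔ Finsupp.weight vw (m - Finsupp.single v 1) = n := by
      conv_lhs => rw [← h1]
      rw [map_add, Finsupp.weight_single, one_smul, add_left_inj]
    simp only [this]
  · simp [h]

lemma whc_gX_mul (i j : Fin N) (n n' : Fin N → ℤ) (p : Sn N K)
    (hn : n' = n + Pi.single i 1 + Pi.single j 1) :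
    weightedHomogeneousComponent vw n' (gX N K i j * p) =
      gX N K i j * weightedHomogeneousComponent vw n p := by
  subst hn
  have hlt : ∀ i j (h : i < j),
      weightedHomogeneousComponent vw (n + Pi.single i 1 + Pi.single j 1) (gX N K i j * p) =
        gX N K i j * weightedHomogeneousComponent vw n p := by
    intro i j h
    rw [gX, skew_of_lt _ h, add_assoc]
    exact whc_X_mul ⟨(i, j), h⟩ n p
  rcases lt_trichotomy i j with h | h | h
  · exact hlt i j h
  · subst h
    rw [gX, skew_self, zero_mul, zero_mul, map_zero]
  · have e : gX N K i j = - gX N K j i := skew_swap _ _ _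
    rw [add_right_comm, e, neg_mul, map_neg, hlt j i h, neg_mul]

variable (v : Fin N → ℤ)

/-- The projection to a torus weight space. -/
def wp : Module.End K (Fk N (Sn N K)) where
  toFun f I α m := weightedHomogeneousComponent vw (v - shw I α) (f I α m)
  map_add' f g := by funext I α m; simp
  map_smul' c f := by funext I α m; simp

@[simp] lemma wp_apply (f : Fk N (Sn N K)) (I α m) :
    wp v f I α m = weightedHomogeneousComponent vw (v - shw I α) (f I α m) := rfl

lemma wp_dD (f : Fk N (Sn N K)) : wp v (dD K (gX N K) f) = dD K (gX N K) (wp v f) := by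
  funext I α m
  rw [wp_apply, dD_apply, dD_apply, map_add, map_sum, map_sum]
  congr 1
  · refine sum_congr rfl fun i _ => ?_
    rw [map_sum]
    refine sum_congr rfl fun j _ => ?_
    simp only [opE_apply, opP_apply, wp_apply]
    by_cases hi : i ∈ I
    · simp only [hi, if_true, mul_smul_comm, map_zsmul]
      congr 1
      refine whc_gX_mul i j _ _ _ ?_
      funext l
      simp only [Pi.sub_apply, shw, Pi.add_apply, Pi.single_apply, Finsupp.add_apply,
        Finsupp.single_apply, mem_erase]
      grind
    · simp [hi]
  · refine sum_congr rfl fun j _ => ?_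
    simp only [opS_apply, opP_apply, opH_apply, wp_apply, map_zsmul]
    by_cases hj : j ∈ I
    · simp [hj]
    · simp only [hj, if_false]
      congr 4
      funext l
      simp only [Pi.sub_apply, shw, Pi.add_apply, Pi.single_apply, Finsupp.add_apply,
        Finsupp.single_apply, mem_insert]
      grind

lemma wp_coef (a b : Fin N) (f : Fk N (Sn N K)) (r : ℕ) :
    ((coef K (mulE K (gX N K a b))) ^ r) (wp v f) =
      wp (v + r • (Pi.single a 1 + Pi.single b 1)) (((coef K (mulE K (gX N K a b))) ^ r) f) := by
  induction r generalizing v f with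
  | zero => simp
  | succ r ih =>
    rw [pow_succ, Module.End.mul_apply, Module.End.mul_apply]
    have : coef K (mulE K (gX N K a b)) (wp v f) =
        wp (v + (Pi.single a 1 + Pi.single b 1)) (coef K (mulE K (gX N K a b)) f) := by
      funext I α m
      simp only [coef_apply, wp_apply, LinearMap.mulLeft_apply]
      rw [whc_gX_mul a b (v - shw I α)]
      abel
    rw [this, ih, add_assoc, ← succ_nsmul']

lemma wp_mem {d q : ℕ} {f : Fk N (Sn N K)} (hf : f ∈ Supp K d q) : wp v f ∈ Supp K d q :=
  fun I α m h => hf I α m fun h0 => h (by simp [h0])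

lemma gdX_leibniz (i j : Fin N) (p q : Sn N K) :
    gdX i j (p * q) = p * gdX i j q + q * gdX i j p := by
  refine skew_induction (B := Module.End K (Sn N K))
    (p := fun _ _ b => b (p * q) = p * b q + q * b p) _ ?_ ?_ ?_ i j
  · intro v; simp
  · intro i; simp
  · intro i j b h; rw [LinearMap.neg_apply, h]; simp; ring

lemma gdX_C (i j : Fin N) (c : K) : gdX i j (C c : Sn N K) = 0 := by
  refine skew_induction (B := Module.End K (Sn N K)) (p := fun _ _ b => b (C c) = 0) _ ?_ ?_ ?_ i j
  · intro v; simp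
  · intro i; simp
  · intro i j b h; rw [LinearMap.neg_apply, h, neg_zero]

lemma gdX_gX_apply (i j k l : Fin N) : gdX i j (gX N K k l) =
    (if i = k then if j = l then 1 else 0 else 0) - (if i = l then if j = k then 1 else 0 else 0) := by
  have h1 := LinearMap.congr_fun (gdX_gX (K := K) i j k l) (1 : Sn N K)
  have h2 := gdX_C (K := K) i j 1
  rw [map_one] at h2
  simp only [cm, LinearMap.sub_apply, Module.End.mul_apply, LinearMap.mulLeft_apply, mul_one, h2,
    mul_zero, sub_zero] at h1
  rw [h1]
  congr 1 <;> (split_ifs <;> simp)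

lemma euler_gX (i a b : Fin N) : ∑ k, gX N K i k * gdX i k (gX N K a b) =
    ((if i = a then 1 else 0) + (if i = b then 1 else 0)) * gX N K a b := by
  simp only [gdX_gX_apply, mul_sub, sum_sub_distrib]
  by_cases h1 : i = a <;> by_cases h2 : i = b
  · subst h1; subst h2; simp [gX]
  · subst h1; simp [h2]
  · subst h2
    simp only [h1, if_false, mul_zero, sum_const_zero, mul_ite, mul_one, if_true, sum_ite_eq',
      mem_univ, zero_sub, zero_add, one_mul]
    rw [gX, skew_swap, neg_neg]
  · simp [h1, h2]

lemma euler_monomial (i : Fin N) (s : Vars N →₀ ℕ) (c : K) :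
    ∑ k, gX N K i k * gdX i k (monomial s c) = (Finsupp.weight vw s i) • (monomial s c : Sn N K) := by
  have mulcase : ∀ (p q : Sn N K) (a b : ℤ), ∑ k, gX N K i k * gdX i k p = a • p →
      ∑ k, gX N K i k * gdX i k q = b • q → ∑ k, gX N K i k * gdX i k (p * q) = (a + b) • (p * q) := by
    intro p q a b hp hq
    simp only [gdX_leibniz, mul_add, sum_add_distrib, mul_left_comm _ p, mul_left_comm _ q, ← mul_sum,
      hp, hq]
    simp [add_smul]; ring
  have key : ∀ s : Vars N →₀ ℕ, ∑ k, gX N K i k * gdX i k (monomial s 1) =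
      (Finsupp.weight vw s i) • (monomial s 1 : Sn N K) := by
    intro s
    induction s using Finsupp.induction_linear with
    | zero => simp only [map_zero, Pi.zero_apply, zero_smul]
              exact sum_eq_zero fun k _ => by
                rw [show (monomial 0 1 : Sn N K) = C 1 from rfl, gdX_C, mul_zero]
    | add f g hf hg =>
      have : (monomial (f + g) 1 : Sn N K) = monomial f 1 * monomial g 1 := by simp [monomial_mul]
      rw [this, mulcase _ _ _ _ hf hg, map_add, Pi.add_apply]
    | single v n =>
      induction n with
      | zero => simp only [Finsupp.single_zero, map_zero, Pi.zero_apply, zero_smul]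
                exact sum_eq_zero fun k _ => by
                  rw [show (monomial 0 1 : Sn N K) = C 1 from rfl, gdX_C, mul_zero]
      | succ n ih =>
        have : (monomial (Finsupp.single v (n + 1)) 1 : Sn N K) =
            monomial (Finsupp.single v n) 1 * X v := by
          simp [X, monomial_mul, Finsupp.single_add]
        have hX := euler_gX (K := K) i v.1.1 v.1.2
        rw [gX, skew_of_lt _ v.2] at hX
        rw [this, mulcase _ _ _ (vw v i) ih]
        · rw [Finsupp.single_add, map_add, Pi.add_apply, Finsupp.weight_single _ _ 1, one_smul]
        · refine hX.trans ?_
          simp [vw, Pi.single_apply]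
  have hc : (monomial s c : Sn N K) = c • monomial s 1 := by simp [smul_monomial]
  rw [hc]
  simp only [map_smul, mul_smul_comm, ← smul_sum, key]
  rw [smul_comm]

lemma euler_whc (i : Fin N) (n : Fin N → ℤ) (p : Sn N K) :
    ∑ k, gX N K i k * gdX i k (weightedHomogeneousComponent vw n p) =
      n i • weightedHomogeneousComponent vw n p := by
  classical
  rw [weightedHomogeneousComponent_apply]
  simp only [map_sum, mul_sum]
  rw [sum_comm, smul_sum]
  refine sum_congr rfl fun s hs => ?_
  rw [euler_monomial, (mem_filter.mp hs).2]

/-- Weight spaces consist of simultaneous eigenvectors. -/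
lemma cE_wp (i : Fin N) (f : Fk N (Sn N K)) :
    FockRel.cE N (opE K) (opH K) (opY K) (opP K) (fun i j => coef K (mulE K (gX N K i j)))
      (fun i j => coef K (gdX i j)) i i (wp v f) = (v i : K) • wp v f := by
  funext I α m
  simp only [FockRel.cE, FockRel.cρ, LinearMap.add_apply, LinearMap.sum_apply, LinearMap.sub_apply,
    Pi.add_apply, Pi.sub_apply, Finset.sum_apply, Module.End.mul_apply, coef_apply,
    LinearMap.mulLeft_apply, Pi.smul_apply, Int.cast_smul_eq_zsmul]
  simp only [wp_apply]
  rw [euler_whc]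
  simp only [opY_apply, opP_apply, opE_apply, opH_apply, mem_erase, ne_eq, not_true_eq_false,
    false_and, if_false, smul_smul, wp_apply]
  have h1 : (α i : ℤ) • weightedHomogeneousComponent vw (v - shw I (α - Finsupp.single i 1 + Finsupp.single i 1))
      (f I (α - Finsupp.single i 1 + Finsupp.single i 1) m) =
      (α i : ℤ) • weightedHomogeneousComponent vw (v - shw I α) (f I α m) := by
    by_cases h : α i = 0
    · simp [h]
    · rw [sub_single_add h]
  rw [h1]
  by_cases hi : i ∈ I
  · simp only [hi, if_true, insert_erase hi, sg_erase, lt_irrefl, if_false, sg_sq]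
    rw [← sub_smul, ← add_smul]
    congr 1
    simp [shw, hi]
  · simp only [hi, if_false, zero_mul, zero_smul, sub_zero]
    rw [← add_smul]
    congr 1
    simp [shw, hi]

lemma exists_wp_sum {d q : ℕ} {f : Fk N (Sn N K)} (hf : f ∈ Supp K d q) :
    ∃ F : Finset (Fin N → ℤ), f = ∑ v ∈ F, wp v f := by
  classical
  have hfin : Set.Finite {t : Finset (Fin N) × (Fin N →₀ ℕ) × ℕ | f t.1 t.2.1 t.2.2 ≠ 0} := by
    refine Set.Finite.subset (Set.finite_univ.prod
      ((Finsupp.finite_of_degree_le (σ := Fin N) d).prod (Set.finite_le_nat q))) ?_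
    rintro ⟨I, α, m⟩ h
    have := hf I α m h
    simp only [Set.mem_prod, Set.mem_univ, true_and, Set.mem_ofPred_eq]
    omega
  refine ⟨hfin.toFinset.biUnion fun t => (f t.1 t.2.1 t.2.2).support.image
    fun s => Finsupp.weight vw s + shw t.1 t.2.1, ?_⟩
  funext I α m
  rw [Finset.sum_apply, Finset.sum_apply, Finset.sum_apply]
  ext s
  simp only [wp_apply, coeff_sum, coeff_weightedHomogeneousComponent, eq_sub_iff_add_eq]
  by_cases hs : coeff s (f I α m) = 0
  · simp [hs]
  · rw [sum_ite_eq, if_pos]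
    simp only [mem_biUnion, mem_image, Set.Finite.mem_toFinset, Set.mem_ofPred_eq]
    exact ⟨(I, α, m), fun h0 => hs (by simp at h0; simp [h0]), s, by simpa using hs, rfl⟩

end

end PfExt

namespace PfExt

open Finset

noncomputable section

section Ring

variable {R : Type} [Ring R]

/-- The anticommutator. -/
def ac (a b : R) : R := a * b + b * a

lemma ac_add (a b c : R) : ac a (b + c) = ac a b + ac a c := by unfold ac; noncomm_ring
lemma add_ac (a b c : R) : ac (a + b) c = ac a c + ac b c := by unfold ac; noncomm_ring
lemma ac_zsmul (a b : R) (e : ℤ) : ac a (e • b) = e • ac a b := by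
  simp only [ac, mul_smul_comm, smul_mul_assoc, smul_add]
lemma zsmul_ac (a b : R) (e : ℤ) : ac (e • a) b = e • ac a b := by
  simp only [ac, mul_smul_comm, smul_mul_assoc, smul_add]
lemma ac_sum {ι : Type} (a : R) (s : Finset ι) (f : ι → R) :
    ac a (∑ i ∈ s, f i) = ∑ i ∈ s, ac a (f i) := by
  simp [ac, mul_sum, sum_mul, sum_add_distrib]
lemma sum_ac {ι : Type} (a : R) (s : Finset ι) (f : ι → R) :
    ac (∑ i ∈ s, f i) a = ∑ i ∈ s, ac (f i) a := by
  simp [ac, mul_sum, sum_mul, sum_add_distrib]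
lemma ac_comm (a b : R) : ac a b = ac b a := by unfold ac; exact add_comm _ _
lemma mul_ac {a c : R} (b : R) (h : Commute a c) : ac (a * b) c = a * ac b c := by
  unfold ac
  rw [mul_add, ← mul_assoc c, ← h.eq]
  noncomm_ring
lemma ac_mul {a c : R} (b : R) (h : Commute a c) : ac c (a * b) = a * ac c b := by
  rw [ac_comm, mul_ac _ h, ac_comm]
lemma mul_ac_right {b c : R} (a : R) (h : Commute b c) : ac (a * b) c = ac a c * b := by
  unfold ac
  rw [add_mul, mul_assoc, h.eq]
  noncomm_ring

lemma sum_sum_antisymm (h2 : ∀ x : R, x + x = 0 → x = 0) {ι : Type} (s : Finset ι) (F : ι → ι → R)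
    (h : ∀ i j, F i j = - F j i) : ∑ i ∈ s, ∑ j ∈ s, F i j = 0 := by
  have h1 : ∑ i ∈ s, ∑ j ∈ s, F i j = - ∑ i ∈ s, ∑ j ∈ s, F i j := by
    conv_lhs => rw [sum_comm]
    simp_rw [← sum_neg_distrib]
    exact sum_congr rfl fun i _ => sum_congr rfl fun j _ => h j i
  exact h2 _ (add_eq_zero_iff_eq_neg.mpr h1)

/-- The differential attached to operators `x, T, H, t, E`, using only the indices in `J`; the
parameter `ε` switches the second term on and off. -/
def ddA {ι : Type} (x : ι → ι → R) (T H E : ι → R) (t : R) (ε : ℤ) (J : Finset ι) : R :=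
  ∑ i ∈ J, (∑ j ∈ J, x i j * T j) * H i + ε • ∑ j ∈ J, T j * t * E j

/-- The commutation relations which make `ddA` a differential. -/
structure DdRel {ι : Type} [DecidableEq ι] (x : ι → ι → R) (T H E : ι → R) (t : R) : Prop where
  xx : ∀ i j k l, Commute (x i j) (x k l)
  xT : ∀ i j k, Commute (x i j) (T k)
  xH : ∀ i j k, Commute (x i j) (H k)
  xE : ∀ i j k, Commute (x i j) (E k)
  xt : ∀ i j, Commute (x i j) t
  TT : ∀ i j, Commute (T i) (T j)
  TH : ∀ i j, Commute (T i) (H j)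
  TE : ∀ i j, Commute (T i) (E j)
  Tt : ∀ i, Commute (T i) t
  Ht : ∀ i, Commute (H i) t
  Et : ∀ i, Commute (E i) t
  HH : ∀ i j, ac (H i) (H j) = 0
  EE : ∀ i j, ac (E i) (E j) = 0
  HE : ∀ i j, ac (H i) (E j) = if i = j then 1 else 0
  xskew : ∀ i j, x j i = - x i j

section

variable {ι : Type} {x : ι → ι → R} {T H E : ι → R} {t : R} {ε : ℤ} {J : Finset ι}

lemma ddA_commute {z : R} (hx : ∀ i ∈ J, ∀ j ∈ J, Commute (x i j) z)
    (hT : ∀ j ∈ J, Commute (T j) z) (hH : ∀ j ∈ J, Commute (H j) z)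
    (hE : ∀ j ∈ J, Commute (E j) z) (ht : Commute t z) : Commute (ddA x T H E t ε J) z := by
  refine Commute.add_left (Commute.sum_left _ _ _ fun l hl => ?_)
    (Commute.smul_left (Commute.sum_left _ _ _ fun l hl => ?_) _)
  · exact Commute.mul_left (Commute.sum_left _ _ _ fun j hj => (hx l hl j hj).mul_left (hT j hj))
      (hH l hl)
  · exact ((hT l hl).mul_left ht).mul_left (hE l hl)

lemma ac_ddA {z : R} (hx : ∀ i ∈ J, ∀ j ∈ J, Commute (x i j) z)
    (hT : ∀ j ∈ J, Commute (T j) z) (ht : Commute t z) : ac (ddA x T H E t ε J) z =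
      ∑ i ∈ J, (∑ j ∈ J, x i j * T j) * ac (H i) z + ε • ∑ j ∈ J, T j * t * ac (E j) z := by
  rw [ddA, add_ac, zsmul_ac, sum_ac, sum_ac]
  congr 1
  · refine sum_congr rfl fun l hl => ?_
    have hc : Commute (∑ j ∈ J, x l j * T j) z :=
      Commute.sum_left _ _ _ fun j hj => (hx l hl j hj).mul_left (hT j hj)
    rw [mul_ac _ hc]
  · refine congrArg (ε • ·) (sum_congr rfl fun l hl => ?_)
    rw [mul_ac _ ((hT l hl).mul_left ht)]

lemma ac_ddA_eq_zero {z : R} (hx : ∀ i ∈ J, ∀ j ∈ J, Commute (x i j) z)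
    (hT : ∀ j ∈ J, Commute (T j) z) (ht : Commute t z) (hH : ∀ j ∈ J, ac (H j) z = 0)
    (hE : ∀ j ∈ J, ac (E j) z = 0) : ac (ddA x T H E t ε J) z = 0 := by
  rw [ac_ddA hx hT ht, sum_eq_zero, sum_eq_zero, smul_zero, add_zero]
  · exact fun l hl => by rw [hE l hl, mul_zero]
  · exact fun l hl => by rw [hH l hl, mul_zero]

variable [DecidableEq ι]

lemma ddA_insert {ν : ι} (hν : ν ∉ J) (h0 : x ν ν = 0) (hc : ∀ i, Commute (x i ν) (T ν)) :
    ddA x T H E t ε (insert ν J) = ddA x T H E t ε J +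
      T ν * (∑ i ∈ J, x i ν * H i + ε • (t * E ν)) + (∑ j ∈ J, x ν j * T j) * H ν := by
  have h1 : ∀ i, (∑ j ∈ insert ν J, x i j * T j) = x i ν * T ν + ∑ j ∈ J, x i j * T j := fun i =>
    sum_insert hν
  simp only [ddA, sum_insert hν, h0, zero_mul, zero_add, add_mul, sum_add_distrib,
    smul_add, mul_add, mul_sum, mul_smul_comm]
  have h2 : ∀ i, x i ν * T ν * H i = T ν * (x i ν * H i) := fun i => by
    rw [(hc i).eq, mul_assoc]
  simp only [h2, mul_assoc]
  abel

omit [DecidableEq ι] in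
lemma rowL_comm (i : ι) {z : R} (hx : ∀ j, Commute (x i j) z)
    (hT : ∀ j, Commute (T j) z) : Commute (∑ j ∈ J, x i j * T j) z :=
  Commute.sum_left _ _ _ fun j _ => (hx j).mul_left (hT j)

lemma DdRel.sum_rowL_mul (h2 : ∀ x : R, x + x = 0 → x = 0) (h : DdRel x T H E t) :
    ∑ i ∈ J, (∑ j ∈ J, x i j * T j) * (T i * t) = 0 := by
  simp only [sum_mul]
  refine sum_sum_antisymm h2 _ _ fun i j => ?_
  rw [h.xskew j i, neg_mul, neg_mul, mul_assoc, mul_assoc, ← mul_assoc (T j), (h.TT j i).eq,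
    mul_assoc]

lemma DdRel.ac_parts (h2 : ∀ x : R, x + x = 0 → x = 0) (h : DdRel x T H E t) :
    ac (∑ i ∈ J, (∑ j ∈ J, x i j * T j) * H i) (∑ i ∈ J, T i * t * E i) = 0 := by
  have h1 : ∀ i j, ac ((∑ j ∈ J, x i j * T j) * H i) (T j * t * E j) =
      if i = j then (∑ j ∈ J, x i j * T j) * (T j * t) else 0 := fun i j => by
    rw [mul_ac _ (rowL_comm i (fun l => ((h.xT i l j).mul_right (h.xt i l)).mul_right (h.xE i l j))
      (fun l => ((h.TT l j).mul_right (h.Tt l)).mul_right (h.TE l j))),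
      ac_mul _ ((h.TH j i).mul_left (h.Ht i).symm), h.HE]
    split_ifs <;> simp
  rw [ac_sum]
  simp only [sum_ac, h1]
  rw [sum_comm]
  refine Eq.trans ?_ (h.sum_rowL_mul (J := J) h2)
  refine sum_congr rfl fun i hi => ?_
  rw [sum_ite_eq, if_pos hi]

lemma DdRel.part_one_sq (h2 : ∀ x : R, x + x = 0 → x = 0) (h : DdRel x T H E t) :
    (∑ i ∈ J, (∑ j ∈ J, x i j * T j) * H i) * (∑ i ∈ J, (∑ j ∈ J, x i j * T j) * H i) = 0 := by
  set r : ι → R := fun i => ∑ j ∈ J, x i j * T j with hr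
  have hH : ∀ i j, Commute (r i) (H j) := fun i j =>
    rowL_comm i (fun l => h.xH i l j) fun l => h.TH l j
  have hrr : ∀ i j, Commute (r i) (r j) := fun i j => rowL_comm i
    (fun l => (rowL_comm j (fun m => h.xx j m i l) fun m => (h.xT i l m).symm).symm)
    (fun l => (rowL_comm j (fun m => h.xT j m l) fun m => h.TT m l).symm)
  rw [sum_mul_sum]
  refine sum_sum_antisymm h2 _ _ fun i j => ?_
  have h1 : ∀ i j, r i * H i * (r j * H j) = r i * r j * (H i * H j) := fun i j => by
    rw [mul_assoc, ← mul_assoc (H i), ← (hH j i).eq, mul_assoc, mul_assoc]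
  rw [h1, h1, (hrr i j).eq, eq_neg_of_add_eq_zero_left (h.HH i j), mul_neg]

lemma DdRel.part_two_sq (h2 : ∀ x : R, x + x = 0 → x = 0) (h : DdRel x T H E t) :
    (∑ i ∈ J, T i * t * E i) * (∑ i ∈ J, T i * t * E i) = 0 := by
  obtain ⟨r, hr⟩ : ∃ r : ι → R, ∀ i, T i * t = r i := ⟨_, fun _ => rfl⟩
  have hH : ∀ i j, Commute (r i) (E j) := fun i j => by
    rw [← hr]; exact (h.TE i j).mul_left (h.Et j).symm
  have hrr : ∀ i j, Commute (r i) (r j) := fun i j => by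
    rw [← hr, ← hr]
    exact ((h.TT i j).mul_right (h.Tt i)).mul_left ((h.Tt j).symm.mul_right (Commute.refl _))
  simp only [hr]
  rw [sum_mul_sum]
  refine sum_sum_antisymm h2 _ _ fun i j => ?_
  have h1 : ∀ i j, r i * E i * (r j * E j) = r i * r j * (E i * E j) := fun i j => by
    rw [mul_assoc (r i), ← mul_assoc (E i), ← (hH j i).eq]; simp only [mul_assoc]
  rw [h1, h1, (hrr i j).eq, eq_neg_of_add_eq_zero_left (h.EE i j), mul_neg]

lemma DdRel.ddA_sq (h2 : ∀ x : R, x + x = 0 → x = 0) (h : DdRel x T H E t) :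
    ddA x T H E t ε J * ddA x T H E t ε J = 0 := by
  rw [ddA, add_mul, mul_add, mul_add, h.part_one_sq h2, smul_mul_smul_comm, h.part_two_sq h2,
    smul_zero, zero_add, add_zero, mul_smul_comm, smul_mul_assoc, ← smul_add]
  exact (congrArg (ε • ·) (h.ac_parts h2)).trans (smul_zero _)

lemma DdRel.ac_bt (h : DdRel x T H E t) {ν : ι} {a : ι → R} {m : R}
    (hε : ε * ε = ε)
    (ax : ∀ i ∈ J, ∀ j ∈ J, a j * x i ν = x i ν * a j + if i = j then 1 else 0)
    (aH : ∀ i j, Commute (a i) (H j)) (aE : ∀ i j, Commute (a i) (E j)) (at_ : ∀ i, Commute (a i) t)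
    (mx : ∀ i j, Commute m (x i j)) (mH : ∀ i, Commute m (H i)) (mE : ∀ i, Commute m (E i))
    (tm : t * m = m * t + 1) :
    ac (∑ i ∈ J, x i ν * H i + ε • (t * E ν)) (∑ i ∈ J, E i * a i + ε • (m * H ν)) =
      ∑ i ∈ J, (x i ν * a i + E i * H i) + ε • (E ν * H ν + m * t) := by
  have hEH : ∀ i j, E i * H j = (if j = i then 1 else 0) - H j * E i := fun i j => by
    rw [← h.HE, ac]; abel
  have h1 : ∀ i ∈ J, ∀ j ∈ J, ac (x i ν * H i) (E j * a j) =
      if i = j then x i ν * a i + E i * H i else 0 := fun i hi j hj => by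
    have e1 : x i ν * H i * (E j * a j) = x i ν * a j * (H i * E j) := by
      rw [mul_assoc, ← mul_assoc (H i), ← ((aH j i).mul_right (aE j j)).eq, mul_assoc]
    have e2 : E j * a j * (x i ν * H i) =
        x i ν * a j * (E j * H i) + if i = j then E j * H i else 0 := by
      rw [mul_assoc, ← mul_assoc (a j), ax i hi j hj, add_mul, mul_add, mul_assoc, (aH j i).eq]
      congr 1
      · rw [← mul_assoc, ← (h.xE i ν j).eq, mul_assoc, ← (aH j i).eq, ← mul_assoc (E j),
          ← (aE j j).eq, mul_assoc, mul_assoc]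
      · split_ifs <;> simp
    rw [ac, e1, e2, ← add_assoc, ← mul_add]
    rw [show H i * E j + E j * H i = ac (H i) (E j) from rfl, h.HE]
    split_ifs with hij
    · subst hij; rw [mul_one]
    · simp
  have h2 : ∀ i ∈ J, ac (x i ν * H i) (m * H ν) = 0 := fun i hi => by
    rw [mul_ac _ ((mx i ν).symm.mul_right (h.xH i ν ν)), ac_mul _ (mH i), h.HH, mul_zero, mul_zero]
  have h3 : ∀ i ∈ J, ac (t * E ν) (E i * a i) = 0 := fun i hi => by
    rw [mul_ac _ ((h.Et i).symm.mul_right (at_ i).symm), ac_comm, mul_ac_right _ (aE i ν), h.EE,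
      zero_mul, mul_zero]
  have h4 : ac (t * E ν) (m * H ν) = E ν * H ν + m * t := by
    have e1 : t * E ν * (m * H ν) = t * m * (E ν * H ν) := by
      rw [mul_assoc, ← mul_assoc (E ν), ← (mE ν).eq, mul_assoc, mul_assoc]
    have e2 : m * H ν * (t * E ν) = m * t * (H ν * E ν) := by
      rw [mul_assoc, ← mul_assoc (H ν), (h.Ht ν).eq, mul_assoc, mul_assoc]
    rw [ac, e1, e2, tm, add_mul, one_mul, hEH, if_pos rfl, mul_sub, mul_one]
    abel
  rw [add_ac, ac_add, ac_add, zsmul_ac, zsmul_ac, ac_zsmul, ac_zsmul, h4, smul_smul, hε]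
  simp only [sum_ac, ac_sum]
  rw [sum_comm, sum_congr rfl fun i hi => sum_congr rfl fun j hj => h1 i hi j hj, sum_eq_zero h2,
    sum_eq_zero h3, smul_zero, add_zero, zero_add]
  congr 1
  exact sum_congr rfl fun i hi => by simp [hi]

end

end Ring

section

variable {N : ℕ} {A : Type} [CommRing A] (k : Type) [CommRing k] [Algebra k A]

/-- Multiplication of coefficients. -/
abbrev cX (a : A) : Module.End k (Fk N A) := coef k (mulE k a)

/-- The differential, using only the indices in `J`; the parameter `ε` switches the extra term on
and off. -/
def dd (X : Matrix (Fin N) (Fin N) A) (ε : ℤ) (J : Finset (Fin N)) : Module.End k (Fk N A) :=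
  ddA (fun i j => cX k (X i j)) (opT k) (opH k) (opE k) (opDt k) ε J

/-- The linear form in the symmetric variables given by a row of the matrix. -/
def rowL (X : Matrix (Fin N) (Fin N) A) (J : Finset (Fin N)) (i : Fin N) :
    Module.End k (Fk N A) := ∑ j ∈ J, cX k (X i j) * opT k j

/-- The part of the differential divisible by the symmetric variable `T ν`, divided by it. -/
def bt (X : Matrix (Fin N) (Fin N) A) (ε : ℤ) (J : Finset (Fin N)) (ν : Fin N) :
    Module.End k (Fk N A) :=
  ∑ i ∈ J, cX k (X i ν) * opH k i + ε • (opDt k * opE k ν)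

variable {k}

lemma cX_comm (a b : A) : Commute (cX k a : Module.End k (Fk N A)) (cX k b) := by
  refine op_ext fun f I α m => ?_
  simp [mul_left_comm]

lemma cX_opP (a : A) (i : Fin N) : Commute (cX k a) (opP k i) := coef_slotS ..

lemma cX_neg (a : A) : (cX k (-a) : Module.End k (Fk N A)) = - cX k a := by
  refine op_ext fun f I α m => ?_; simp

variable {X : Matrix (Fin N) (Fin N) A} {ε : ℤ} {J : Finset (Fin N)}

lemma ddRel (hX : ∀ i j, X j i = - X i j) : DdRel (R := Module.End k (Fk N A))
    (fun i j => cX k (X i j)) (opT k) (opH k) (opE k) (opDt k) where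
  xx _ _ _ _ := cX_comm _ _
  xT _ _ _ := coef_slotS ..
  xH _ _ _ := coef_slotI ..
  xE _ _ _ := coef_slotI ..
  xt _ _ := coef_slotM ..
  TT := opT_opT
  TH _ _ := (slotI_slotS ..).symm
  TE _ _ := (slotI_slotS ..).symm
  Tt _ := slotS_slotM ..
  Ht _ := slotI_slotM ..
  Et _ := slotI_slotM ..
  HH i j := by rw [ac, opH_opH]; exact neg_add_cancel _
  EE i j := by rw [ac, opE_opE]; exact neg_add_cancel _
  HE i j := by rw [ac, opH_opE]; exact sub_add_cancel _ _
  xskew i j := by rw [hX, cX_neg]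

lemma dd_opT (hX : ∀ i j, X j i = - X i j) (i : Fin N) : Commute (dd k X ε J) (opT k i) :=
  have h := ddRel (k := k) hX
  ddA_commute (fun _ _ _ _ => h.xT _ _ _) (fun _ _ => h.TT _ _) (fun _ _ => (h.TH _ _).symm)
    (fun _ _ => (h.TE _ _).symm) (h.Tt _).symm

lemma dd_cX (a : A) : Commute (dd k X ε J) (cX k a) :=
  ddA_commute (fun _ _ _ _ => cX_comm _ _) (fun _ _ => (coef_slotS ..).symm)
    (fun _ _ => (coef_slotI ..).symm) (fun _ _ => (coef_slotI ..).symm) (coef_slotM ..).symm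

lemma dd_opP {ν : Fin N} (hν : ν ∉ J) : Commute (dd k X ε J) (opP k ν) :=
  ddA_commute (fun _ _ _ _ => cX_opP _ _)
    (fun _ hl => (opP_opT_of_ne (ne_of_mem_of_not_mem hl hν).symm).symm)
    (fun _ _ => slotI_slotS ..) (fun _ _ => slotI_slotS ..) (slotS_slotM ..).symm

lemma dd_opH_apply (hX : ∀ i j, X j i = - X i j) {ν : Fin N} (hν : ν ∉ J) (f : Fk N A) :
    dd k X ε J (opH k ν f) = - opH k ν (dd k X ε J f) := by
  have h := ddRel (k := k) hX
  have h0 : ac (dd k X ε J) (opH k ν) = 0 := ac_ddA_eq_zero (fun _ _ _ _ => h.xH _ _ _)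
    (fun _ _ => h.TH _ _) (h.Ht _).symm (fun _ _ => h.HH _ _) (fun l hl => by
      rw [ac_comm, h.HE, if_neg (ne_of_mem_of_not_mem hl hν).symm])
  exact eq_neg_of_add_eq_zero_left (LinearMap.congr_fun h0 f)

lemma dd_opE_apply (hX : ∀ i j, X j i = - X i j) {ν : Fin N} (hν : ν ∉ J) (f : Fk N A) :
    dd k X ε J (opE k ν f) = - opE k ν (dd k X ε J f) := by
  have h := ddRel (k := k) hX
  have h0 : ac (dd k X ε J) (opE k ν) = 0 := ac_ddA_eq_zero (fun _ _ _ _ => h.xE _ _ _)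
    (fun _ _ => h.TE _ _) (h.Et _).symm (fun l hl => by
      rw [h.HE, if_neg (ne_of_mem_of_not_mem hl hν)]) (fun _ _ => h.EE _ _)
  exact eq_neg_of_add_eq_zero_left (LinearMap.congr_fun h0 f)

lemma dd_insert {ν : Fin N} (hν : ν ∉ J) (h0 : X ν ν = 0) :
    dd k X ε (insert ν J) = dd k X ε J + opT k ν * bt k X ε J ν + rowL k X J ν * opH k ν :=
  ddA_insert hν (by rw [h0]; refine op_ext fun f I α m => ?_; simp) fun _ => coef_slotS ..

end

section

variable {N : ℕ} {A : Type} [CommRing A] {K : Type} [Field K] [CharZero K] [Algebra K A]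
variable {X : Matrix (Fin N) (Fin N) A} {ε : ℤ} {J : Finset (Fin N)}

lemma dd_dd (hX : ∀ i j, X j i = - X i j) (f : Fk N A) : dd K X ε J (dd K X ε J f) = 0 := by
  refine LinearMap.congr_fun (DdRel.ddA_sq (R := Module.End K (Fk N A)) ?_ (ddRel hX)) f
  intro u h
  rw [← two_smul K] at h
  exact (smul_eq_zero.mp h).resolve_left two_ne_zero

end

end

end PfExt

namespace PfExt

open Finset

noncomputable section

section Predicates

variable {N : ℕ} {K : Type} [Field K]

/-- Families whose monomials all satisfy a predicate. -/
def PM (P : Finset (Fin N) → (Fin N →₀ ℕ) → ℕ → (Vars N →₀ ℕ) → Prop) :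
    Submodule K (Fk N (Sn N K)) where
  carrier := {f | ∀ I α m s, (f I α m).coeff s ≠ 0 → P I α m s}
  add_mem' {f g} hf hg I α m s h := by
    by_cases h1 : (f I α m).coeff s = 0
    · exact hg I α m s (by simpa [h1] using h)
    · exact hf I α m s h1
  zero_mem' I α m s h := absurd (MvPolynomial.coeff_zero s) h
  smul_mem' c f hf I α m s h := hf I α m s fun h0 => h (by simp [h0])

variable {P Q : Finset (Fin N) → (Fin N →₀ ℕ) → ℕ → (Vars N →₀ ℕ) → Prop} {f : Fk N (Sn N K)}

lemma PM_mono (hf : f ∈ PM P) (h : ∀ I α m s, P I α m s → Q I α m s) : f ∈ PM Q :=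
  fun I α m s hm => h _ _ _ _ (hf I α m s hm)

lemma PM_and (hf : f ∈ PM P) (hg : f ∈ PM Q) : f ∈ PM (fun I α m s => P I α m s ∧ Q I α m s) :=
  fun I α m s hm => ⟨hf I α m s hm, hg I α m s hm⟩

lemma PM_zero (hf : f ∈ PM P) (h : ∀ I α m s, ¬ P I α m s) : f = 0 := by
  funext I α m
  refine MvPolynomial.ext _ _ fun s => ?_
  by_contra h0
  exact h _ _ _ _ (hf I α m s (by simpa using h0))

lemma coeff_zsmul (c : ℤ) (p : Sn N K) (s) : (c • p).coeff s = c • p.coeff s :=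
  map_zsmul (MvPolynomial.coeffAddMonoidHom s) c p

lemma opE_PM (i : Fin N) (hf : f ∈ PM P) :
    opE K i f ∈ PM (fun I α m s => i ∈ I ∧ P (I.erase i) α m s) := by
  intro I α m s h
  rw [opE_apply, coeff_zsmul] at h
  by_cases hi : i ∈ I
  · exact ⟨hi, hf _ _ _ _ (right_ne_zero_of_smul h)⟩
  · simp [hi] at h

lemma opH_PM (i : Fin N) (hf : f ∈ PM P) :
    opH K i f ∈ PM (fun I α m s => i ∉ I ∧ P (insert i I) α m s) := by
  intro I α m s h
  rw [opH_apply, coeff_zsmul] at h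
  by_cases hi : i ∈ I
  · simp [hi] at h
  · exact ⟨hi, hf _ _ _ _ (right_ne_zero_of_smul h)⟩

lemma opT_PM (i : Fin N) (hf : f ∈ PM P) :
    opT K i f ∈ PM (fun I α m s => α i ≠ 0 ∧ P I (α - Finsupp.single i 1) m s) := by
  intro I α m s h
  rw [opT_apply, coeff_zsmul] at h
  by_cases hi : α i = 0
  · simp [hi] at h
  · exact ⟨hi, hf _ _ _ _ (right_ne_zero_of_smul h)⟩

lemma opP_PM (i : Fin N) (hf : f ∈ PM P) :
    opP K i f ∈ PM (fun I α m s => P I (α + Finsupp.single i 1) m s) := by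
  intro I α m s h
  rw [opP_apply] at h
  exact hf _ _ _ _ h

lemma opDt_PM (hf : f ∈ PM P) : opDt K f ∈ PM (fun I α m s => P I α (m + 1) s) := by
  intro I α m s h
  rw [opDt_apply] at h
  exact hf _ _ _ _ h

lemma opMt_PM (hf : f ∈ PM P) :
    opMt K f ∈ PM (fun I α m s => m ≠ 0 ∧ P I α (m - 1) s) := by
  intro I α m s h
  rw [opMt_apply, coeff_zsmul] at h
  exact ⟨by rintro rfl; simp at h, hf _ _ _ _ (right_ne_zero_of_smul h)⟩

/-- The variable `v` is the entry with indices `i`, `j` in some order. -/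
def IsVar (i j : Fin N) (v : Vars N) : Prop := v.1 = (i, j) ∨ v.1 = (j, i)

lemma gX_eq_zero_or (i j : Fin N) : gX N K i j = 0 ∨
    ∃ v, IsVar i j v ∧ (gX N K i j = MvPolynomial.X v ∨ gX N K i j = - MvPolynomial.X v) := by
  rcases lt_trichotomy i j with h | h | h
  · exact Or.inr ⟨⟨(i, j), h⟩, Or.inl rfl, Or.inl (skew_of_lt _ h)⟩
  · subst h; exact Or.inl (skew_self _ _)
  · exact Or.inr ⟨⟨(j, i), h⟩, Or.inr rfl, Or.inr (by rw [gX, skew_swap, skew_of_lt _ h])⟩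

lemma gdX_eq_zero_or (i j : Fin N) : (gdX i j : Module.End K (Sn N K)) = 0 ∨
    ∃ v, IsVar i j v ∧ ((∀ f : Sn N K, gdX i j f = MvPolynomial.pderiv v f) ∨
      ∀ f : Sn N K, gdX i j f = - MvPolynomial.pderiv v f) := by
  rcases lt_trichotomy i j with h | h | h
  · exact Or.inr ⟨⟨(i, j), h⟩, Or.inl rfl, Or.inl fun f => by rw [gdX, skew_of_lt _ h]; rfl⟩
  · subst h; exact Or.inl (skew_self _ _)
  · exact Or.inr ⟨⟨(j, i), h⟩, Or.inr rfl, Or.inr fun f => by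
      rw [gdX, skew_swap, skew_of_lt _ h]; rfl⟩

lemma cX_PM (i j : Fin N) (hf : f ∈ PM P) : cX K (gX N K i j) f ∈
    PM (fun I α m s => ∃ v s', IsVar i j v ∧ s = s' + Finsupp.single v 1 ∧ P I α m s') := by
  intro I α m s h
  rw [coef_apply, LinearMap.mulLeft_apply] at h
  rcases gX_eq_zero_or (K := K) i j with h0 | ⟨v, hv, h0⟩
  · simp [h0] at h
  · have h1 : (MvPolynomial.X v * f I α m).coeff s ≠ 0 := by
      rcases h0 with h0 | h0 <;> rw [h0] at h <;> simpa using h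
    rw [MvPolynomial.coeff_X_mul'] at h1
    by_cases hs : v ∈ s.support
    · rw [if_pos hs] at h1
      refine ⟨v, s - Finsupp.single v 1, hv, (tsub_add_cancel_of_le ?_).symm, hf _ _ _ _ h1⟩
      rw [Finsupp.single_le_iff]
      exact Nat.one_le_iff_ne_zero.mpr (Finsupp.mem_support_iff.mp hs)
    · exact absurd (if_neg hs) h1

lemma coeff_pderiv (v : Vars N) (p : Sn N K) (s : Vars N →₀ ℕ) :
    (MvPolynomial.pderiv v p).coeff s = (s v + 1) * p.coeff (s + Finsupp.single v 1) := by
  induction p using MvPolynomial.induction_on' with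
  | add p q hp hq => rw [map_add, MvPolynomial.coeff_add, hp, hq, MvPolynomial.coeff_add, mul_add]
  | monomial t c =>
    rw [MvPolynomial.pderiv_monomial, MvPolynomial.coeff_monomial, MvPolynomial.coeff_monomial]
    by_cases ht : t v = 0
    · have : t ≠ s + Finsupp.single v 1 := by rintro rfl; simp at ht
      simp [ht, this]
    · have h1 : t - Finsupp.single v 1 = s ↔ t = s + Finsupp.single v 1 := by
        constructor
        · rintro rfl
          exact (tsub_add_cancel_of_le (by rw [Finsupp.single_le_iff]; omega)).symm
        · rintro rfl; simp
      simp only [h1]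
      split_ifs with h2
      · subst h2; simp; ring
      · simp

lemma gdX_PM (i j : Fin N) (hf : f ∈ PM P) : coef K (gdX i j) f ∈
    PM (fun I α m s => ∃ v, IsVar i j v ∧ P I α m (s + Finsupp.single v 1)) := by
  intro I α m s h
  rw [coef_apply] at h
  rcases gdX_eq_zero_or (K := K) i j with h0 | ⟨v, hv, h0⟩
  · simp [h0] at h
  · have h1 : (MvPolynomial.pderiv v (f I α m)).coeff s ≠ 0 := by
      rcases h0 with h0 | h0 <;> rw [h0] at h <;> simpa using h
    rw [coeff_pderiv] at h1
    exact ⟨v, hv, hf _ _ _ _ (right_ne_zero_of_mul h1)⟩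

/-- Families with bounded powers of the extra generator and bounded polynomial degree. -/
def Bd : Submodule K (Fk N (Sn N K)) where
  carrier := {f | ∃ B : ℕ, f ∈ PM (fun _ _ m s => m ≤ B ∧ s.degree ≤ B)}
  add_mem' := by
    rintro f g ⟨B, hB⟩ ⟨C, hC⟩
    refine ⟨max B C, add_mem (PM_mono hB ?_) (PM_mono hC ?_)⟩ <;> · intros; omega
  zero_mem' := ⟨0, zero_mem _⟩
  smul_mem' c f := fun ⟨B, hB⟩ => ⟨B, Submodule.smul_mem _ c hB⟩

lemma Bd_of {g : Fk N (Sn N K)} (hf : f ∈ Bd)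
    (h : ∀ B, f ∈ PM (fun _ _ m s => m ≤ B ∧ s.degree ≤ B) →
      g ∈ PM (fun _ _ m s => m ≤ B + 1 ∧ s.degree ≤ B + 1)) : g ∈ Bd := by
  obtain ⟨B, hB⟩ := hf
  exact ⟨B + 1, h B hB⟩

lemma opE_Bd (i : Fin N) (hf : f ∈ Bd) : opE K i f ∈ Bd :=
  Bd_of hf fun B hB => PM_mono (opE_PM i hB) fun _ _ _ _ h => by omega
lemma opH_Bd (i : Fin N) (hf : f ∈ Bd) : opH K i f ∈ Bd :=
  Bd_of hf fun B hB => PM_mono (opH_PM i hB) fun _ _ _ _ h => by omega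
lemma opT_Bd (i : Fin N) (hf : f ∈ Bd) : opT K i f ∈ Bd :=
  Bd_of hf fun B hB => PM_mono (opT_PM i hB) fun _ _ _ _ h => by omega
lemma opP_Bd (i : Fin N) (hf : f ∈ Bd) : opP K i f ∈ Bd :=
  Bd_of hf fun B hB => PM_mono (opP_PM i hB) fun _ _ _ _ h => by omega
lemma opDt_Bd (hf : f ∈ Bd) : opDt K f ∈ Bd :=
  Bd_of hf fun B hB => PM_mono (opDt_PM hB) fun _ _ _ _ h => by omega
lemma opMt_Bd (hf : f ∈ Bd) : opMt K f ∈ Bd :=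
  Bd_of hf fun B hB => PM_mono (opMt_PM hB) fun _ _ _ _ h => by omega
lemma cX_Bd (i j : Fin N) (hf : f ∈ Bd) : cX K (gX N K i j) f ∈ Bd :=
  Bd_of hf fun B hB => PM_mono (cX_PM i j hB) fun _ _ _ _ h => by
    obtain ⟨v, s', -, rfl, h1, h2⟩ := h
    rw [map_add, Finsupp.degree_single]
    omega
lemma gdX_Bd (i j : Fin N) (hf : f ∈ Bd) : coef K (gdX i j) f ∈ Bd :=
  Bd_of hf fun B hB => PM_mono (gdX_PM i j hB) fun _ _ _ _ h => by
    obtain ⟨v, -, h1, h2⟩ := h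
    rw [map_add, Finsupp.degree_single] at h2
    omega

lemma Supp_le_Bd (d q : ℕ) {f : Fk N (Sn N K)} (hf : f ∈ Supp K d q) : f ∈ Bd := by
  classical
  refine ⟨q + ∑ I : Finset (Fin N), ∑ α ∈ finsuppAntidiag univ (d - q),
    ∑ m ∈ range (q + 1), (f I α m).totalDegree, fun I α m s h => ?_⟩
  have h1 : f I α m ≠ 0 := fun h0 => h (by simp [h0])
  obtain ⟨h2, h3⟩ := hf I α m h1
  have hs : s.degree ≤ (f I α m).totalDegree :=
    MvPolynomial.le_totalDegree (MvPolynomial.mem_support_iff.mpr h)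
  have hα : α ∈ finsuppAntidiag univ (d - q) := by
    rw [mem_finsuppAntidiag]
    refine ⟨?_, subset_univ _⟩
    rw [Finsupp.degree_eq_sum] at h2
    change ∑ i, α i = d - q
    omega
  have hm : m ∈ range (q + 1) := by rw [mem_range]; omega
  have l1 := single_le_sum (f := fun m => (f I α m).totalDegree) (fun _ _ => Nat.zero_le _) hm
  have l2 := single_le_sum (f := fun α => ∑ m ∈ range (q + 1), (f I α m).totalDegree)
    (fun _ _ => Nat.zero_le _) hα
  have l3 := single_le_sum (f := fun I : Finset (Fin N) => ∑ α ∈ finsuppAntidiag univ (d - q),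
    ∑ m ∈ range (q + 1), (f I α m).totalDegree) (fun _ _ => Nat.zero_le _) (mem_univ I)
  omega

end Predicates

section Projection

variable {N : ℕ} {A : Type} [CommRing A] (k : Type) [CommRing k] [Algebra k A]

open Classical in
/-- Projection onto the components satisfying a predicate. -/
def prM (P : Finset (Fin N) → (Fin N →₀ ℕ) → ℕ → Prop) : Module.End k (Fk N A) where
  toFun f I α m := if P I α m then f I α m else 0
  map_add' f g := by funext I α m; simp only [Pi.add_apply]; split_ifs <;> simp
  map_smul' c f := by funext I α m; simp

variable {k} {P P' : Finset (Fin N) → (Fin N →₀ ℕ) → ℕ → Prop}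

open Classical in
lemma prM_apply (f : Fk N A) (I α m) :
    prM k P f I α m = if P I α m then f I α m else 0 := rfl

lemma prM_eq_self {f : Fk N A} (h : ∀ I α m, f I α m ≠ 0 → P I α m) : prM k P f = f := by
  funext I α m
  rw [prM_apply]
  split_ifs with h1
  · rfl
  · by_contra h2
    exact h1 (h _ _ _ (Ne.symm h2))

lemma prM_ne {f : Fk N A} {I α m} (h : prM k P f I α m ≠ 0) : P I α m ∧ f I α m ≠ 0 := by
  rw [prM_apply] at h
  by_cases hP : P I α m
  · exact ⟨hP, by simpa [hP] using h⟩
  · simp [hP] at h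

lemma dd_apply (X : Matrix (Fin N) (Fin N) A) (ε : ℤ) (J : Finset (Fin N)) (f : Fk N A) (I α m) :
    dd k X ε J f I α m = ∑ i ∈ J, ∑ j ∈ J, X i j * opT k j (opH k i f) I α m +
      ε • ∑ j ∈ J, opT k j (opE k j f) I α (m + 1) := by
  simp only [dd, ddA, LinearMap.add_apply, LinearMap.sum_apply, Pi.add_apply, LinearMap.smul_apply,
    Pi.smul_apply, Finset.sum_apply, Module.End.mul_apply, coef_apply, LinearMap.mulLeft_apply,
    sum_mul]
  simp only [opT_apply, opDt_apply]

lemma prM_dd {X : Matrix (Fin N) (Fin N) A} {ε : ℤ} {J : Finset (Fin N)}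
    (h1 : ∀ I α m, ∀ i ∈ J, ∀ j ∈ J, i ∉ I → α j ≠ 0 →
      (P I α m ↔ P' (insert i I) (α - Finsupp.single j 1) m))
    (h2 : ε ≠ 0 → ∀ I α m, ∀ j ∈ J, j ∈ I → α j ≠ 0 →
      (P I α m ↔ P' (I.erase j) (α - Finsupp.single j 1) (m + 1))) (f : Fk N A) :
    prM k P (dd k X ε J f) = dd k X ε J (prM k P' f) := by
  classical
  funext I α m
  rw [prM_apply, dd_apply, dd_apply]
  have e1 : ∀ i ∈ J, ∀ j ∈ J, opT k j (opH k i (prM k P' f)) I α m =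
      if P I α m then opT k j (opH k i f) I α m else 0 := fun i hi j hj => by
    simp only [opT_apply, opH_apply, prM_apply]
    by_cases hI : i ∈ I
    · simp [hI]
    by_cases hα : α j = 0
    · simp [hα]
    rw [h1 I α m i hi j hj hI hα]
    split_ifs <;> simp
  have e2 : ε ≠ 0 → ∀ j ∈ J, opT k j (opE k j (prM k P' f)) I α (m + 1) =
      if P I α m then opT k j (opE k j f) I α (m + 1) else 0 := fun hε j hj => by
    simp only [opT_apply, opE_apply, prM_apply]
    by_cases hI : j ∈ I
    swap
    · simp [hI]
    by_cases hα : α j = 0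
    · simp [hα]
    rw [h2 hε I α m j hj hI hα]
    split_ifs <;> simp
  have e3 : ε • ∑ j ∈ J, opT k j (opE k j (prM k P' f)) I α (m + 1) =
      ε • ∑ j ∈ J, (if P I α m then opT k j (opE k j f) I α (m + 1) else 0) := by
    by_cases hε : ε = 0
    · simp [hε]
    · rw [sum_congr rfl (e2 hε)]
  rw [sum_congr rfl fun i hi => sum_congr rfl fun j hj => congrArg (X i j * ·) (e1 i hi j hj), e3]
  split_ifs <;> simp

end Projection

end

end PfExt

namespace PfExt

open Finset

noncomputable section

variable {N : ℕ}

/-- The exponent of the variable with indices `i` and `j`. -/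
def ct (i j : Fin N) (s : Vars N →₀ ℕ) : ℕ :=
  if h : i < j then s ⟨(i, j), h⟩ else if h : j < i then s ⟨(j, i), h⟩ else 0

/-- The degree in the variables with one index `ν` and the other index in `J`. -/
def uu (J : Finset (Fin N)) (ν : Fin N) (s : Vars N →₀ ℕ) : ℕ := ∑ i ∈ J, ct i ν s

open Classical in
lemma ct_add_single (i j : Fin N) (s : Vars N →₀ ℕ) (v : Vars N) :
    ct i j (s + Finsupp.single v 1) = ct i j s + if IsVar i j v then 1 else 0 := by
  obtain ⟨⟨a, b⟩, hv⟩ := v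
  simp only at hv
  unfold ct IsVar
  split_ifs <;>
    simp only [Finsupp.add_apply, Finsupp.single_apply, Subtype.mk.injEq, Prod.mk.injEq] at * <;>
    grind

lemma uu_add_of_mem {J : Finset (Fin N)} {i j ν : Fin N} (hi : i ∈ J) (hj : j ∈ J) (hν : ν ∉ J)
    {v : Vars N} (hv : IsVar i j v) (s : Vars N →₀ ℕ) :
    uu J ν (s + Finsupp.single v 1) = uu J ν s := by
  classical
  refine sum_congr rfl fun l hl => ?_
  rw [ct_add_single, if_neg, add_zero]
  unfold IsVar at *
  grind

lemma uu_add_self {J : Finset (Fin N)} {i ν : Fin N} (hi : i ∈ J) (hν : ν ∉ J)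
    {v : Vars N} (hv : IsVar i ν v) (s : Vars N →₀ ℕ) :
    uu J ν (s + Finsupp.single v 1) = uu J ν s + 1 := by
  classical
  have : ∀ l ∈ J, (if IsVar l ν v then 1 else 0) = if l = i then 1 else 0 := fun l hl => by
    unfold IsVar at *
    congr 1
    grind
  unfold uu
  rw [sum_congr rfl fun l _ => ct_add_single l ν s v, sum_add_distrib, sum_congr rfl this,
    sum_ite_eq', if_pos hi]

lemma IsVar.symm {i j : Fin N} {v : Vars N} (h : IsVar i j v) : IsVar j i v := Or.symm h

variable {K : Type} [Field K]

/-- Scaling monomials. -/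
def scaleMon (c : (Vars N →₀ ℕ) → K) : Module.End K (Sn N K) :=
  (MvPolynomial.basisMonomials _ _).constr K (fun s => MvPolynomial.monomial s (c s))

lemma coeff_scaleMon (c : (Vars N →₀ ℕ) → K) (p : Sn N K) (s) :
    (scaleMon c p).coeff s = c s * p.coeff s := by
  induction p using MvPolynomial.induction_on' with
  | add p q hp hq => rw [map_add, MvPolynomial.coeff_add, hp, hq, MvPolynomial.coeff_add, mul_add]
  | monomial t a =>
    have : MvPolynomial.monomial t a = a • MvPolynomial.basisMonomials (Vars N) K t := by
      rw [MvPolynomial.coe_basisMonomials, MvPolynomial.smul_monomial, smul_eq_mul, mul_one]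
    rw [this, map_smul, scaleMon, Module.Basis.constr_basis, MvPolynomial.coe_basisMonomials,
      MvPolynomial.coeff_smul, MvPolynomial.coeff_smul, MvPolynomial.coeff_monomial,
      MvPolynomial.coeff_monomial]
    split_ifs with h
    · subst h; simp [mul_comm]
    · simp

/-- Scaling all the monomials of a family. -/
def diagM (c : Finset (Fin N) → ℕ → (Vars N →₀ ℕ) → K) : Module.End K (Fk N (Sn N K)) where
  toFun f I α m := scaleMon (c I m) (f I α m)
  map_add' f g := by funext I α m; simp
  map_smul' a f := by funext I α m; simp

lemma coeff_diagM (c : Finset (Fin N) → ℕ → (Vars N →₀ ℕ) → K) (f : Fk N (Sn N K)) (I α m s) :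
    (diagM c f I α m).coeff s = c I m s * (f I α m).coeff s := coeff_scaleMon _ _ _

lemma fk_ext {f g : Fk N (Sn N K)} (h : ∀ I α m s, (f I α m).coeff s = (g I α m).coeff s) :
    f = g := by
  funext I α m
  exact MvPolynomial.ext _ _ (h I α m)

lemma diagM_PM {P : Finset (Fin N) → (Fin N →₀ ℕ) → ℕ → (Vars N →₀ ℕ) → Prop} {f : Fk N (Sn N K)}
    (c) (hf : f ∈ PM P) : diagM c f ∈ PM P := by
  intro I α m s h
  rw [coeff_diagM] at h
  exact hf _ _ _ _ (right_ne_zero_of_mul h)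

lemma diagM_Bd {f : Fk N (Sn N K)} (c) (hf : f ∈ Bd) : diagM c f ∈ Bd := by
  obtain ⟨B, hB⟩ := hf
  exact ⟨B, diagM_PM c hB⟩

variable {c c' : Finset (Fin N) → ℕ → (Vars N →₀ ℕ) → K}

lemma diagM_opT (j : Fin N) (f : Fk N (Sn N K)) : diagM c (opT K j f) = opT K j (diagM c f) := by
  refine fk_ext fun I α m s => ?_
  rw [coeff_diagM, opT_apply, opT_apply, coeff_zsmul, coeff_zsmul, coeff_diagM, mul_smul_comm]

lemma diagM_opH (i : Fin N) (h : ∀ I m s, i ∉ I → c I m s = c' (insert i I) m s)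
    (f : Fk N (Sn N K)) : diagM c (opH K i f) = opH K i (diagM c' f) := by
  refine fk_ext fun I α m s => ?_
  rw [coeff_diagM, opH_apply, opH_apply, coeff_zsmul, coeff_zsmul, coeff_diagM]
  by_cases hi : i ∈ I
  · simp [hi]
  · rw [mul_smul_comm, h I m s hi]

lemma diagM_opE (i : Fin N) (h : ∀ I m s, i ∈ I → c I m s = c' (I.erase i) m s)
    (f : Fk N (Sn N K)) : diagM c (opE K i f) = opE K i (diagM c' f) := by
  refine fk_ext fun I α m s => ?_
  rw [coeff_diagM, opE_apply, opE_apply, coeff_zsmul, coeff_zsmul, coeff_diagM]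
  by_cases hi : i ∈ I
  · rw [mul_smul_comm, h I m s hi]
  · simp [hi]

lemma diagM_opDt (h : ∀ I m s, c I m s = c' I (m + 1) s)
    (f : Fk N (Sn N K)) : diagM c (opDt K f) = opDt K (diagM c' f) := by
  refine fk_ext fun I α m s => ?_
  rw [coeff_diagM, opDt_apply, opDt_apply, coeff_diagM, h]

lemma diagM_cX (i j : Fin N)
    (h : ∀ I m s v, IsVar i j v → c I m (s + Finsupp.single v 1) = c' I m s)
    (f : Fk N (Sn N K)) :
    diagM c (cX K (gX N K i j) f) = cX K (gX N K i j) (diagM c' f) := by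
  refine fk_ext fun I α m s => ?_
  rw [coeff_diagM, coef_apply, coef_apply, LinearMap.mulLeft_apply, LinearMap.mulLeft_apply]
  rcases gX_eq_zero_or (K := K) i j with h0 | ⟨v, hv, h0⟩
  · simp [h0]
  · have key : c I m s * (MvPolynomial.X v * f I α m).coeff s =
        (MvPolynomial.X v * diagM c' f I α m).coeff s := by
      rw [MvPolynomial.coeff_X_mul', MvPolynomial.coeff_X_mul', coeff_diagM]
      split_ifs with hs
      · rw [← h I m _ v hv, tsub_add_cancel_of_le]
        rw [Finsupp.single_le_iff]
        exact Nat.one_le_iff_ne_zero.mpr (Finsupp.mem_support_iff.mp hs)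
      · simp
    rcases h0 with h0 | h0 <;> rw [h0]
    · exact key
    · simp only [neg_mul, MvPolynomial.coeff_neg, mul_neg, key]

lemma coeff_gX_mul_gdX {i j : Fin N} (hij : i ≠ j) (p : Sn N K) (s) :
    (gX N K i j * gdX i j p).coeff s = ct i j s * p.coeff s := by
  have key : ∀ v : Vars N, (MvPolynomial.X v * MvPolynomial.pderiv v p).coeff s =
      s v * p.coeff s := fun v => by
    rw [MvPolynomial.coeff_X_mul']
    split_ifs with hs
    · have h1 : 1 ≤ s v := Nat.one_le_iff_ne_zero.mpr (Finsupp.mem_support_iff.mp hs)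
      rw [coeff_pderiv, tsub_add_cancel_of_le (by rwa [Finsupp.single_le_iff])]
      congr 1
      rw [Finsupp.tsub_apply, Finsupp.single_eq_same, Nat.cast_sub h1]
      simp
    · rw [Finsupp.notMem_support_iff.mp hs]; simp
  rcases lt_or_gt_of_ne hij with h | h
  · rw [ct, dif_pos h, ← key, gX, gdX, skew_of_lt _ h, skew_of_lt _ h]; rfl
  · rw [ct, dif_neg h.not_gt, dif_pos h, ← key, gX, gdX, skew_swap, skew_swap _ j i,
      skew_of_lt _ h, skew_of_lt _ h, LinearMap.neg_apply, neg_mul_neg]; rfl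

lemma commute_hh {R ι : Type} [Ring R] (J : Finset ι) (T : R) (E D : ι → R) (M H : R) (e : ℤ)
    (hE : ∀ i, Commute (E i) T) (hD : ∀ i, Commute (D i) T) (hM : Commute M T) (hH : Commute H T) :
    (∑ i ∈ J, E i * D i + e • (M * H)) * T = T * (∑ i ∈ J, E i * D i + e • (M * H)) :=
  ((Commute.sum_left _ _ _ fun i _ => (hE i).mul_left (hD i)).add_left
    ((hM.mul_left hH).smul_left e)).eq

/-- Iterating a contraction which is only defined up to a nilpotent error. -/
lemma iterate_contract {K V : Type} [Field K] [AddCommGroup V] [Module K V]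
    {T D p H S : Module.End K V} {B G : Submodule K V} {F : ℕ → Submodule K V}
    (hFG : ∀ w, F w ≤ G) (hTG : ∀ f ∈ G, T f ∈ G) (hpG : ∀ f ∈ G, p f ∈ G)
    (hTB : ∀ f ∈ B, T f ∈ B) (hHB : ∀ f ∈ G, H f ∈ B)
    (step : ∀ f, D f = 0 → T f = T (p f) + D (H f) + S f)
    (hS0 : ∀ f ∈ F 0, S f = 0) (hS : ∀ w, ∀ f ∈ F (w + 1), S f ∈ F w)
    (hDT : ∀ f, D (T f) = T (D f)) (hDD : ∀ f, D (D f) = 0) (hpT : ∀ f, p (T f) = T (p f))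
    (hpp : ∀ f, p (p f) = p f) (h0 : ∀ f ∈ G, D f = 0 → D (p f) = 0) (w : ℕ) :
    ∀ f ∈ F w, D f = 0 → ∃ g ∈ B, ∃ c ∈ G, p c = c ∧ (T ^ (w + 1)) f = D g + c := by
  have hT : ∀ k, (∀ f ∈ G, (T ^ k) f ∈ G) ∧ (∀ f ∈ B, (T ^ k) f ∈ B) ∧
      (∀ f, D ((T ^ k) f) = (T ^ k) (D f)) ∧ (∀ f, p ((T ^ k) f) = (T ^ k) (p f)) := fun k => by
    induction k with
    | zero => exact ⟨fun _ h => h, fun _ h => h, fun _ => rfl, fun _ => rfl⟩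
    | succ k ih =>
      obtain ⟨i1, i2, i3, i4⟩ := ih
      simp only [pow_succ', Module.End.mul_apply]
      exact ⟨fun f h => hTG _ (i1 f h), fun f h => hTB _ (i2 f h), fun f => by rw [hDT, i3],
        fun f => by rw [hpT, i4]⟩
  induction w with
  | zero =>
    intro f hf hD
    refine ⟨_, hHB f (hFG _ hf), T (p f), hTG _ (hpG f (hFG _ hf)), by rw [hpT, hpp], ?_⟩
    rw [zero_add, pow_one, step f hD, hS0 f hf]
    abel
  | succ w ih =>
    intro f hf hD
    have hDS : D (S f) = 0 := by
      have h1 := congrArg D (step f hD)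
      rw [map_add, map_add, hDD, hDT, hDT, hD, h0 f (hFG _ hf) hD, map_zero, zero_add,
        zero_add] at h1
      exact h1.symm
    obtain ⟨g, hg, c, hc, hc0, h⟩ := ih _ (hS w f hf) hDS
    obtain ⟨-, i2, i3, -⟩ := hT (w + 1)
    obtain ⟨i1', -, -, i4'⟩ := hT (w + 2)
    refine ⟨(T ^ (w + 1)) (H f) + g, add_mem (i2 _ (hHB f (hFG _ hf))) hg,
      (T ^ (w + 2)) (p f) + c, add_mem (i1' _ (hpG f (hFG _ hf))) hc, ?_, ?_⟩
    · rw [map_add, hc0, i4', hpp]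
    · rw [pow_succ, Module.End.mul_apply, step f hD, map_add, map_add, h,
        Module.End.mul_apply, map_add, i3]
      abel

section Contraction

variable (e : ℕ) (J : Finset (Fin N)) (ν : Fin N)

/-- The eigenvalue of the anticommutator of the differential with the contracting homotopy. -/
def nn (I : Finset (Fin N)) (m : ℕ) (s : Vars N →₀ ℕ) : ℕ :=
  uu J ν s + (I ∩ J).card + e * ((if ν ∈ I then 1 else 0) + m)

/-- Families supported in prescribed degrees, relative to `insert ν J`. -/
def MD (Q : ℕ → ℕ → ℕ → Prop) : Submodule K (Fk N (Sn N K)) :=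
  PM fun I α m s => Q ((I ∩ J).card + (if ν ∈ I then 1 else 0) + 2 * e * m)
    (α ν + ∑ i ∈ J, α i) (2 * ((if ν ∈ I then 1 else 0) + m) + uu J ν s + (I ∩ J).card)

variable (K)

/-- The contracting homotopy. -/
def hh : Module.End K (Fk N (Sn N K)) :=
  ∑ i ∈ J, opE K i * coef K (gdX i ν) + (e : ℤ) • (opMt K * opH K ν)

/-- The part of the differential which lowers the filtration. -/
def RR : Module.End K (Fk N (Sn N K)) :=
  dd K (gX N K) e J + rowL K (gX N K) J ν * opH K ν

variable {K e J ν}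

lemma gX_swap (i j : Fin N) : gX N K j i = - gX N K i j := skew_swap _ _ _

lemma card_insert_inter {I : Finset (Fin N)} {i : Fin N} (hi : i ∈ J) (hI : i ∉ I) :
    (insert i I ∩ J).card = (I ∩ J).card + 1 := by
  rw [insert_inter_of_mem hi, card_insert_of_notMem (by simp [hI])]

lemma card_insert_inter' {I : Finset (Fin N)} {i : Fin N} (hi : i ∉ J) :
    (insert i I ∩ J).card = (I ∩ J).card := by
  rw [insert_inter_of_notMem hi]

lemma card_erase_inter {I : Finset (Fin N)} {i : Fin N} (hi : i ∈ J) (hI : i ∈ I) :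
    (I ∩ J).card = (I.erase i ∩ J).card + 1 := by
  rw [erase_inter, card_erase_add_one (by simp [hi, hI])]

lemma card_erase_inter' {I : Finset (Fin N)} {i : Fin N} (hi : i ∉ J) :
    (I.erase i ∩ J).card = (I ∩ J).card := by
  rw [erase_inter, erase_eq_of_notMem (by simp [hi])]

lemma sum_sub_single {α : Fin N →₀ ℕ} {j : Fin N} (hj : j ∈ J) (h : α j ≠ 0) :
    ∑ i ∈ J, α i = ∑ i ∈ J, (α - Finsupp.single j 1 : Fin N →₀ ℕ) i + 1 := by
  conv_lhs => rw [← sub_single_add h]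
  simp only [Finsupp.add_apply, sum_add_distrib, Finsupp.single_apply, sum_ite_eq, if_pos hj]

lemma sum_sub_single' {α : Fin N →₀ ℕ} {j : Fin N} (hj : j ∉ J) :
    ∑ i ∈ J, (α - Finsupp.single j 1 : Fin N →₀ ℕ) i = ∑ i ∈ J, α i := by
  refine sum_congr rfl fun i hi => ?_
  rw [Finsupp.tsub_apply, Finsupp.single_eq_of_ne (ne_of_mem_of_not_mem hi hj), tsub_zero]

lemma sub_single_self (α : Fin N →₀ ℕ) (j : Fin N) :
    (α - Finsupp.single j 1 : Fin N →₀ ℕ) j = α j - 1 := by simp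

lemma sub_single_of_ne (α : Fin N →₀ ℕ) {i j : Fin N} (h : i ≠ j) :
    (α - Finsupp.single j 1 : Fin N →₀ ℕ) i = α i := by
  rw [Finsupp.tsub_apply, Finsupp.single_eq_of_ne h, tsub_zero]

variable {Q : ℕ → ℕ → ℕ → Prop} {f : Fk N (Sn N K)}

lemma MD_mono {Q' : ℕ → ℕ → ℕ → Prop} (hf : f ∈ MD e J ν Q) (h : ∀ q a w, Q q a w → Q' q a w) :
    f ∈ MD e J ν Q' := PM_mono hf fun _ _ _ _ => h _ _ _

lemma RR_MD (hν : ν ∉ J) (he : e ≤ 1) (hf : f ∈ MD e J ν Q) :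
    RR K e J ν f ∈ MD e J ν (fun q a w => ∃ a', a = a' + 1 ∧ Q (q + 1) a' (w + 1)) := by
  simp only [RR, dd, ddA, rowL, LinearMap.add_apply, LinearMap.sum_apply, sum_mul,
    Module.End.mul_apply, LinearMap.smul_apply]
  refine add_mem (add_mem (sum_mem fun i hi => sum_mem fun j hj => ?_) ?_)
    (sum_mem fun j hj => ?_)
  · refine PM_mono (cX_PM _ _ (opT_PM j (opH_PM i hf))) ?_
    rintro I α m s ⟨v, s', hv, rfl, hα, hI, h⟩
    have hjν : ν ≠ j := (ne_of_mem_of_not_mem hj hν).symm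
    have hiν : ν ≠ i := (ne_of_mem_of_not_mem hi hν).symm
    refine ⟨(α - Finsupp.single j 1 : Fin N →₀ ℕ) ν +
      ∑ i ∈ J, (α - Finsupp.single j 1 : Fin N →₀ ℕ) i, ?_, ?_⟩
    rotate_left
    · rw [uu_add_of_mem hi hj hν hv]
      rw [card_insert_inter hi hI] at h
      simp only [mem_insert, hiν, false_or] at h
      convert h using 1 <;> ring
    · rw [sum_sub_single hj hα, sub_single_of_ne _ hjν]; ring
  · rcases Nat.le_one_iff_eq_zero_or_eq_one.mp he with rfl | rfl
    · simp
    refine Submodule.smul_of_tower_mem _ _ (sum_mem fun j hj => ?_)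
    refine PM_mono (opT_PM j (opDt_PM (opE_PM j hf))) ?_
    rintro I α m s ⟨hα, hI, h⟩
    have hjν : ν ≠ j := (ne_of_mem_of_not_mem hj hν).symm
    refine ⟨(α - Finsupp.single j 1 : Fin N →₀ ℕ) ν +
      ∑ i ∈ J, (α - Finsupp.single j 1 : Fin N →₀ ℕ) i, ?_, ?_⟩
    rotate_left
    · rw [card_erase_inter hj hI]
      simp only [mem_erase, ne_eq, hjν, not_false_eq_true, true_and] at h
      convert h using 1 <;> ring
    · rw [sum_sub_single hj hα, sub_single_of_ne _ hjν]; ring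
  · refine PM_mono (cX_PM _ _ (opT_PM j (opH_PM ν hf))) ?_
    rintro I α m s ⟨v, s', hv, rfl, hα, hI, h⟩
    have hjν : ν ≠ j := (ne_of_mem_of_not_mem hj hν).symm
    refine ⟨(α - Finsupp.single j 1 : Fin N →₀ ℕ) ν +
      ∑ i ∈ J, (α - Finsupp.single j 1 : Fin N →₀ ℕ) i, ?_, ?_⟩
    rotate_left
    · rw [uu_add_self hj hν hv.symm]
      rw [card_insert_inter' hν] at h
      simp only [mem_insert, true_or, if_true] at h
      simp only [hI, if_false]
      convert h using 1 <;> ring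
    · rw [sum_sub_single hj hα, sub_single_of_ne _ hjν]; ring

lemma hh_MD (hν : ν ∉ J) (he : e ≤ 1) (hf : f ∈ MD e J ν Q) :
    hh K e J ν f ∈ MD e J ν (fun q a w => ∃ q', q = q' + 1 ∧ Q q' a w) := by
  simp only [hh, LinearMap.add_apply, LinearMap.sum_apply,
    Module.End.mul_apply, LinearMap.smul_apply]
  refine add_mem (sum_mem fun i hi => ?_) ?_
  · refine PM_mono (opE_PM i (gdX_PM _ _ hf)) ?_
    rintro I α m s ⟨hI, v, hv, h⟩
    have hiν : ν ≠ i := (ne_of_mem_of_not_mem hi hν).symm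
    rw [uu_add_self hi hν hv] at h
    refine ⟨(I.erase i ∩ J).card + (if ν ∈ I then 1 else 0) + 2 * e * m, ?_, ?_⟩
    rotate_left
    · simp only [mem_erase, ne_eq, hiν, not_false_eq_true, true_and] at h
      rw [card_erase_inter hi hI]
      convert h using 1; ring
    · rw [card_erase_inter hi hI]; ring
  · rcases Nat.le_one_iff_eq_zero_or_eq_one.mp he with rfl | rfl
    · simp
    refine Submodule.smul_of_tower_mem _ _ ?_
    refine PM_mono (opMt_PM (opH_PM ν hf)) ?_
    rintro I α m s ⟨hm, hI, h⟩
    obtain ⟨m, rfl⟩ := Nat.exists_eq_succ_of_ne_zero hm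
    rw [card_insert_inter' hν] at h
    simp only [mem_insert, true_or, if_true, Nat.succ_eq_add_one, Nat.add_sub_cancel] at h
    refine ⟨(I ∩ J).card + 1 + 2 * 1 * m, ?_, ?_⟩
    rotate_left
    · simp only [hI, if_false]
      convert h using 1; simp only [Nat.succ_eq_add_one]; ring
    · simp only [hI, if_false, Nat.succ_eq_add_one]; ring

lemma opT_MD (hν : ν ∉ J) (hf : f ∈ MD e J ν Q) :
    opT K ν f ∈ MD e J ν (fun q a w => ∃ a', a = a' + 1 ∧ Q q a' w) := by
  refine PM_mono (opT_PM ν hf) ?_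
  rintro I α m s ⟨hα, h⟩
  refine ⟨_, ?_, h⟩
  rw [sum_sub_single' hν, sub_single_self]
  omega

lemma diagM_nn_bt (hν : ν ∉ J) (he : e ≤ 1) (F : ℕ → K) (f : Fk N (Sn N K)) :
    diagM (fun I m s => F (nn e J ν I m s)) (bt K (gX N K) e J ν f) =
      bt K (gX N K) e J ν (diagM (fun I m s => F (nn e J ν I m s)) f) := by
  simp only [bt, LinearMap.add_apply, LinearMap.sum_apply, Module.End.mul_apply, map_add, map_sum,
    LinearMap.smul_apply, map_zsmul]
  congr 1
  · refine sum_congr rfl fun i hi => ?_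
    have hiν : ν ≠ i := (ne_of_mem_of_not_mem hi hν).symm
    rw [diagM_cX (c' := fun I m s => F (nn e J ν I m s + 1)) i ν,
      diagM_opH (c' := fun I m s => F (nn e J ν I m s)) i]
    · intro I m s hI
      simp only [nn, card_insert_inter hi hI, mem_insert, hiν, false_or]
      congr 1; ring
    · intro I m s v hv
      simp only [nn, uu_add_self hi hν hv]
      congr 1; ring
  · rcases Nat.le_one_iff_eq_zero_or_eq_one.mp he with rfl | rfl
    · simp
    congr 1
    rw [diagM_opDt (c' := fun I m s => F (nn 1 J ν I m s - 1)),
      diagM_opE (c' := fun I m s => F (nn 1 J ν I m s)) ν]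
    · intro I m s hI
      simp only [nn, card_erase_inter' hν, hI, if_true, mem_erase, ne_eq, not_true, false_and,
        if_false]
      congr 1; omega
    · intro I m s
      simp only [nn]
      congr 1

lemma opE_opH_self (i : Fin N) (f : Fk N (Sn N K)) (I α m) :
    opE K i (opH K i f) I α m = (if i ∈ I then 1 else 0 : ℤ) • f I α m := by
  rw [opE_apply, opH_apply]
  by_cases hi : i ∈ I
  · simp only [hi, if_true, mem_erase, ne_eq, not_true, false_and, if_false, insert_erase,
      sg_erase, lt_irrefl, smul_smul, sg_sq]
  · simp [hi]

lemma ac_bt_hh (hν : ν ∉ J) (he : e ≤ 1) (f : Fk N (Sn N K)) :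
    bt K (gX N K) e J ν (hh K e J ν f) + hh K e J ν (bt K (gX N K) e J ν f) =
      diagM (fun I m s => (nn e J ν I m s : K)) f := by
  have h := (ddRel (k := K) (N := N) gX_swap).ac_bt (J := J) (ν := ν) (ε := e)
    (a := fun i => coef K (gdX i ν)) (m := opMt K)
    (by rcases Nat.le_one_iff_eq_zero_or_eq_one.mp he with rfl | rfl <;> simp)
    (fun i hi j hj => by
      have hij := cm_coef (N := N) (gdX j ν) (mulE K (gX N K i ν))
      rw [gdX_gX, if_pos rfl, if_neg (ne_of_mem_of_not_mem hj hν), sub_zero, cm,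
        sub_eq_iff_eq_add', apply_ite (coef K), map_one, map_zero] at hij
      simp only [eq_comm (a := j)] at hij
      exact hij)
    (fun _ _ => coef_slotI ..) (fun _ _ => coef_slotI ..) (fun _ => coef_slotM ..)
    (fun _ _ => (coef_slotM ..).symm) (fun _ => (slotI_slotM ..).symm)
    (fun _ => (slotI_slotM ..).symm) (opDt_opMt.trans (add_comm _ _))
  refine (LinearMap.congr_fun h f).trans (fk_ext fun I α m s => ?_)
  have e1 : ∀ i ∈ J, ((cX K (gX N K i ν) (coef K (gdX i ν) f)) I α m).coeff s =
      (ct i ν s : K) * (f I α m).coeff s := fun i hi =>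
    coeff_gX_mul_gdX (ne_of_mem_of_not_mem hi hν) _ _
  have e2 : ∀ i, (opE K i (opH K i f)) I α m = (if i ∈ I then 1 else 0 : ℤ) • f I α m :=
    fun i => opE_opH_self i f I α m
  have e3 : opMt K (opDt K f) I α m = (m : ℤ) • f I α m := by
    rw [opMt_apply, opDt_apply]
    rcases m with _ | m
    · simp
    · rfl
  have e4 : ((I ∩ J).card : K) = ∑ i ∈ J, if i ∈ I then 1 else 0 := by
    rw [sum_boole, inter_comm, ← filter_mem_eq_inter]
  rw [coeff_diagM]
  simp only [LinearMap.add_apply, LinearMap.sum_apply, Module.End.mul_apply, Pi.add_apply,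
    LinearMap.smul_apply, Pi.smul_apply, Finset.sum_apply, MvPolynomial.coeff_add, MvPolynomial.coeff_sum, coeff_zsmul,
    e2, e3]
  rw [sum_add_distrib, sum_congr rfl e1]
  simp only [nn, uu, Nat.cast_add, Nat.cast_mul, Nat.cast_sum, e4, add_mul, sum_mul, mul_add]
  congr 1
  · congr 1
    refine sum_congr rfl fun i _ => ?_
    split_ifs <;> simp
  · split_ifs <;> simp [mul_assoc]

lemma opT_hh (f : Fk N (Sn N K)) : hh K e J ν (opT K ν f) = opT K ν (hh K e J ν f) := by
  have h1 : ∀ i j, Commute (coef K (gdX i j : Module.End K (Sn N K))) (opT K ν) :=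
    fun i j => coef_slotS ..
  have h2 : ∀ i, Commute (opE (A := Sn N K) K i) (opT K ν) := fun i => slotI_slotS ..
  have h3 : ∀ i, Commute (opH (A := Sn N K) K i) (opT K ν) := fun i => slotI_slotS ..
  have h4 : Commute (opMt (N := N) (A := Sn N K) K) (opT K ν) := (slotS_slotM ..).symm
  exact LinearMap.congr_fun (commute_hh J _ (fun i => opE K i) (fun i => coef K (gdX i ν)) _ _ (e : ℤ)
    h2 (fun i => h1 i ν) h4 (h3 ν)) f

lemma RR_add_bt (hν : ν ∉ J) (f : Fk N (Sn N K)) :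
    dd K (gX N K) e (insert ν J) f = RR K e J ν f + opT K ν (bt K (gX N K) e J ν f) := by
  rw [dd_insert hν (skew_self _ _), RR]
  simp only [LinearMap.add_apply, Module.End.mul_apply]
  abel

lemma RR_Bd (hf : f ∈ Bd) : RR K e J ν f ∈ Bd := by
  simp only [RR, dd, ddA, rowL, LinearMap.add_apply, LinearMap.sum_apply, sum_mul,
    Module.End.mul_apply, LinearMap.smul_apply]
  exact add_mem (add_mem (sum_mem fun i _ => sum_mem fun j _ => cX_Bd _ _ (opT_Bd _ (opH_Bd _ hf)))
    (Submodule.smul_of_tower_mem _ _ (sum_mem fun j _ => opT_Bd _ (opDt_Bd (opE_Bd _ hf)))))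
    (sum_mem fun j _ => cX_Bd _ _ (opT_Bd _ (opH_Bd _ hf)))

lemma hh_Bd (hf : f ∈ Bd) : hh K e J ν f ∈ Bd := by
  simp only [hh, LinearMap.add_apply, LinearMap.sum_apply, Module.End.mul_apply,
    LinearMap.smul_apply]
  exact add_mem (sum_mem fun i _ => opE_Bd _ (gdX_Bd _ _ hf))
    (Submodule.smul_of_tower_mem _ _ (opMt_Bd (opH_Bd _ hf)))

lemma diagM_MD (c) (hf : f ∈ MD e J ν Q) : diagM c f ∈ MD e J ν Q := diagM_PM c hf

variable (K e J ν)

/-- The inverse of the anticommutator of the differential with the homotopy. -/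
def thInv : Module.End K (Fk N (Sn N K)) := diagM fun I m s => ((nn e J ν I m s : ℕ) : K)⁻¹

/-- The projection onto the kernel of the anticommutator. -/
def pr0 : Module.End K (Fk N (Sn N K)) := diagM fun I m s => if nn e J ν I m s = 0 then 1 else 0

variable {K e J ν}

lemma pr0_pr0 (f : Fk N (Sn N K)) : pr0 K e J ν (pr0 K e J ν f) = pr0 K e J ν f := by
  refine fk_ext fun I α m s => ?_
  simp only [pr0, coeff_diagM]
  split_ifs <;> simp

variable (K e J ν) in
/-- The homotopy of the contraction. -/
def hC : Module.End K (Fk N (Sn N K)) := hh K e J ν * thInv K e J ν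

variable (K e J ν) in
/-- The error term of the contraction. -/
def eC : Module.End K (Fk N (Sn N K)) :=
  -(RR K e J ν * hC K e J ν + hh K e J ν * (thInv K e J ν * RR K e J ν))

variable (K e J ν) in
lemma hC_apply (f : Fk N (Sn N K)) : hC K e J ν f = hh K e J ν (thInv K e J ν f) := rfl

variable (K e J ν) in
lemma eC_apply (f : Fk N (Sn N K)) : eC K e J ν f =
    -(RR K e J ν (hC K e J ν f) + hh K e J ν (thInv K e J ν (RR K e J ν f))) := rfl

lemma thInv_Bd (hf : f ∈ Bd) : thInv K e J ν f ∈ Bd := by unfold thInv; exact diagM_Bd _ hf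

lemma thInv_MD (hf : f ∈ MD e J ν Q) : thInv K e J ν f ∈ MD e J ν Q := by
  unfold thInv; exact diagM_MD _ hf

lemma pr0_Bd (hf : f ∈ Bd) : pr0 K e J ν f ∈ Bd := by unfold pr0; exact diagM_Bd _ hf

lemma pr0_MD (hf : f ∈ MD e J ν Q) : pr0 K e J ν f ∈ MD e J ν Q := by
  unfold pr0; exact diagM_MD _ hf

lemma pr0_opT (f : Fk N (Sn N K)) : pr0 K e J ν (opT K ν f) = opT K ν (pr0 K e J ν f) := by
  unfold pr0; exact diagM_opT _ _

lemma hC_Bd (hf : f ∈ Bd) : hC K e J ν f ∈ Bd := by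
  rw [hC_apply]; exact hh_Bd (thInv_Bd hf)

lemma eC_Bd (hf : f ∈ Bd) : eC K e J ν f ∈ Bd := by
  rw [eC_apply]; exact neg_mem (add_mem (RR_Bd (hC_Bd hf)) (hh_Bd (thInv_Bd (RR_Bd hf))))

lemma eC_MD (hν : ν ∉ J) (he : e ≤ 1) (hf : f ∈ MD e J ν Q) :
    eC K e J ν f ∈ MD e J ν (fun q a w => ∃ a', a = a' + 1 ∧ Q q a' (w + 1)) := by
  rw [eC_apply, hC_apply]
  refine neg_mem (add_mem ?_ ?_)
  · refine MD_mono (RR_MD hν he (hh_MD hν he (thInv_MD hf))) ?_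
    rintro q a w ⟨a', rfl, q', h, h'⟩
    obtain rfl : q = q' := by omega
    exact ⟨a', rfl, h'⟩
  · refine MD_mono (hh_MD hν he (thInv_MD (RR_MD hν he hf))) ?_
    rintro q a w ⟨q', rfl, a', rfl, h⟩
    exact ⟨a', rfl, h⟩

variable [CharZero K]

lemma thInv_add_pr0 (f : Fk N (Sn N K)) :
    diagM (fun I m s => (nn e J ν I m s : K)) (thInv K e J ν f) + pr0 K e J ν f = f := by
  refine fk_ext fun I α m s => ?_
  simp only [Pi.add_apply, MvPolynomial.coeff_add, thInv, pr0, coeff_diagM]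
  by_cases h : nn e J ν I m s = 0
  · simp [h]
  · rw [if_neg h, zero_mul, add_zero, mul_inv_cancel_left₀ (Nat.cast_ne_zero.mpr h)]

lemma contract_step (hν : ν ∉ J) (he : e ≤ 1) (hf : dd K (gX N K) e (insert ν J) f = 0) :
    opT K ν f = opT K ν (pr0 K e J ν f) +
      dd K (gX N K) e (insert ν J) (hC K e J ν f) + eC K e J ν f := by
  have h1 := congrArg (opT K ν) (thInv_add_pr0 (e := e) (J := J) (ν := ν) f)
  rw [map_add, ← ac_bt_hh hν he, map_add] at h1
  have h2 : opT K ν (bt K (gX N K) e J ν (thInv K e J ν f)) = - thInv K e J ν (RR K e J ν f) := by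
    rw [RR_add_bt hν] at hf
    rw [thInv, ← diagM_nn_bt hν he (fun x => (x : K)⁻¹), ← diagM_opT,
      eq_neg_of_add_eq_zero_right hf, map_neg]
  rw [← opT_hh, h2, map_neg] at h1
  rw [RR_add_bt hν (hC K e J ν f), ← h1]
  rw [eC_apply, hC_apply]
  abel

/-- Multiplying a cycle by a power of a variable makes it homologous to a cycle concentrated
in the kernel of the anticommutator. -/
theorem contract (hν : ν ∉ J) (he : e ≤ 1) (G : ℕ → ℕ → Prop) (hG : ∀ q a, G q a → G q (a + 1))
    (h0 : ∀ f ∈ MD e J ν (fun q a _ => G q a), dd K (gX N K) e (insert ν J) f = 0 →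
      dd K (gX N K) e (insert ν J) (pr0 K e J ν f) = 0) (w : ℕ) :
    ∀ f ∈ Bd, f ∈ MD e J ν (fun q a w' => G q a ∧ w' ≤ w) →
      dd K (gX N K) e (insert ν J) f = 0 → ∃ g ∈ Bd, ∃ c ∈ Bd,
        c ∈ MD e J ν (fun q a _ => G q a) ∧ pr0 K e J ν c = c ∧
          (opT K ν ^ (w + 1)) f = dd K (gX N K) e (insert ν J) g + c := by
  intro f hB hf hD
  suffices h : ∃ g ∈ Bd (K := K), ∃ c ∈ Bd (K := K) ⊓ MD e J ν (fun q a _ => G q a),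
      pr0 K e J ν c = c ∧ (opT K ν ^ (w + 1)) f = dd K (gX N K) e (insert ν J) g + c by
    obtain ⟨g, hg, c, hc, hc0, h⟩ := h
    exact ⟨g, hg, c, hc.1, hc.2, hc0, h⟩
  have hTG : ∀ f ∈ Bd (K := K) ⊓ MD e J ν (fun q a _ => G q a),
      opT K ν f ∈ Bd (K := K) ⊓ MD e J ν (fun q a _ => G q a) := fun f hf =>
    ⟨opT_Bd _ hf.1, MD_mono (opT_MD hν hf.2) (by rintro q a w ⟨a', rfl, h⟩; exact hG _ _ h)⟩
  have hS0 : ∀ f ∈ Bd (K := K) ⊓ MD e J ν (fun q a w' => G q a ∧ w' ≤ 0),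
      eC K e J ν f = 0 := fun f hf =>
    PM_zero (eC_MD hν he hf.2) (by rintro I α m s ⟨a', -, -, h⟩; omega)
  have hS : ∀ w, ∀ f ∈ Bd (K := K) ⊓ MD e J ν (fun q a w' => G q a ∧ w' ≤ w + 1),
      eC K e J ν f ∈ Bd (K := K) ⊓ MD e J ν (fun q a w' => G q a ∧ w' ≤ w) := fun w f hf =>
    ⟨eC_Bd hf.1, MD_mono (eC_MD hν he hf.2) (by
      rintro q a w' ⟨a', rfl, h, h'⟩; exact ⟨hG _ _ h, by omega⟩)⟩
  have hDT : ∀ f : Fk N (Sn N K), dd K (gX N K) e (insert ν J) (opT K ν f) =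
      opT K ν (dd K (gX N K) e (insert ν J) f) := fun f => by
    rw [← Module.End.mul_apply, (dd_opT gX_swap ν).eq, Module.End.mul_apply]
  have hDD : ∀ f : Fk N (Sn N K), dd K (gX N K) e (insert ν J)
      (dd K (gX N K) e (insert ν J) f) = 0 := fun f => by
    rw [dd_dd gX_swap]
  refine iterate_contract (T := opT K ν) (D := dd K (gX N K) e (insert ν J)) (p := pr0 K e J ν)
    (H := hC K e J ν) (S := eC K e J ν) (B := Bd) (G := Bd ⊓ MD e J ν (fun q a _ => G q a))
    (F := fun w => Bd ⊓ MD e J ν (fun q a w' => G q a ∧ w' ≤ w))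
    ?_ ?_ ?_ ?_ ?_ ?_ ?_ ?_ ?_ ?_ ?_ ?_ ?_ w f ?_ ?_
  · exact fun w f hf => ⟨hf.1, MD_mono hf.2 fun _ _ _ h => h.1⟩
  · exact hTG
  · exact fun f hf => ⟨pr0_Bd hf.1, pr0_MD hf.2⟩
  · exact fun f hf => opT_Bd _ hf
  · exact fun f hf => hC_Bd hf.1
  · exact fun f hf => contract_step hν he hf
  · exact hS0
  · exact hS
  · exact hDT
  · exact hDD
  · exact pr0_opT
  · exact pr0_pr0
  · exact fun f hf => h0 f hf.2
  · exact ⟨hB,hf⟩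
  · exact hD

end Contraction

end

end PfExt

namespace PfExt

open Finset

noncomputable section

section Abstract

variable {K V : Type} [Field K] [AddCommGroup V] [Module K V]

lemma commute_apply {f g : Module.End K V} (h : Commute f g) (v : V) : f (g v) = g (f v) :=
  LinearMap.congr_fun h.eq v

/-- The relations used for removing one index from the differential. -/
structure CancelRel (D' D T P β L H E : Module.End K V) : Prop where
  split (v : V) : D' v = D v + T (β v) + L (H v)
  D'T (v : V) : D' (T v) = T (D' v)
  sq_D' (v : V) : D' (D' v) = 0
  PT (v : V) : P (T v) = v
  DP (v : V) : D (P v) = P (D v)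
  LP (v : V) : L (P v) = P (L v)
  HP (v : V) : H (P v) = P (H v)
  DT (v : V) : D (T v) = T (D v)
  LT (v : V) : L (T v) = T (L v)
  HT (v : V) : H (T v) = T (H v)
  DH (v : V) : D (H v) = - H (D v)
  DE (v : V) : D (E v) = - E (D v)
  LH (v : V) : L (H v) = H (L v)
  LE (v : V) : L (E v) = E (L v)
  DL (v : V) : D (L v) = L (D v)
  HE (v : V) : H (E v) + E (H v) = v
  HH (v : V) : H (H v) = 0

variable {D' D T P β L H E : Module.End K V} (R : CancelRel D' D T P β L H E)
include R

lemma CancelRel.rest {f g : V} (h : T f = D' g) : D (g - T (P g)) + L (H (g - T (P g))) = 0 := by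
  have h1 := R.split g
  rw [← h] at h1
  have h2 := congrArg (fun v => v - T (P v)) h1
  simp only [R.PT, sub_self, map_add, ← R.DP, ← R.LP, ← R.HP, ← R.DT, ← R.LT, ← R.HT] at h2
  simp only [map_sub]
  rw [h2]
  abel

lemma CancelRel.cycle_top {f g : V} (h : T f = D' g) : D (H (g - T (P g))) = 0 := by
  have h1 := congrArg H (R.rest h)
  rwa [map_add, ← R.LH, R.HH, map_zero, map_zero, add_zero, ← neg_eq_zero, ← R.DH] at h1

lemma CancelRel.cycle_bot {f g : V} (h : T f = D' g) :
    D (H (E (g - T (P g)))) + L (H (g - T (P g))) = 0 := by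
  have h1 := congrArg H (congrArg E (R.rest h))
  rw [map_add, map_add, ← R.LE, ← R.LH, map_zero, map_zero] at h1
  have h2 := R.HE (H (g - T (P g)))
  rw [R.HH, map_zero, add_zero] at h2
  rw [h2] at h1
  rwa [R.DH, R.DE, map_neg, neg_neg]

lemma CancelRel.lift_cycle {f g h₁ : V} (h : T f = D' g) (hh₁ : D h₁ = H (g - T (P g))) :
    D (H (E (g - T (P g))) + L (H (E h₁))) = 0 := by
  have h2 := R.HE (H (g - T (P g)))
  rw [R.HH, map_zero, add_zero] at h2
  rw [map_add, R.DL, R.DH (E h₁), R.DE h₁, map_neg H, map_neg L, map_neg L, neg_neg, hh₁, h2, R.cycle_bot h]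

lemma CancelRel.conclusion {f g h₁ h₀ : V} (h : T f = D' g) (hh₁ : D h₁ = H (g - T (P g)))
    (hh₀ : D h₀ = H (E (g - T (P g))) + L (H (E h₁))) :
    f = D' (P g - β (H (E h₀) - E (H (E h₁)))) := by
  have hHEH : ∀ v, H (E (H v)) = H v := fun v => by
    have := R.HE (H v)
    rwa [R.HH, map_zero, add_zero] at this
  have hD : ∀ v, D (H (E v)) = H (E (D v)) := fun v => by rw [R.DH, R.DE, map_neg, neg_neg]
  have hL : ∀ v, H (E (L v)) = L (H (E v)) := fun v => by rw [← R.LE, ← R.LH]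
  have h1 : D (H (E h₁)) = H (g - T (P g)) := by rw [hD, hh₁, hHEH]
  have h0 : D (H (E h₀)) = H (E (g - T (P g))) + L (H (E h₁)) := by
    rw [hD, hh₀, map_add, map_add, hHEH, hL, hHEH]
  have hu : D' (H (E h₀) - E (H (E h₁))) =
      g - T (P g) + T (β (H (E h₀) - E (H (E h₁)))) := by
    have h3 := R.HE (g - T (P g))
    rw [R.split, map_sub D, map_sub H, R.DE, h1, h0, R.HH, hHEH, zero_sub, map_neg]
    generalize β (H (E h₀) - E (H (E h₁))) = b
    generalize L (H (E h₁)) = l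
    generalize g - T (P g) = c at h3
    calc H (E c) + l - -E (H c) + T b + -l = H (E c) + E (H c) + T b := by abel
      _ = c + T b := by rw [h3]
  have key : T f = T (D' (P g - β (H (E h₀) - E (H (E h₁))))) := by
    have h4 := congrArg D' hu
    rw [R.sq_D', map_add, map_sub, R.D'T, R.D'T, ← h] at h4
    rw [map_sub D', map_sub T, ← sub_eq_zero]
    refine Eq.trans ?_ h4.symm
    abel
  have := congrArg P key
  rwa [R.PT, R.PT] at this

end Abstract

section Cancel

variable {N : ℕ} {K : Type} [Field K] [CharZero K]

omit [CharZero K]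

lemma rowL_opT (J : Finset (Fin N)) (ν i : Fin N) :
    Commute (rowL K (gX N K) J ν) (opT K i) :=
  Commute.sum_left _ _ _ fun _ _ => Commute.mul_left (coef_slotS ..) (opT_opT _ _)

lemma rowL_opH (J : Finset (Fin N)) (ν i : Fin N) :
    Commute (rowL K (gX N K) J ν) (opH K i) :=
  Commute.sum_left _ _ _ fun _ _ => Commute.mul_left (coef_slotI ..) (slotI_slotS ..).symm

lemma rowL_opE (J : Finset (Fin N)) (ν i : Fin N) :
    Commute (rowL K (gX N K) J ν) (opE K i) :=
  Commute.sum_left _ _ _ fun _ _ => Commute.mul_left (coef_slotI ..) (slotI_slotS ..).symm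

lemma rowL_opP {J : Finset (Fin N)} {ν : Fin N} (hν : ν ∉ J) :
    Commute (rowL K (gX N K) J ν) (opP K ν) :=
  Commute.sum_left _ _ _ fun _ hj => (cX_opP _ _).mul_left
    (opP_opT_of_ne (ne_of_mem_of_not_mem hj hν).symm).symm

lemma dd_rowL (e : ℤ) (J : Finset (Fin N)) (ν : Fin N) :
    Commute (dd K (gX N K) e J) (rowL K (gX N K) J ν) :=
  Commute.sum_right _ _ _ fun _ _ => (dd_cX _).mul_right (dd_opT gX_swap _)

variable [CharZero K]

lemma cancelRel (e : ℤ) {J : Finset (Fin N)} {ν : Fin N} (hν : ν ∉ J) :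
    CancelRel (dd K (gX N K) e (insert ν J)) (dd K (gX N K) e J) (opT K ν) (opP K ν)
      (bt K (gX N K) e J ν) (rowL K (gX N K) J ν) (opH K ν) (opE K ν) where
  split v := by
    rw [dd_insert hν (skew_self _ _)]
    simp only [LinearMap.add_apply, Module.End.mul_apply]
  D'T := commute_apply (dd_opT gX_swap _)
  sq_D' v := by rw [dd_dd gX_swap]
  PT v := by rw [← Module.End.mul_apply, opP_opT_self, Module.End.one_apply]
  DP := commute_apply (dd_opP hν)
  LP := commute_apply (rowL_opP hν)
  HP := commute_apply (slotI_slotS ..)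
  DT := commute_apply (dd_opT gX_swap _)
  LT := commute_apply (rowL_opT _ _ _)
  HT := commute_apply (slotI_slotS ..)
  DH v := by rw [dd_opH_apply gX_swap hν]
  DE v := by rw [dd_opE_apply gX_swap hν]
  LH := commute_apply (rowL_opH _ _ _)
  LE := commute_apply (rowL_opE _ _ _)
  DL := commute_apply (dd_rowL _ _ _)
  HE v := by
    rw [← Module.End.mul_apply, opH_opE, if_pos rfl, LinearMap.sub_apply, Module.End.one_apply,
      Module.End.mul_apply, sub_add_cancel]
  HH v := by
    have h := LinearMap.congr_fun (opH_opH (k := K) (A := Sn N K) ν ν) v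
    rw [LinearMap.neg_apply, Module.End.mul_apply, eq_neg_iff_add_eq_zero, ← two_smul K] at h
    exact (smul_eq_zero.mp h).resolve_left two_ne_zero

end Cancel

end

end PfExt

namespace PfExt

open Finset

noncomputable section

variable {N : ℕ} {K : Type} [Field K]

/-- Families supported in prescribed degrees, relative to `J`. -/
def MJ (e : ℕ) (J : Finset (Fin N)) (Q : ℕ → ℕ → Prop) : Submodule K (Fk N (Sn N K)) :=
  PM fun I α m _ => Q ((I ∩ J).card + 2 * e * m) (∑ i ∈ J, α i)

variable {e : ℕ} {J : Finset (Fin N)} {ν : Fin N} {Q Q' : ℕ → ℕ → Prop} {f g : Fk N (Sn N K)}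

lemma MJ_mono (hf : f ∈ MJ e J Q) (h : ∀ q a, Q q a → Q' q a) : f ∈ MJ e J Q' :=
  PM_mono hf fun _ _ _ _ => h _ _

lemma card_inter_insert (hν : ν ∉ J) (I : Finset (Fin N)) :
    (I ∩ insert ν J).card = (I ∩ J).card + if ν ∈ I then 1 else 0 := by
  split_ifs with h
  · rw [inter_insert_of_mem h, card_insert_of_notMem (by simp [hν])]
  · rw [inter_insert_of_notMem h, add_zero]

lemma MJ_insert (hν : ν ∉ J) (hf : f ∈ MJ e (insert ν J) Q) : f ∈ MD e J ν (fun q a _ => Q q a) :=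
  PM_mono hf fun I α m s h => by rwa [card_inter_insert hν, sum_insert hν] at h

lemma MJ_of_MD (hν : ν ∉ J) (hf : f ∈ MD e J ν (fun q a _ => Q q a)) : f ∈ MJ e (insert ν J) Q :=
  PM_mono hf fun I α m s h => by rwa [card_inter_insert hν, sum_insert hν]

lemma uu_le_degree (J : Finset (Fin N)) (ν : Fin N) (s : Vars N →₀ ℕ) :
    uu J ν s ≤ J.card * s.degree := by
  refine sum_le_card_nsmul _ _ _ fun i _ => ?_
  unfold ct
  split_ifs
  · exact Finsupp.le_degree _ _
  · exact Finsupp.le_degree _ _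
  · exact Nat.zero_le _

lemma exists_weight_le (J : Finset (Fin N)) (ν : Fin N) (hf : f ∈ Bd)
    (h : f ∈ MD e J ν (fun q a _ => Q q a)) : ∃ w, f ∈ MD e J ν (fun q a w' => Q q a ∧ w' ≤ w) := by
  obtain ⟨B, hB⟩ := hf
  refine ⟨2 * (1 + B) + J.card * B + J.card, PM_mono (PM_and hB h) ?_⟩
  rintro I α m s ⟨⟨h1, h2⟩, h3⟩
  refine ⟨h3, ?_⟩
  have h4 := (uu_le_degree J ν s).trans (Nat.mul_le_mul_left _ h2)
  have h5 : (I ∩ J).card ≤ J.card := card_le_card inter_subset_right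
  split_ifs <;> omega

lemma coeff_prM (P : Finset (Fin N) → (Fin N →₀ ℕ) → ℕ → Prop) (f : Fk N (Sn N K)) (I α m s)
    (h : (prM K P f I α m).coeff s ≠ 0) : P I α m ∧ (f I α m).coeff s ≠ 0 := by
  rw [prM_apply] at h
  by_cases hP : P I α m
  · exact ⟨hP, by simpa [hP] using h⟩
  · simp [hP] at h

lemma prM_Bd (P : Finset (Fin N) → (Fin N →₀ ℕ) → ℕ → Prop) (hf : f ∈ Bd) : prM K P f ∈ Bd :=
  Bd_of hf fun B hB I α m s h => by
    have := hB _ _ _ _ (coeff_prM P f _ _ _ _ h).2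
    omega

/-- Preimages under the differential may be taken in the expected degrees. -/
lemma exists_pre (he : e ≤ 1) (hf : f ∈ MJ e J Q) (hg : g ∈ Bd) (h : f = dd K (gX N K) e J g) :
    ∃ g' ∈ Bd, g' ∈ MJ e J (fun q a => 1 ≤ q ∧ Q (q - 1) (a + 1)) ∧ f = dd K (gX N K) e J g' := by
  refine ⟨prM K (fun I α m => 1 ≤ (I ∩ J).card + 2 * e * m ∧
    Q ((I ∩ J).card + 2 * e * m - 1) (∑ i ∈ J, α i + 1)) g, prM_Bd _ hg,
    fun I α m s h => (coeff_prM _ _ _ _ _ _ h).1, ?_⟩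
  rw [← prM_dd (P := fun I α m => Q ((I ∩ J).card + 2 * e * m) (∑ i ∈ J, α i)), ← h, prM_eq_self]
  · intro I α m h
    obtain ⟨s, hs⟩ := MvPolynomial.ne_zero_iff.mp h
    exact hf I α m s hs
  · intro I α m i hi j hj hI hα
    rw [card_insert_inter hi hI, sum_sub_single hj hα, add_right_comm, Nat.add_sub_cancel]
    simp
  · intro he0 I α m j hj hI hα
    obtain rfl : e = 1 := by
      rcases Nat.le_one_iff_eq_zero_or_eq_one.mp he with rfl | rfl
      · simp at he0
      · rfl
    rw [card_erase_inter hj hI, sum_sub_single hj hα]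
    have : (I.erase j ∩ J).card + 2 * 1 * (m + 1) - 1 = (I.erase j ∩ J).card + 1 + 2 * 1 * m := by
      omega
    rw [this]
    simp
    omega

lemma bt_Bd (hf : f ∈ Bd) : bt K (gX N K) e J ν f ∈ Bd := by
  simp only [bt, LinearMap.add_apply, LinearMap.sum_apply, Module.End.mul_apply,
    LinearMap.smul_apply]
  exact add_mem (sum_mem fun j _ => cX_Bd _ _ (opH_Bd _ hf))
    (Submodule.smul_of_tower_mem _ _ (opDt_Bd (opE_Bd _ hf)))

lemma rowL_Bd (hf : f ∈ Bd) : rowL K (gX N K) J ν f ∈ Bd := by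
  simp only [rowL, LinearMap.sum_apply, Module.End.mul_apply]
  exact sum_mem fun j _ => cX_Bd _ _ (opT_Bd _ hf)

lemma opT_MJ (hf : f ∈ MJ e (insert ν J) Q) :
    opT K ν f ∈ MJ e (insert ν J) (fun q a => 1 ≤ a ∧ Q q (a - 1)) := by
  refine PM_mono (opT_PM ν hf) ?_
  rintro I α m s ⟨hα, h⟩
  rw [sum_sub_single (mem_insert_self _ _) hα, Nat.add_sub_cancel]
  exact ⟨by omega, h⟩

lemma rowL_MJ (hf : f ∈ MJ e J Q) :
    rowL K (gX N K) J ν f ∈ MJ e J (fun q a => 1 ≤ a ∧ Q q (a - 1)) := by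
  simp only [rowL, LinearMap.sum_apply, Module.End.mul_apply]
  refine sum_mem fun j hj => PM_mono (cX_PM _ _ (opT_PM j hf)) ?_
  rintro I α m s ⟨v, s', -, -, hα, h⟩
  rw [sum_sub_single hj hα, Nat.add_sub_cancel]
  exact ⟨by omega, h⟩

lemma opH_opE_MJ (hf : f ∈ MJ e J Q) : opH K ν (opE K ν f) ∈ MJ e J Q := by
  refine PM_mono (opH_PM ν (opE_PM ν hf)) ?_
  rintro I α m s ⟨hI, -, h⟩
  rwa [erase_insert hI] at h

lemma rest_PM (hf : f ∈ MJ e (insert ν J) Q) : f - opT K ν (opP K ν f) ∈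
    PM fun I α m _ => α ν = 0 ∧ Q ((I ∩ insert ν J).card + 2 * e * m) (∑ i ∈ insert ν J, α i) := by
  intro I α m s h
  simp only [Pi.sub_apply, opT_apply, opP_apply] at h
  by_cases hα : α ν = 0
  · exact ⟨hα, hf I α m s (by simpa [hα] using h)⟩
  · simp [hα, sub_single_add hα] at h

lemma opH_rest_MJ (hν : ν ∉ J) (hf : f ∈ MJ e (insert ν J) Q) :
    opH K ν (f - opT K ν (opP K ν f)) ∈ MJ e J (fun q a => Q (q + 1) a) := by
  refine PM_mono (opH_PM ν (rest_PM hf)) ?_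
  rintro I α m s ⟨hI, hα, h⟩
  rw [sum_insert hν, hα, card_inter_insert hν, if_pos (mem_insert_self _ _),
    card_insert_inter' hν] at h
  convert h using 1 <;> omega

lemma opH_opE_rest_MJ (hν : ν ∉ J) (hf : f ∈ MJ e (insert ν J) Q) :
    opH K ν (opE K ν (f - opT K ν (opP K ν f))) ∈ MJ e J Q := by
  refine PM_mono (opH_PM ν (opE_PM ν (rest_PM hf))) ?_
  rintro I α m s ⟨hI, -, hα, h⟩
  rw [erase_insert hI, sum_insert hν, hα, card_inter_insert hν, if_neg hI] at h
  rwa [add_zero, zero_add] at h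

/-- The degrees in which the complexes are exact. -/
def Good (e q a : ℕ) : Prop := 2 ≤ q + e ∧ (e = 1 → 1 ≤ a)

lemma pr0_Good (he : e ≤ 1) (hf : f ∈ MD e J ν (fun q a _ => Good e q a)) :
    pr0 K e J ν f = 0 := by
  refine fk_ext fun I α m s => ?_
  rw [pr0, coeff_diagM]
  split_ifs with h
  · by_contra h0
    have h1 := hf I α m s (by simpa using h0)
    unfold Good at h1
    unfold nn at h
    rcases Nat.le_one_iff_eq_zero_or_eq_one.mp he with rfl | rfl
    · split_ifs at h1 <;> omega
    · split_ifs at h1 h <;> omega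
  · simp

variable [CharZero K]

theorem exact_of_good (he : e ≤ 1) (J : Finset (Fin N)) : ∀ f ∈ Bd, f ∈ MJ e J (Good e) →
    dd K (gX N K) e J f = 0 → ∃ g ∈ Bd, f = dd K (gX N K) e J g := by
  induction J using Finset.induction_on with
  | empty =>
    intro f _ hf _
    refine ⟨0, zero_mem _, ?_⟩
    rw [map_zero]
    refine PM_zero hf fun I α m s h => ?_
    unfold Good at h
    simp only [inter_empty, card_empty, sum_empty] at h
    rcases Nat.le_one_iff_eq_zero_or_eq_one.mp he with rfl | rfl <;> omega
  | insert ν J hν ih =>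
    have cancel : ∀ f ∈ Bd (K := K), f ∈ MJ e (insert ν J) (Good e) →
        (∃ g ∈ Bd (K := K), opT K ν f = dd K (gX N K) e (insert ν J) g) →
        ∃ g ∈ Bd, f = dd K (gX N K) e (insert ν J) g := by
      rintro f hfB hf ⟨g, hgB, hg⟩
      obtain ⟨g, hgB, hgM, hg⟩ := exists_pre he (opT_MJ hf) hgB hg
      have R := cancelRel (K := K) (N := N) e hν
      obtain ⟨h₁, hB1, hh₁⟩ := ih _ (opH_Bd ν (sub_mem hgB (opT_Bd _ (opP_Bd _ hgB))))
        (MJ_mono (opH_rest_MJ hν hgM) (by unfold Good; intro q a h; omega)) (R.cycle_top hg)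
      obtain ⟨h₁, hB1, hM1, hh₁⟩ := exists_pre he (MJ_mono (opH_rest_MJ (e := e) hν hgM)
        (Q' := Good e) (by unfold Good; intro q a h; omega)) hB1 hh₁
      obtain ⟨h₀, hB0, hh₀⟩ := ih _ (add_mem
        (opH_Bd ν (opE_Bd ν (sub_mem hgB (opT_Bd _ (opP_Bd _ hgB)))))
        (rowL_Bd (J := J) (ν := ν) (opH_Bd ν (opE_Bd ν hB1)))) (add_mem
        (MJ_mono (opH_opE_rest_MJ hν hgM) (by unfold Good; intro q a h; omega))
        (MJ_mono (rowL_MJ (opH_opE_MJ hM1)) (by unfold Good; intro q a h; omega)))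
        (R.lift_cycle hg hh₁.symm)
      exact ⟨_, sub_mem (opP_Bd _ hgB) (bt_Bd (sub_mem (opH_Bd _ (opE_Bd _ hB0))
        (opE_Bd _ (opH_Bd _ (opE_Bd _ hB1))))), R.conclusion hg hh₁.symm hh₀.symm⟩
    intro f hfB hf hD
    have hTM : ∀ k, (opT K ν ^ k) f ∈ Bd ∧ (opT K ν ^ k) f ∈ MJ e (insert ν J) (Good e) := by
      intro k
      induction k with
      | zero => exact ⟨hfB, hf⟩
      | succ k ihk =>
        rw [pow_succ', Module.End.mul_apply]
        exact ⟨opT_Bd _ ihk.1, MJ_mono (opT_MJ ihk.2) (by unfold Good; intro q a h; omega)⟩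
    obtain ⟨w, hw⟩ := exists_weight_le J ν hfB (MJ_insert hν hf)
    obtain ⟨g, hg, c, hc, hcM, hcp, h⟩ := contract hν he (Good e)
      (by unfold Good; intro q a h; omega)
      (fun f hf _ => by rw [pr0_Good he hf, map_zero]) w f hfB hw hD
    rw [← hcp, pr0_Good he hcM, add_zero] at h
    have key : ∀ k, (∃ g ∈ Bd (K := K), (opT K ν ^ k) f = dd K (gX N K) e (insert ν J) g) →
        ∃ g ∈ Bd, f = dd K (gX N K) e (insert ν J) g := by
      intro k
      induction k with
      | zero => exact id
      | succ k ihk =>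
        intro hk
        rw [pow_succ', Module.End.mul_apply] at hk
        exact ihk (cancel _ (hTM k).1 (hTM k).2 hk)
    exact key _ ⟨g, hg, h⟩

end

end PfExt

namespace PfExt

open Finset

noncomputable section

section Abstract

variable {K V : Type} [Field K] [CharZero K] [AddCommGroup V] [Module K V]

/-- The relations of a Weyl algebra pair compatible with a differential `D`. -/
structure WeylRel (D L D₀ x T : Module.End K V) : Prop where
  D₀L (v : V) : D₀ (L v) = L (D₀ v) + T v
  D₀x (v : V) : D₀ (x v) = x (D₀ v) + v
  DD₀ (v : V) : D (D₀ v) = D₀ (D v)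
  Dx (v : V) : D (x v) = x (D v)
  DL (v : V) : D (L v) = L (D v)
  TD₀ (v : V) : T (D₀ v) = D₀ (T v)

variable {D L D₀ x T : Module.End K V} (R : WeylRel D L D₀ x T)
include R

omit [CharZero K] in
lemma WeylRel.pow_L (r : ℕ) (v : V) :
    (D₀ ^ (r + 1)) (L v) = L ((D₀ ^ (r + 1)) v) + (r + 1 : K) • T ((D₀ ^ r) v) := by
  induction r with
  | zero => simp [R.D₀L]
  | succ r ih =>
    rw [pow_succ', Module.End.mul_apply, ih, map_add, map_smul, R.D₀L, ← R.TD₀,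
      ← Module.End.mul_apply D₀, ← Module.End.mul_apply D₀, ← pow_succ', ← pow_succ']
    push_cast
    module

omit [CharZero K] in
lemma WeylRel.mul_pow (r : ℕ) (v : V) :
    D₀ ((x ^ (r + 1)) v) = (x ^ (r + 1)) (D₀ v) + (r + 1 : K) • (x ^ r) v := by
  induction r with
  | zero => simp [R.D₀x]
  | succ r ih =>
    rw [pow_succ' x (r + 1), Module.End.mul_apply, R.D₀x, ih, map_add, map_smul,
      ← Module.End.mul_apply x (x ^ r), ← pow_succ', Module.End.mul_apply]
    push_cast
    module

omit [CharZero K] in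
lemma WeylRel.pow_pow {v : V} (hv : D₀ v = 0) (r : ℕ) :
    (D₀ ^ r) ((x ^ r) v) = (r.factorial : K) • v := by
  induction r with
  | zero => simp
  | succ r ih =>
    rw [pow_succ, Module.End.mul_apply, R.mul_pow, hv, map_zero, zero_add, map_smul, ih,
      Nat.factorial_succ, smul_smul]
    push_cast
    rfl

/-- If `L f` is a boundary for the differential `D`, so is `f`. -/
lemma WeylRel.boundary_of_mul {B G : Submodule K V} (hBD : ∀ b ∈ B, D₀ b ∈ B)
    (hBx : ∀ b ∈ B, x b ∈ B) (hBL : ∀ b ∈ B, L b ∈ B) (hGD : ∀ b ∈ G, D₀ b ∈ G)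
    (hGx : ∀ b ∈ G, x b ∈ G)
    (inj : ∀ f ∈ G, (∃ b ∈ B, T f = D b) → ∃ b ∈ B, f = D b) (r : ℕ) :
    ∀ f ∈ G, (∃ b ∈ B, L f = D b) → (D₀ ^ r) f = 0 → ∃ b ∈ B, f = D b := by
  have pow_mem : ∀ {a : Module.End K V} {M : Submodule K V}, (∀ b ∈ M, a b ∈ M) →
      ∀ k, ∀ b ∈ M, (a ^ k) b ∈ M := fun ha k b hb => by
    induction k with
    | zero => exact hb
    | succ k ih => rw [pow_succ', Module.End.mul_apply]; exact ha _ ih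
  have pow_D : ∀ {a : Module.End K V}, (∀ v, D (a v) = a (D v)) →
      ∀ k v, D ((a ^ k) v) = (a ^ k) (D v) := fun ha k v => by
    induction k with
    | zero => rfl
    | succ k ih => rw [pow_succ', Module.End.mul_apply, ha, ih, Module.End.mul_apply]
  induction r with
  | zero => exact fun f _ _ h => ⟨0, B.zero_mem, by rw [map_zero]; exact h⟩
  | succ r ih =>
    rintro f hf ⟨b, hb, hL⟩ h0
    have h1 := R.pow_L r f
    rw [h0, map_zero, zero_add, hL, ← pow_D R.DD₀] at h1
    obtain ⟨h, hh, hv⟩ := inj _ (pow_mem hGD r f hf)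
      ⟨(r + 1 : K)⁻¹ • (D₀ ^ (r + 1)) b, B.smul_mem _ (pow_mem hBD _ _ hb), by
        rw [map_smul, h1, inv_smul_smul₀ (Nat.cast_add_one_ne_zero r)]⟩
    have hv0 : D₀ ((D₀ ^ r) f) = 0 := by rwa [← Module.End.mul_apply, ← pow_succ']
    set v := (D₀ ^ r) f with hvdef
    have hxv : (x ^ r) v = D ((x ^ r) h) := by rw [pow_D R.Dx, ← hv]
    obtain ⟨b', hb', h'⟩ := ih (f - (r.factorial : K)⁻¹ • (x ^ r) v)
      (G.sub_mem hf (G.smul_mem _ (pow_mem hGx _ _ (pow_mem hGD r f hf))))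
      ⟨b - (r.factorial : K)⁻¹ • L ((x ^ r) h),
        B.sub_mem hb (B.smul_mem _ (hBL _ (pow_mem hBx _ _ hh))), by
          rw [map_sub, map_sub, map_smul, map_smul, hL, hxv, R.DL]⟩
      (by rw [map_sub, map_smul, R.pow_pow hv0,
        inv_smul_smul₀ (Nat.cast_ne_zero.mpr r.factorial_ne_zero), sub_self])
    refine ⟨b' + (r.factorial : K)⁻¹ • (x ^ r) h,
      B.add_mem hb' (B.smul_mem _ (pow_mem hBx _ _ hh)), ?_⟩
    rw [map_add, map_smul, ← h', ← hxv, sub_add_cancel]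

end Abstract

variable {N : ℕ} {K : Type} [Field K] [CharZero K]

variable {J : Finset (Fin N)} {ν : Fin N} {f g : Fk N (Sn N K)}

omit [CharZero K] in
lemma gdX_gX_coef (i j k l : Fin N) (f : Fk N (Sn N K)) :
    coef K (gdX i j) (cX K (gX N K k l) f) = cX K (gX N K k l) (coef K (gdX i j) f) +
      coef K ((if i = k then if j = l then 1 else 0 else 0) -
        (if i = l then if j = k then 1 else 0 else 0)) f := by
  rw [← gdX_gX, ← cm_coef, cm, LinearMap.sub_apply, Module.End.mul_apply, Module.End.mul_apply]
  abel

omit [CharZero K] in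
lemma weylRel {j : Fin N} (hν : ν ∉ J) (hj : j ∈ J) :
    WeylRel (dd K (gX N K) 1 J) (rowL K (gX N K) J ν) (coef K (gdX ν j))
      (cX K (gX N K ν j)) (opT K j) where
  D₀L v := by
    have hjν : j ≠ ν := ne_of_mem_of_not_mem hj hν
    have hT : ∀ i (v : Fk N (Sn N K)), coef K (gdX ν j) (opT K i v) = opT K i (coef K (gdX ν j) v) :=
      fun i => commute_apply (coef_slotS ..)
    simp only [rowL, LinearMap.sum_apply, map_sum, Module.End.mul_apply, gdX_gX_coef, hT, hjν,
      if_false, ite_self, sub_zero, if_true, sum_add_distrib]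
    congr 1
    rw [sum_eq_single_of_mem j hj]
    · rw [if_pos rfl, map_one, Module.End.one_apply]
    · intro i _ hi
      rw [if_neg hi.symm, map_zero, LinearMap.zero_apply]
  D₀x v := by
    have hjν : j ≠ ν := ne_of_mem_of_not_mem hj hν
    rw [gdX_gX_coef, if_pos rfl, if_pos rfl, if_neg hjν, ite_self, sub_zero, map_one,
      Module.End.one_apply]
  DD₀ := commute_apply (ddA_commute (fun i hi l hl => by
      refine Eq.symm ?_
      have h := cm_coef (N := N) (gdX ν j) (mulE K (gX N K i l))
      rw [gdX_gX, if_neg (ne_of_mem_of_not_mem hi hν).symm,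
        if_neg (ne_of_mem_of_not_mem hl hν).symm, sub_zero, map_zero, cm, sub_eq_zero] at h
      exact h)
    (fun _ _ => (coef_slotS ..).symm) (fun _ _ => (coef_slotI ..).symm)
    (fun _ _ => (coef_slotI ..).symm) (coef_slotM ..).symm)
  Dx := commute_apply (dd_cX _)
  DL := commute_apply (dd_rowL _ _ _)
  TD₀ := commute_apply (coef_slotS ..).symm

omit [CharZero K] in
lemma gdX_nilpotent (i j : Fin N) (hf : f ∈ Bd) : ∃ r, (coef K (gdX i j) ^ r) f = 0 := by
  obtain ⟨B, hB⟩ := hf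
  have key : ∀ r, (coef K (gdX i j) ^ r) f ∈ PM (fun _ _ _ s => s.degree + r ≤ B) := fun r => by
    induction r with
    | zero => exact PM_mono hB fun _ _ _ _ h => h.2
    | succ r ih =>
      rw [pow_succ', Module.End.mul_apply]
      refine PM_mono (gdX_PM i j ih) ?_
      rintro I α m s ⟨v, -, h⟩
      rw [map_add, Finsupp.degree_single] at h
      omega
  exact ⟨B + 1, PM_zero (key _) fun _ _ _ s => by omega⟩

/-- Multiplication by a symmetric variable is injective on homology in degree zero. -/
theorem boundary_of_opT (hν : ν ∉ J) : ∀ f ∈ Bd,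
    f ∈ MJ 1 (insert ν J) (fun q a => q = 0 ∧ 1 ≤ a) →
    (∃ g ∈ Bd, opT K ν f = dd K (gX N K) 1 (insert ν J) g) →
    ∃ g ∈ Bd, f = dd K (gX N K) 1 (insert ν J) g := by
  induction hc : J.card using Nat.strong_induction_on generalizing J ν with | _ c ih
  rintro f hfB hf ⟨g, hgB, hg⟩
  obtain ⟨g, hgB, hgM, hg⟩ := exists_pre (e := 1) le_rfl (opT_MJ hf) hgB hg
  have R := cancelRel (K := K) (N := N) 1 hν
  have hγB : g - opT K ν (opP K ν g) ∈ Bd := sub_mem hgB (opT_Bd _ (opP_Bd _ hgB))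
  have hγM : opH K ν (g - opT K ν (opP K ν g)) ∈ MJ 1 J (fun q a => q = 0 ∧ 1 ≤ a) :=
    MJ_mono (opH_rest_MJ hν hgM) (by intro q a h; omega)
  have hb : ∃ b ∈ Bd (K := K), rowL K (gX N K) J ν (opH K ν (g - opT K ν (opP K ν g))) =
      dd K (gX N K) 1 J b := by
    refine ⟨_, neg_mem (opH_Bd ν (opE_Bd ν hγB)), ?_⟩
    rw [map_neg, eq_neg_iff_add_eq_zero, add_comm]
    exact R.cycle_bot hg
  have h₁ : ∃ h₁ ∈ Bd (K := K), opH K ν (g - opT K ν (opP K ν g)) = dd K (gX N K) 1 J h₁ := by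
    rcases J.eq_empty_or_nonempty with rfl | ⟨j, hj⟩
    · refine ⟨0, zero_mem _, ?_⟩
      rw [map_zero]
      refine PM_zero hγM fun I α m s h => ?_
      rw [sum_empty] at h
      omega
    · obtain ⟨r, hr⟩ := gdX_nilpotent ν j (opH_Bd ν hγB)
      refine (weylRel hν hj).boundary_of_mul (B := Bd)
        (G := Bd ⊓ MJ 1 J (fun q a => q = 0 ∧ 1 ≤ a)) (fun b => gdX_Bd _ _) (fun b => cX_Bd _ _)
        (fun b => rowL_Bd) (fun b hb => ⟨gdX_Bd _ _ hb.1, PM_mono (gdX_PM _ _ hb.2) ?_⟩)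
        (fun b hb => ⟨cX_Bd _ _ hb.1, PM_mono (cX_PM _ _ hb.2) ?_⟩) (fun f hf h => ?_) r _
        ⟨opH_Bd ν hγB, hγM⟩ hb hr
      · rintro I α m s ⟨v, -, h⟩; exact h
      · rintro I α m s ⟨v, s', -, -, h⟩; exact h
      · have hlt := card_erase_lt_of_mem hj
        rw [← insert_erase hj] at hf h ⊢
        exact ih _ (hc ▸ hlt) (notMem_erase j J) rfl f hf.1 hf.2 h
  obtain ⟨h₁, hB1, hh₁⟩ := h₁
  obtain ⟨h₁, hB1, hM1, hh₁⟩ := exists_pre (e := 1) le_rfl hγM hB1 hh₁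
  obtain ⟨h₀, hB0, hh₀⟩ := exact_of_good (e := 1) le_rfl J _ (add_mem
    (opH_Bd ν (opE_Bd ν hγB)) (rowL_Bd (J := J) (ν := ν) (opH_Bd ν (opE_Bd ν hB1)))) (add_mem
    (MJ_mono (opH_opE_rest_MJ hν hgM) (by unfold Good; intro q a h; omega))
    (MJ_mono (rowL_MJ (opH_opE_MJ hM1)) (by unfold Good; intro q a h; omega)))
    (R.lift_cycle hg hh₁.symm)
  exact ⟨_, sub_mem (opP_Bd _ hgB) (bt_Bd (sub_mem (opH_Bd _ (opE_Bd _ hB0))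
    (opE_Bd _ (opH_Bd _ (opE_Bd _ hB1))))), R.conclusion hg hh₁.symm hh₀.symm⟩

end

end PfExt

namespace PfExt

open Finset

noncomputable section

section Abstract

variable {R : Type} [Ring R] {ω φ e : R}

lemma mul_pow_comm (h : ω * e = e * ω + φ) (hφ : Commute ω φ) (m : ℕ) :
    e * ω ^ (m + 1) = ω ^ (m + 1) * e - (m + 1 : ℕ) • (φ * ω ^ m) := by
  induction m with
  | zero => simp [h]
  | succ m ih =>
    have h' : e * ω = ω * e - φ := by rw [h]; abel
    rw [pow_succ ω (m + 1), ← mul_assoc, ih, sub_mul, mul_assoc _ e, h', mul_sub,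
      (hφ.pow_left (m + 1)).eq, smul_mul_assoc, mul_assoc φ, ← pow_succ, ← mul_assoc,
      succ_nsmul _ (m + 1)]
    abel

lemma mul_exp_comm {K : Type} [Field K] [CharZero K] [Algebra K R]
    (h : ω * e = e * ω + φ) (hφ : Commute ω φ) (M : ℕ) :
    (φ + e) * ∑ m ∈ range (M + 1), (m.factorial : K)⁻¹ • ω ^ m =
      (∑ m ∈ range (M + 1), (m.factorial : K)⁻¹ • ω ^ m) * e +
        (M.factorial : K)⁻¹ • (φ * ω ^ M) := by
  induction M with
  | zero => simp [add_comm]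
  | succ M ih =>
    have hM : ((M + 1).factorial : K)⁻¹ * ((M + 1 : ℕ) : K) = (M.factorial : K)⁻¹ := by
      rw [Nat.factorial_succ, Nat.cast_mul, mul_inv, mul_comm, ← mul_assoc,
        mul_inv_cancel₀ (Nat.cast_ne_zero.mpr M.succ_ne_zero), one_mul]
    rw [sum_range_succ, mul_add, ih, add_mul _ _ e, mul_smul_comm, add_mul φ, mul_pow_comm h hφ,
      smul_add, smul_sub, ← Nat.cast_smul_eq_nsmul K, smul_smul, hM, smul_mul_assoc]
    abel

lemma add_pow_of_sq_zero {y : R} (hy : y * y = 0) (hc : Commute ω y) (m : ℕ) :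
    (ω + y) ^ (m + 1) = ω ^ (m + 1) + (m + 1 : ℕ) • (y * ω ^ m) := by
  induction m with
  | zero => simp
  | succ m ih =>
    rw [pow_succ, ih, add_mul, mul_add, mul_add, ← pow_succ, (hc.pow_left (m + 1)).eq,
      smul_mul_assoc, smul_mul_assoc, mul_assoc, ← pow_succ, mul_assoc, (hc.pow_left m).eq,
      ← mul_assoc y y, hy, zero_mul, smul_zero, add_zero, succ_nsmul _ (m + 1)]
    abel

section TwoForm

variable {ι : Type} [Fintype ι] {x : ι → ι → R} {H E : ι → R}

lemma twoForm_mul_E [DecidableEq ι] (hx : ∀ i j, x j i = - x i j) (hHE : ∀ i j, H i * E j =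
    (if i = j then 1 else 0) - E j * H i) (hc : ∀ i j l, E l * x i j = x i j * E l) (l : ι) :
    (∑ i, ∑ j, x i j * (H i * H j)) * E l =
      E l * (∑ i, ∑ j, x i j * (H i * H j)) + (2 : ℕ) • ∑ i, x i l * H i := by
  have h1 : ∀ i j, (x i j * (H i * H j)) * E l = E l * (x i j * (H i * H j)) +
      ((if j = l then x i j * H i else 0) - (if i = l then x i j * H j else 0)) := fun i j => by
    rw [mul_assoc, mul_assoc, hHE, mul_sub, ← mul_assoc (H i) (E l), hHE, ← mul_assoc (E l), hc]
    split_ifs <;> noncomm_ring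
  have h3 : ∑ i, ∑ j, (if i = l then x i j * H j else 0) = - ∑ i, x i l * H i := by
    rw [sum_comm, ← sum_neg_distrib]
    refine sum_congr rfl fun j _ => ?_
    rw [sum_ite_eq' univ l, if_pos (mem_univ l), hx, neg_mul]
  have h4 : ∑ i, ∑ j, (if j = l then x i j * H i else 0) = ∑ i, x i l * H i := by
    refine sum_congr rfl fun j _ => ?_
    rw [sum_ite_eq' univ l, if_pos (mem_univ l)]
  simp only [sum_mul, mul_sum, h1, sum_add_distrib, sum_sub_distrib, h3, h4]
  rw [sub_neg_eq_add, two_nsmul]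

lemma twoForm_comm {a : R}
    (hx : ∀ i j, Commute (x i j) a) (hH : ∀ i, H i * a = - (a * H i)) :
    Commute (∑ i, ∑ j, x i j * (H i * H j)) a :=
  Commute.sum_left _ _ _ fun i _ => Commute.sum_left _ _ _ fun j _ =>
    (hx i j).mul_left (by
      rw [Commute, SemiconjBy, mul_assoc, hH, mul_neg, ← mul_assoc, hH, neg_mul, neg_neg,
        mul_assoc])

lemma twoForm_comm_even {a : R} (hx : ∀ i j, Commute (x i j) a) (hH : ∀ i, Commute (H i) a) :
    Commute (∑ i, ∑ j, x i j * (H i * H j)) a :=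
  Commute.sum_left _ _ _ fun i _ => Commute.sum_left _ _ _ fun j _ =>
    (hx i j).mul_left ((hH i).mul_left (hH j))

lemma twoForm_comm_one (hHH : ∀ i j, H i * H j = - (H j * H i))
    (hx : ∀ i j k l, Commute (x i j) (x k l)) (hH : ∀ i j l, Commute (x i j) (H l)) (l : ι) :
    Commute (∑ i, ∑ j, x i j * (H i * H j)) (∑ i, x i l * H i) :=
  Commute.sum_right _ _ _ fun _ _ =>
    (twoForm_comm_even (fun _ _ => hx ..) fun _ => (hH ..).symm).mul_right
      (twoForm_comm (fun _ _ => hH ..) fun _ => hHH ..)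

end TwoForm

lemma add_mul_exp_eq_zero {K V : Type} [Field K] [AddCommGroup V] [Module K V]
    [CharZero K] {ω φ e : Module.End K V}
    (h : ω * e = e * ω + φ) (hφ : Commute ω φ) (M : ℕ) (v : V) (he : e v = 0)
    (hv : φ ((ω ^ M) v) = 0) :
    φ ((∑ m ∈ range (M + 1), (m.factorial : K)⁻¹ • ω ^ m) v) +
      e ((∑ m ∈ range (M + 1), (m.factorial : K)⁻¹ • ω ^ m) v) = 0 := by
  have := LinearMap.congr_fun (mul_exp_comm (K := K) h hφ M) v
  rw [Module.End.mul_apply, LinearMap.add_apply, LinearMap.add_apply, Module.End.mul_apply, he,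
    map_zero, zero_add, LinearMap.smul_apply, Module.End.mul_apply, hv, smul_zero] at this
  exact this

end Abstract

variable {N : ℕ} {K A : Type} [Field K] [CommRing A] [Algebra K A]

variable (K) in
/-- Contraction with the two-form of a skew-symmetric matrix. -/
def om (X : Matrix (Fin N) (Fin N) A) : Module.End K (Fk N A) :=
  (2 : K)⁻¹ • ∑ i, ∑ j, cX K (X i j) * (opH K i * opH K j)

variable (K) in
/-- Contraction with a column of a matrix. -/
def ph (X : Matrix (Fin N) (Fin N) A) (l : Fin N) : Module.End K (Fk N A) :=
  ∑ i, cX K (X i l) * opH K i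

/-- The top form. -/
def topF : Fk N A := fun I _ _ => if I = univ then 1 else 0

variable (K) in
/-- The exponential of the two-form of a matrix, applied to the top form. -/
def PfF (X : Matrix (Fin N) (Fin N) A) : Fk N A :=
  (∑ m ∈ range (N + 1), (m.factorial : K)⁻¹ • om K X ^ m) topF

variable (K) in
/-- The sub-Pfaffian obtained by deleting the rows and columns indexed by `I`, up to sign. -/
def pfc (X : Matrix (Fin N) (Fin N) A) (I : Finset (Fin N)) : A := PfF K X I 0 0

variable {X : Matrix (Fin N) (Fin N) A}

lemma om_apply (f : Fk N A) (I α m) : om K X f I α m = (2 : K)⁻¹ • ∑ i, ∑ j, X i j *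
    opH K i (opH K j f) I α m := by
  simp only [om, LinearMap.smul_apply, LinearMap.sum_apply, Module.End.mul_apply, Pi.smul_apply,
    Finset.sum_apply, coef_apply, LinearMap.mulLeft_apply]

lemma opH_congr {f g : Fk N A} {α β : Fin N →₀ ℕ} {m n : ℕ} (i : Fin N)
    (h : ∀ I, f I α m = g I β n) (I) : opH K i f I α m = opH K i g I β n := by
  rw [opH_apply, opH_apply, h]

lemma om_congr {f g : Fk N A} {α β : Fin N →₀ ℕ} {m n : ℕ}
    (h : ∀ I, f I α m = g I β n) (I) : om K X f I α m = om K X g I β n := by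
  rw [om_apply, om_apply]
  congr 1
  refine sum_congr rfl fun i _ => sum_congr rfl fun j _ => ?_
  rw [opH_congr i (opH_congr j h)]

lemma PfF_eq (I α m) : PfF K X I α m = pfc K X I := by
  have key : ∀ r I, (om K X ^ r) topF I α m = (om K X ^ r) topF I 0 0 := fun r => by
    induction r with
    | zero => exact fun I => rfl
    | succ r ih => rw [pow_succ']; exact om_congr ih
  simp only [pfc, PfF, LinearMap.sum_apply, LinearMap.smul_apply, Finset.sum_apply, Pi.smul_apply,
    key]

lemma om_pow_card (f : Fk N A) (r : ℕ) :
    ∀ I α m, N < I.card + 2 * r → (om K X ^ r) f I α m = 0 := by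
  induction r with
  | zero =>
    intro I α m h
    have := card_le_univ I
    rw [Fintype.card_fin] at this
    omega
  | succ r ih =>
    intro I α m h
    rw [pow_succ', Module.End.mul_apply, om_apply]
    refine (congrArg _ (sum_eq_zero fun i _ => sum_eq_zero fun j _ => ?_)).trans (smul_zero _)
    rw [opH_apply]
    split_ifs with hi
    · rw [zero_smul, mul_zero]
    rw [opH_apply]
    split_ifs with hj
    · rw [zero_smul, smul_zero, mul_zero]
    · rw [ih, smul_zero, smul_zero, mul_zero]
      rw [card_insert_of_notMem hj, card_insert_of_notMem hi]
      omega

lemma pfc_univ : pfc K X univ = 1 := by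
  have hr : ∀ r, (om K X ^ (r + 1)) topF univ 0 0 = 0 := fun r => om_pow_card _ _ _ _ _ (by
    rw [card_univ, Fintype.card_fin]; omega)
  simp only [pfc, PfF, LinearMap.sum_apply, LinearMap.smul_apply, Finset.sum_apply, Pi.smul_apply]
  rw [sum_range_succ', sum_eq_zero fun m _ => by rw [hr, smul_zero]]
  simp [topF]

lemma om_opE [CharZero K] (hX : ∀ i j, X j i = - X i j) (l : Fin N) :
    om K X * opE K l = opE K l * om K X + ph K X l := by
  rw [om, smul_mul_assoc, twoForm_mul_E (x := fun i j => cX K (X i j)), smul_add, mul_smul_comm,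
    ph, ← Nat.cast_smul_eq_nsmul K, smul_smul, Nat.cast_ofNat,
    inv_mul_cancel₀ (two_ne_zero (α := K)), one_smul]
  · exact fun i j => by rw [hX, cX_neg]
  · exact opH_opE
  · exact fun i j l => (coef_slotI ..).symm

lemma om_opH (l : Fin N) : Commute (om K X) (opH K l) := by
  refine (twoForm_comm (x := fun i j => cX K (X i j)) ?_ ?_).smul_left _
  · exact fun i j => coef_slotI ..
  · exact fun i => opH_opH ..

lemma om_cX (a : A) : Commute (om K X) (cX K a) := by
  refine (twoForm_comm_even (x := fun i j => cX K (X i j)) ?_ ?_).smul_left _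
  · exact fun i j => cX_comm ..
  · exact fun i => (coef_slotI ..).symm

lemma om_ph (l : Fin N) : Commute (om K X) (ph K X l) := by
  refine (twoForm_comm_one (x := fun i j => cX K (X i j)) opH_opH ?_ ?_ l).smul_left _
  · exact fun i j k l => cX_comm ..
  · exact fun i j l => coef_slotI ..

lemma opE_topF (l : Fin N) : opE K l (topF : Fk N A) = 0 := by
  refine funext fun I => funext fun α => funext fun m => ?_
  rw [opE_apply]
  have : I.erase l ≠ univ := fun h => notMem_erase l I (h ▸ mem_univ l)
  simp [topF, this]

lemma ph_apply (l : Fin N) (f : Fk N A) (I α m) :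
    ph K X l f I α m = ∑ i, X i l * opH K i f I α m := by
  simp only [ph, LinearMap.sum_apply, Module.End.mul_apply, Finset.sum_apply, coef_apply,
    LinearMap.mulLeft_apply]

theorem ph_opE_PfF [CharZero K] (hX : ∀ i j, X j i = - X i j) (l : Fin N) :
    ph K X l (PfF K X) + opE K l (PfF K X) = 0 := by
  unfold PfF
  refine add_mul_exp_eq_zero (om_opE hX l) (om_ph l) N topF (opE_topF l) ?_
  refine funext fun I => funext fun α => funext fun m => ?_
  have h0 : ∀ i, opH K i ((om K X ^ N) topF) I α m = 0 := fun i => by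
    rw [opH_apply]
    split_ifs with hi
    · exact zero_smul _ _
    · rw [om_pow_card _ N (insert i I), smul_zero]
      rw [card_insert_of_notMem hi]
      have := i.isLt
      omega
  rw [ph_apply, sum_eq_zero fun i _ => by rw [h0, mul_zero]]
  rfl

lemma pfc_congr {X' : Matrix (Fin N) (Fin N) A} {I : Finset (Fin N)}
    (h : ∀ i ∉ I, ∀ j ∉ I, X i j = X' i j) : pfc K X I = pfc K X' I := by
  have key : ∀ r, ∀ J, I ⊆ J → (om K X ^ r) (topF : Fk N A) J 0 0 =
      (om K X' ^ r) (topF : Fk N A) J 0 0 := fun r => by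
    induction r with
    | zero => exact fun J _ => rfl
    | succ r ih =>
      intro J hJ
      rw [pow_succ', pow_succ', Module.End.mul_apply, Module.End.mul_apply, om_apply, om_apply]
      refine congrArg _ (sum_congr rfl fun i _ => sum_congr rfl fun j _ => ?_)
      simp only [opH_apply]
      by_cases hi : i ∈ J
      · simp only [hi, if_true, zero_smul, mul_zero]
      by_cases hj : j ∈ insert i J
      · simp only [hj, if_true, zero_smul, smul_zero, mul_zero]
      rw [if_neg hi, if_neg hj]
      rw [ih _ (hJ.trans ((subset_insert _ _).trans (subset_insert _ _))),
        h i (fun hh => hi (hJ hh)) j (fun hh => hj (mem_insert_of_mem (hJ hh)))]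
  simp only [pfc, PfF, LinearMap.sum_apply, LinearMap.smul_apply, Finset.sum_apply, Pi.smul_apply]
  exact sum_congr rfl fun r _ => by rw [key r I subset_rfl]

lemma map_pfc {B : Type} [CommRing B] [Algebra K B] (φ : A →ₐ[K] B) (I : Finset (Fin N)) :
    φ (pfc K X I) = pfc K (X.map φ) I := by
  have key : ∀ r, ∀ J, φ ((om K X ^ r) (topF : Fk N A) J 0 0) =
      (om K (X.map φ) ^ r) (topF : Fk N B) J 0 0 := fun r => by
    induction r with
    | zero =>
      intro J
      show φ (if J = univ then 1 else 0) = if J = univ then 1 else 0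
      split_ifs <;> simp
    | succ r ih =>
      intro J
      rw [pow_succ', pow_succ', Module.End.mul_apply, Module.End.mul_apply, om_apply, om_apply,
        map_smul, map_sum]
      refine congrArg _ (sum_congr rfl fun i _ => ?_)
      rw [map_sum]
      refine sum_congr rfl fun j _ => ?_
      simp only [opH_apply, map_mul, map_zsmul, ih, Matrix.map_apply]
  simp only [pfc, PfF, LinearMap.sum_apply, LinearMap.smul_apply, Finset.sum_apply, Pi.smul_apply]
  rw [map_sum]
  exact sum_congr rfl fun r _ => by rw [map_smul, key r I]

end

end PfExt

namespace PfExt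

open Finset

noncomputable section

variable {N : ℕ} {K A : Type} [Field K] [CommRing A] [Algebra K A]

variable (K) in
/-- The Pfaffian cycle in degree `d`. -/
def ze (X : Matrix (Fin N) (Fin N) A) (d : ℕ) : Fk N A :=
  fun I α m => if α = 0 ∧ I.card + 2 * m = d then pfc K X I else 0

variable {X : Matrix (Fin N) (Fin N) A}

lemma ze_mem (d : ℕ) : ze K X d ∈ Supp K d d := by
  intro I α m h
  unfold ze at h
  split_ifs at h with h1
  · simp [h1]
  · exact absurd rfl h

lemma opH_ze (d : ℕ) (i : Fin N) (I β m) : opH K i (ze K X d) I β m =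
    if β = 0 ∧ I.card + 1 + 2 * m = d then opH K i (PfF K X) I β m else 0 := by
  rw [opH_apply, opH_apply, PfF_eq]
  by_cases hi : i ∈ I
  · simp [hi]
  · simp only [hi, if_false, ze, card_insert_of_notMem hi]
    split_ifs <;> simp

lemma opE_ze (d : ℕ) (i : Fin N) (I β m) : opE K i (ze K X d) I β (m + 1) =
    if β = 0 ∧ I.card + 1 + 2 * m = d then opE K i (PfF K X) I β m else 0 := by
  rw [opE_apply, opE_apply, PfF_eq]
  by_cases hi : i ∈ I
  · have := card_erase_add_one hi
    have h : ((I.erase i).card + 2 * (m + 1) = d) ↔ I.card + 1 + 2 * m = d := by omega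
    simp only [hi, if_true, ze, h]
    split_ifs <;> simp
  · simp [hi]

theorem dd_ze [CharZero K] (hX : ∀ i j, X j i = - X i j) (d : ℕ) :
    dd K X 1 univ (ze K X d) = 0 := by
  refine funext fun I => funext fun α => funext fun m => ?_
  rw [dd_apply, one_smul, sum_comm, ← sum_add_distrib]
  refine sum_eq_zero fun j _ => ?_
  simp only [opT_apply]
  by_cases hα : α j = 0
  · simp [hα]
  have h := congrFun (congrFun (congrFun (ph_opE_PfF (K := K) hX j) I) (α - Finsupp.single j 1)) m
  simp only [Pi.add_apply, ph_apply] at h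
  simp only [hα, if_false, one_smul, opH_ze, opE_ze]
  split_ifs
  · exact h
  · simp

lemma opDt_ze (d : ℕ) : opDt K (ze K X (d + 2)) = ze K X d := by
  refine funext fun I => funext fun α => funext fun m => ?_
  rw [opDt_apply]
  unfold ze
  have h : (I.card + 2 * (m + 1) = d + 2) ↔ I.card + 2 * m = d := by omega
  simp only [h]

/-- A cycle is determined by its coefficients on the top form, in large degrees. -/
lemma cycle_eq_zero_of_top {d : ℕ} (hd : N ≤ d) {f : Fk N A} (hf : f ∈ Supp K d d)
    (h : dd K X 1 univ f = 0) (h0 : ∀ m, f univ 0 m = 0) : f = 0 := by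
  have key : ∀ c I, N - I.card = c → ∀ m, f I 0 m = 0 := fun c => by
    induction c using Nat.strong_induction_on with | _ c ih
    intro I hc m
    by_cases hI : I = univ
    · rw [hI, h0]
    have hlt : I.card < N := by
      have := card_lt_card (ssubset_univ_iff.mpr hI)
      rwa [card_univ, Fintype.card_fin] at this
    obtain ⟨j, hj⟩ : ∃ j, j ∉ I := by
      by_contra! hh
      exact hI (eq_univ_iff_forall.mpr hh)
    by_contra hne
    have h1 := (hf _ _ _ hne).2
    obtain ⟨m, rfl⟩ : ∃ m', m = m' + 1 := ⟨m - 1, by omega⟩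
    have h2 := congrFun (congrFun (congrFun h (insert j I)) (Finsupp.single j 1)) m
    rw [dd_apply, one_smul, sum_comm, ← sum_add_distrib, sum_eq_single j] at h2
    · simp only [opT_apply, Finsupp.single_eq_same, one_ne_zero, if_false, one_smul, tsub_self,
        opE_apply, mem_insert_self, if_true, erase_insert hj] at h2
      rw [sum_eq_zero, zero_add] at h2
      · refine hne ?_
        have := congrArg (fun z => sg j (insert j I) • z) h2
        rw [smul_smul, sg_sq, one_smul] at this
        exact this.trans (smul_zero _)
      · intro i _
        rw [opH_apply]
        split_ifs with hi
        · simp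
        · rw [ih (N - (insert i (insert j I)).card) _ _ rfl]
          · simp
          · rw [card_insert_of_notMem hi, card_insert_of_notMem hj]
            omega
    · intro l _ hl
      simp [opT_apply, Finsupp.single_eq_of_ne hl]
    · simp
  refine funext fun I => funext fun α => funext fun m => ?_
  by_contra hne
  have h1 := (hf _ _ _ hne).1
  have : α = 0 := (Finsupp.degree_eq_zero_iff _).mp (by omega)
  exact hne (by rw [this]; exact key _ _ rfl _)

/-- On families without extra variable the two differentials agree. -/
lemma dd_one_eq {f : Fk N A} (hf : ∀ I α m, f I α (m + 1) = 0) (J : Finset (Fin N)) :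
    dd K X 1 J f = dd K X ((0 : ℕ) : ℤ) J f := by
  refine funext fun I => funext fun α => funext fun m => ?_
  rw [dd_apply, dd_apply]
  simp [opT_apply, opE_apply, hf]

lemma dd_opS (f : Fk N A) (J : Finset (Fin N)) (I α m) :
    dd K X 1 J (opS K f) I α (m + 1) = dd K X 1 J f I α m := by
  rw [dd_apply, dd_apply]
  simp [opT_apply, opE_apply, opH_apply, opS_apply]

lemma dd_mem (J : Finset (Fin N)) {d q : ℕ} {f : Fk N A} (hf : f ∈ Supp K d (q + 1)) :
    dd K X 1 J f ∈ Supp K d q := by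
  simp only [dd, ddA, LinearMap.add_apply, LinearMap.sum_apply, mul_sum, sum_mul,
    Module.End.mul_apply, one_smul]
  refine add_mem (sum_mem fun i _ => sum_mem fun j _ => ?_) (sum_mem fun j _ => ?_)
  · refine Gr.mono (coef_mem _ (opT_mem _ (opH_mem _ hf))) ?_
    grind
  · refine Gr.mono (opT_mem _ (opDt_mem (opE_mem _ hf))) ?_
    grind

end

section

variable {N : ℕ} {K : Type} [Field K] {d : ℕ} {f : Fk N (Sn N K)}

lemma MJ_zero_of_Supp {q : ℕ} (hf : f ∈ Supp K d q) (h0 : ∀ I α m, f I α (m + 1) = 0) :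
    f ∈ MJ 0 univ (fun b a => b = q ∧ a + q = d) := by
  intro I α m s h
  have h1 : f I α m ≠ 0 := fun hh => h (by simp [hh])
  obtain ⟨h2, h3⟩ := hf _ _ _ h1
  obtain rfl : m = 0 := by
    rcases m with _ | m
    · rfl
    · exact absurd (h0 I α m) h1
  rw [inter_univ, ← Finsupp.degree_eq_sum]
  exact ⟨by omega, h2⟩

variable [CharZero K]

lemma cycle_eq_zero_of_opDt (hd : 2 ≤ d) (hf : f ∈ Supp K d d)
    (h : dd K (gX N K) 1 univ f = 0) (h0 : opDt K f = 0) : f = 0 := by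
  have hm : ∀ I α m, f I α (m + 1) = 0 := fun I α m =>
    (opDt_apply ..).symm.trans (congrFun (congrFun (congrFun h0 I) α) m)
  rw [dd_one_eq hm] at h
  have hM := MJ_zero_of_Supp hf hm
  obtain ⟨g, hgB, hg⟩ := exact_of_good (Nat.zero_le 1) univ f (Supp_le_Bd d d hf)
    (MJ_mono hM fun q a hh => ⟨by omega, by omega⟩) h
  obtain ⟨g, -, hgM, hg⟩ := exists_pre (Nat.zero_le 1) hM hgB hg
  rw [hg, PM_zero hgM fun I α m s hh => by omega, map_zero]

lemma exists_cycle_lift (hd : 1 ≤ d) (hf : f ∈ Supp K d d) (h : dd K (gX N K) 1 univ f = 0) :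
    ∃ f' ∈ Supp K (d + 2) (d + 2), dd K (gX N K) 1 univ f' = 0 ∧ opDt K f' = f := by
  have hS : opS K f ∈ Supp K (d + 2) (d + 2) := Gr.mono (opS_mem hf) fun b a c hh => by
    obtain ⟨c', rfl, h1, h2⟩ := hh
    omega
  have hu := dd_mem (X := gX N K) univ (q := d + 1) hS
  have hum : ∀ I α m, dd K (gX N K) 1 univ (opS K f) I α (m + 1) = 0 := fun I α m => by
    rw [dd_opS, h]; rfl
  have hM := MJ_zero_of_Supp hu hum
  obtain ⟨g, hgB, hg⟩ := exact_of_good (Nat.zero_le 1) univ _ (Supp_le_Bd _ _ hu)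
    (MJ_mono hM fun q a hh => ⟨by omega, by omega⟩) (by rw [← dd_one_eq hum, dd_dd gX_swap])
  obtain ⟨g, -, hgM, hg⟩ := exists_pre (Nat.zero_le 1) hM hgB hg
  have hg0 : ∀ I α m, prM K (fun _ _ m => m = 0) g I α (m + 1) = 0 := fun I α m => by
    simp [prM_apply]
  have hg1 : dd K (gX N K) 1 univ (prM K (fun _ _ m => m = 0) g) =
      dd K (gX N K) 1 univ (opS K f) := by
    rw [dd_one_eq hg0, ← prM_dd (P := fun _ _ m => m = 0), ← hg, prM_eq_self]
    · intro I α m hh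
      rcases m with _ | m
      · rfl
      · exact absurd (hum I α m) hh
    · exact fun _ _ _ _ _ _ _ _ _ => Iff.rfl
    · exact fun h => absurd rfl h
  refine ⟨opS K f - prM K (fun _ _ m => m = 0) g, sub_mem hS ?_, ?_, ?_⟩
  · intro I α m hh
    obtain ⟨rfl, hh⟩ := prM_ne hh
    obtain ⟨s, hs⟩ := MvPolynomial.ne_zero_iff.mp hh
    have := hgM I α 0 s hs
    beta_reduce at this
    rw [inter_univ, ← Finsupp.degree_eq_sum] at this
    omega
  · rw [map_sub, hg1, sub_self]
  · refine funext fun I => funext fun α => funext fun m => ?_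
    rw [opDt_apply]
    simp [opS_apply, prM_apply]

/-- The cycles in the top symmetric degree are the multiples of the Pfaffian cycle. -/
theorem cycle_eq_smul_ze (hN : Odd N) (hd : 1 ≤ d) (hf : f ∈ Supp K d d)
    (h : dd K (gX N K) 1 univ f = 0) :
    ∃ c : Sn N K, f = cX K c (ze K (gX N K) d) ∧ (Even d → c = 0) := by
  obtain ⟨r, hr⟩ : ∃ r, N ≤ d + 2 * r := ⟨N, by omega⟩
  induction r generalizing d f with
  | zero =>
    refine ⟨f univ 0 ((d - N) / 2), ?_, fun he => ?_⟩
    · rw [← sub_eq_zero]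
      refine cycle_eq_zero_of_top (X := gX N K) (by omega) (sub_mem hf (coef_mem _ (ze_mem d))) ?_
        fun m => ?_
      · rw [map_sub, h, commute_apply (dd_cX _), dd_ze gX_swap, map_zero, sub_zero]
      · simp only [Pi.sub_apply, coef_apply, ze, pfc_univ, LinearMap.mulLeft_apply, card_univ,
          Fintype.card_fin, true_and]
        split_ifs with hh
        · rw [← hh, Nat.add_sub_cancel_left, Nat.mul_div_cancel_left _ two_pos, mul_one, sub_self]
        · rw [mul_zero, sub_zero]
          by_contra hne
          have := (hf _ _ _ hne).2
          rw [card_univ, Fintype.card_fin] at this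
          exact hh this
    · by_contra hne
      have := (hf _ _ _ hne).2
      rw [card_univ, Fintype.card_fin] at this
      obtain ⟨a, ha⟩ := hN
      obtain ⟨b, hb⟩ := he
      omega
  | succ r ih =>
    obtain ⟨f', hf', h', rfl⟩ := exists_cycle_lift hd hf h
    obtain ⟨c, rfl, hc⟩ := ih (by omega) hf' h' (by omega)
    refine ⟨c, ?_, fun he => hc (he.add even_two)⟩
    have hcm : Commute (opDt K) (cX K c : Module.End K (Fk N (Sn N K))) := (coef_slotM ..).symm
    rw [commute_apply hcm, opDt_ze]

theorem ze_ne_zero (hN : Odd N) (hd : Odd d) : ze K (gX N K) d ≠ 0 := by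
  obtain ⟨r, hr⟩ : ∃ r, N ≤ d + 2 * r := ⟨N, by omega⟩
  induction r generalizing d with
  | zero =>
    intro h0
    have h1 := congrFun (congrFun (congrFun h0 univ) 0) ((d - N) / 2)
    have h2 : N + 2 * ((d - N) / 2) = d := by
      obtain ⟨a, ha⟩ := hN
      obtain ⟨b, hb⟩ := hd
      omega
    simp [ze, h2, pfc_univ] at h1
  | succ r ih =>
    intro h0
    have := hd.pos
    refine ih (d := d + 2) (hd.add_even even_two) (by omega)
      (cycle_eq_zero_of_opDt (by omega) (ze_mem _) (dd_ze gX_swap _) ?_)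
    rw [opDt_ze, h0]

end

end PfExt

namespace PfExt

open Finset

noncomputable section

section Kernel

variable {N : ℕ} {K A : Type} [Field K] [CommRing A] [Algebra K A] [CharZero K]
  {X : Matrix (Fin N) (Fin N) A}

lemma sum_mul_opH_PfF (hX : ∀ i j, X j i = - X i j) (j : Fin N) (I) :
    ∑ i, X i j * opH K i (PfF K X) I 0 0 + opE K j (PfF K X) I 0 0 = 0 := by
  have := congrFun (congrFun (congrFun (ph_opE_PfF (K := K) hX j) I) 0) 0
  rwa [Pi.add_apply, Pi.add_apply, Pi.add_apply, ph_apply] at this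

variable (K) in
/-- The sub-maximal Pfaffians are killed by the matrix. -/
lemma sum_mul_pfc (hX : ∀ i j, X j i = - X i j) (j : Fin N) :
    ∑ i, X i j * pfc K X {i} = 0 := by
  have := sum_mul_opH_PfF (K := K) hX j ∅
  simpa [opH_apply, opE_apply, PfF_eq, sg] using this

variable (K) in
/-- Every kernel vector is proportional to the vector of sub-maximal Pfaffians. -/
lemma mul_pfc_swap (hX : ∀ i j, X j i = - X i j) (v : Fin N → A)
    (hv : ∀ i, ∑ j, X i j * v j = 0) (a b : Fin N) :
    v a * pfc K X {b} = v b * pfc K X {a} := by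
  wlog hab : a < b generalizing a b
  · rcases eq_or_lt_of_le (not_lt.mp hab) with rfl | h
    · rfl
    · exact (this b a h).symm
  have h1 := sum_eq_zero fun j (_ : j ∈ univ) => congrArg (v j * ·)
    (sum_mul_opH_PfF (K := K) hX j {a, b}) |>.trans (mul_zero _)
  simp only [mul_add, sum_add_distrib, mul_sum] at h1
  rw [sum_comm, sum_eq_zero, zero_add] at h1
  · rw [← sum_subset (subset_univ ({a, b} : Finset (Fin N)))] at h1
    · rw [sum_pair hab.ne, opE_apply, opE_apply, PfF_eq, PfF_eq, if_pos (by simp),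
        if_pos (by simp), erase_insert (by simp [hab.ne]), pair_comm, erase_insert
          (by simp [hab.ne'])] at h1
      have h2 : sg a {b, a} = 1 := by
        simp [sg, filter_insert, filter_singleton, hab.not_gt]
      have h3 : sg b {b, a} = -1 := by
        simp [sg, filter_insert, filter_singleton, hab]
      rw [h2, h3] at h1
      linear_combination h1
    · intro j _ hj
      rw [opE_apply, if_neg hj, zero_smul, mul_zero]
  · intro i _
    rw [← mul_zero (opH K i (PfF K X) {a, b} 0 0), ← hv i, mul_sum]
    exact sum_congr rfl fun j _ => by ring

end Kernel

lemma sum_sum_eq_zero_of_neg {K V ι : Type} [Field K] [CharZero K] [AddCommGroup V] [Module K V]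
    {s : Finset ι} {F : ι → ι → V} (h : ∀ j ∈ s, ∀ l ∈ s, F j l = - F l j) :
    ∑ j ∈ s, ∑ l ∈ s, F j l = 0 := by
  have h2 : ∑ j ∈ s, ∑ l ∈ s, F j l = - ∑ j ∈ s, ∑ l ∈ s, F j l := by
    conv_rhs => rw [sum_comm]
    simp only [← sum_neg_distrib]
    exact sum_congr rfl fun j hj => sum_congr rfl (h j hj)
  have h3 : (2 : K) • ∑ j ∈ s, ∑ l ∈ s, F j l = 0 := by
    rw [two_smul]; exact add_eq_zero_iff_eq_neg.mpr h2
  exact (smul_eq_zero.mp h3).resolve_left two_ne_zero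

section Specialization

variable {N : ℕ} {K : Type} [Field K]

/-- The generic matrix with the row and the column of index `ν` replaced by linear forms. -/
def spX (ν : Fin N) : Matrix (Fin N) (Fin N) (MvPolynomial (Fin N) (Sn N K)) := fun i j =>
  if i = ν then (if j = ν then 0 else ∑ l ∈ univ.erase ν,
    MvPolynomial.C (gX N K j l) * MvPolynomial.X l)
  else if j = ν then -∑ l ∈ univ.erase ν, MvPolynomial.C (gX N K i l) * MvPolynomial.X l
  else MvPolynomial.C (gX N K i j)

lemma spX_swap (ν i j : Fin N) : spX (K := K) ν j i = - spX ν i j := by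
  unfold spX
  by_cases hi : i = ν <;> by_cases hj : j = ν <;> simp [hi, hj]
  rw [gX_swap, map_neg]

/-- The specialization of the generic matrix. -/
def spec (ν : Fin N) : Sn N K →ₐ[K] MvPolynomial (Fin N) (Sn N K) :=
  MvPolynomial.aeval fun v => spX ν v.1.1 v.1.2

lemma spec_gX (ν : Fin N) : (gX N K).map (spec ν) = spX ν := by
  refine Matrix.ext fun i j => ?_
  rw [Matrix.map_apply]
  refine skew_induction MvPolynomial.X (p := fun i j b => spec ν b = spX ν i j) ?_ ?_ ?_ i j
  · exact fun v => MvPolynomial.aeval_X ..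
  · intro i
    unfold spX
    by_cases h : i = ν <;> simp [h, gX]
  · intro i j b h
    rw [map_neg, h, ← spX_swap]

/-- A kernel vector of the specialized matrix. -/
def kv (ν i : Fin N) : MvPolynomial (Fin N) (Sn N K) := if i = ν then 1 else MvPolynomial.X i

variable [CharZero K]

lemma spX_mul_kv (ν i : Fin N) : ∑ j, spX (K := K) ν i j * kv ν j = 0 := by
  rw [← insert_erase (mem_univ ν), sum_insert (notMem_erase _ _)]
  by_cases hi : i = ν
  · subst hi
    simp only [spX, kv, if_true, zero_mul, zero_add]
    have h : ∀ j ∈ univ.erase i, ∀ l ∈ univ.erase i, (MvPolynomial.C (gX N K j l) *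
        MvPolynomial.X l * MvPolynomial.X j : MvPolynomial (Fin N) (Sn N K)) =
        -(MvPolynomial.C (gX N K l j) * MvPolynomial.X j * MvPolynomial.X l) :=
      fun j _ l _ => by rw [gX_swap, map_neg]; ring
    rw [sum_congr rfl fun j hj => by
      rw [if_neg (ne_of_mem_erase hj), if_neg (ne_of_mem_erase hj), sum_mul]]
    exact sum_sum_eq_zero_of_neg (K := K) h
  · have h : ∀ j ∈ univ.erase ν, spX (K := K) ν i j * kv ν j =
        MvPolynomial.C (gX N K i j) * MvPolynomial.X j := fun j hj => by
      simp only [spX, kv, hi, ne_of_mem_erase hj, if_false]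
    rw [sum_congr rfl h]
    simp only [spX, kv, hi, if_true, if_false, mul_one, neg_add_cancel]

lemma spec_pfc (ν i : Fin N) : spec ν (pfc K (gX N K) {i}) =
    kv ν i * MvPolynomial.C (pfc K (gX N K) {ν}) := by
  have h1 := mul_pfc_swap K (spX_swap (K := K) ν) (kv ν) (spX_mul_kv ν) ν i
  rw [map_pfc, spec_gX]
  rw [kv, if_pos rfl, one_mul] at h1
  rw [h1]
  congr 1
  have h2 := map_pfc (IsScalarTower.toAlgHom K (Sn N K) (MvPolynomial (Fin N) (Sn N K)))
    (X := gX N K) {ν}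
  rw [IsScalarTower.coe_toAlgHom', MvPolynomial.algebraMap_eq] at h2
  rw [h2]
  refine pfc_congr fun i hi j hj => ?_
  rw [mem_singleton] at hi hj
  simp [spX, hi, hj]

omit [CharZero K] in
lemma spec_eq_C (ν : Fin N) (c : Sn N K)
    (h : ∀ s, c.coeff s ≠ 0 → uu (univ.erase ν) ν s = 0) : spec ν c = MvPolynomial.C c := by
  have : (MvPolynomial.C : Sn N K →+* MvPolynomial (Fin N) (Sn N K)) =
      MvPolynomial.eval₂Hom (algebraMap K _) (fun v => MvPolynomial.C (MvPolynomial.X v)) := by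
    refine MvPolynomial.ringHom_ext (fun r => ?_) fun v => ?_
    · simp [MvPolynomial.algebraMap_eq, IsScalarTower.algebraMap_apply K (Sn N K)]
    · simp
  rw [this]
  refine MvPolynomial.eval₂Hom_congr' rfl (fun v hv _ => ?_) rfl
  obtain ⟨s, hs, hv⟩ := (MvPolynomial.mem_vars_iff_mem_support v).mp hv
  have h1 := h s (MvPolynomial.mem_support_iff.mp hs)
  rw [uu, sum_eq_zero_iff] at h1
  rw [Finsupp.mem_support_iff] at hv
  obtain ⟨⟨i, j⟩, hij⟩ := v
  simp only at hij
  have hi : i ≠ ν := by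
    rintro rfl
    refine hv ?_
    have := h1 j (by simp [hij.ne'])
    rwa [ct, dif_neg hij.not_gt, dif_pos hij] at this
  have hj : j ≠ ν := by
    rintro rfl
    refine hv ?_
    have := h1 i (by simp [hij.ne])
    rwa [ct, dif_pos hij] at this
  simp only [spX, hi, hj, if_false]
  rw [gX, skew_of_lt _ hij]

/-- A form in the sub-maximal Pfaffians without the variables of index `ν` in its coefficients
vanishes identically. -/
lemma eq_zero_of_eval_pfc {ν : Fin N} (hν : pfc K (gX N K) {ν} ≠ 0) (d : ℕ)
    (P : MvPolynomial (Fin N) (Sn N K)) (hP : P.IsHomogeneous d)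
    (h : ∀ α s, (P.coeff α).coeff s ≠ 0 → uu (univ.erase ν) ν s = 0)
    (h0 : MvPolynomial.eval (fun i => pfc K (gX N K) {i}) P = 0) : P = 0 := by
  set g := pfc K (gX N K) {ν}
  have h1 := congrArg (spec ν) h0
  rw [MvPolynomial.eval_eq, map_sum, map_zero] at h1
  have hkv : ∀ α : Fin N →₀ ℕ, ∏ i ∈ α.support, (kv (K := K) ν i) ^ α i =
      MvPolynomial.monomial (α.erase ν) 1 := fun α => by
    rw [MvPolynomial.monomial_eq, map_one, one_mul, Finsupp.prod, Finsupp.support_erase]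
    by_cases hα : ν ∈ α.support
    · rw [← mul_prod_erase _ _ hα, kv, if_pos rfl, one_pow, one_mul]
      refine prod_congr rfl fun i hi => ?_
      rw [kv, if_neg (ne_of_mem_erase hi), Finsupp.erase_ne (ne_of_mem_erase hi)]
    · rw [erase_eq_of_notMem hα]
      refine prod_congr rfl fun i hi => ?_
      have : i ≠ ν := fun hh => hα (hh ▸ hi)
      rw [kv, if_neg this, Finsupp.erase_ne this]
  have h2 : ∀ α ∈ P.support, spec ν (P.coeff α * ∏ i ∈ α.support, pfc K (gX N K) {i} ^ α i) =
      MvPolynomial.monomial (α.erase ν) (P.coeff α * g ^ d) := fun α hα => by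
    rw [map_mul, spec_eq_C ν _ (h α), map_prod]
    simp only [map_pow, spec_pfc, mul_pow, prod_mul_distrib, hkv]
    have hd : ∑ i ∈ α.support, α i = d := by
      have h3 : α.degree = d := by
        rw [Finsupp.degree_eq_weight_one]
        exact hP (MvPolynomial.mem_support_iff.mp hα)
      exact h3
    rw [prod_pow_eq_pow_sum, hd, ← map_pow, mul_comm (MvPolynomial.monomial _ _), ← mul_assoc,
      ← map_mul, MvPolynomial.C_mul_monomial, mul_one]
  rw [sum_congr rfl h2] at h1
  by_contra hne
  obtain ⟨β, hβ⟩ := MvPolynomial.support_nonempty.mpr hne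
  have h3 := congrArg (MvPolynomial.coeff (β.erase ν)) h1
  rw [MvPolynomial.coeff_sum, MvPolynomial.coeff_zero, sum_eq_single β] at h3
  · rw [MvPolynomial.coeff_monomial, if_pos rfl] at h3
    exact (mul_ne_zero (MvPolynomial.mem_support_iff.mp hβ) (pow_ne_zero d hν)) h3
  · intro α hα hαβ
    rw [MvPolynomial.coeff_monomial, if_neg]
    intro he
    refine hαβ ?_
    have hd : α.degree = β.degree := by
      rw [Finsupp.degree_eq_weight_one]
      exact (hP (MvPolynomial.mem_support_iff.mp hα)).trans
        (hP (MvPolynomial.mem_support_iff.mp hβ)).symm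
    have h4 : α ν = β ν := by
      have h5 := congrArg Finsupp.degree he
      rw [← Finsupp.erase_add_single ν α, ← Finsupp.erase_add_single ν β, map_add, map_add,
        Finsupp.degree_single, Finsupp.degree_single, h5] at hd
      omega
    rw [← Finsupp.erase_add_single ν α, ← Finsupp.erase_add_single ν β, he, h4]
  · exact fun hh => absurd hβ hh

end Specialization

end

end PfExt

namespace PfExt

open Finset

noncomputable section

section Form

variable {N : ℕ} {K A : Type} [Field K] [CommRing A] [Algebra K A]

/-- The form of degree `d` given by the coefficients in homological degree zero. -/
def tp (d : ℕ) (f : Fk N A) : MvPolynomial (Fin N) A :=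
  ∑ α ∈ finsuppAntidiag univ d, MvPolynomial.monomial α (f ∅ α 0)

lemma coeff_tp (d : ℕ) (f : Fk N A) (α : Fin N →₀ ℕ) :
    (tp d f).coeff α = if α.degree = d then f ∅ α 0 else 0 := by
  simp only [tp, MvPolynomial.coeff_sum, MvPolynomial.coeff_monomial, sum_ite_eq',
    mem_finsuppAntidiag, subset_univ, and_true, Finsupp.degree_eq_sum]

lemma tp_isHomogeneous (d : ℕ) (f : Fk N A) : (tp d f).IsHomogeneous d := by
  intro α h
  rw [coeff_tp] at h
  have h1 : α.degree = d := by
    by_contra h1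
    exact h (if_neg h1)
  rw [Finsupp.degree_eq_weight_one] at h1
  exact h1

lemma tp_add (d : ℕ) (f g : Fk N A) : tp d (f + g) = tp d f + tp d g := by
  simp only [tp, Pi.add_apply, map_add, sum_add_distrib]

lemma tp_opT (d : ℕ) (j : Fin N) (f : Fk N A) :
    tp (d + 1) (opT K j f) = MvPolynomial.X j * tp d f := by
  refine MvPolynomial.ext _ _ fun α => ?_
  rw [mul_comm, MvPolynomial.coeff_mul_X', coeff_tp, coeff_tp, opT_apply]
  by_cases h : α j = 0
  · simp [h]
  · rw [if_pos (Finsupp.mem_support_iff.mpr h), degree_sub_single h]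
    simp [h]

lemma tp_dd (X : Matrix (Fin N) (Fin N) A) (d : ℕ) (f : Fk N A) :
    tp (d + 1) (dd K X 1 univ f) = ∑ i, ∑ j, MvPolynomial.C (X i j) *
      (MvPolynomial.X j * tp d (opH K i f)) := by
  simp only [← tp_opT (K := K)]
  refine MvPolynomial.ext _ _ fun α => ?_
  simp only [MvPolynomial.coeff_sum, MvPolynomial.coeff_C_mul, coeff_tp, dd_apply]
  split_ifs with h
  · have : ∀ j, opT K j (opE K j f) ∅ α (0 + 1) = 0 := fun j => by
      rw [opT_apply, opE_apply]; simp
    rw [sum_congr rfl fun j _ => this j, sum_const_zero, smul_zero, add_zero]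
  · simp

variable (K) in
/-- Evaluation of the form at the Pfaffians. -/
def evp (X : Matrix (Fin N) (Fin N) A) (d : ℕ) (f : Fk N A) : A :=
  MvPolynomial.eval (fun i => pfc K X {i}) (tp d f)

lemma evp_add (X : Matrix (Fin N) (Fin N) A) (d : ℕ) (f g : Fk N A) :
    evp K X d (f + g) = evp K X d f + evp K X d g := by
  rw [evp, tp_add, map_add, evp, evp]

lemma evp_opT (X : Matrix (Fin N) (Fin N) A) (d : ℕ) (j : Fin N) (f : Fk N A) :
    evp K X (d + 1) (opT K j f) = pfc K X {j} * evp K X d f := by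
  rw [evp, tp_opT, map_mul, MvPolynomial.eval_X, evp]

lemma evp_dd [CharZero K] {X : Matrix (Fin N) (Fin N) A} (hX : ∀ i j, X j i = - X i j) (d : ℕ) (f : Fk N A) :
    evp K X (d + 1) (dd K X 1 univ f) = 0 := by
  rw [evp, tp_dd]
  simp only [map_sum, map_mul, MvPolynomial.eval_C, MvPolynomial.eval_X]
  refine sum_eq_zero fun i _ => ?_
  have h : ∑ j, X i j * pfc K X {j} = 0 := by
    rw [← neg_eq_zero, ← sum_neg_distrib, ← sum_mul_pfc (K := K) hX i]
    exact sum_congr rfl fun j _ => by rw [hX i j, neg_mul]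
  simp only [← mul_assoc, ← sum_mul, h, zero_mul]

lemma dd_eq_zero_of_empty {X : Matrix (Fin N) (Fin N) A} {f : Fk N A} {ε : ℤ} {J : Finset (Fin N)}
    (h : ∀ I α m, f I α m ≠ 0 → I = ∅ ∧ m = 0) : dd K X ε J f = 0 := by
  have hH : ∀ i, opH K i f = 0 := fun i => funext fun I => funext fun α => funext fun m => by
    have : f (insert i I) α m = 0 := by
      by_contra h0
      exact insert_ne_empty _ _ (h _ _ _ h0).1
    rw [opH_apply, this, smul_zero]
    rfl
  refine funext fun I => funext fun α => funext fun m => ?_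
  rw [dd_apply]
  have hE : ∀ j, opT K j (opE K j f) I α (m + 1) = 0 := fun j => by
    have : ∀ J β, f J β (m + 1) = 0 := fun J β => by
      by_contra h0
      exact absurd (h _ _ _ h0).2 (Nat.succ_ne_zero m)
    rw [opT_apply, opE_apply, this, smul_zero, smul_zero]
  simp only [hH, hE, map_zero, Pi.zero_apply, mul_zero, sum_const_zero, smul_zero, add_zero]

end Form

variable {N : ℕ} {K : Type} [Field K] [CharZero K] {f : Fk N (Sn N K)} {d : ℕ}

lemma exists_pfc_ne_zero (hN : Odd N) : ∃ ν, pfc K (gX N K) {ν} ≠ 0 := by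
  by_contra! h
  refine ze_ne_zero (K := K) hN odd_one (funext fun I => funext fun α => funext fun m => ?_)
  unfold ze
  split_ifs with h1
  · obtain ⟨i, rfl⟩ := card_eq_one.mp (show I.card = 1 by omega)
    exact h i
  · rfl

/-- The relations of degree `d` between the sub-maximal Pfaffians. -/
theorem exact_zero (hN : Odd N) (hd : 1 ≤ d) (hf : f ∈ Supp K d 0)
    (h : evp K (gX N K) d f = 0) : ∃ g ∈ Supp K d 1, f = dd K (gX N K) 1 univ g := by
  obtain ⟨ν, hν⟩ := exists_pfc_ne_zero (K := K) hN
  have hνJ : ν ∉ univ.erase ν := notMem_erase _ _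
  have hU : insert ν (univ.erase ν) = univ := insert_erase (mem_univ ν)
  have hfB := Supp_le_Bd _ _ hf
  have hfM : f ∈ MJ 1 univ (fun q a => q = 0 ∧ a = d) := fun I α m s hs => by
    have h1 : f I α m ≠ 0 := fun hh => hs (by simp [hh])
    have := hf _ _ _ h1
    beta_reduce
    rw [inter_univ, ← Finsupp.degree_eq_sum]
    omega
  have hMz : ∀ c ∈ MD (K := K) 1 (univ.erase ν) ν (fun q a _ => q = 0 ∧ d ≤ a),
      ∀ I α m, c I α m ≠ 0 → I = ∅ ∧ m = 0 := fun c hc I α m h0 => by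
    obtain ⟨s, hs⟩ := MvPolynomial.ne_zero_iff.mp h0
    have h1 := MJ_of_MD hνJ hc I α m s hs
    rw [hU] at h1
    rw [inter_univ] at h1
    exact ⟨card_eq_zero.mp (by omega), by omega⟩
  have hfD : f ∈ MD (K := K) 1 (univ.erase ν) ν (fun q a _ => q = 0 ∧ d ≤ a) :=
    MJ_insert hνJ (hU.symm ▸ MJ_mono hfM fun q a hh => ⟨hh.1, hh.2.ge⟩)
  obtain ⟨w, hw⟩ := exists_weight_le _ ν hfB hfD
  obtain ⟨g, hgB, c, hcB, hcM, hcp, hg⟩ := contract hνJ le_rfl (fun q a => q = 0 ∧ d ≤ a)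
    (fun q a hh => ⟨hh.1, by omega⟩)
    (fun f hf _ => dd_eq_zero_of_empty fun I α m hh => hMz f hf I α m fun h0 => hh (by
      refine MvPolynomial.ext _ _ fun s => ?_
      rw [pr0, coeff_diagM, h0, MvPolynomial.coeff_zero, mul_zero])) w f hfB hw
    (dd_eq_zero_of_empty (hMz f hfD))
  rw [hU, Nat.cast_one] at hg
  have hT : ∀ k, evp K (gX N K) (d + k) ((opT K ν ^ k) f) = 0 := fun k => by
    induction k with
    | zero => exact h
    | succ k ih =>
      rw [pow_succ', Module.End.mul_apply, ← add_assoc, evp_opT, ih, mul_zero]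
  have hc0 : tp (d + w + 1) c = 0 := by
    refine eq_zero_of_eval_pfc hν (d + w + 1) _ (tp_isHomogeneous _ _) (fun α s hs => ?_) ?_
    · rw [coeff_tp] at hs
      split_ifs at hs with h1
      · by_contra h2
        refine hs ?_
        rw [← hcp, pr0, coeff_diagM, if_neg, zero_mul]
        unfold nn
        omega
      · exact absurd (MvPolynomial.coeff_zero s) hs
    · have h1 : evp K (gX N K) (d + w + 1) ((opT K ν ^ (w + 1)) f) = 0 := hT (w + 1)
      have h2 := evp_dd (K := K) (X := gX N K) gX_swap (d + w) g
      rw [hg, evp_add, h2, zero_add] at h1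
      exact h1
  have hcz : ∀ I α m, α.degree = d + w + 1 → c I α m = 0 := fun I α m hα => by
    by_contra h0
    obtain ⟨rfl, rfl⟩ := hMz c hcM _ _ _ h0
    have h1 := congrArg (MvPolynomial.coeff α) hc0
    rw [coeff_tp, if_pos hα, MvPolynomial.coeff_zero] at h1
    exact h0 h1
  have hTM : ∀ k, (opT K ν ^ k) f ∈ Bd ∧
      (opT K ν ^ k) f ∈ MJ (K := K) 1 (insert ν (univ.erase ν)) (fun q a => q = 0 ∧ a = d + k) := by
    intro k
    induction k with
    | zero => exact ⟨hfB, hU.symm ▸ hfM⟩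
    | succ k ih =>
      rw [pow_succ', Module.End.mul_apply]
      exact ⟨opT_Bd _ ih.1, MJ_mono (opT_MJ ih.2) fun q a hh => ⟨hh.2.1, by omega⟩⟩
  have hstart : (opT K ν ^ (w + 1)) f = dd K (gX N K) 1 univ
      (prM K (fun _ α _ => α.degree + 1 = d + w + 1) g) := by
    rw [← prM_dd (P := fun _ α _ => α.degree = d + w + 1),
      ← prM_eq_self (k := K) (f := (opT K ν ^ (w + 1)) f) (P := fun _ α _ => α.degree = d + w + 1), hg,
      map_add]
    · rw [add_eq_left]
      refine funext fun I => funext fun α => funext fun m => ?_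
      rw [prM_apply]
      split_ifs with h1
      · exact hcz _ _ _ h1
      · rfl
    · intro I α m h0
      obtain ⟨s, hs⟩ := MvPolynomial.ne_zero_iff.mp h0
      have h1 := (hTM (w + 1)).2 I α m s hs
      rw [hU] at h1
      beta_reduce at h1
      rw [← Finsupp.degree_eq_sum] at h1
      omega
    · intro I α m i _ j _ _ hj
      rw [degree_sub_single hj]
    · intro _ I α m j _ _ hj
      rw [degree_sub_single hj]
  have key : ∀ k, (∃ g ∈ Bd (K := K), (opT K ν ^ k) f = dd K (gX N K) 1 (insert ν (univ.erase ν)) g) →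
      ∃ g ∈ Bd, f = dd K (gX N K) 1 (insert ν (univ.erase ν)) g := by
    intro k
    induction k with
    | zero => exact id
    | succ k ihk =>
      intro hk
      rw [pow_succ', Module.End.mul_apply] at hk
      exact ihk (boundary_of_opT hνJ _ (hTM k).1
        (MJ_mono (hTM k).2 fun q a hh => ⟨hh.1, by omega⟩) hk)
  obtain ⟨g', hgB', hg'⟩ := key (w + 1) ⟨_, prM_Bd _ hgB, by rw [hU]; exact hstart⟩
  rw [hU] at hg'
  refine ⟨prM K (fun I α m => α.degree + 1 = d ∧ I.card + 2 * m = 1) g', fun I α m h0 => ?_, ?_⟩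
  · exact (prM_ne h0).1
  · rw [← prM_dd (k := K) (P := fun I α m => α.degree = d ∧ I.card + 2 * m = 0), ← hg', prM_eq_self]
    · exact fun I α m h0 => hf I α m h0
    · intro I α m i _ j _ hi hj
      rw [degree_sub_single hj, card_insert_of_notMem hi]
      omega
    · intro _ I α m j _ hi hj
      have := card_pos.mpr ⟨_, hi⟩
      rw [degree_sub_single hj, card_erase_of_mem hi]
      omega

end

end PfExt

namespace PfExt

open Finset Matrix

noncomputable section

/-- The indices of the basis in homological degree `q` and total degree `d`. -/
abbrev Ix (N d q : ℕ) : Type :=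
  {x : Finset (Fin N) × (Fin N →₀ ℕ) × ℕ // x.2.1.degree + q = d ∧ x.1.card + 2 * x.2.2 = q}

instance (N d q : ℕ) : Fintype (Ix N d q) := by
  refine Set.Finite.fintype (Set.Finite.subset
    ((univ ×ˢ (finsuppAntidiag univ (d - q) ×ˢ range (q + 1)) :
      Finset (Finset (Fin N) × (Fin N →₀ ℕ) × ℕ))).finite_toSet ?_)
  rintro ⟨I, α, m⟩ ⟨h1, h2⟩
  simp only [mem_coe, mem_product, mem_univ, true_and, mem_finsuppAntidiag, mem_range,
    subset_univ, and_true, ← Finsupp.degree_eq_sum]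
  dsimp only at h1 h2
  omega

variable {N : ℕ} {K A : Type} [Field K] [CommRing A] [Algebra K A]

open Classical in
/-- A basis vector. -/
def dl (x : Finset (Fin N) × (Fin N →₀ ℕ) × ℕ) : Fk N A :=
  fun I α m => if (I, α, m) = x then 1 else 0

variable {d q : ℕ}

variable (K) in
/-- The family with given coordinates. -/
def toFk (v : Ix N d q → A) : Fk N A := ∑ y, cX K (v y) (dl y.1)

/-- The coordinates of a family. -/
def res (d q : ℕ) (f : Fk N A) : Ix N d q → A := fun x => f x.1.1 x.1.2.1 x.1.2.2

lemma cX_apply (a : A) (f : Fk N A) (I α m) : cX K a f I α m = a * f I α m := by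
  simp [coef_apply]

lemma toFk_apply (v : Ix N d q → A) (I α m) :
    toFk K v I α m = ∑ y, v y * dl y.1 I α m := by
  simp only [toFk, Finset.sum_apply, cX_apply]

lemma res_toFk (v : Ix N d q → A) : res d q (toFk K v) = v := by
  funext x
  rw [res, toFk_apply, sum_eq_single x]
  · simp [dl]
  · intro y _ hy
    rw [dl, if_neg, mul_zero]
    exact fun h => hy (Subtype.ext h.symm)
  · simp

lemma toFk_mem (v : Ix N d q → A) : toFk K v ∈ Supp K d q := by
  intro I α m h
  rw [toFk_apply] at h
  obtain ⟨y, _, hy⟩ := exists_ne_zero_of_sum_ne_zero h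
  by_cases hh : (I, α, m) = y.1
  · have := y.2
    rwa [← hh] at this
  · rw [dl, if_neg hh, mul_zero] at hy
    exact absurd rfl hy

lemma toFk_res {f : Fk N A} (hf : f ∈ Supp K d q) : toFk K (res d q f) = f := by
  funext I α m
  by_cases h : f I α m = 0
  · rw [toFk_apply, h]
    refine sum_eq_zero fun y _ => ?_
    by_cases hh : (I, α, m) = y.1
    · rw [res, ← hh, h, zero_mul]
    · rw [dl, if_neg hh, mul_zero]
  · exact congrFun (res_toFk (K := K) (res d q f)) ⟨(I, α, m), hf I α m h⟩

lemma res_eq_zero {f : Fk N A} (hf : f ∈ Supp K d q) (h : res d q f = 0) : f = 0 := by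
  rw [← toFk_res hf, h]
  funext I α m
  simp [toFk_apply]

variable (X : Matrix (Fin N) (Fin N) A)

variable (K) in
/-- The matrix of the differential. -/
def mat (d q : ℕ) : Matrix (Ix N d q) (Ix N d (q + 1)) A :=
  fun x y => res d q (dd K X 1 univ (dl y.1)) x

lemma res_dd (v : Ix N d (q + 1) → A) :
    res d q (dd K X 1 univ (toFk K v)) = mat K X d q *ᵥ v := by
  funext x
  rw [toFk, map_sum]
  have h : ∀ y : Ix N d (q + 1), dd K X 1 univ (cX K (v y) (dl y.1)) =
      cX K (v y) (dd K X 1 univ (dl y.1)) := fun y => by rw [commute_apply (dd_cX _)]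
  rw [sum_congr rfl fun y _ => h y, res, Finset.sum_apply, Finset.sum_apply, Finset.sum_apply]
  simp only [cX_apply, mulVec, dotProduct]
  exact sum_congr rfl fun y _ => mul_comm _ _

lemma dD_cX (a : A) (f : Fk N A) : dD K X (cX K a f) = cX K a (dD K X f) := by
  funext I α m
  simp only [cX_apply, dD_apply, opE_apply, opP_apply, opS_apply, opH_apply, mul_add, mul_sum,
    mul_smul_comm, mul_left_comm a]

lemma dl_H_E (i j : Fin N) (x y : Finset (Fin N) × (Fin N →₀ ℕ) × ℕ) :
    opT K j (opH K i (dl y)) x.1 x.2.1 x.2.2 =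
      (opE K i (opP K j (dl x)) y.1 y.2.1 y.2.2 : A) := by
  obtain ⟨I, α, m⟩ := x
  obtain ⟨J, β, l⟩ := y
  simp only [opT_apply, opH_apply, opE_apply, opP_apply, dl, Prod.mk.injEq]
  by_cases h : i ∉ I ∧ α j ≠ 0 ∧ insert i I = J ∧ α - Finsupp.single j 1 = β ∧ m = l
  · obtain ⟨hi, hj, rfl, rfl, rfl⟩ := h
    simp [hi, hj, sub_single_add hj, sg_insert i i I hi]
  · have h1 : ((if α j = 0 then 0 else 1 : ℤ) • (if i ∈ I then 0 else sg i I) •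
        if insert i I = J ∧ α - Finsupp.single j 1 = β ∧ m = l then (1 : A) else 0) = 0 := by
      split_ifs <;> simp_all
    rw [h1]
    split_ifs with h2 h3
    · obtain ⟨rfl, rfl, rfl⟩ := h3
      refine absurd ⟨notMem_erase _ _, ?_, insert_erase h2, ?_, rfl⟩ h
      · simp
      · simp
    · simp
    · simp
    · simp

lemma dl_E_H (j : Fin N) (x y : Finset (Fin N) × (Fin N →₀ ℕ) × ℕ) :
    opT K j (opE K j (dl y)) x.1 x.2.1 (x.2.2 + 1) =
      (opS K (opP K j (opH K j (dl x))) y.1 y.2.1 y.2.2 : A) := by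
  obtain ⟨I, α, m⟩ := x
  obtain ⟨J, β, l⟩ := y
  simp only [opT_apply, opH_apply, opE_apply, opP_apply, opS_apply, dl, Prod.mk.injEq]
  by_cases h : j ∈ I ∧ α j ≠ 0 ∧ I.erase j = J ∧ α - Finsupp.single j 1 = β ∧ m + 1 = l
  · obtain ⟨hi, hj, rfl, rfl, rfl⟩ := h
    simp [hi, hj, sub_single_add hj, sg_erase j j I hi]
  · have h1 : ((if α j = 0 then 0 else 1 : ℤ) • (if j ∈ I then sg j I else 0) •
        if I.erase j = J ∧ α - Finsupp.single j 1 = β ∧ m + 1 = l then (1 : A) else 0) = 0 := by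
      split_ifs <;> simp_all
    rw [h1]
    by_cases h2 : l = 0
    · simp [h2]
    by_cases h3 : j ∈ J
    · simp [h3]
    by_cases h5 : insert j J = I ∧ β + Finsupp.single j 1 = α ∧ l - 1 = m
    · obtain ⟨rfl, rfl, rfl⟩ := h5
      refine absurd ⟨mem_insert_self _ _, ?_, erase_insert h3, ?_, by omega⟩ h
      · simp
      · simp
    · simp [h5]

lemma mat_eq (x : Ix N d q) (y : Ix N d (q + 1)) :
    mat K X d q x y = res d (q + 1) (dD K X (dl x.1)) y := by
  unfold mat res
  rw [dd_apply, dD_apply, one_smul]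
  simp only [dl_H_E, dl_E_H]

lemma res_dD (v : Ix N d q → A) :
    res d (q + 1) (dD K X (toFk K v)) = v ᵥ* mat K X d q := by
  funext x
  rw [toFk, map_sum]
  simp only [dD_cX]
  rw [res, Finset.sum_apply, Finset.sum_apply, Finset.sum_apply]
  simp only [cX_apply, vecMul, dotProduct, mat_eq]
  rfl

end

end PfExt

namespace PfExt

open Finset Matrix MvPolynomial

noncomputable section

section Preimage

variable {N : ℕ} {K A : Type} [Field K] [CommRing A] [Algebra K A]

lemma prM_dD {P P' : Finset (Fin N) → (Fin N →₀ ℕ) → ℕ → Prop} {X : Matrix (Fin N) (Fin N) A}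
    (h1 : ∀ I α m, ∀ i ∈ I, ∀ j, (P I α m ↔ P' (I.erase i) (α + Finsupp.single j 1) m))
    (h2 : ∀ I α m, ∀ j, j ∉ I →
      (P I α (m + 1) ↔ P' (insert j I) (α + Finsupp.single j 1) m)) (f : Fk N A) :
    prM K P (dD K X f) = dD K X (prM K P' f) := by
  classical
  funext I α m
  rw [prM_apply, dD_apply, dD_apply]
  simp only [opE_apply, opP_apply, opS_apply, opH_apply, prM_apply]
  have e1 : ∀ i j, (if P I α m then X i j * ((if i ∈ I then sg i I else 0) •
      f (I.erase i) (α + Finsupp.single j 1) m) else 0) = X i j * ((if i ∈ I then sg i I else 0) •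
      if P' (I.erase i) (α + Finsupp.single j 1) m then
        f (I.erase i) (α + Finsupp.single j 1) m else 0) := fun i j => by
    by_cases hi : i ∈ I
    · rw [← h1 I α m i hi j]
      split_ifs <;> simp
    · simp [hi]
  have e2 : ∀ j, (if P I α m then ((if m = 0 then 0 else 1 : ℤ) • (if j ∈ I then 0 else sg j I) •
      f (insert j I) (α + Finsupp.single j 1) (m - 1)) else 0) =
      (if m = 0 then 0 else 1 : ℤ) • (if j ∈ I then 0 else sg j I) •
      if P' (insert j I) (α + Finsupp.single j 1) (m - 1) then
        f (insert j I) (α + Finsupp.single j 1) (m - 1) else 0 := fun j => by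
    rcases m with _ | m
    · simp
    · by_cases hj : j ∈ I
      · simp [hj]
      · rw [Nat.add_sub_cancel, ← h2 I α m j hj]
        split_ifs <;> simp
  simp only [← e1, ← e2]
  split_ifs <;> simp

lemma exists_dD_pre {X : Matrix (Fin N) (Fin N) A} {d q : ℕ} {f g : Fk N A}
    (hf : f ∈ Supp K d (q + 1)) (h : f = dD K X g) : ∃ g' ∈ Supp K d q, f = dD K X g' := by
  refine ⟨prM K (fun I α m => α.degree + q = d ∧ I.card + 2 * m = q) g,
    fun I α m h0 => (prM_ne h0).1, ?_⟩
  rw [← prM_dD (P := fun I α m => α.degree + (q + 1) = d ∧ I.card + 2 * m = q + 1), ← h,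
    prM_eq_self fun I α m h0 => hf I α m h0]
  · intro I α m i hi j
    have := card_pos.mpr ⟨_, hi⟩
    rw [card_erase_of_mem hi, map_add, Finsupp.degree_single]
    omega
  · intro I α m j hj
    rw [card_insert_of_notMem hj, map_add, Finsupp.degree_single]
    omega

end Preimage

variable {N : ℕ} {K : Type} [Field K] {d q : ℕ} {f : Fk N (Sn N K)}

variable (N K) in
/-- The `gl`-action on the concrete complex. -/
def gE (i j : Fin N) : Module.End K (Fk N (Sn N K)) :=
  FockRel.cE N (opE K) (opH K) (opY K) (opP K) (fun i j => coef K (mulE K (gX N K i j)))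
    (fun i j => coef K (gdX i j)) i j

lemma gE_mem (hf : f ∈ Supp K d q) (i j : Fin N) : gE N K i j f ∈ Supp K d q := by
  simp only [gE, FockRel.cE, FockRel.cρ, LinearMap.add_apply, LinearMap.sum_apply,
    LinearMap.sub_apply, Module.End.mul_apply]
  refine add_mem (sum_mem fun k _ => coef_mem _ (coef_mem _ hf)) (sub_mem ?_ ?_)
  · refine Gr.mono (opY_mem _ (opP_mem _ hf)) ?_
    grind
  · refine Gr.mono (opE_mem _ (opH_mem _ hf)) ?_
    grind

lemma gP_mem (hf : f ∈ Supp K d q) (i j : Fin N) :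
    FockRel.cP N (opE K) (opH K) (opY K) (opP K) (opS K) (opDs K)
      (fun i j => coef K (mulE K (gX N K i j))) (fun i j => coef K (gdX i j)) i j f ∈
      Supp K d q := by
  have hρ : ∀ (g : Fk N (Sn N K)), g ∈ Supp K d q → ∀ i j,
      FockRel.cρ N (opE K) (opH K) (opY K) (opP K) i j g ∈ Supp K d q := fun g hg i j => by
    simp only [FockRel.cρ, LinearMap.sub_apply, Module.End.mul_apply]
    refine sub_mem ?_ ?_
    · refine Gr.mono (opY_mem _ (opP_mem _ hg)) ?_
      grind
    · refine Gr.mono (opE_mem _ (opH_mem _ hg)) ?_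
      grind
  have hn : ∀ (g : Fk N (Sn N K)), g ∈ Supp K d q →
      FockRel.cn N (opE K) (opH K) (opY K) (opP K) (opS K) (opDs K) g ∈ Supp K d q :=
      fun g hg => by
    have h2 : ∀ u : Module.End K (Fk N (Sn N K)), (2 * u) g = u g + u g := fun u => by
      rw [two_mul, LinearMap.add_apply]
    simp only [FockRel.cn, LinearMap.add_apply, LinearMap.sum_apply, h2, Module.End.mul_apply]
    refine add_mem (add_mem (sum_mem fun k _ => ?_) (sum_mem fun k _ => ?_)) ?_
    · refine Gr.mono (opY_mem _ (opP_mem _ hg)) ?_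
      grind
    · refine Gr.mono (opE_mem _ (opH_mem _ hg)) ?_
      grind
    · refine add_mem ?_ ?_ <;>
      · refine Gr.mono (opS_mem (opDs_mem hg)) ?_
        grind
  have h2 : ∀ u : Module.End K (Fk N (Sn N K)), (2 * u) f = u f + u f := fun u => by
    rw [two_mul, LinearMap.add_apply]
  have hN : ∀ g : Fk N (Sn N K), ((N : Module.End K (Fk N (Sn N K)))) g = (N : K) • g := fun g => by
    rw [Module.End.natCast_apply, Nat.cast_smul_eq_nsmul]
  simp only [FockRel.cP, LinearMap.add_apply, LinearMap.sum_apply, LinearMap.sub_apply,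
    Module.End.mul_apply, h2, hN]
  refine add_mem (add_mem (sum_mem fun k _ => sub_mem ?_ ?_) (sub_mem ?_ ?_)) (add_mem ?_ ?_)
  · exact gE_mem (coef_mem _ hf) _ _
  · exact hρ _ (coef_mem _ hf) _ _
  · exact Submodule.smul_mem _ _ (coef_mem _ hf)
  · exact hn _ (coef_mem _ hf)
  all_goals
    refine Gr.mono (opE_mem _ (opE_mem _ (opDs_mem hf))) ?_
    grind

lemma opY_opP_self (i : Fin N) (f : Fk N (Sn N K)) (I α m) :
    opY K i (opP K i f) I α m = (α i : ℤ) • f I α m := by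
  simp only [opY_apply, opP_apply]
  by_cases h : α i = 0
  · simp [h]
  · rw [sub_single_add h]

lemma gn_eq (hf : f ∈ Supp K d q) :
    FockRel.cn N (opE K) (opH K) (opY K) (opP K) (opS K) (opDs K) f = (d : K) • f := by
  funext I α m
  have h2 : ∀ u : Module.End K (Fk N (Sn N K)), (2 * u) f = u f + u f := fun u => by
    rw [two_mul, LinearMap.add_apply]
  have h3 : (opS K (opDs K f)) I α m = (m : ℤ) • f I α m := by
    rw [opS_apply, opDs_apply]
    rcases m with _ | m <;> simp
  simp only [FockRel.cn, LinearMap.add_apply, LinearMap.sum_apply, h2, Module.End.mul_apply,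
    Pi.add_apply, Finset.sum_apply, opY_opP_self, opE_opH_self, h3, Pi.smul_apply]
  by_cases h : f I α m = 0
  · simp [h]
  · obtain ⟨h4, h5⟩ := hf I α m h
    rw [← sum_smul, ← sum_smul, ← add_smul, ← add_smul, ← add_smul, Nat.cast_smul_eq_nsmul,
      ← natCast_zsmul]
    congr 1
    rw [← Nat.cast_sum, ← Finsupp.degree_eq_sum, sum_boole, filter_mem_eq_inter, univ_inter]
    omega

lemma coeff_gE (hf : f ∈ Supp K d q) (i : Fin N) (I α m s) :
    (gE N K i i f I α m).coeff s =
      (((Finsupp.weight vw s + shw I α) i : ℤ) : K) * (f I α m).coeff s := by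
  classical
  obtain ⟨F, hF⟩ := exists_wp_sum hf
  have h1 : gE N K i i f = ∑ v ∈ F, (v i : K) • wp v f := by
    conv_lhs => rw [hF]
    rw [map_sum]
    exact sum_congr rfl fun v _ => cE_wp v i f
  have h2 := congrFun (congrFun (congrFun hF I) α) m
  rw [Finset.sum_apply, Finset.sum_apply, Finset.sum_apply] at h2
  have h3 := congrArg (coeff s) h2
  rw [h1, Finset.sum_apply, Finset.sum_apply, Finset.sum_apply]
  conv_rhs => rw [h3]
  simp only [coeff_sum, Pi.smul_apply, coeff_smul, wp_apply,
    coeff_weightedHomogeneousComponent, mul_sum, smul_eq_mul]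
  refine sum_congr rfl fun v _ => ?_
  split_ifs with h
  · rw [h, sub_add_cancel]
  · simp

lemma weight_eq [CharZero K] (hf : f ∈ Supp K d q) {v : Fin N → ℤ}
    (hv : ∀ i, gE N K i i f = (v i : K) • f) {I α m s} (h : (f I α m).coeff s ≠ 0) (i : Fin N) :
    v i = Finsupp.weight vw s i + shw I α i := by
  have h1 := coeff_gE hf i I α m s
  rw [hv, Pi.smul_apply, Pi.smul_apply, Pi.smul_apply, coeff_smul, smul_eq_mul] at h1
  exact_mod_cast mul_right_cancel₀ h h1

lemma weight_vw_apply (s : Vars N →₀ ℕ) (i : Fin N) :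
    Finsupp.weight vw s i = ∑ v ∈ s.support, (s v : ℤ) * vw v i := by
  simp [Finsupp.weight_apply, Finsupp.sum, Finset.sum_apply]

lemma vw_nonneg (v : Vars N) (i : Fin N) : 0 ≤ vw v i := by
  simp only [vw, Pi.add_apply, Pi.single_apply]
  split_ifs <;> norm_num

lemma weight_vw_nonneg (s : Vars N →₀ ℕ) (i : Fin N) : 0 ≤ Finsupp.weight vw s i := by
  rw [weight_vw_apply]
  exact sum_nonneg fun v _ => mul_nonneg (by positivity) (vw_nonneg v i)

lemma eq_zero_of_weight_vw (s : Vars N →₀ ℕ) (b : Fin N)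
    (h : ∀ i ≠ b, Finsupp.weight vw s i = 0) : s = 0 := by
  by_contra h0
  obtain ⟨v, hv⟩ := Finsupp.support_nonempty_iff.mpr h0
  obtain ⟨i, hi, hvi⟩ : ∃ i, i ≠ b ∧ 1 ≤ vw v i := by
    have hlt := v.2
    by_cases h1 : v.1.1 = b
    · refine ⟨v.1.2, fun h2 => ?_, ?_⟩
      · rw [h1, h2] at hlt
        exact lt_irrefl _ hlt
      · simp only [vw, Pi.add_apply, Pi.single_apply]
        split_ifs <;> norm_num
    · refine ⟨v.1.1, h1, ?_⟩
      simp only [vw, Pi.add_apply, Pi.single_apply]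
      split_ifs <;> norm_num
  have h2 := h i hi
  rw [weight_vw_apply, sum_eq_zero_iff_of_nonneg fun w _ =>
    mul_nonneg (by positivity) (vw_nonneg w i)] at h2
  have h3 := h2 v hv
  have h4 : (0 : ℤ) < s v := by exact_mod_cast Nat.pos_of_ne_zero (Finsupp.mem_support_iff.mp hv)
  have := mul_pos h4 (by omega : 0 < vw v i)
  omega

lemma terminal_support [CharZero K] (hf : f ∈ Supp K d q) (hq : q + 1 ≠ N) {v : Fin N → ℤ}
    (hv : ∀ i, gE N K i i f = (v i : K) • f) (b : Fin N) (hvi : ∀ i, i ≠ b → v i = -1)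
    (hvb : v b = -1 ∨ v b = d - N + 1) {I α m s} (h : (f I α m).coeff s ≠ 0) :
    I = univ ∧ α = 0 := by
  have hw := weight_eq hf hv h
  have h1 : ∀ i ≠ b, Finsupp.weight vw s i = 0 ∧ α i = 0 ∧ i ∈ I := fun i hi => by
    have h2 := hw i
    have h3 := weight_vw_nonneg s i
    rw [hvi i hi, shw] at h2
    by_cases hI : i ∈ I
    · rw [if_pos hI] at h2
      exact ⟨by omega, by omega, hI⟩
    · rw [if_neg hI] at h2
      omega
  have hs : s = 0 := eq_zero_of_weight_vw s b fun i hi => (h1 i hi).1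
  have hb := hw b
  rw [hs, map_zero, Pi.zero_apply, zero_add, shw] at hb
  obtain ⟨h2, h3⟩ := hf I α m fun h0 => h (by simp [h0])
  rw [Finsupp.degree_eq_sum, sum_eq_single b (fun i _ hi => (h1 i hi).2.1) (by simp)] at h2
  by_cases hI : b ∈ I
  · have hu : I = univ := eq_univ_iff_forall.mpr fun i => by
      by_cases hi : i = b
      · exact hi ▸ hI
      · exact (h1 i hi).2.2
    refine ⟨hu, Finsupp.ext fun i => ?_⟩
    rw [hu, card_univ, Fintype.card_fin] at h3
    rw [if_pos hI] at hb
    by_cases hi : i = b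
    · rw [hi, Finsupp.zero_apply]
      omega
    · exact (h1 i hi).2.1
  · have hu : I = univ.erase b := Finset.ext fun i => by
      by_cases hi : i = b
      · simp [hi, hI]
      · simp [hi, (h1 i hi).2.2]
    rw [hu, card_erase_of_mem (mem_univ b), card_univ, Fintype.card_fin] at h3
    rw [if_neg hI] at hb
    have := b.2
    omega

lemma cX_pow_apply {A : Type} [CommRing A] [Algebra K A] (a : A) (r : ℕ) (f : Fk N A) :
    ((cX K a) ^ r) f = cX K (a ^ r) f := by
  induction r with
  | zero => funext I α m; rw [pow_zero, pow_zero, Module.End.one_apply, cX_apply, one_mul]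
  | succ r ih =>
    funext I α m
    rw [pow_succ', Module.End.mul_apply, ih, cX_apply, cX_apply, cX_apply, pow_succ', mul_assoc]

lemma gX_ne_zero {a b : Fin N} (h : a < b) : gX N K a b ≠ 0 := by
  rw [gX, skew_of_lt _ h]
  exact X_ne_zero _

lemma zeta_dD [CharZero K] (u : Fk N (Sn N K)) (hu : u ∈ Supp K d q) (hd : q + 1 = d) :
    res d (q + 1) (ze K (gX N K) d) ⬝ᵥ res d (q + 1) (dD K (gX N K) u) = 0 := by
  have h1 : ze K (gX N K) d ∈ Supp K d (q + 1) := hd ▸ ze_mem _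
  have h2 := res_dd (K := K) (gX N K) (res d (q + 1) (ze K (gX N K) d))
  rw [toFk_res h1, dd_ze gX_swap] at h2
  rw [← toFk_res hu, res_dD, dotProduct_comm, ← dotProduct_mulVec, ← h2]
  exact dotProduct_zero _

/-- Cocycles which become coboundaries after multiplication by a power of the last variable are
coboundaries. -/
theorem coboundary_of_torsion [CharZero K] (a b : Fin N) (ha : a.val + 2 = N) (hb : b.val + 1 = N)
    (hq : q + 2 ≠ N) {z : Fk N (Sn N K)} (hzC : z ∈ Supp K d (q + 1)) (hz : dD K (gX N K) z = 0)
    (hm : ∃ m, ∃ u, cX K (gX N K a b ^ m) z = dD K (gX N K) u) :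
    ∃ w ∈ Supp K d q, z = dD K (gX N K) w := by
  have hab : a < b := by rw [Fin.lt_def]; omega
  suffices h : z ∈ LinearMap.range (dD K (gX N K)) by
    obtain ⟨w, hw⟩ := h
    exact exists_dD_pre hzC hw.symm
  obtain ⟨m, u, hu⟩ := hm
  obtain ⟨F, hF⟩ := exists_wp_sum hzC
  rw [hF]
  refine Submodule.sum_mem _ fun v _ => ?_
  refine FockRel.mem_range_of_torsion fockRel d a b ha hb (Supp K d (q + 1))
    (fun i j w hw => gE_mem hw i j) (fun i j w hw => gP_mem hw i j) (fun w hw => gn_eq hw)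
    ?_ ?_ _ (wp_mem v hzC) ?_ ⟨m, ?_⟩ v (fun i => cE_wp v i z)
  · intro w hw hw0 v hv i
    obtain ⟨I, α, k, h0⟩ : ∃ I α k, w I α k ≠ 0 := by
      by_contra! h
      exact hw0 (funext fun I => funext fun α => funext fun k => h I α k)
    obtain ⟨s, hs⟩ := MvPolynomial.ne_zero_iff.mp h0
    have h1 := weight_eq hw hv hs i
    have h2 := weight_vw_nonneg s i
    rw [shw] at h1
    split_ifs at h1 <;> omega
  · rintro w hw - ⟨r, t, ht⟩ v hv hvi hvb
    by_contra hne
    have hsup : ∀ I α k, w I α k ≠ 0 → I = univ ∧ α = 0 := fun I α k h0 => by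
      obtain ⟨s, hs⟩ := MvPolynomial.ne_zero_iff.mp h0
      exact terminal_support hw (by omega) hv b hvi hvb hs
    obtain ⟨I, α, k, h0⟩ : ∃ I α k, w I α k ≠ 0 := by
      by_contra! h
      refine hne ?_
      have : w = 0 := funext fun I => funext fun α => funext fun k => h I α k
      rw [this]
      exact zero_mem _
    obtain ⟨rfl, rfl⟩ := hsup _ _ _ h0
    have hk := hw _ _ _ h0
    have hd : q + 1 = d := by simpa using hk.1
    have ht' : cX K (gX N K a b ^ r) w = dD K (gX N K) t := by
      rw [← cX_pow_apply]
      exact ht.symm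
    obtain ⟨t, htm, ht⟩ := exists_dD_pre (coef_mem _ hw) ht'
    have h1 := zeta_dD t htm hd
    rw [← ht, dotProduct, sum_eq_single ⟨(univ, 0, k), hk⟩] at h1
    · have h2 : ze K (gX N K) d univ 0 k = 1 := by
        rw [ze, if_pos ⟨rfl, by rw [← hd]; exact hk.2⟩, pfc_univ]
      simp only [res, cX_apply, h2, one_mul] at h1
      exact (mul_ne_zero (pow_ne_zero r (gX_ne_zero hab)) h0) h1
    · rintro ⟨⟨I, α, l⟩, hx⟩ _ hne
      have : w I α l = 0 := by
        by_contra h3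
        obtain ⟨rfl, rfl⟩ := hsup _ _ _ h3
        refine hne (Subtype.ext ?_)
        have h4 := hx.2.trans hk.2.symm
        dsimp only at h4
        simp only [Prod.mk.injEq, true_and]
        omega
      simp only [res, cX_apply, this, mul_zero]
    · exact fun h => absurd (mem_univ _) h
  · have h1 := wp_dD v z
    rw [hz, map_zero] at h1
    exact h1.symm
  · rw [wp_coef, cX_pow_apply, hu, wp_dD]
    exact ⟨_, rfl⟩

end

end PfExt

namespace PfExt

open Matrix CategoryTheory

noncomputable section

variable {A : Type} [CommRing A] {ι κ : ℕ → Type} [∀ q, Fintype (ι q)] [∀ q, Fintype (κ q)]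

/-- A resolution by finite free modules of the ideal generated by the family `g`. -/
structure FreeRes (M : ∀ q, Matrix (ι q) (ι (q + 1)) A) (g : ι 0 → A) : Prop where
  vecMul_zero : g ᵥ* M 0 = 0
  mul_zero : ∀ q, M q * M (q + 1) = 0
  exact_zero : ∀ v, g ⬝ᵥ v = 0 → ∃ w, v = M 0 *ᵥ w
  exact_succ : ∀ q v, M q *ᵥ v = 0 → ∃ w, v = M (q + 1) *ᵥ w

/-- Exactness of the dual complex in degree `q + 1`. -/
def HomEx (M : ∀ q, Matrix (ι q) (ι (q + 1)) A) (q : ℕ) : Prop :=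
  ∀ z : ι (q + 1) → A, z ᵥ* M (q + 1) = 0 → ∃ w, z = w ᵥ* M q

variable {M : ∀ q, Matrix (ι q) (ι (q + 1)) A} {g : ι 0 → A}

/-- The complex of a resolution. -/
def cpx (h : FreeRes M g) : ChainComplex (ModuleCat A) ℕ :=
  ChainComplex.of (fun q => ModuleCat.of A (ι q → A)) (fun q => ModuleCat.ofHom (mulVecLin (M q)))
    (fun q => by
      rw [← ModuleCat.ofHom_comp, ← mulVecLin_mul, h.mul_zero q, mulVecLin_zero]
      rfl)

lemma cpx_d (h : FreeRes M g) (q : ℕ) :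
    (cpx h).d (q + 1) q = ModuleCat.ofHom (mulVecLin (M q)) :=
  ChainComplex.of_d (fun q => ModuleCat.of A (ι q → A)) (fun q => ModuleCat.ofHom (mulVecLin (M q)))
    q

/-- The augmentation of a resolution. -/
def aug (g : ι 0 → A) : (ι 0 → A) →ₗ[A] Ideal.span (Set.range g) :=
  LinearMap.codRestrict _ (Fintype.linearCombination A g) (fun v => by
    rw [Fintype.linearCombination_apply]
    exact Submodule.sum_mem _ fun i _ => Submodule.smul_mem _ _ (Ideal.subset_span ⟨i, rfl⟩))

lemma aug_coe (v : ι 0 → A) : (aug g v : A) = g ⬝ᵥ v := by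
  simp [aug, Fintype.linearCombination_apply, dotProduct, mul_comm]

lemma aug_surjective : Function.Surjective (aug g) := by
  rintro ⟨x, hx⟩
  obtain ⟨c, hc⟩ := (Ideal.mem_span_range_iff_exists_fun).mp hx
  refine ⟨c, Subtype.ext ?_⟩
  rw [aug_coe]
  exact (dotProduct_comm _ _).trans hc

lemma cpx_aug (h : FreeRes M g) : (cpx h).d 1 0 ≫ ModuleCat.ofHom (aug g) = 0 := by
  rw [cpx_d]
  refine ModuleCat.hom_ext (LinearMap.ext fun v => Subtype.ext ?_)
  refine (aug_coe (M 0 *ᵥ v)).trans ?_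
  exact (dotProduct_mulVec _ _ _).trans ((congrArg (· ⬝ᵥ v) h.vecMul_zero).trans
    (zero_dotProduct _))

/-- A resolution by free modules as a projective resolution. -/
def projRes (h : FreeRes M g) :
    ProjectiveResolution (ModuleCat.of A (Ideal.span (Set.range g))) where
  complex := cpx h
  projective q := by
    change Projective (ModuleCat.of A (ι q → A))
    infer_instance
  π := (ChainComplex.toSingle₀Equiv _ _).symm ⟨ModuleCat.ofHom (aug g), cpx_aug h⟩
  quasiIso := ⟨fun q => by
    cases q with
    | zero =>
      rw [ChainComplex.quasiIsoAt₀_iff, ShortComplex.quasiIso_iff_of_zeros']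
      · have h0 := ChainComplex.toSingle₀Equiv_symm_apply_f_zero
          (C := cpx h) (X := ModuleCat.of A (Ideal.span (Set.range g))) (ModuleCat.ofHom (aug g))
          (cpx_aug h)
        constructor
        · rw [ShortComplex.moduleCat_exact_iff]
          intro v hv
          have h1 : ((ChainComplex.toSingle₀Equiv (cpx h)
            (ModuleCat.of A (Ideal.span (Set.range g)))).symm
            ⟨ModuleCat.ofHom (aug g), cpx_aug h⟩).f 0 v = 0 := hv
          rw [h0] at h1
          obtain ⟨w, hw⟩ := h.exact_zero v
            ((aug_coe v).symm.trans (congrArg Subtype.val h1))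
          refine ⟨w, ?_⟩
          change (cpx h).d 1 0 w = v
          rw [cpx_d]
          exact hw.symm
        · change Epi (((ChainComplex.toSingle₀Equiv (cpx h)
            (ModuleCat.of A (Ideal.span (Set.range g)))).symm
            ⟨ModuleCat.ofHom (aug g), cpx_aug h⟩).f 0)
          rw [h0]
          exact (ModuleCat.epi_iff_surjective (ModuleCat.ofHom (aug g))).mpr aug_surjective
      all_goals rfl
    | succ q =>
      rw [quasiIsoAt_iff_exactAt' _ _ (ChainComplex.exactAt_succ_single_obj _ _)]
      rw [HomologicalComplex.exactAt_iff' _ (q + 1 + 1) (q + 1) q (by simp) (by simp)]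
      rw [ShortComplex.moduleCat_exact_iff]
      intro v hv
      change (cpx h).d (q + 1) q v = 0 at hv
      rw [cpx_d] at hv
      obtain ⟨w, hw⟩ := h.exact_succ q v hv
      refine ⟨w, ?_⟩
      change (cpx h).d (q + 1 + 1) (q + 1) w = v
      rw [cpx_d]
      exact hw.symm⟩

/-- A family as a functional on the complex of a resolution. -/
def fnl (h : FreeRes M g) (q : ℕ) (z : ι q → A) : (cpx h).X q ⟶ ModuleCat.of A A :=
  ModuleCat.ofHom (dotProductBilin A A z)

lemma d_fnl (h : FreeRes M g) (q : ℕ) (z : ι q → A) :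
    (cpx h).d (q + 1) q ≫ fnl h q z = fnl h (q + 1) (z ᵥ* M q) := by
  rw [cpx_d]
  exact ModuleCat.hom_ext (LinearMap.ext fun v => dotProduct_mulVec z (M q) v)

lemma exists_fnl (h : FreeRes M g) (q : ℕ) (f : (cpx h).X q ⟶ ModuleCat.of A A) :
    ∃ z, f = fnl h q z := by
  classical
  let f' : (ι q → A) →ₗ[A] A := f.hom
  have h1 : f' = dotProductBilin A A fun i => f' (Pi.single i 1) := by
    refine LinearMap.pi_ext' fun i => LinearMap.ext_ring ?_
    simp [dotProductBilin]
  exact ⟨_, ModuleCat.hom_ext h1⟩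

lemma fnl_injective (h : FreeRes M g) (q : ℕ) : Function.Injective (fnl h q) := by
  classical
  intro z z' hz
  funext i
  have h1 := LinearMap.congr_fun (congrArg ModuleCat.Hom.hom hz) (Pi.single i (1 : A) : ι q → A)
  change z ⬝ᵥ Pi.single i 1 = z' ⬝ᵥ Pi.single i 1 at h1
  simpa using h1

/-- Vanishing of `Ext` in terms of a free resolution. -/
theorem subsingleton_ext_iff (h : FreeRes M g) (q : ℕ) :
    Subsingleton (((Ext A (ModuleCat A) (q + 1)).obj
      (Opposite.op (ModuleCat.of A (Ideal.span (Set.range g))))).obj (ModuleCat.of A A)) ↔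
      HomEx M q := by
  rw [← ModuleCat.isZero_iff_subsingleton,
    ((projRes h).isoExt (R := A) (q + 1) (ModuleCat.of A A)).isZero_iff,
    ← HomologicalComplex.exactAt_iff_isZero_homology,
    HomologicalComplex.exactAt_iff' _ q (q + 1) (q + 1 + 1) (by simp) (by simp),
    ShortComplex.moduleCat_exact_iff]
  have h0 : fnl h (q + 1 + 1) 0 = 0 :=
    ModuleCat.hom_ext (LinearMap.ext fun v => zero_dotProduct v)
  constructor
  · intro h1 z hz
    have h2 : (cpx h).d (q + 1 + 1) (q + 1) ≫ fnl h (q + 1) z = 0 := by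
      rw [d_fnl, hz, h0]
    obtain ⟨f, hf⟩ := h1 (fnl h (q + 1) z) h2
    obtain ⟨w, rfl⟩ := exists_fnl h q f
    have h3 : (cpx h).d (q + 1) q ≫ fnl h q w = fnl h (q + 1) z := hf
    rw [d_fnl] at h3
    exact ⟨w, (fnl_injective h _ h3).symm⟩
  · intro h1 f hf
    obtain ⟨z, rfl⟩ := exists_fnl h (q + 1) f
    have h2 : (cpx h).d (q + 1 + 1) (q + 1) ≫ fnl h (q + 1) z = 0 := hf
    rw [d_fnl, ← h0] at h2
    obtain ⟨w, rfl⟩ := h1 z (fnl_injective h _ h2)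
    exact ⟨fnl h q w, d_fnl h q w⟩

/-- Exactness of the dual complex does not depend on the resolution. -/
theorem homEx_congr {N : ∀ q, Matrix (κ q) (κ (q + 1)) A} {g' : κ 0 → A} (h : FreeRes M g)
    (h' : FreeRes N g') (hg : Ideal.span (Set.range g) = Ideal.span (Set.range g')) (q : ℕ) :
    HomEx M q ↔ HomEx N q := by
  rw [← subsingleton_ext_iff h, ← subsingleton_ext_iff h', hg]

end

section Flat

variable {A B : Type} [CommRing A] [CommRing B] [Algebra A B] [Module.Flat A B]

/-- Kernels of matrices commute with flat base change. -/
lemma exists_of_mulVec_map_eq_zero {m n : Type} [Fintype m] [Fintype n] (P : Matrix m n A)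
    (v : n → B) (hv : P.map (algebraMap A B) *ᵥ v = 0) :
    ∃ (l : ℕ) (y : Fin l → B) (a : Fin l → n → A), (∀ i, P *ᵥ a i = 0) ∧
      v = ∑ i, y i • (algebraMap A B ∘ a i) := by
  classical
  have h : (Fintype.linearCombination A v) ∘ₗ (Fintype.linearCombination A P.row) = 0 := by
    refine LinearMap.pi_ext' fun i => LinearMap.ext_ring ?_
    have h1 := congrFun hv i
    simp only [mulVec, dotProduct, map_apply] at h1
    rw [LinearMap.comp_apply, LinearMap.comp_apply, LinearMap.coe_single,
      Fintype.linearCombination_apply_single, one_smul, Fintype.linearCombination_apply]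
    simpa [Algebra.smul_def, row] using h1
  obtain ⟨l, a, y, hx, ha⟩ := Module.Flat.exists_factorization_of_comp_eq_zero_of_free h
  refine ⟨l, fun i => y (Finsupp.single i 1), fun i j => a (Pi.single j 1) i, fun i => ?_, ?_⟩
  · funext r
    have h1 := DFunLike.congr_fun (LinearMap.congr_fun ha (Pi.single r 1)) i
    simp only [LinearMap.comp_apply, Fintype.linearCombination_apply_single, one_smul,
      LinearMap.zero_apply, Finsupp.coe_zero, Pi.zero_apply] at h1
    rw [show P.row r = ∑ j, P r j • (Pi.single j (1 : A) : n → A) by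
      funext j; simp [Pi.single_apply, row]] at h1
    simpa [Finsupp.finsetSum_apply, mulVec, dotProduct] using h1
  · funext j
    have h1 := LinearMap.congr_fun hx (Pi.single j 1)
    simp only [LinearMap.comp_apply, Fintype.linearCombination_apply_single, one_smul] at h1
    have h2 : a (Pi.single j 1) = ∑ i, a (Pi.single j 1) i • Finsupp.single i (1 : A) := by
      ext i; simp [Finsupp.finsetSum_apply, Finsupp.single_apply]
    rw [h1, h2, map_sum, Finset.sum_apply]
    exact Finset.sum_congr rfl fun i _ => by
      rw [map_smul, Algebra.smul_def, mul_comm]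
      simp [Finsupp.finsetSum_apply, Finsupp.single_apply]

/-- Exactness of matrices is preserved by flat base change. -/
lemma exact_map {m n p : Type} [Fintype m] [Fintype n] [Fintype p] (P : Matrix m n A)
    (Q : Matrix n p A) (h : ∀ v, P *ᵥ v = 0 → ∃ w, v = Q *ᵥ w) (v : n → B)
    (hv : P.map (algebraMap A B) *ᵥ v = 0) : ∃ w, v = Q.map (algebraMap A B) *ᵥ w := by
  obtain ⟨l, y, a, ha, rfl⟩ := exists_of_mulVec_map_eq_zero P v hv
  choose w hw using fun i => h (a i) (ha i)
  refine ⟨∑ i, y i • (algebraMap A B ∘ w i), ?_⟩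
  rw [mulVec_sum]
  refine Finset.sum_congr rfl fun i _ => ?_
  rw [mulVec_smul, hw i]
  exact congrArg (y i • ·) (funext fun j => RingHom.map_mulVec _ _ _ _)

variable {ι : ℕ → Type} [∀ q, Fintype (ι q)] {M : ∀ q, Matrix (ι q) (ι (q + 1)) A} {g : ι 0 → A}

/-- Flat base change of a resolution. -/
theorem FreeRes.map (h : FreeRes M g) :
    FreeRes (fun q => (M q).map (algebraMap A B)) (algebraMap A B ∘ g) where
  vecMul_zero := by
    funext i
    rw [← RingHom.map_vecMul, h.vecMul_zero]
    simp
  mul_zero q := by rw [← Matrix.map_mul, h.mul_zero q]; ext; simp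
  exact_zero v hv := by
    refine exact_map (replicateRow Unit g) (M 0) (fun v hv => h.exact_zero v ?_) v ?_
    · exact congrFun hv ()
    · funext i
      exact hv
  exact_succ q v hv := exact_map _ _ (h.exact_succ q) v hv

/-- Flat base change of the dual complex. -/
theorem HomEx.map {q : ℕ} (h : HomEx M q) :
    HomEx (fun q => (M q).map (algebraMap A B)) q := by
  intro z hz
  have h1 : ∀ v, (M (q + 1))ᵀ *ᵥ v = 0 → ∃ w, v = (M q)ᵀ *ᵥ w := fun v hv => by
    rw [mulVec_transpose] at hv
    obtain ⟨w, hw⟩ := h v hv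
    exact ⟨w, by rw [mulVec_transpose, hw]⟩
  obtain ⟨w, hw⟩ := exact_map _ _ h1 z ((mulVec_transpose _ _).trans hz)
  exact ⟨w, hw.trans (mulVec_transpose _ _)⟩

end Flat

end PfExt

namespace PfExt

open Finset Matrix

noncomputable section

section Defs

variable {N : ℕ} {K A : Type} [Field K] [CommRing A] [Algebra K A]

/-- The indices of the basis of the resolution in homological degree `q`. -/
abbrev Jx (N d q : ℕ) : Type := Ix N d q ⊕ {_u : Unit // q = d + 1 ∧ Odd d}

variable (K) in
/-- The differentials of the resolution. -/
def rM (X : Matrix (Fin N) (Fin N) A) (d q : ℕ) : Matrix (Jx N d q) (Jx N d (q + 1)) A :=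
  fromBlocks (mat K X d q) (of fun x _ => res d q (ze K X d) x) 0 0

variable (K) in
/-- The augmentation of the resolution. -/
def rg (X : Matrix (Fin N) (Fin N) A) (d : ℕ) : Jx N d 0 → A :=
  Sum.elim (fun x => x.1.2.1.prod fun i e => pfc K X {i} ^ e) 0

lemma mulVec_rM (X : Matrix (Fin N) (Fin N) A) (d q : ℕ) (v : Jx N d (q + 1) → A) :
    rM K X d q *ᵥ v = Sum.elim (mat K X d q *ᵥ (v ∘ Sum.inl) +
      ∑ u, v (Sum.inr u) • res d q (ze K X d)) 0 := by
  rw [rM, fromBlocks_mulVec]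
  simp only [zero_mulVec, add_zero]
  congr 2
  funext x
  simp [mulVec, dotProduct, mul_comm]

lemma vecMul_rM (X : Matrix (Fin N) (Fin N) A) (d q : ℕ) (v : Jx N d q → A) :
    v ᵥ* rM K X d q = Sum.elim ((v ∘ Sum.inl) ᵥ* mat K X d q)
      (fun _ => (v ∘ Sum.inl) ⬝ᵥ res d q (ze K X d)) := by
  rw [rM, vecMul_fromBlocks]
  simp only [vecMul_zero, add_zero]
  rfl

lemma evp_eq (X : Matrix (Fin N) (Fin N) A) (d : ℕ) (f : Fk N A) :
    evp K X d f = ∑ x : Ix N d 0, (x.1.2.1.prod fun i e => pfc K X {i} ^ e) * res d 0 f x := by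
  rw [evp, tp, map_sum]
  symm
  refine sum_bij (fun x _ => x.1.2.1) ?_ ?_ ?_ ?_
  · rintro ⟨⟨I, α, m⟩, h⟩ _
    rw [mem_finsuppAntidiag, ← Finsupp.degree_eq_sum]
    exact ⟨h.1, subset_univ _⟩
  · rintro ⟨⟨I, α, m⟩, h⟩ _ ⟨⟨J, β, l⟩, h'⟩ _ hh
    dsimp only at h h' hh
    have h1 : I = ∅ := card_eq_zero.mp (by omega)
    have h2 : J = ∅ := card_eq_zero.mp (by omega)
    have h3 : m = 0 := by omega
    have h4 : l = 0 := by omega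
    simp [h1, h2, h3, h4, hh]
  · intro α hα
    rw [mem_finsuppAntidiag, ← Finsupp.degree_eq_sum] at hα
    exact ⟨⟨(∅, α, 0), hα.1, by simp⟩, mem_univ _, rfl⟩
  · rintro ⟨⟨I, α, m⟩, h⟩ _
    dsimp only at h
    have h1 : I = ∅ := card_eq_zero.mp (by omega)
    have h3 : m = 0 := by omega
    rw [MvPolynomial.eval_monomial, mul_comm]
    simp [res, h1, h3]

lemma rg_dotProduct (X : Matrix (Fin N) (Fin N) A) (d : ℕ) (v : Jx N d 0 → A) :
    rg K X d ⬝ᵥ v = evp K X d (toFk K (v ∘ Sum.inl)) := by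
  rw [evp_eq, res_toFk, dotProduct, Fintype.sum_sum_type]
  simp [rg]

lemma res_dd_eq (X : Matrix (Fin N) (Fin N) A) {d q : ℕ} {f : Fk N A} (hf : f ∈ Supp K d (q + 1)) :
    mat K X d q *ᵥ res d (q + 1) f = res d q (dd K X 1 univ f) := by
  rw [← res_dd, toFk_res hf]

variable [CharZero K] {X : Matrix (Fin N) (Fin N) A}

lemma rM_mul_rM (hX : ∀ i j, X j i = - X i j) (d q : ℕ) : rM K X d q * rM K X d (q + 1) = 0 := by
  classical
  refine toLin'.injective (LinearMap.ext fun v => ?_)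
  rw [toLin'_mul, LinearMap.comp_apply, toLin'_apply, toLin'_apply, map_zero, LinearMap.zero_apply,
    mulVec_rM, mulVec_rM]
  have h1 : mat K X d q *ᵥ (mat K X d (q + 1) *ᵥ (v ∘ Sum.inl)) = 0 := by
    rw [← res_dd, ← res_dd, toFk_res (dd_mem _ (toFk_mem _)), dd_dd hX]
    rfl
  have h2 : ∀ u : {_u : Unit // q + 1 + 1 = d + 1 ∧ Odd d},
      mat K X d q *ᵥ res d (q + 1) (ze K X d) = 0 := fun u => by
    obtain rfl : q + 1 = d := by have := u.2.1; omega
    rw [res_dd_eq _ (ze_mem _), dd_ze hX]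
    rfl
  refine funext fun x => ?_
  rcases x with x | x
  · simp only [Sum.elim_inl, Sum.elim_inr, Sum.elim_comp_inl, mulVec_add, mulVec_sum, mulVec_smul,
      h1, zero_add, Pi.zero_apply, zero_smul, sum_const_zero, add_zero]
    rw [sum_congr rfl fun u _ => by rw [h2 u, smul_zero], sum_const_zero]
    rfl
  · rfl

lemma rg_vecMul (hX : ∀ i j, X j i = - X i j) {d : ℕ} (hd : 1 ≤ d) :
    rg K X d ᵥ* rM K X d 0 = 0 := by
  classical
  have h : ∀ v, rg K X d ⬝ᵥ (rM K X d 0 *ᵥ v) = 0 := fun v => by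
    rw [rg_dotProduct, mulVec_rM, Sum.elim_comp_inl, Fintype.sum_eq_zero _ (fun u => by
      have := u.2.1; omega), add_zero, ← res_dd, toFk_res (dd_mem _ (toFk_mem _))]
    obtain ⟨e, rfl⟩ := Nat.exists_eq_add_of_le' hd
    exact evp_dd hX _ _
  funext y
  have h1 := h (Pi.single y 1)
  rw [dotProduct_mulVec, dotProduct_single, mul_one] at h1
  exact h1

end Defs

variable {N : ℕ} {K : Type} [Field K] [CharZero K] {d : ℕ}

/-- Exactness in the intermediate degrees. -/
lemma exact_mid {q : ℕ} (hq : 1 ≤ q) (hqd : q < d) {f : Fk N (Sn N K)} (hf : f ∈ Supp K d q)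
    (h : dd K (gX N K) 1 univ f = 0) :
    ∃ g ∈ Supp K d (q + 1), f = dd K (gX N K) 1 univ g := by
  have hM : f ∈ MJ 1 univ (fun r a => r = q ∧ a + q = d) := fun I α m s hs => by
    have h1 := hf I α m fun hh => hs (by simp [hh])
    beta_reduce
    rw [inter_univ, ← Finsupp.degree_eq_sum]
    omega
  obtain ⟨g, hg, hfg⟩ := exact_of_good (e := 1) le_rfl univ f (Supp_le_Bd _ _ hf)
    (MJ_mono hM fun r a hra => by unfold Good; omega) (by exact_mod_cast h)
  obtain ⟨g', hg', hgM, h2⟩ := exists_pre (e := 1) le_rfl hM hg hfg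
  refine ⟨g', fun I α m h0 => ?_, by exact_mod_cast h2⟩
  obtain ⟨s, hs⟩ := MvPolynomial.ne_zero_iff.mp h0
  have h3 := hgM I α m s hs
  beta_reduce at h3
  rw [inter_univ, ← Finsupp.degree_eq_sum] at h3
  omega

/-- The resolution of the power of the ideal of sub-maximal Pfaffians. -/
theorem freeRes (hN : Odd N) (hd : 1 ≤ d) :
    FreeRes (rM K (gX N K) d) (rg K (gX N K) d) where
  vecMul_zero := rg_vecMul gX_swap hd
  mul_zero q := rM_mul_rM gX_swap d q
  exact_zero v hv := by
    rw [rg_dotProduct] at hv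
    obtain ⟨g, hg, h⟩ := exact_zero hN hd (toFk_mem _) hv
    refine ⟨Sum.elim (res d 1 g) 0, ?_⟩
    rw [mulVec_rM, Sum.elim_comp_inl, res_dd_eq _ hg, ← h, res_toFk]
    refine funext fun x => ?_
    rcases x with x | x
    · simp
    · have := x.2.1
      omega
  exact_succ q v hv := by
    rw [mulVec_rM] at hv
    have h1 := congrArg (· ∘ Sum.inl) hv
    simp only [Sum.elim_comp_inl] at h1
    rcases lt_trichotomy (q + 1) (d + 1) with hq | hq | hq
    · rw [Fintype.sum_eq_zero _ (fun u => by have := u.2.1; omega), add_zero, ← res_dd] at h1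
      have h2 := res_eq_zero (dd_mem _ (toFk_mem _)) h1
      have h3 : ∀ u, v (Sum.inr u) = 0 := fun u => by have := u.2.1; omega
      rcases (Nat.lt_succ_iff.mp hq).lt_or_eq with hq' | hq'
      · obtain ⟨g, hg, h⟩ := exact_mid (by omega) hq' (toFk_mem _) h2
        refine ⟨Sum.elim (res d (q + 1 + 1) g) 0, ?_⟩
        rw [mulVec_rM, Sum.elim_comp_inl, res_dd_eq _ hg, ← h, res_toFk]
        refine funext fun x => ?_
        rcases x with x | x
        · simp
        · exact h3 x
      · subst hq'
        obtain ⟨c, hc, hc'⟩ := cycle_eq_smul_ze hN hd (toFk_mem _) h2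
        refine ⟨Sum.elim 0 fun _ => c, ?_⟩
        rw [mulVec_rM]
        refine funext fun x => ?_
        rcases x with x | x
        · have h4 := congrFun (congrArg (res (q + 1) (q + 1)) hc) x
          rw [res_toFk] at h4
          simp only [Sum.elim_inl, Sum.elim_comp_inl, mulVec_zero, Sum.elim_inr, zero_add,
            Finset.sum_apply, Pi.smul_apply, smul_eq_mul]
          refine h4.trans ?_
          rw [res, cX_apply]
          rcases Nat.even_or_odd (q + 1) with he | ho
          · rw [hc' he, zero_mul]
            simp
          · have : Unique {_u : Unit // q + 1 + 1 = q + 1 + 1 ∧ Odd (q + 1)} :=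
              ⟨⟨⟨(), rfl, ho⟩⟩, fun _ => Subtype.ext rfl⟩
            rw [Fintype.sum_unique]
            rfl
        · exact h3 x
    · obtain rfl : q = d := by omega
      refine ⟨0, ?_⟩
      rw [mulVec_zero]
      refine funext fun x => ?_
      rcases x with ⟨x, hx⟩ | x
      · omega
      · have : Unique {_u : Unit // q + 1 = q + 1 ∧ Odd q} :=
          ⟨⟨x⟩, fun _ => Subtype.ext rfl⟩
        have h2 : v ∘ Sum.inl = 0 := funext fun x => by have := x.2; omega
        rw [h2, mulVec_zero, zero_add, Fintype.sum_unique, Subsingleton.elim default x] at h1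
        have h3 : cX K (v (Sum.inr x)) (ze K (gX N K) q) = 0 := by
          refine res_eq_zero (coef_mem _ (ze_mem q)) ?_
          refine Eq.trans ?_ h1
          funext y
          rw [res, cX_apply]
          rfl
        by_contra hne
        refine ze_ne_zero (K := K) hN x.2.2 (funext fun I => funext fun α => funext fun m => ?_)
        have h4 := congrFun (congrFun (congrFun h3 I) α) m
        rw [cX_apply] at h4
        exact (mul_eq_zero.mp h4).resolve_left hne
    · refine ⟨0, ?_⟩
      rw [mulVec_zero]
      refine funext fun x => ?_
      rcases x with ⟨x, hx⟩ | ⟨x, hx⟩ <;> omega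

end

end PfExt

namespace PfExt

open Finset Matrix

noncomputable section

variable {N : ℕ} {K A B : Type} [Field K] [CommRing A] [Algebra K A] [CommRing B] [Algebra K B]
  (X : Matrix (Fin N) (Fin N) A) {d q : ℕ}

lemma map_rg (φ : A →ₐ[K] B) : φ ∘ rg K X d = rg K (X.map φ) d := by
  funext x
  rcases x with x | x
  · simp only [Function.comp_apply, rg, Sum.elim_inl, Finsupp.prod, map_prod, map_pow, map_pfc]
  · simp [rg]

lemma span_rg : Ideal.span (Set.range (rg K X d)) =
    Ideal.span (Set.range fun i => pfc K X {i}) ^ d := by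
  classical
  refine le_antisymm (Ideal.span_le.mpr ?_) ?_
  · rintro _ ⟨x | x, rfl⟩
    · have h1 : ∑ i ∈ x.1.2.1.support, x.1.2.1 i = d := x.2.1
      have h2 : (x.1.2.1.prod fun i e => pfc K X {i} ^ e) ∈
          ∏ i ∈ x.1.2.1.support, Ideal.span (Set.range fun i => pfc K X {i}) ^ (x.1.2.1 i) :=
        Ideal.prod_mem_prod fun i _ => Ideal.pow_mem_pow (Ideal.subset_span (Set.mem_range_self i)) _
      rw [prod_pow_eq_pow_sum, h1] at h2
      exact h2
    · exact Submodule.zero_mem _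
  · rw [Ideal.span, Submodule.span_pow]
    refine Submodule.span_le.mpr ?_
    intro y hy
    obtain ⟨f, rfl⟩ := Set.mem_pow.mp hy
    choose k hk using fun i => (f i).2
    beta_reduce at hk
    refine Ideal.subset_span ⟨Sum.inl ⟨(∅, ∑ i, Finsupp.single (k i) 1, 0), ?_⟩, ?_⟩
    · simp [map_sum]
    · simp only [rg, Sum.elim_inl]
      rw [← Finsupp.prod_finsetSum_index (fun _ => pow_zero _) fun _ _ _ => pow_add _ _ _,
        List.prod_ofFn]
      exact prod_congr rfl fun i _ => (Finsupp.prod_single_index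
        (h := fun x e => pfc K X {x} ^ e) (pow_zero _)).trans ((pow_one _).trans (hk i))

end

end PfExt

namespace PfExt

open Finset Matrix

noncomputable section

variable {M : ℕ}

/-- The inclusion of the first indices, leaving out the last two. -/
def io (i : Fin M) : Fin (M + 2) := i.castSucc.castSucc

/-- The last index but one. -/
def ixa (M : ℕ) : Fin (M + 2) := (Fin.last M).castSucc

/-- The last index. -/
def ixb (M : ℕ) : Fin (M + 2) := Fin.last (M + 1)

lemma sum_io {V : Type} [AddCommMonoid V] (f : Fin (M + 2) → V) :
    ∑ i, f i = ∑ i, f (io i) + f (ixa M) + f (ixb M) := by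
  rw [Fin.sum_univ_castSucc, Fin.sum_univ_castSucc]
  rfl

lemma io_val (i : Fin M) : (io i).val = i.val := rfl
lemma ixa_val : (ixa M).val = M := rfl
lemma ixb_val : (ixb M).val = M + 1 := rfl

lemma io_injective : Function.Injective (io : Fin M → Fin (M + 2)) := fun i j h =>
  Fin.ext (congrArg Fin.val h : (io i).val = (io j).val)

lemma io_ne_ixa (i : Fin M) : io i ≠ ixa M := fun h => by
  have := congrArg Fin.val h
  rw [io_val, ixa_val] at this
  omega

lemma io_ne_ixb (i : Fin M) : io i ≠ ixb M := fun h => by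
  have := congrArg Fin.val h
  rw [io_val, ixb_val] at this
  omega

lemma ixa_ne_ixb : ixa M ≠ ixb M := fun h => by
  have := congrArg Fin.val h
  rw [ixa_val, ixb_val] at this
  omega

lemma ix_cases (i : Fin (M + 2)) : (∃ k, i = io k) ∨ i = ixa M ∨ i = ixb M := by
  by_cases h : i.val < M
  · exact Or.inl ⟨⟨i.val, h⟩, rfl⟩
  · have := i.isLt
    by_cases h2 : i.val = M
    · exact Or.inr (Or.inl (Fin.ext h2))
    · refine Or.inr (Or.inr (Fin.ext ?_))
      rw [ixb_val]
      omega

/-- The set of indices obtained by adding the last two. -/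
def ups (J : Finset (Fin M)) : Finset (Fin (M + 2)) :=
  insert (ixa M) (insert (ixb M) (J.image io))

lemma io_mem_ups {i : Fin M} {J : Finset (Fin M)} : io i ∈ ups J ↔ i ∈ J := by
  simp [ups, io_ne_ixa, io_ne_ixb, io_injective.eq_iff]

lemma insert_ups (i : Fin M) (J : Finset (Fin M)) : insert (io i) (ups J) = ups (insert i J) := by
  rw [ups, ups, image_insert]
  ext x
  simp only [mem_insert]
  tauto

lemma sg_ups (i : Fin M) (J : Finset (Fin M)) : sg (io i) (ups J) = sg i J := by
  have h : (ups J).filter (· < io i) = (J.filter (· < i)).image io := by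
    ext x
    simp only [mem_filter, mem_image]
    constructor
    · rintro ⟨h1, h2⟩
      obtain ⟨k, rfl⟩ | rfl | rfl := ix_cases x
      · exact ⟨k, ⟨io_mem_ups.mp h1, h2⟩, rfl⟩
      · have : M < i.val := h2
        omega
      · have : M + 1 < i.val := h2
        omega
    · rintro ⟨k, ⟨h1, h2⟩, rfl⟩
      exact ⟨io_mem_ups.mpr h1, h2⟩
  rw [sg, sg, h, card_image_of_injective _ io_injective]

lemma ups_eq_univ {J : Finset (Fin M)} : ups J = univ ↔ J = univ := by
  constructor
  · intro h
    refine eq_univ_of_forall fun i => io_mem_ups.mp (h ▸ mem_univ _)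
  · rintro rfl
    refine eq_univ_of_forall fun i => ?_
    obtain ⟨k, rfl⟩ | rfl | rfl := ix_cases i
    · exact io_mem_ups.mpr (mem_univ k)
    · simp [ups]
    · simp [ups]

variable {K A : Type} [Field K] [CommRing A] [Algebra K A]

lemma om_pow_ups {T : Matrix (Fin (M + 2)) (Fin (M + 2)) A} (ha : ∀ i, T (ixa M) i = 0)
    (hb : ∀ i, T (ixb M) i = 0) (ha' : ∀ i, T i (ixa M) = 0) (hb' : ∀ i, T i (ixb M) = 0) (r : ℕ) :
    ∀ J : Finset (Fin M), (om K T ^ r) (topF : Fk (M + 2) A) (ups J) 0 0 =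
      (om K (T.submatrix io io) ^ r) (topF : Fk M A) J 0 0 := by
  induction r with
  | zero =>
    intro J
    show (if ups J = univ then 1 else 0) = if J = univ then 1 else 0
    exact if_congr ups_eq_univ rfl rfl
  | succ r ih =>
    intro J
    rw [pow_succ', pow_succ', Module.End.mul_apply, Module.End.mul_apply, om_apply, om_apply]
    refine congrArg _ ?_
    rw [sum_io]
    simp only [ha, hb, zero_mul, sum_const_zero, add_zero]
    refine sum_congr rfl fun i _ => ?_
    rw [sum_io]
    simp only [ha', hb', zero_mul, add_zero, opH_apply, io_mem_ups, sg_ups, insert_ups, ih,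
      submatrix_apply]

lemma om_pow_eq_zero {N : ℕ} {T : Matrix (Fin N) (Fin N) A} {a : Fin N} (ha : ∀ i, T a i = 0)
    (ha' : ∀ i, T i a = 0) (r : ℕ) :
    ∀ I : Finset (Fin N), a ∉ I → (om K T ^ r) (topF : Fk N A) I 0 0 = 0 := by
  induction r with
  | zero =>
    intro I hI
    exact if_neg fun h : I = univ => hI (h ▸ mem_univ a)
  | succ r ih =>
    intro I hI
    rw [pow_succ', Module.End.mul_apply, om_apply]
    rw [sum_eq_zero fun i _ => sum_eq_zero fun j _ => ?_, smul_zero]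
    by_cases hi : a = i
    · rw [← hi, ha, zero_mul]
    by_cases hj : a = j
    · rw [← hj, ha', zero_mul]
    rw [opH_apply, opH_apply, ih _ (by simp [hi, hj, hI]), smul_zero, smul_zero, mul_zero]

section Schur

variable {N : ℕ} {X : Matrix (Fin N) (Fin N) A}

lemma ph_ph_apply (a b : Fin N) (f : Fk N A) (I α m) : ph K X a (ph K X b f) I α m =
    ∑ i, ∑ j, X i a * X j b * opH K i (opH K j f) I α m := by
  rw [ph_apply]
  refine sum_congr rfl fun i _ => ?_
  rw [opH_apply, ph_apply]
  simp only [opH_apply, smul_sum, mul_sum, mul_smul_comm, mul_assoc]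

lemma ph_ph_swap (a b : Fin N) : ph K X a * ph K X b = - (ph K X b * ph K X a) := by
  refine LinearMap.ext fun f => funext fun I => funext fun α => funext fun m => ?_
  rw [Module.End.mul_apply, LinearMap.neg_apply, Module.End.mul_apply, Pi.neg_apply, Pi.neg_apply,
    Pi.neg_apply, ph_ph_apply, ph_ph_apply, sum_comm, ← sum_neg_distrib]
  refine sum_congr rfl fun i _ => ?_
  rw [← sum_neg_distrib]
  refine sum_congr rfl fun j _ => ?_
  have h : opH K j (opH K i f) I α m = - opH K i (opH K j f) I α m := by
    rw [← Module.End.mul_apply, opH_opH]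
    rfl
  rw [h]
  ring

/-- The Schur complement with respect to the rows and columns `a` and `b`; here `c` is the
inverse of the entry in position `(a, b)`. -/
def schur (X : Matrix (Fin N) (Fin N) A) (c : A) (a b : Fin N) : Matrix (Fin N) (Fin N) A :=
  fun i j => X i j - c * (X i a * X j b - X i b * X j a)

lemma om_schur [CharZero K] (c : A) (a b : Fin N) :
    om K X = om K (schur X c a b) + cX K c * (ph K X a * ph K X b) := by
  refine LinearMap.ext fun f => funext fun I => funext fun α => funext fun m => ?_
  rw [LinearMap.add_apply, Module.End.mul_apply, Module.End.mul_apply, Pi.add_apply, Pi.add_apply,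
    Pi.add_apply, cX_apply, om_apply, om_apply]
  have h1 : (2 : K)⁻¹ • ∑ i, ∑ j, c * (X i a * X j b - X i b * X j a) *
      opH K i (opH K j f) I α m = c * ph K X a (ph K X b f) I α m := by
    have h2 : ph K X b (ph K X a f) I α m = - ph K X a (ph K X b f) I α m := by
      rw [← Module.End.mul_apply, ph_ph_swap]
      rfl
    have h3 : ∑ i, ∑ j, c * (X i a * X j b - X i b * X j a) * opH K i (opH K j f) I α m =
        (2 : K) • (c * ph K X a (ph K X b f) I α m) := by
      have h4 : ∑ i, ∑ j, c * (X i a * X j b - X i b * X j a) * opH K i (opH K j f) I α m =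
          c * ph K X a (ph K X b f) I α m - c * ph K X b (ph K X a f) I α m := by
        rw [ph_ph_apply, ph_ph_apply]
        simp only [mul_sum, ← sum_sub_distrib]
        exact sum_congr rfl fun i _ => sum_congr rfl fun j _ => by ring
      rw [h4, h2, two_smul]
      ring
    rw [h3, smul_smul, inv_mul_cancel₀ two_ne_zero, one_smul]
  rw [← h1, ← smul_add, ← sum_add_distrib]
  refine congrArg _ (sum_congr rfl fun i _ => ?_)
  rw [← sum_add_distrib]
  refine sum_congr rfl fun j _ => ?_
  rw [schur]
  ring

lemma ph_sq [CharZero K] (a : Fin N) : ph K X a * ph K X a = 0 := by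
  have h := ph_ph_swap (K := K) (X := X) a a
  have h2 : (2 : K) • (ph K X a * ph K X a) = 0 := by
    rw [two_smul]
    nth_rewrite 1 [h]
    exact neg_add_cancel _
  exact (smul_eq_zero.mp h2).resolve_left two_ne_zero

lemma om_ph_comm (Y : Matrix (Fin N) (Fin N) A) (l : Fin N) : Commute (om K Y) (ph K X l) :=
  Commute.sum_right _ _ _ fun i _ => (om_cX _).mul_right (om_opH i)

lemma ph_cX (c : A) (l : Fin N) : Commute (ph K X l) (cX K c) :=
  Commute.sum_left _ _ _ fun _ _ => (cX_comm ..).mul_left (coef_slotI ..).symm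

lemma sq_zero_of_anticomm {R : Type} [Ring R] {c p q : R} (hcp : Commute p c) (hcq : Commute q c)
    (hpq : p * q = - (q * p)) (hp : p * p = 0) : c * (p * q) * (c * (p * q)) = 0 := by
  have h : p * q * c = c * (p * q) := by rw [mul_assoc, hcq.eq, ← mul_assoc, hcp.eq, mul_assoc]
  have h2 : p * q * (p * q) = 0 := by
    rw [hpq, mul_neg, neg_mul, neg_neg, mul_assoc, ← mul_assoc p q p, hpq, neg_mul,
      mul_assoc q p p, hp, mul_zero, neg_zero, mul_zero]
  rw [mul_assoc, ← mul_assoc (p * q), h, mul_assoc c, h2, mul_zero, mul_zero]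

lemma exp_add_of_sq_zero {R : Type} [Ring R] [CharZero K] [Algebra K R] {ω y : R}
    (hy : y * y = 0) (hc : Commute ω y) (n : ℕ) :
    ∑ m ∈ range (n + 1), (m.factorial : K)⁻¹ • (ω + y) ^ m =
      (∑ m ∈ range (n + 1), (m.factorial : K)⁻¹ • ω ^ m) +
        y * ∑ m ∈ range n, (m.factorial : K)⁻¹ • ω ^ m := by
  rw [sum_range_succ', sum_range_succ' _ n, mul_sum]
  have h : ∀ m, ((m + 1).factorial : K)⁻¹ • (ω + y) ^ (m + 1) =
      ((m + 1).factorial : K)⁻¹ • ω ^ (m + 1) + y * ((m.factorial : K)⁻¹ • ω ^ m) := fun m => by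
    rw [add_pow_of_sq_zero hy hc, smul_add, mul_smul_comm, ← Nat.cast_smul_eq_nsmul K, smul_smul,
      Nat.factorial_succ, Nat.cast_mul, mul_inv, mul_comm _ (m.factorial : K)⁻¹, mul_assoc,
      inv_mul_cancel₀ (Nat.cast_ne_zero.mpr m.succ_ne_zero), mul_one]
  rw [sum_congr rfl fun m _ => h m, sum_add_distrib, pow_zero, pow_zero]
  abel

section Entries

variable {N : ℕ} {X : Matrix (Fin N) (Fin N) A} {c : A} {a b : Fin N}

lemma schur_swap (hX : ∀ i j, X j i = - X i j) (i j : Fin N) :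
    schur X c a b j i = - schur X c a b i j := by
  rw [schur, schur, hX]
  ring

lemma schur_left (hX : ∀ i j, X j i = - X i j) (h0 : ∀ i, X i i = 0) (hc : c * X a b = 1)
    (i : Fin N) : schur X c a b a i = 0 := by
  rw [schur, h0, hX a i]
  linear_combination (-X a i) * hc

lemma schur_right (hX : ∀ i j, X j i = - X i j) (h0 : ∀ i, X i i = 0) (hc : c * X a b = 1)
    (i : Fin N) : schur X c a b b i = 0 := by
  rw [schur, h0, hX a b, hX b i]
  linear_combination (-X b i) * hc

end Entries

/-- Comparison of the sub-maximal Pfaffians of a matrix and of its Schur complement. -/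
theorem pfc_io [CharZero K] {X : Matrix (Fin (M + 2)) (Fin (M + 2)) A}
    (hX : ∀ i j, X j i = - X i j) (h0 : ∀ i, X i i = 0) {c : A}
    (hc : c * X (ixa M) (ixb M) = 1) (k : Fin M) : ∃ s : ℤ, s * s = 1 ∧ pfc K X {io k} =
      X (ixb M) (ixa M) * (s • pfc K ((schur X c (ixa M) (ixb M)).submatrix io io) {k}) := by
  have hl := schur_left hX h0 hc
  have hr := schur_right hX h0 hc
  have hl' : ∀ i, schur X c (ixa M) (ixb M) i (ixa M) = 0 := fun i => by
    rw [schur_swap hX, hl, neg_zero]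
  have hr' : ∀ i, schur X c (ixa M) (ixb M) i (ixb M) = 0 := fun i => by
    rw [schur_swap hX, hr, neg_zero]
  set a := ixa M with ha
  set b := ixb M with hb
  set T := schur X c a b with hT
  have hak : a ∉ ({io k} : Finset (Fin (M + 2))) := by
    rw [mem_singleton]
    exact (io_ne_ixa k).symm
  have hbk : b ∉ ({io k} : Finset (Fin (M + 2))) := by
    rw [mem_singleton]
    exact (io_ne_ixb k).symm
  have hab : a ≠ b := ixa_ne_ixb
  obtain ⟨g, hg⟩ : ∃ g : Fk (M + 2) A, g = (∑ m ∈ range (M + 2), (m.factorial : K)⁻¹ • om K T ^ m)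
    topF := ⟨_, rfl⟩
  have hga : ∀ I : Finset (Fin (M + 2)), a ∉ I → g I 0 0 = 0 := fun I hI => by
    rw [hg]
    simp only [LinearMap.sum_apply, LinearMap.smul_apply, Finset.sum_apply, Pi.smul_apply]
    exact sum_eq_zero fun r _ => by rw [om_pow_eq_zero hl hl' r I hI, smul_zero]
  have hgb : ∀ I : Finset (Fin (M + 2)), b ∉ I → g I 0 0 = 0 := fun I hI => by
    rw [hg]
    simp only [LinearMap.sum_apply, LinearMap.smul_apply, Finset.sum_apply, Pi.smul_apply]
    exact sum_eq_zero fun r _ => by rw [om_pow_eq_zero hr hr' r I hI, smul_zero]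
  have hgk : g (insert a (insert b {io k})) 0 0 = pfc K (T.submatrix io io) {k} := by
    have h1 : insert a (insert b {io k}) = ups {k} := by simp [ups, ha, hb]
    rw [h1, hg, pfc, PfF]
    simp only [LinearMap.sum_apply, LinearMap.smul_apply, Finset.sum_apply, Pi.smul_apply,
      om_pow_ups hl hr hl' hr']
    rw [sum_range_succ, om_pow_card _ (M + 1), smul_zero, add_zero]
    rw [card_singleton]
    omega
  have hy := sq_zero_of_anticomm (ph_cX (K := K) (X := X) c a) (ph_cX (K := K) c b)
    (ph_ph_swap a b) (ph_sq a)
  have hcom : Commute (om K T) (cX K c * (ph K X a * ph K X b)) :=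
    (om_cX _).mul_right ((om_ph_comm ..).mul_right (om_ph_comm ..))
  have h1 : pfc K X {io k} = c * ph K X a (ph K X b g) {io k} 0 0 := by
    rw [pfc, PfF, om_schur c a b, ← hT, exp_add_of_sq_zero hy hcom, LinearMap.add_apply,
      Module.End.mul_apply, ← hg, Module.End.mul_apply, Module.End.mul_apply, Pi.add_apply,
      Pi.add_apply, Pi.add_apply, cX_apply]
    have h2 : (∑ m ∈ range (M + 2 + 1), (m.factorial : K)⁻¹ • om K T ^ m) (topF : Fk (M + 2) A)
        {io k} 0 0 = 0 := by
      simp only [LinearMap.sum_apply, LinearMap.smul_apply, Finset.sum_apply, Pi.smul_apply]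
      exact sum_eq_zero fun r _ => by rw [om_pow_eq_zero hl hl' r _ hak, smul_zero]
    rw [h2, zero_add]
  refine ⟨sg b {io k} * sg a (insert b {io k}), ?_, ?_⟩
  · have h3 := sg_sq b {io k}
    have h4 := sg_sq a (insert b {io k})
    calc _ = (sg b {io k} * sg b {io k}) * (sg a (insert b {io k}) * sg a (insert b {io k})) := by
          ring
      _ = 1 := by rw [h3, h4, one_mul]
  · have hz : ∀ i j, (i ≠ b ∨ j ≠ a) → X i a * X j b * opH K i (opH K j g) {io k} 0 0 = 0 :=
      fun i j hij => by
        by_cases hia : i = a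
        · rw [hia, h0, zero_mul, zero_mul]
        by_cases hjb : j = b
        · rw [hjb, h0, mul_zero, zero_mul]
        rw [opH_apply, opH_apply]
        rcases hij with hij | hij
        · rw [hgb _ (by simp [Ne.symm hjb, Ne.symm hij, mem_singleton.not.mp hbk]), smul_zero, smul_zero,
            mul_zero]
        · rw [hga _ (by simp [Ne.symm hia, Ne.symm hij, mem_singleton.not.mp hak]), smul_zero, smul_zero,
            mul_zero]
    rw [h1, ph_ph_apply, sum_eq_single b (fun i _ hi => sum_eq_zero fun j _ => hz i j (Or.inl hi))
      (by simp), sum_eq_single a (fun j _ hj => hz b j (Or.inr hj)) (by simp), opH_apply, opH_apply,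
      if_neg hbk, if_neg (by rw [mem_insert]; exact not_or.mpr ⟨hab, hak⟩), hgk, smul_smul,
      mul_smul_comm, mul_smul_comm, mul_smul_comm]
    refine congrArg _ ?_
    linear_combination X b a * pfc K (T.submatrix io io) {k} * hc

/-- The ideals of sub-maximal Pfaffians of a matrix and of its Schur complement agree. -/
theorem span_pfc_schur [CharZero K] {X : Matrix (Fin (M + 2)) (Fin (M + 2)) A}
    (hX : ∀ i j, X j i = - X i j) (h0 : ∀ i, X i i = 0) {c : A}
    (hc : c * X (ixa M) (ixb M) = 1) :
    Ideal.span (Set.range fun i => pfc K X {i}) = Ideal.span (Set.range fun i =>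
      pfc K ((schur X c (ixa M) (ixb M)).submatrix io io) {i}) := by
  set J := Ideal.span (Set.range fun i =>
      pfc K ((schur X c (ixa M) (ixb M)).submatrix io io) {i}) with hJ
  have hio : ∀ k, pfc K X {io k} ∈ J := fun k => by
    obtain ⟨s, -, h⟩ := pfc_io (K := K) hX h0 hc k
    rw [h]
    exact J.mul_mem_left _ (zsmul_mem (Ideal.subset_span (Set.mem_range_self k)) _)
  have hs : ∀ l, ∑ k, X (io k) l * pfc K X {io k} ∈ J := fun l =>
    sum_mem fun k _ => J.mul_mem_left _ (hio k)
  refine le_antisymm (Ideal.span_le.mpr ?_) (Ideal.span_le.mpr ?_)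
  · rintro _ ⟨i, rfl⟩
    obtain ⟨k, rfl⟩ | rfl | rfl := ix_cases i
    · exact hio k
    · have h1 := sum_mul_pfc K hX (ixb M)
      rw [sum_io, h0, zero_mul, add_zero] at h1
      have h2 : pfc K X {ixa M} = (-c) * ∑ k, X (io k) (ixb M) * pfc K X {io k} := by
        linear_combination c * h1 - pfc K X {ixa M} * hc
      exact (congrArg (· ∈ J) h2).mpr (J.mul_mem_left _ (hs _))
    · have h1 := sum_mul_pfc K hX (ixa M)
      rw [sum_io, h0, zero_mul, add_zero, hX (ixa M) (ixb M)] at h1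
      have h2 : pfc K X {ixb M} = c * ∑ k, X (io k) (ixa M) * pfc K X {io k} := by
        linear_combination (-c) * h1 - pfc K X {ixb M} * hc
      exact (congrArg (· ∈ J) h2).mpr (J.mul_mem_left _ (hs _))
  · rintro _ ⟨k, rfl⟩
    obtain ⟨s, hs, h⟩ := pfc_io (K := K) hX h0 hc k
    have h2 : pfc K ((schur X c (ixa M) (ixb M)).submatrix io io) {k} =
        (-c) * (s • pfc K X {io k}) := by
      rw [h, hX (ixa M) (ixb M), ← mul_smul_comm, smul_smul, hs, one_smul]
      linear_combination (-pfc K ((schur X c (ixa M) (ixb M)).submatrix io io) {k}) * hc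
    refine (congrArg (· ∈ Ideal.span (Set.range fun i => pfc K X {i})) h2).mpr ?_
    exact Ideal.mul_mem_left _ _ (zsmul_mem (Ideal.subset_span (Set.mem_range_self (io k))) _)

end Schur

end

end PfExt

namespace PfExt

open Finset Matrix

noncomputable section

section Rename

lemma flat_of_factor {A B C : Type} [CommRing A] [CommRing B] [CommRing C] [Algebra A B]
    [Module.Flat A B] {f : A →+* C} {g : B →+* C} (hg : Function.Bijective g)
    (h : f = g.comp (algebraMap A B)) : f.Flat := by
  rw [h]
  refine RingHom.Flat.comp ?_ (RingHom.Flat.of_bijective hg)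
  rw [RingHom.flat_algebraMap_iff]
  infer_instance

variable {σ τ K : Type} [Field K]

/-- Polynomial rings are flat over polynomial rings in fewer variables. -/
lemma rename_flat (f : σ → τ) (hf : Function.Injective f) :
    (MvPolynomial.rename f : MvPolynomial σ K →ₐ[K] MvPolynomial τ K).toRingHom.Flat := by
  classical
  let e' : ((Set.range f)ᶜ : Set τ) ⊕ σ ≃ τ := (Equiv.sumComm _ _).trans
    ((Equiv.sumCongr (Equiv.ofInjective f hf) (Equiv.refl _)).trans (Equiv.Set.sumCompl _))
  let e := (MvPolynomial.sumAlgEquiv K ((Set.range f)ᶜ : Set τ) σ).symm.trans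
    (MvPolynomial.renameEquiv K e')
  have h1 : (MvPolynomial.rename f : MvPolynomial σ K →ₐ[K] MvPolynomial τ K) =
      e.toAlgHom.comp (IsScalarTower.toAlgHom K (MvPolynomial σ K) _) := by
    refine MvPolynomial.algHom_ext fun i => ?_
    rw [MvPolynomial.rename_X, AlgHom.comp_apply]
    change _ = MvPolynomial.rename e' ((MvPolynomial.sumAlgEquiv K _ σ).symm
      (MvPolynomial.C (MvPolynomial.X i)))
    rw [MvPolynomial.sumAlgEquiv_symm_C_X, MvPolynomial.rename_X]
    rfl
  exact flat_of_factor (g := e.toAlgHom.toRingHom) e.bijective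
    (congrArg AlgHom.toRingHom h1)

end Rename

section BaseChange

variable {A B : Type} [CommRing A] [CommRing B] {ι : ℕ → Type} [∀ q, Fintype (ι q)]
  {M : ∀ q, Matrix (ι q) (ι (q + 1)) A} {g : ι 0 → A} {f : A →+* B}

lemma FreeRes.map_flat (hf : f.Flat) (h : FreeRes M g) :
    FreeRes (fun q => (M q).map f) (f ∘ g) := by
  let := f.toAlgebra
  have : Module.Flat A B := hf
  exact h.map

lemma HomEx.map_flat (hf : f.Flat) {q : ℕ} (h : HomEx M q) :
    HomEx (fun q => (M q).map f) q := by
  let := f.toAlgebra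
  have : Module.Flat A B := hf
  exact h.map

end BaseChange

variable {M : ℕ} {K : Type} [Field K]

variable (M K) in
/-- The last entry above the diagonal of the generic matrix. -/
def xab : Sn (M + 2) K := gX (M + 2) K (ixa M) (ixb M)

variable (M K) in
/-- The localization of the coordinate ring at the last entry above the diagonal. -/
abbrev Rl := Localization.Away (xab M K)

variable (M K) in
/-- The generic matrix over the localization. -/
def Xl : Matrix (Fin (M + 2)) (Fin (M + 2)) (Rl M K) :=
  (gX (M + 2) K).map (algebraMap (Sn (M + 2) K) (Rl M K))

lemma Xl_apply (i j : Fin (M + 2)) :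
    Xl M K i j = algebraMap (Sn (M + 2) K) (Rl M K) (gX (M + 2) K i j) := rfl

variable (M K) in
/-- The inverse of the last entry. -/
def cl : Rl M K := IsLocalization.Away.invSelf (xab M K)

lemma cl_mul : cl M K * Xl M K (ixa M) (ixb M) = 1 := by
  rw [mul_comm]
  exact IsLocalization.Away.mul_invSelf (xab M K)

lemma Xl_swap (i j : Fin (M + 2)) : Xl M K j i = - Xl M K i j := by
  rw [Xl_apply, Xl_apply, gX_swap, map_neg]

lemma Xl_self (i : Fin (M + 2)) : Xl M K i i = 0 := by
  rw [Xl_apply, gX, skew_self, map_zero]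

variable (M K) in
/-- The correction terms of the Schur complement. -/
def cor (i j : Fin (M + 2)) : Rl M K := if i.val < M ∧ j.val < M then
  cl M K * (Xl M K i (ixa M) * Xl M K j (ixb M) - Xl M K i (ixb M) * Xl M K j (ixa M)) else 0

lemma cor_swap (i j : Fin (M + 2)) : cor M K j i = - cor M K i j := by
  unfold cor
  by_cases h : i.val < M ∧ j.val < M
  · rw [if_pos h, if_pos h.symm]
    ring
  · rw [if_neg h, if_neg fun h' => h h'.symm, neg_zero]

lemma cor_self (i : Fin (M + 2)) : cor M K i i = 0 := by
  unfold cor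
  split_ifs <;> ring

lemma cor_right {i j : Fin (M + 2)} (hj : M ≤ j.val) : cor M K i j = 0 :=
  if_neg fun h => absurd h.2 (not_lt.mpr hj)

/-- The translation of the generic matrix by a multiple of the correction terms. -/
def psi (ε : ℤ) : Sn (M + 2) K →ₐ[K] Rl M K :=
  MvPolynomial.aeval fun v => Xl M K v.1.1 v.1.2 - (ε : Rl M K) * cor M K v.1.1 v.1.2

lemma psi_gX (ε : ℤ) (i j : Fin (M + 2)) :
    psi ε (gX (M + 2) K i j) = Xl M K i j - (ε : Rl M K) * cor M K i j := by
  refine skew_induction _ (p := fun i j b => psi ε b = Xl M K i j - (ε : Rl M K) * cor M K i j)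
    (fun v => MvPolynomial.aeval_X _ v) (fun i => ?_) (fun i j b h => ?_) i j
  · rw [map_zero, Xl_self, cor_self]
    ring
  · rw [map_neg, h, Xl_swap, cor_swap]
    ring

lemma psi_unit (ε : ℤ) (y : Submonoid.powers (xab M K)) : IsUnit (psi ε (y : Sn (M + 2) K)) := by
  obtain ⟨_, n, rfl⟩ := y
  dsimp only
  rw [map_pow]
  refine IsUnit.pow n ?_
  change IsUnit (psi ε (gX (M + 2) K (ixa M) (ixb M)))
  rw [psi_gX, cor_right (by rw [ixb_val]; omega), mul_zero, sub_zero]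
  exact IsUnit.of_mul_eq_one _ ((mul_comm _ _).trans cl_mul)

/-- The translation on the localization. -/
def psl (ε : ℤ) : Rl M K →ₐ[K] Rl M K :=
  IsLocalization.liftAlgHom (M := Submonoid.powers (xab M K)) (f := psi ε) (psi_unit ε)

lemma psl_algebraMap (ε : ℤ) (s : Sn (M + 2) K) : psl ε (algebraMap _ (Rl M K) s) = psi ε s :=
  IsLocalization.lift_eq _ _

lemma psl_Xl (ε : ℤ) (i j : Fin (M + 2)) :
    psl ε (Xl M K i j) = Xl M K i j - (ε : Rl M K) * cor M K i j := by
  rw [Xl_apply, psl_algebraMap, psi_gX, Xl_apply]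

lemma psl_Xl_right (ε : ℤ) {i j : Fin (M + 2)} (hj : M ≤ j.val) :
    psl ε (Xl M K i j) = Xl M K i j := by
  rw [psl_Xl, cor_right hj, mul_zero, sub_zero]

lemma psl_cl (ε : ℤ) : psl ε (cl M K) = cl M K := by
  have h1 : psl ε (cl M K) * Xl M K (ixa M) (ixb M) = 1 := by
    have := congrArg (psl ε) (cl_mul (M := M) (K := K))
    rwa [map_mul, map_one, psl_Xl_right ε (by rw [ixb_val]; omega)] at this
  linear_combination cl M K * h1 - psl ε (cl M K) * cl_mul (M := M) (K := K)

lemma psl_cor (ε : ℤ) (i j : Fin (M + 2)) : psl ε (cor M K i j) = cor M K i j := by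
  unfold cor
  split_ifs
  · have hA : ∀ i, psl ε (Xl M K i (ixa M)) = Xl M K i (ixa M) :=
      fun i => psl_Xl_right ε (by rw [ixa_val])
    have hB : ∀ i, psl ε (Xl M K i (ixb M)) = Xl M K i (ixb M) :=
      fun i => psl_Xl_right ε (by rw [ixb_val]; omega)
    rw [map_mul, map_sub, map_mul, map_mul, psl_cl, hA, hA, hB, hB]
  · exact map_zero _

lemma psl_psl (ε : ℤ) (y : Rl M K) : psl ε (psl (-ε) y) = y := by
  have h : ((psl ε).comp (psl (-ε))) = AlgHom.id K (Rl M K) := by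
    refine IsLocalization.algHom_ext (Submonoid.powers (xab M K)) ?_
    refine MvPolynomial.algHom_ext fun v => ?_
    have h2 : (MvPolynomial.X v : Sn (M + 2) K) = gX (M + 2) K v.1.1 v.1.2 :=
      (skew_of_lt MvPolynomial.X v.2).symm
    rw [h2]
    change psl ε (psl (-ε) (Xl M K v.1.1 v.1.2)) = Xl M K v.1.1 v.1.2
    rw [psl_Xl, map_sub, map_mul, psl_Xl, psl_cor, map_intCast]
    push_cast
    ring
  exact DFunLike.congr_fun h y

lemma psl_bijective (ε : ℤ) : Function.Bijective (psl (M := M) (K := K) ε) := by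
  refine Function.bijective_iff_has_inverse.mpr ⟨psl (-ε), fun y => ?_, psl_psl ε⟩
  have := psl_psl (-ε) y
  rwa [neg_neg] at this

/-- The inclusion of the variables of the smaller matrix. -/
def iov (v : Vars M) : Vars (M + 2) := ⟨(io v.1.1, io v.1.2), v.2⟩

lemma iov_injective : Function.Injective (iov : Vars M → Vars (M + 2)) := fun v w h => by
  have h1 := congrArg Subtype.val h
  exact Subtype.ext (Prod.ext (io_injective (congrArg Prod.fst h1))
    (io_injective (congrArg Prod.snd h1)))

variable (M K) in
/-- The flat map sending the generic matrix to the Schur complement. -/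
def phl : Sn M K →ₐ[K] Rl M K := (psl 1).comp
  ((IsScalarTower.toAlgHom K (Sn (M + 2) K) (Rl M K)).comp (MvPolynomial.rename iov))

lemma phl_flat : (phl M K).toRingHom.Flat := by
  have h1 : (algebraMap (Sn (M + 2) K) (Rl M K)).Flat := by
    rw [RingHom.flat_algebraMap_iff]
    exact IsLocalization.flat _ (Submonoid.powers (xab M K))
  have h2 : (psl (M := M) (K := K) 1).toRingHom.Flat :=
    RingHom.Flat.of_bijective (psl_bijective 1)
  exact ((rename_flat (K := K) _ iov_injective).comp h1).comp h2

lemma phl_gX : (gX M K).map (phl M K) =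
    (schur (Xl M K) (cl M K) (ixa M) (ixb M)).submatrix io io := by
  ext i j
  rw [Matrix.map_apply, submatrix_apply]
  have h1 : MvPolynomial.rename iov (gX M K i j) = gX (M + 2) K (io i) (io j) := by
    refine skew_induction _ (p := fun i j b => MvPolynomial.rename iov b =
      gX (M + 2) K (io i) (io j)) (fun v => ?_) (fun i => ?_) (fun i j b h => ?_) i j
    · rw [MvPolynomial.rename_X]
      exact (skew_of_lt MvPolynomial.X (iov v).2).symm
    · rw [map_zero, gX, skew_self]
    · rw [map_neg, h, ← gX_swap]
  change psl 1 (algebraMap (Sn (M + 2) K) (Rl M K) (MvPolynomial.rename iov (gX M K i j))) = _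
  rw [h1, ← Xl_apply, psl_Xl, cor, if_pos ⟨i.isLt, j.isLt⟩, schur, Int.cast_one, one_mul]

end

end PfExt

namespace PfExt

open Finset Matrix

noncomputable section

variable {K : Type} [Field K] {M N d q : ℕ}

lemma freeRes_unit {A : Type} [CommRing A] :
    FreeRes (ι := fun q => {_u : Unit // q = 0}) (A := A) (fun _ => 0) (fun _ => 1) where
  vecMul_zero := vecMul_zero _
  mul_zero _ := Matrix.mul_zero _
  exact_zero v h := by
    refine ⟨0, funext fun i => ?_⟩
    rw [mulVec_zero, Pi.zero_apply, ← h, dotProduct, sum_eq_single i]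
    · rw [one_mul]
    · exact fun j _ hj => absurd (Subsingleton.elim j i) hj
    · exact fun hh => absurd (mem_univ i) hh
  exact_succ q v _ := ⟨0, funext fun i => absurd i.2 (Nat.succ_ne_zero q)⟩

lemma homEx_one [CharZero K] (hd : 1 ≤ d) : HomEx (rM K (gX 1 K) d) q := by
  refine (homEx_congr (freeRes odd_one hd) freeRes_unit ?_ q).mpr fun z _ =>
    ⟨0, funext fun i => absurd i.2 (Nat.succ_ne_zero q)⟩
  rw [span_rg]
  have h1 : pfc K (gX 1 K) {0} = 1 := pfc_univ
  have h2 : Ideal.span (Set.range fun i => pfc K (gX 1 K) {i}) = ⊤ :=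
    (Ideal.eq_top_iff_one _).mpr (Ideal.subset_span ⟨0, h1⟩)
  have h3 : Ideal.span (Set.range fun _ : {_u : Unit // 0 = 0} => (1 : Sn 1 K)) = ⊤ :=
    (Ideal.eq_top_iff_one _).mpr (Ideal.subset_span ⟨⟨(), rfl⟩, rfl⟩)
  rw [h2, Ideal.top_pow]
  exact h3.symm

lemma flat_Rl : (algebraMap (Sn (M + 2) K) (Rl M K)).Flat := by
  rw [RingHom.flat_algebraMap_iff]
  exact IsLocalization.flat _ (Submonoid.powers (xab M K))

lemma homEx_loc [CharZero K] (hM : Odd M) (hd : 1 ≤ d) (ih : HomEx (rM K (gX M K) d) q) :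
    HomEx (fun q => (rM K (gX (M + 2) K) d q).map (algebraMap _ (Rl M K))) q := by
  refine (homEx_congr ((freeRes (hM.add_even even_two) hd).map_flat flat_Rl)
    ((freeRes hM hd).map_flat phl_flat) ?_ q).mpr (ih.map_flat phl_flat)
  have h1 : (algebraMap (Sn (M + 2) K) (Rl M K)) ∘ rg K (gX (M + 2) K) d = rg K (Xl M K) d :=
    map_rg _ (IsScalarTower.toAlgHom K (Sn (M + 2) K) (Rl M K))
  have h2 : (phl M K).toRingHom ∘ rg K (gX M K) d = rg K ((gX M K).map (phl M K)) d :=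
    map_rg _ (phl M K)
  rw [h1, h2, span_rg, span_rg, phl_gX, ← span_pfc_schur Xl_swap Xl_self cl_mul]

lemma homEx_of_lt [CharZero K] (hq : q + 2 ≠ M + 2) (hqd : q < d)
    (h : HomEx (fun q => (rM K (gX (M + 2) K) d q).map (algebraMap _ (Rl M K))) q) :
    HomEx (rM K (gX (M + 2) K) d) q := by
  intro z hz
  have hx : xab M K ≠ 0 := gX_ne_zero (by rw [Fin.lt_def, ixa_val, ixb_val]; omega)
  have hinj : Function.Injective (algebraMap (Sn (M + 2) K) (Rl M K)) :=
    IsLocalization.injective _ (powers_le_nonZeroDivisors_of_noZeroDivisors hx)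
  obtain ⟨w, hw⟩ := h (algebraMap (Sn (M + 2) K) (Rl M K) ∘ z) (by
    funext i
    have h1 := RingHom.map_vecMul (algebraMap (Sn (M + 2) K) (Rl M K))
      (rM K (gX (M + 2) K) d (q + 1)) z i
    rw [hz, Pi.zero_apply, map_zero] at h1
    exact h1.symm)
  obtain ⟨⟨_, m, rfl⟩, hb⟩ := IsLocalization.exist_integer_multiples_of_finite
    (Submonoid.powers (xab M K)) w
  choose u hu using hb
  have h2 : xab M K ^ m • z = u ᵥ* rM K (gX (M + 2) K) d q := by
    funext i
    refine hinj ?_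
    rw [RingHom.map_vecMul, Pi.smul_apply, smul_eq_mul, map_mul]
    have h3 : (algebraMap (Sn (M + 2) K) (Rl M K)) ∘ u =
        algebraMap (Sn (M + 2) K) (Rl M K) (xab M K ^ m) • w := by
      funext j
      refine (hu j).trans ?_
      rw [Pi.smul_apply, smul_eq_mul]
      exact Algebra.smul_def _ _
    rw [h3, smul_vecMul, Pi.smul_apply, smul_eq_mul]
    exact congrArg _ (congrFun hw i)
  rw [vecMul_rM] at h2 hz
  have hz1 : (z ∘ Sum.inl) ᵥ* mat K (gX (M + 2) K) d (q + 1) = 0 :=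
    funext fun i => congrFun hz (Sum.inl i)
  have hC := toFk_mem (K := K) (z ∘ Sum.inl)
  obtain ⟨v, hv, hv1⟩ := coboundary_of_torsion (ixa M) (ixb M) (by rw [ixa_val])
    (by rw [ixb_val]) hq hC
    (res_eq_zero (dD_mem hC) (by rw [res_dD, hz1]))
    ⟨m, toFk K (u ∘ Sum.inl), by
      have h4 : toFk K (xab M K ^ m • (z ∘ Sum.inl)) =
          cX K (xab M K ^ m) (toFk K (z ∘ Sum.inl)) := by
        funext I α l
        simp only [cX_apply, toFk_apply, Pi.smul_apply, smul_eq_mul, mul_sum, mul_assoc]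
      have h5 : xab M K ^ m • (z ∘ Sum.inl) =
          (u ∘ Sum.inl) ᵥ* mat K (gX (M + 2) K) d q :=
        funext fun i => congrFun h2 (Sum.inl i)
      refine h4.symm.trans ?_
      rw [h5, ← res_dD, toFk_res (dD_mem (toFk_mem _))]⟩
  refine ⟨Sum.elim (res d q v) 0, funext fun i => ?_⟩
  rw [vecMul_rM]
  rcases i with i | ⟨i, hi, _⟩
  · rw [Sum.elim_inl, Sum.elim_comp_inl, ← res_dD, toFk_res hv, ← hv1, res_toFk]
    rfl
  · omega

/-- Vanishing of the cohomology of the dual complex. -/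
theorem homEx [CharZero K] (hN : Odd N) (hd : 1 ≤ d) (hq : Odd (q + 1) ∨ N ≤ q + 1) :
    HomEx (rM K (gX N K) d) q := by
  obtain ⟨n, rfl⟩ := hN
  induction n with
  | zero => exact homEx_one hd
  | succ n ih =>
    have hM : Odd (2 * n + 1) := ⟨n, rfl⟩
    rcases lt_trichotomy q d with h | rfl | h
    · have h1 : q + 2 ≠ 2 * n + 1 + 2 := by
        rcases hq with ⟨a, ha⟩ | hq <;> omega
      have h2 : 2 * (n + 1) + 1 ≤ q + 1 → 2 * n + 1 ≤ q + 1 := fun _ => by omega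
      exact homEx_of_lt h1 h (homEx_loc hM hd (ih (hq.imp_right h2)))
    · intro z _
      by_cases ho : Odd q
      · have hNq : 2 * (n + 1) + 1 ≤ q := by
          obtain ⟨a, ha⟩ := ho
          rcases hq with ⟨b, hb⟩ | hq <;> omega
        obtain ⟨a, ha⟩ := ho
        let y : Ix (2 * (n + 1) + 1) q q := ⟨(univ, 0, a - (n + 1)), by
          refine ⟨by simp, ?_⟩
          rw [card_univ, Fintype.card_fin]
          dsimp only
          omega⟩
        have hy : res q q (ze K (gX (2 * (n + 1) + 1) K) q) y = 1 := by
          refine (if_pos ⟨rfl, y.2.2⟩).trans (pfc_univ)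
        refine ⟨Sum.elim (Pi.single y (z (Sum.inr ⟨(), rfl, a, ha⟩))) 0, funext fun i => ?_⟩
        rw [vecMul_rM]
        rcases i with i | i
        · have := i.2.1
          omega
        · rw [Sum.elim_inr, Sum.elim_comp_inl, single_dotProduct, hy, mul_one]
      · refine ⟨0, funext fun i => ?_⟩
        rcases i with i | i
        · have := i.2.1
          omega
        · exact absurd i.2.2 ho
    · intro z _
      refine ⟨0, funext fun i => ?_⟩
      rcases i with i | i
      · have := i.2.1
        omega
      · have := i.2.1
        omega

end

end PfExt

namespace PfExt

open Finset Matrix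

noncomputable section

lemma two_mul_lt {n : ℕ} (i : Fin n) : 2 * (i : ℕ) < 2 * n := by omega

lemma two_mul_add_one_lt {n : ℕ} (i : Fin n) : 2 * (i : ℕ) + 1 < 2 * n := by omega

section Abstract

variable {R A ι : Type} [Ring R] [CommRing A] [Fintype ι]
  {H : ι → R}

lemma twoForm_pow_pairs (x : ι → ι → A) (c : A →* R) (hc : ∀ a i, Commute (c a) (H i)) (n : ℕ) :
    (∑ i, ∑ j, c (x i j) * (H i * H j)) ^ n = ∑ f : Fin n → ι × ι,
      c (∏ t, x (f t).1 (f t).2) * (List.ofFn fun t => H (f t).1 * H (f t).2).prod := by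
  induction n with
  | zero => simp
  | succ n ih =>
    rw [pow_succ', ih, ← (Fin.consEquiv fun _ => ι × ι).sum_comp, Fintype.sum_prod_type,
      Fintype.sum_prod_type, sum_mul]
    refine sum_congr rfl fun i _ => ?_
    rw [sum_mul]
    refine sum_congr rfl fun j _ => ?_
    rw [mul_sum]
    refine sum_congr rfl fun f _ => ?_
    simp only [Fin.consEquiv_apply, Fin.prod_univ_succ, Fin.cons_zero, Fin.cons_succ,
      List.ofFn_succ, List.prod_cons, map_mul c]
    have h1 : H i * H j * c (∏ t, x (f t).1 (f t).2) = c (∏ t, x (f t).1 (f t).2) * (H i * H j) :=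
      ((hc _ i).mul_right (hc _ j)).symm.eq
    rw [mul_assoc, ← mul_assoc (H i * H j), h1, mul_assoc, mul_assoc, mul_assoc]

lemma twoForm_pow (x : ι → ι → A) (c : A →* R) (hc : ∀ a i, Commute (c a) (H i)) (n : ℕ) :
    (∑ i, ∑ j, c (x i j) * (H i * H j)) ^ n = ∑ f : Fin (2 * n) → ι,
      c (∏ t : Fin n, x (f ⟨2 * t, two_mul_lt t⟩) (f ⟨2 * t + 1, two_mul_add_one_lt t⟩)) *
        (List.ofFn fun t => H (f t)).prod := by
  classical
  rw [twoForm_pow_pairs x c hc]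
  let e : (Fin (2 * n) → ι) → Fin n → ι × ι :=
    fun f t => (f ⟨2 * t, two_mul_lt t⟩, f ⟨2 * t + 1, two_mul_add_one_lt t⟩)
  have he : Function.Bijective e := by
    refine (Fintype.bijective_iff_injective_and_card e).mpr ⟨fun f g h => funext fun t => ?_, ?_⟩
    · have h1 := congrFun h ⟨t / 2, by omega⟩
      rcases Nat.even_or_odd' t.val with ⟨a, ha | ha⟩
      · have h2 : t = ⟨2 * (t / 2), by omega⟩ := Fin.ext (by dsimp only; omega)
        rw [h2]
        exact congrArg Prod.fst h1
      · have h2 : t = ⟨2 * (t / 2) + 1, by omega⟩ := Fin.ext (by dsimp only; omega)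
        rw [h2]
        exact congrArg Prod.snd h1
    · simp [pow_mul, sq]
  refine (Fintype.sum_bijective e he _ _ fun f => ?_).symm
  rw [List.ofFn_mul', List.prod_flatten, List.map_ofFn]
  congr 3
  funext t
  simp [e, List.ofFn_succ]

lemma prod_perm (K : Type) [Field K] [CharZero K] [Algebra K R]
    (hH : ∀ i j, H i * H j = - (H j * H i)) {m : ℕ} (f : Fin m → ι)
    (σ : Equiv.Perm (Fin m)) : (List.ofFn fun t => H (f (σ t))).prod =
      (Equiv.Perm.sign σ : ℤ) • (List.ofFn fun t => H (f t)).prod := by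
  classical
  have h0 : ∀ v, Fintype.linearCombination K H v * Fintype.linearCombination K H v = 0 := by
    intro v
    rw [Fintype.linearCombination_apply, sum_mul_sum]
    refine sum_sum_eq_zero_of_neg (K := K) fun j _ l _ => ?_
    rw [smul_mul_smul_comm, smul_mul_smul_comm, hH j l, smul_neg, mul_comm (v j)]
  let L := ExteriorAlgebra.lift K ⟨Fintype.linearCombination K H, h0⟩
  have h1 : ∀ g : Fin m → ι, (List.ofFn fun t => H (g t)).prod =
      L (ExteriorAlgebra.ιMulti K m fun t => Pi.single (g t) (1 : K)) := fun g => by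
    rw [ExteriorAlgebra.ιMulti_apply, map_list_prod, List.map_ofFn]
    congr 2
    funext t
    rw [Function.comp_apply, ExteriorAlgebra.lift_ι_apply,
      Fintype.linearCombination_apply_single, one_smul]
  rw [h1, h1 f, ← map_zsmul]
  refine congrArg L (((ExteriorAlgebra.ιMulti K m).map_perm
    (fun t => (Pi.single (f t) (1 : K) : ι → K)) σ).trans ?_)
  rw [Units.smul_def]

end Abstract

variable {N : ℕ} {K A : Type} [Field K] [CommRing A] [Algebra K A]

lemma opH_prod_topF_eq_zero (l : List (Fin N)) (I : Finset (Fin N)) (α m)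
    (h : ¬ (l.Nodup ∧ l.toFinset = Iᶜ)) :
    (l.map fun i => (opH K i : Module.End K (Fk N A))).prod topF I α m = 0 := by
  induction l generalizing I with
  | nil =>
    rw [List.map_nil, List.prod_nil, Module.End.one_apply, topF, if_neg]
    rintro rfl
    simp at h
  | cons a l ih =>
    rw [List.map_cons, List.prod_cons, Module.End.mul_apply, opH_apply]
    split_ifs with ha
    · exact zero_smul _ _
    · rw [ih, smul_zero]
      rintro ⟨h1, h2⟩
      refine h ⟨List.nodup_cons.mpr ⟨fun h3 => ?_, h1⟩, ?_⟩
      · have := List.mem_toFinset.mpr h3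
        simp [h2] at this
      · rw [List.toFinset_cons, h2]
        ext b
        by_cases hb : b = a <;> simp [hb, ha]

lemma opH_prod_topF (l : List (Fin N)) (I : Finset (Fin N)) (hl : l.Nodup) (h : l.toFinset = Iᶜ) :
    ∃ s : ℤ, s * s = 1 ∧ ∀ α m,
      (l.map fun i => (opH K i : Module.End K (Fk N A))).prod topF I α m = (s : A) := by
  induction l generalizing I with
  | nil =>
    refine ⟨1, rfl, fun α m => ?_⟩
    rw [List.map_nil, List.prod_nil, Module.End.one_apply, topF, if_pos, Int.cast_one]
    rw [List.toFinset_nil] at h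
    exact compl_eq_empty_iff I |>.mp h.symm
  | cons a l ih =>
    obtain ⟨ha, hl⟩ := List.nodup_cons.mp hl
    have haI : a ∉ I := by
      have : a ∈ Iᶜ := h ▸ by simp
      simpa using this
    obtain ⟨s, hs, h1⟩ := ih (insert a I) hl (by
      rw [compl_insert, ← h, List.toFinset_cons, erase_insert (by simpa using ha)])
    refine ⟨sg a I * s, ?_, fun α m => ?_⟩
    · rw [mul_mul_mul_comm, sg_sq, hs, one_mul]
    · rw [List.map_cons, List.prod_cons, Module.End.mul_apply, opH_apply, if_neg haI, h1,
        zsmul_eq_mul, Int.cast_mul]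

lemma om_pow_topF [CharZero K] (X : Matrix (Fin N) (Fin N) A) (r : ℕ) (I) :
    (om K X ^ r) topF I 0 0 = ((2 : K)⁻¹ ^ r) • ∑ f : Fin (2 * r) → Fin N,
      (∏ t : Fin r, X (f ⟨2 * t, two_mul_lt t⟩) (f ⟨2 * t + 1, two_mul_add_one_lt t⟩)) *
        ((List.ofFn f).map fun i => (opH K i : Module.End K (Fk N A))).prod topF I 0 0 := by
  have h := twoForm_pow (H := fun i => (opH K i : Module.End K (Fk N A))) X
    { toFun := fun a => cX K a
      map_one' := op_ext fun f I α m => by rw [cX_apply, one_mul, Module.End.one_apply]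
      map_mul' := fun a b => op_ext fun f I α m => by
        rw [Module.End.mul_apply, cX_apply, cX_apply, cX_apply, mul_assoc] }
    (fun a i => coef_slotI ..) r
  have h1 : om K X ^ r = ((2 : K)⁻¹ ^ r) • ∑ f : Fin (2 * r) → Fin N,
      cX K (∏ t : Fin r, X (f ⟨2 * t, two_mul_lt t⟩) (f ⟨2 * t + 1, two_mul_add_one_lt t⟩)) *
        (List.ofFn fun t => (opH K (f t) : Module.End K (Fk N A))).prod := by
    rw [om, smul_pow]
    exact congrArg _ h
  rw [h1, LinearMap.smul_apply, LinearMap.sum_apply, Pi.smul_apply, Pi.smul_apply, Pi.smul_apply,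
    Finset.sum_apply, Finset.sum_apply, Finset.sum_apply]
  congr 1
  refine sum_congr rfl fun f _ => ?_
  rw [Module.End.mul_apply, cX_apply, List.map_ofFn]
  rfl

/-- The sub-maximal Pfaffians as signed sums over permutations. -/
theorem exists_pfc_eq [CharZero K] {n : ℕ} (X : Matrix (Fin (2 * n + 1)) (Fin (2 * n + 1)) A)
    (k : Fin (2 * n + 1)) : ∃ s : ℤ, s * s = 1 ∧ pfc K X {k} = (s : A) *
      ((((2 ^ n * n.factorial : ℕ) : K)⁻¹) • ∑ σ : Equiv.Perm (Fin (2 * n)),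
        (Equiv.Perm.sign σ : ℤ) • ∏ i : Fin n,
          X.submatrix (Fin.succAbove k) (Fin.succAbove k)
            (σ ⟨2 * (i : ℕ), two_mul_lt i⟩) (σ ⟨2 * (i : ℕ) + 1, two_mul_add_one_lt i⟩)) := by
  classical
  have hcompl : ∀ {r : ℕ} (f : Fin r → Fin (2 * n + 1)), (List.ofFn f).Nodup →
      (List.ofFn f).toFinset = ({k} : Finset (Fin (2 * n + 1)))ᶜ → r = 2 * n := fun f h1 h2 => by
    have := congrArg card h2
    rw [List.toFinset_card_of_nodup h1, List.length_ofFn, card_compl, card_singleton,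
      Fintype.card_fin] at this
    omega
  have hr : ∀ r, r ≠ n → (om K X ^ r) topF {k} 0 0 = 0 := fun r hrn => by
    rw [om_pow_topF, sum_eq_zero, smul_zero]
    intro f _
    rw [opH_prod_topF_eq_zero, mul_zero]
    exact fun h => hrn (by have := hcompl f h.1 h.2; omega)
  obtain ⟨s, hs, hs1⟩ := opH_prod_topF (K := K) (A := A) (List.ofFn k.succAbove) {k}
    (List.nodup_ofFn.mpr Fin.succAbove_right_injective) (by
      ext b
      simp [List.mem_ofFn, Fin.exists_succAbove_eq_iff])
  refine ⟨s, hs, ?_⟩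
  have h1 : pfc K X {k} = (n.factorial : K)⁻¹ • (om K X ^ n) topF {k} 0 0 := by
    simp only [pfc, PfF, LinearMap.sum_apply, LinearMap.smul_apply, Finset.sum_apply,
      Pi.smul_apply]
    refine sum_eq_single n (fun r _ h => by rw [hr r h, smul_zero]) fun h => ?_
    exact absurd (mem_range.mpr (by omega)) h
  rw [h1, om_pow_topF, smul_smul, mul_smul_comm, mul_sum, Nat.cast_mul, Nat.cast_pow,
    Nat.cast_ofNat, mul_inv, inv_pow, mul_comm]
  congr 1
  symm
  refine Fintype.sum_of_injective (fun σ : Equiv.Perm (Fin (2 * n)) => k.succAbove ∘ σ)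
    (fun σ τ h => Equiv.ext fun t => Fin.succAbove_right_injective (congrFun h t)) _ _ ?_ ?_
  · intro f hf
    rw [opH_prod_topF_eq_zero, mul_zero]
    rintro ⟨h2, h3⟩
    refine hf ?_
    have h4 : ∀ t, ∃ u, k.succAbove u = f t := fun t => Fin.exists_succAbove_eq (by
      have : f t ∈ (List.ofFn f).toFinset := by simp [List.mem_ofFn]
      rw [h3] at this
      simpa using this)
    choose u hu using h4
    have h5 : Function.Injective u := fun a b h => List.nodup_ofFn.mp h2 (by rw [← hu, ← hu, h])
    exact ⟨Equiv.ofBijective u (Finite.injective_iff_bijective.mp h5), funext hu⟩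
  · intro σ
    have h2 := prod_perm K (H := fun i => (opH K i : Module.End K (Fk (2 * n + 1) A)))
      opH_opH k.succAbove σ
    have h3 : ((List.ofFn (k.succAbove ∘ σ)).map fun i =>
        (opH K i : Module.End K (Fk (2 * n + 1) A))).prod topF {k} 0 0 =
        (Equiv.Perm.sign σ : ℤ) • (s : A) := by
      rw [← hs1 0 0, List.map_ofFn, List.map_ofFn]
      exact congrArg (fun u : Module.End K (Fk (2 * n + 1) A) => u topF {k} 0 0) h2
    rw [h3, mul_smul_comm, mul_smul_comm]
    exact congrArg _ (mul_comm _ _)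

end

end PfExt

open MvPolynomial

/-- For `d ≥ 1`, the modules `Ext^j_S(I^d, S)` vanish when `j` is odd or `j > 2n`,
where `I` is the ideal of sub-maximal Pfaffians of the generic `(2n+1) × (2n+1)`
skew-symmetric matrix. -/
theorem ext_powers_submaximal_pfaffians_vanishing
    (K : Type) [Field K] [CharZero K] (n : ℕ) (hn : 1 ≤ n)
    (X : Matrix (Fin (2 * n + 1)) (Fin (2 * n + 1))
      (MvPolynomial {p : Fin (2 * n + 1) × Fin (2 * n + 1) // p.1 < p.2} K))
    (hXlt : ∀ (i j : Fin (2 * n + 1)) (h : i < j), X i j = MvPolynomial.X ⟨(i, j), h⟩)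
    (hXgt : ∀ (i j : Fin (2 * n + 1)) (h : j < i), X i j = -MvPolynomial.X ⟨(j, i), h⟩)
    (hXdiag : ∀ i, X i i = 0)
    (pf : Matrix (Fin (2 * n)) (Fin (2 * n))
        (MvPolynomial {p : Fin (2 * n + 1) × Fin (2 * n + 1) // p.1 < p.2} K) →
      MvPolynomial {p : Fin (2 * n + 1) × Fin (2 * n + 1) // p.1 < p.2} K)
    (hpf : ∀ A, pf A = (((2 ^ n * Nat.factorial n : ℕ) : K)⁻¹) •
      ∑ σ : Equiv.Perm (Fin (2 * n)), (Equiv.Perm.sign σ : ℤ) •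
        ∏ i : Fin n, A (σ ⟨2 * (i : ℕ), by omega⟩) (σ ⟨2 * (i : ℕ) + 1, by omega⟩))
    (I : Ideal (MvPolynomial {p : Fin (2 * n + 1) × Fin (2 * n + 1) // p.1 < p.2} K))
    (hI : I = Ideal.span (Set.range fun k : Fin (2 * n + 1) =>
      pf (X.submatrix (Fin.succAbove k) (Fin.succAbove k))))
    (d : ℕ) (hd : 1 ≤ d) (j : ℕ) (hj : Odd j ∨ 2 * n < j) :
    Subsingleton
      (((Ext (MvPolynomial {p : Fin (2 * n + 1) × Fin (2 * n + 1) // p.1 < p.2} K) (ModuleCat (MvPolynomial {p : Fin (2 * n + 1) × Fin (2 * n + 1) // p.1 < p.2} K)) j).obj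
          (Opposite.op (ModuleCat.of (MvPolynomial {p : Fin (2 * n + 1) × Fin (2 * n + 1) // p.1 < p.2} K) (↥(I ^ d))))).obj
        (ModuleCat.of (MvPolynomial {p : Fin (2 * n + 1) × Fin (2 * n + 1) // p.1 < p.2} K) (MvPolynomial {p : Fin (2 * n + 1) × Fin (2 * n + 1) // p.1 < p.2} K))) := by
  classical
  have hX : X = PfExt.gX (2 * n + 1) K := by
    ext a b : 1
    rcases lt_trichotomy a b with h | rfl | h
    · rw [hXlt a b h]
      exact (PfExt.skew_of_lt MvPolynomial.X h).symm
    · rw [hXdiag]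
      exact (PfExt.skew_self MvPolynomial.X a).symm
    · rw [hXgt a b h, PfExt.gX_swap]
      exact congrArg Neg.neg (PfExt.skew_of_lt MvPolynomial.X h).symm
  have hpk : ∀ k, ∃ s : ℤ, s * s = 1 ∧ PfExt.pfc K X {k} = (s : MvPolynomial _ K) *
      pf (X.submatrix (Fin.succAbove k) (Fin.succAbove k)) := fun k => by
    rw [hpf]
    exact PfExt.exists_pfc_eq X k
  have hI' : I = Ideal.span (Set.range fun k => PfExt.pfc K X {k}) := by
    rw [hI]
    refine le_antisymm (Ideal.span_le.mpr ?_) (Ideal.span_le.mpr ?_)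
    · rintro _ ⟨k, rfl⟩
      obtain ⟨s, hs, h⟩ := hpk k
      have h1 : pf (X.submatrix (Fin.succAbove k) (Fin.succAbove k)) =
          (s : MvPolynomial _ K) * PfExt.pfc K X {k} := by
        rw [h, ← mul_assoc, ← Int.cast_mul, hs, Int.cast_one, one_mul]
      beta_reduce
      rw [h1]
      exact Ideal.mul_mem_left _ _ (Ideal.subset_span ⟨k, rfl⟩)
    · rintro _ ⟨k, rfl⟩
      obtain ⟨s, hs, h⟩ := hpk k
      beta_reduce
      rw [h]
      exact Ideal.mul_mem_left _ _ (Ideal.subset_span ⟨k, rfl⟩)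
  obtain ⟨q, rfl⟩ : ∃ q, j = q + 1 := ⟨j - 1, by rcases hj with ⟨a, ha⟩ | hj <;> omega⟩
  rw [hI', hX, ← PfExt.span_rg]
  have hN : Odd (2 * n + 1) := ⟨n, rfl⟩
  exact (PfExt.subsingleton_ext_iff (PfExt.freeRes hN hd) q).mpr
    (PfExt.homEx hN hd (hj.imp_right fun h => h))
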